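/- Assume the normalized hypotheses: Γ(x,t) = (x₁−t, γ(x,t)) with γ(x,0)=x₂, γ̇(x,0)=0, the inverse curve Γ*(y,t) = (y₁+t, γ*(y,t)) with γ*(y,0)=y₂, γ̇*(y,0)=0, the quasi-monotonicity conditions γ̈(x,t)=a(x,t)+O(γ̇(x,t)) and γ̈*(y,t)=a*(y,t)+O(γ̇*(y,t)) with a(x,·), a*(y,·) of constant sign on t>0 and on t<0, the doubling bounds C₀^{-1} g(A^{-1}|t|) ≤ |γ̇(x,t)| ≤ C₀ g(A|t|) and C₀^{-1} g(A^{-1}|t|) ≤ |γ̇*(y,t)| ≤ C₀ g(A|t|) for a doubling function g, and |∂_{x₂}γ(x,t)| ≥ c₁ > 0. Then the maximal operator M is bounded from L^p to L^p(Ω) for p>1, and the Hilbert transform (singular Radon transform) R is bounded from L^p to L^p(Ω) for 1<p<∞; the operator norms depend only on the cutoff function ω, the doubling function g, the constant A, and the L^∞ norms of γ_{x₂}, ∇γ_{x₂}, γ*_{y₂}, ∇γ*_{y₂} (in particular they do not depend on the L¹ norm of γ̈). -/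

import Mathlib

open MeasureTheory Set Filter
open scoped ENNReal NNReal

noncomputable section

/-- The dyadically rescaled cutoff `φ_j(s) = 2^j φ(2^j s)`. -/
def phiJ (φ : ℝ → ℝ) (j : ℤ) (s : ℝ) : ℝ := (2:ℝ) ^ j * φ ((2:ℝ) ^ j * s)

/-- The dyadic pieces `β_k(s) = β₀(2^{-k} s) - β₀(2^{-k+1} s)`. -/
def betaZ (β0 : ℝ → ℝ) (k : ℤ) (s : ℝ) : ℝ :=
  β0 ((2:ℝ) ^ (-k) * s) - β0 ((2:ℝ) ^ (-k + 1) * s)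

/-- The kernel `R_j^k(x,y) = χ(x,y) φ_j(x₁-y₁) ∫ e^{iτ(y₂-γ(x,x₁-y₁))} β_k(τ) dτ`. -/
def kernelR (χ : ℝ × ℝ → ℝ × ℝ → ℝ) (φ : ℝ → ℝ) (γ : ℝ × ℝ → ℝ → ℝ) (β0 : ℝ → ℝ)
    (j k : ℤ) (x y : ℝ × ℝ) : ℂ :=
  ((χ x y * phiJ φ j (x.1 - y.1) : ℝ) : ℂ) *
    ∫ τ : ℝ, ((betaZ β0 k τ : ℝ) : ℂ) *
      Complex.exp (Complex.I * (τ : ℂ) * ((y.2 - γ x (x.1 - y.1) : ℝ) : ℂ))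

/-- The kernel `H_j(x,y) = χ(x,y) φ_j(x₁-y₁) ∫ e^{iτ(y₂-γ(x,x₁-y₁))} β₀(2^{-a_j}τ) dτ`. -/
def kernelH (χ : ℝ × ℝ → ℝ × ℝ → ℝ) (φ : ℝ → ℝ) (γ : ℝ × ℝ → ℝ → ℝ) (β0 : ℝ → ℝ)
    (j aj : ℤ) (x y : ℝ × ℝ) : ℂ :=
  ((χ x y * phiJ φ j (x.1 - y.1) : ℝ) : ℂ) *
    ∫ τ : ℝ, ((β0 ((2:ℝ) ^ (-aj) * τ) : ℝ) : ℂ) *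
      Complex.exp (Complex.I * (τ : ℂ) * ((y.2 - γ x (x.1 - y.1) : ℝ) : ℂ))

/-- Integral operator with kernel `K`. -/
def opK (K : ℝ × ℝ → ℝ × ℝ → ℂ) (f : ℝ × ℝ → ℂ) (x : ℝ × ℝ) : ℂ := ∫ y, K x y * f y

/-- The adjoint kernel. -/
def adjK (K : ℝ × ℝ → ℝ × ℝ → ℂ) (x y : ℝ × ℝ) : ℂ := starRingEnd ℂ (K y x)

/-- Fourier multiplier in the second variable (kernel convention `e^{iξ(x₂-y₂)}`). -/
def mult2 (m : ℝ → ℝ) (f : ℝ × ℝ → ℂ) (x : ℝ × ℝ) : ℂ :=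
  ((2 * Real.pi)⁻¹ : ℝ) • ∫ ξ : ℝ, ∫ y : ℝ,
    ((m ξ : ℝ) : ℂ) * Complex.exp (Complex.I * (ξ : ℂ) * ((x.2 - y : ℝ) : ℂ)) * f (x.1, y)

/-- Fourier multiplier in the first variable. -/
def mult1 (m : ℝ → ℝ) (f : ℝ × ℝ → ℂ) (x : ℝ × ℝ) : ℂ :=
  ((2 * Real.pi)⁻¹ : ℝ) • ∫ ξ : ℝ, ∫ y : ℝ,
    ((m ξ : ℝ) : ℂ) * Complex.exp (Complex.I * (ξ : ℂ) * ((x.1 - y : ℝ) : ℂ)) * f (y, x.2)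

/-- The symbol of the Littlewood-Paley operator `L^k`:
`β₀(2^{-k-10} ξ₂) - β₀(2^{-k+10} ξ₂)`. -/
def symbL (β0 : ℝ → ℝ) (k : ℤ) (ξ : ℝ) : ℝ :=
  β0 ((2:ℝ) ^ (-k - 10) * ξ) - β0 ((2:ℝ) ^ (-k + 10) * ξ)

/-- The Littlewood-Paley operator `L^k` (multiplier in `ξ₂`). -/
def opL (β0 : ℝ → ℝ) (k : ℤ) : (ℝ × ℝ → ℂ) → ℝ × ℝ → ℂ := mult2 (symbL β0 k)

/-- `P_l`, multiplier `β₀(2^{-l} ξ₁)`. -/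
def opP (β0 : ℝ → ℝ) (l : ℤ) : (ℝ × ℝ → ℂ) → ℝ × ℝ → ℂ :=
  mult1 (fun ξ => β0 ((2:ℝ) ^ (-l) * ξ))

/-- `Q_l`, multiplier `β_l(ξ₁)`. -/
def opQ (β0 : ℝ → ℝ) (l : ℤ) : (ℝ × ℝ → ℂ) → ℝ × ℝ → ℂ := mult1 (betaZ β0 l)

/-- The strong maximal function (over axis-parallel rectangles). -/
def Mstr (f : ℝ × ℝ → ℂ) (x : ℝ × ℝ) : ℝ≥0∞ :=
  ⨆ (a₁ : ℝ) (b₁ : ℝ) (a₂ : ℝ) (b₂ : ℝ) (_ : x.1 ∈ Ioo a₁ b₁) (_ : x.2 ∈ Ioo a₂ b₂),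
    (ENNReal.ofReal ((b₁ - a₁) * (b₂ - a₂)))⁻¹ *
      ∫⁻ y in Ioo a₁ b₁ ×ˢ Ioo a₂ b₂, ‖f y‖₊

/-- The strong maximal function of a real-valued function. -/
def MstrR (f : ℝ × ℝ → ℝ) (x : ℝ × ℝ) : ℝ≥0∞ :=
  ⨆ (a₁ : ℝ) (b₁ : ℝ) (a₂ : ℝ) (b₂ : ℝ) (_ : x.1 ∈ Ioo a₁ b₁) (_ : x.2 ∈ Ioo a₂ b₂),
    (ENNReal.ofReal ((b₁ - a₁) * (b₂ - a₂)))⁻¹ *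
      ∫⁻ y in Ioo a₁ b₁ ×ˢ Ioo a₂ b₂, ‖f y‖₊

/-- `L^p → L^p` operator (quasi-)norm, tested on continuous compactly supported functions. -/
def opNorm (p : ℝ≥0∞) (T : (ℝ × ℝ → ℂ) → ℝ × ℝ → ℂ) : ℝ≥0∞ :=
  sInf {C : ℝ≥0∞ | ∀ f : ℝ × ℝ → ℂ, Continuous f → HasCompactSupport f →
    eLpNorm (T f) p volume ≤ C * eLpNorm f p volume}

/-- The averaging operator `M_j` along the curves, at scale `2^{-j}`. -/
def opM (χt : ℝ × ℝ → ℝ × ℝ → ℝ) (φt : ℝ → ℝ) (γ : ℝ × ℝ → ℝ → ℝ) (j : ℤ)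
    (f : ℝ × ℝ → ℂ) (x : ℝ × ℝ) : ℂ :=
  ∫ y₁ : ℝ, (phiJ φt j (x.1 - y₁) * χt x (y₁, x.2 + γ x (x.1 - y₁))) •
    f (y₁, x.2 + γ x (x.1 - y₁))

/-- The averaging operator `M_j` acting on real-valued functions. -/
def opMR (χt : ℝ × ℝ → ℝ × ℝ → ℝ) (φt : ℝ → ℝ) (γ : ℝ × ℝ → ℝ → ℝ) (j : ℤ)
    (f : ℝ × ℝ → ℝ) (x : ℝ × ℝ) : ℝ :=
  ∫ y₁ : ℝ, phiJ φt j (x.1 - y₁) * χt x (y₁, x.2 + γ x (x.1 - y₁)) *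
    f (y₁, x.2 + γ x (x.1 - y₁))

/-- Standing hypotheses on `β₀`. -/
structure IsBump (β0 : ℝ → ℝ) : Prop where
  smooth : ContDiff ℝ (⊤ : ℕ∞) β0
  even : ∀ s, β0 (-s) = β0 s
  one : ∀ s, |s| ≤ 1 / 2 → β0 s = 1
  zero : ∀ s, 3 / 4 ≤ |s| → β0 s = 0

/-- Standing hypotheses on `φ`. -/
structure IsPhi (φ : ℝ → ℝ) : Prop where
  smooth : ContDiff ℝ (⊤ : ℕ∞) φ
  supp : ∀ s, φ s ≠ 0 → 1 / 2 < |s| ∧ |s| < 2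

/-- Standing hypotheses on `χ`. -/
structure IsChi (χ : ℝ × ℝ → ℝ × ℝ → ℝ) : Prop where
  smooth : ContDiff ℝ (⊤ : ℕ∞) (fun p : (ℝ × ℝ) × (ℝ × ℝ) => χ p.1 p.2)
  cpt : HasCompactSupport (fun p : (ℝ × ℝ) × (ℝ × ℝ) => χ p.1 p.2)

/-- `g` is a doubling function (on `[0,∞)`) with doubling constant `A`. -/
structure IsDoubling (g : ℝ → ℝ) (A : ℝ) : Prop where
  A_ge_one : 1 ≤ A
  cont : ContinuousOn g (Ici 0)
  zero : g 0 = 0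
  pos : ∀ t, 0 < t → 0 < g t
  dbl : ∀ t₁ t₂, 0 ≤ t₁ → A * t₁ ≤ t₂ → 2 * g t₁ ≤ g t₂

/-- The defining property of the integers `a_j`: `2^{-a_j-1} < 2^{-j} g(2^{-5-j} B) ≤ 2^{-a_j}`
with `B = 2^20 A`. -/
def ajSpec (g : ℝ → ℝ) (A : ℝ) (a : ℤ → ℤ) : Prop :=
  ∀ j : ℤ, (2:ℝ) ^ (-a j - 1) < (2:ℝ) ^ (-j) * g ((2:ℝ) ^ (-5 - j) * (2 ^ 20 * A)) ∧
    (2:ℝ) ^ (-j) * g ((2:ℝ) ^ (-5 - j) * (2 ^ 20 * A)) ≤ (2:ℝ) ^ (-a j)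

/-- The defining property of the integers `b_j`: `2^{-b_j-1} < 2^{-j} g(2^{5-j} B⁻¹) ≤ 2^{-b_j}`
with `B = 2^20 A`. -/
def bjSpec (g : ℝ → ℝ) (A : ℝ) (b : ℤ → ℤ) : Prop :=
  ∀ j : ℤ, (2:ℝ) ^ (-b j - 1) < (2:ℝ) ^ (-j) * g ((2:ℝ) ^ (5 - j) * (2 ^ 20 * A)⁻¹) ∧
    (2:ℝ) ^ (-j) * g ((2:ℝ) ^ (5 - j) * (2 ^ 20 * A)⁻¹) ≤ (2:ℝ) ^ (-b j)

/-- The normalized curve hypotheses (1.19)-(1.24) of Theorem B:  `γ(x,0) = x₂`,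
`γ̇(x,0) = 0`, quasi-monotonicity of `γ̇`, doubling bounds for `|γ̇|`, and bounds for
`γ_{x₂}` and its gradient. -/
structure CurveHyp (c₀ A C₀ κ c₁ M : ℝ) (g : ℝ → ℝ)
    (γ γd γdd γ2 : ℝ × ℝ → ℝ → ℝ) : Prop where
  c₀_pos : 0 < c₀
  init : ∀ x : ℝ × ℝ, γ x 0 = x.2
  initd : ∀ x : ℝ × ℝ, γd x 0 = 0
  deriv1 : ∀ x t, |t| ≤ c₀ → HasDerivAt (γ x) (γd x t) t
  deriv2 : ∀ x t, |t| ≤ c₀ → HasDerivAt (γd x) (γdd x t) t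
  derivx2 : ∀ (x : ℝ × ℝ) t, |t| ≤ c₀ → HasDerivAt (fun v => γ (x.1, v) t) (γ2 x t) x.2
  smooth : ContDiff ℝ (⊤ : ℕ∞) (fun p : (ℝ × ℝ) × ℝ => γ p.1 p.2)
  qm : ∃ a E : ℝ × ℝ → ℝ → ℝ,
    (∀ x t, |t| ≤ c₀ → γdd x t = a x t + E x t) ∧
    (∀ x t, |t| ≤ c₀ → |E x t| ≤ κ * |γd x t|) ∧
    (∀ x, (∀ t ∈ Ioc (0:ℝ) c₀, 0 ≤ a x t) ∨ (∀ t ∈ Ioc (0:ℝ) c₀, a x t ≤ 0)) ∧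
    (∀ x, (∀ t ∈ Ico (-c₀) (0:ℝ), 0 ≤ a x t) ∨ (∀ t ∈ Ico (-c₀) (0:ℝ), a x t ≤ 0))
  dbl : ∀ x t, |t| ≤ c₀ →
    C₀⁻¹ * g (A⁻¹ * |t|) ≤ |γd x t| ∧ |γd x t| ≤ C₀ * g (A * |t|)
  g2_lower : ∀ x t, |t| ≤ c₀ → c₁ ≤ |γ2 x t|
  g2_upper : ∀ x t, |t| ≤ c₀ → |γ2 x t| ≤ M
  g2_grad : ∀ x t, |t| ≤ c₀ →
    ‖fderiv ℝ (fun p : (ℝ × ℝ) × ℝ => γ2 p.1 p.2) (x, t)‖ ≤ M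

section
namespace TB

/-- Bounded measurable functions of bounded support. -/
def IsD (f : ℝ × ℝ → ℝ) : Prop :=
  Measurable f ∧ (∃ B, ∀ x, |f x| ≤ B) ∧ ∃ R, ∀ x, f x ≠ 0 → |x.1| ≤ R ∧ |x.2| ≤ R

lemma IsD.comp {f : ℝ × ℝ → ℝ} (hf : IsD f) (φ : ℝ → ℝ) (hm : Measurable φ) (h0 : φ 0 = 0)
    (hb : ∀ B, ∃ B', ∀ y, |y| ≤ B → |φ y| ≤ B') : IsD (fun x => φ (f x)) := by
  obtain ⟨h1, ⟨B, hB⟩, R, hR⟩ := hf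
  refine ⟨hm.comp h1, ?_, R, fun x hx => hR x ?_⟩
  · obtain ⟨B', hB'⟩ := hb B
    exact ⟨B', fun x => hB' _ (hB x)⟩
  · intro h; apply hx; simp [h, h0]

lemma IsD.mul_bdd {f h : ℝ × ℝ → ℝ} (hf : IsD f) (hm : Measurable h) (B : ℝ)
    (hB : ∀ x, |h x| ≤ B) : IsD (fun x => h x * f x) := by
  obtain ⟨h1, ⟨B', hB'⟩, R, hR⟩ := hf
  refine ⟨hm.mul h1, ⟨B * B', fun x => ?_⟩, R, fun x hx => hR x ?_⟩
  · rw [abs_mul]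
    exact mul_le_mul (hB x) (hB' x) (abs_nonneg _) ((abs_nonneg _).trans (hB x))
  · intro h; apply hx; simp [h]

lemma IsD.of_le {f h : ℝ × ℝ → ℝ} (hf : IsD f) (hm : Measurable h)
    (hB : ∀ x, |h x| ≤ |f x|) : IsD h := by
  obtain ⟨h1, ⟨B', hB'⟩, R, hR⟩ := hf
  refine ⟨hm, ⟨B', fun x => (hB x).trans (hB' x)⟩, R, fun x hx => hR x ?_⟩
  intro h; apply hx; have := hB x; simpa [h] using this

lemma IsD.add {f g : ℝ × ℝ → ℝ} (hf : IsD f) (hh : IsD g) : IsD (f + g) := by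
  obtain ⟨h1, ⟨B, hB⟩, R, hR⟩ := hf
  obtain ⟨h1', ⟨B', hB'⟩, R', hR'⟩ := hh
  refine ⟨h1.add h1', ⟨B + B', fun x => (abs_add_le _ _).trans (add_le_add (hB x) (hB' x))⟩,
    max R R', fun x hx => ?_⟩
  by_cases h : f x = 0
  · have : g x ≠ 0 := by intro h2; apply hx; simp [h, h2]
    exact ⟨(hR' x this).1.trans (le_max_right _ _), (hR' x this).2.trans (le_max_right _ _)⟩
  · exact ⟨(hR x h).1.trans (le_max_left _ _), (hR x h).2.trans (le_max_left _ _)⟩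

lemma IsD.zero : IsD (0 : ℝ × ℝ → ℝ) :=
  ⟨measurable_zero, ⟨0, by simp⟩, 0, by simp⟩

lemma IsD.smul {f : ℝ × ℝ → ℝ} (c : ℝ) (hf : IsD f) : IsD (c • f) :=
  hf.mul_bdd measurable_const |c| (fun _ => le_rfl)

/-- The space of bounded measurable functions of bounded support. -/
def DD : Submodule ℝ (ℝ × ℝ → ℝ) where
  carrier := {f | IsD f}
  add_mem' := IsD.add
  zero_mem' := IsD.zero
  smul_mem' := fun c _ hf => hf.smul c

instance : CoeFun DD (fun _ => ℝ × ℝ → ℝ) := ⟨fun f => f.1⟩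

lemma dD (f : DD) : IsD f := f.2
lemma dM (f : DD) : Measurable f := f.2.1
@[simp] lemma add_val (f h : DD) (x) : (f + h) x = f x + h x := rfl
@[simp] lemma sub_val (f h : DD) (x) : (f - h) x = f x - h x := rfl
@[simp] lemma neg_val (f : DD) (x) : (-f) x = - f x := rfl
@[simp] lemma smul_val (c : ℝ) (f : DD) (x) : (c • f) x = c * f x := rfl
@[simp] lemma zero_val (x) : (0 : DD) x = 0 := rfl
lemma sum_val {ι : Type*} (s : Finset ι) (F : ι → DD) (x) :
    (∑ i ∈ s, F i) x = ∑ i ∈ s, F i x := by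
  have : (∑ i ∈ s, F i).1 = ∑ i ∈ s, (F i).1 := by simp
  change (∑ i ∈ s, F i).1 x = _
  rw [this]; simp

@[ext] lemma dext {f h : DD} (H : ∀ x, f x = h x) : f = h := Subtype.ext (funext H)

lemma IsD.integrable {f : ℝ × ℝ → ℝ} (hf : IsD f) : Integrable f := by
  obtain ⟨h1, ⟨B, hB⟩, R, hR⟩ := hf
  have hs : Function.support f ⊆ Icc (-R) R ×ˢ Icc (-R) R := by
    intro x hx
    have := hR x hx
    exact ⟨abs_le.1 this.1, abs_le.1 this.2⟩
  rw [← integrableOn_iff_integrable_of_support_subset hs]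
  refine Measure.integrableOn_of_bounded (M := B) ?_ h1.aestronglyMeasurable ?_
  · exact (isCompact_Icc.prod isCompact_Icc).measure_lt_top.ne
  · exact Eventually.of_forall fun x => hB x

lemma IsD.abs {f : ℝ × ℝ → ℝ} (hf : IsD f) : IsD (fun x => |f x|) :=
  hf.comp (fun y => |y|) measurable_norm (by simp) (fun B => ⟨B, fun y hy => by simpa using hy⟩)

lemma IsD.rpow {f : ℝ × ℝ → ℝ} (hf : IsD f) {p : ℝ} (hp : 0 < p) : IsD (fun x => |f x| ^ p) :=
  hf.comp (fun y => |y| ^ p) (by fun_prop) (by simp [Real.zero_rpow hp.ne'])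
    (fun B => ⟨B ^ p, fun y hy => by
      rw [abs_of_nonneg (by positivity)]
      exact Real.rpow_le_rpow (abs_nonneg _) hy hp.le⟩)

lemma IsD.mul {f h : ℝ × ℝ → ℝ} (hf : IsD f) (hh : IsD h) : IsD (fun x => f x * h x) := by
  obtain ⟨h1, ⟨B, hB⟩, -⟩ := hf
  exact hh.mul_bdd h1 B hB

lemma IsD.sum {ι : Type*} (s : Finset ι) {F : ι → ℝ × ℝ → ℝ} (h : ∀ i ∈ s, IsD (F i)) :
    IsD (fun x => ∑ i ∈ s, F i x) := by
  have : IsD (∑ i ∈ s, F i) := DD.sum_mem h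
  convert this using 1; ext x; simp

lemma IsD.sq {f : ℝ × ℝ → ℝ} (hf : IsD f) : IsD (fun x => f x ^ 2) := by
  simpa [pow_two] using hf.mul hf

lemma IsD.sqrt {f : ℝ × ℝ → ℝ} (hf : IsD f) : IsD (fun x => √(f x)) :=
  hf.comp (fun y => √y) (by fun_prop) (by simp)
    (fun B => ⟨√B, fun y hy => by
      rw [abs_of_nonneg (by positivity)]
      exact Real.sqrt_le_sqrt ((le_abs_self _).trans hy)⟩)

lemma IsD.memLp {f : ℝ × ℝ → ℝ} (hf : IsD f) {p : ℝ} (hp : 0 < p) :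
    MemLp f (ENNReal.ofReal p) := by
  have h := (hf.rpow hp).integrable
  rw [← integrable_norm_rpow_iff hf.1.aestronglyMeasurable (by simpa using hp) (by simp)]
  simpa [ENNReal.toReal_ofReal hp.le] using h

/-- absolute value in `DD` -/
def dabs (f : DD) : DD := ⟨fun x => |f x|, (dD f).abs⟩
@[simp] lemma abs_val (f : DD) (x) : dabs f x = |f x| := rfl
/-- product in `DD` -/
def dmul (f h : DD) : DD := ⟨fun x => f x * h x, (dD f).mul (dD h)⟩
@[simp] lemma mul_val (f h : DD) (x) : dmul f h x = f x * h x := rfl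

/-- `L^p` norm. -/
def N (p : ℝ) (f : ℝ × ℝ → ℝ) : ℝ := (∫ x, |f x| ^ p) ^ (1 / p)

lemma int_rpow_nonneg (p : ℝ) (f : ℝ × ℝ → ℝ) : 0 ≤ ∫ x, |f x| ^ p :=
  integral_nonneg fun x => by positivity

lemma N_nonneg (p : ℝ) (f : ℝ × ℝ → ℝ) : 0 ≤ N p f :=
  Real.rpow_nonneg (int_rpow_nonneg p f) _

lemma N_pow {p : ℝ} (hp : 0 < p) (f : ℝ × ℝ → ℝ) : N p f ^ p = ∫ x, |f x| ^ p := by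
  rw [N, ← Real.rpow_mul (int_rpow_nonneg p f), one_div_mul_cancel hp.ne', Real.rpow_one]

lemma N_le_of_pow {p c : ℝ} (hp : 0 < p) (hc : 0 ≤ c) {f h : ℝ × ℝ → ℝ}
    (H : ∫ x, |f x| ^ p ≤ c ^ p * ∫ x, |h x| ^ p) : N p f ≤ c * N p h := by
  rw [← N_pow hp, ← N_pow hp, ← Real.mul_rpow hc (N_nonneg _ _)] at H
  exact (Real.rpow_le_rpow_iff (N_nonneg _ _) (mul_nonneg hc (N_nonneg _ _)) hp).1 H

lemma pow_le_of_N {p c : ℝ} (hp : 0 < p) (hc : 0 ≤ c) {f h : ℝ × ℝ → ℝ}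
    (H : N p f ≤ c * N p h) : ∫ x, |f x| ^ p ≤ c ^ p * ∫ x, |h x| ^ p := by
  rw [← N_pow hp, ← N_pow hp, ← Real.mul_rpow hc (N_nonneg _ _)]
  exact Real.rpow_le_rpow (N_nonneg _ _) H hp.le

lemma N_eq_lpNorm {p : ℝ} (hp : 0 < p) {f : ℝ × ℝ → ℝ} (hf : Measurable f) :
    N p f = lpNorm f (ENNReal.ofReal p) volume := by
  rw [lpNorm_eq_integral_norm_rpow_toReal (by simpa using hp) (by simp) hf.aestronglyMeasurable,
    ENNReal.toReal_ofReal hp.le, N]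
  simp

lemma N_add_le {p : ℝ} (hp : 1 ≤ p) (f h : DD) : N p (f + h : DD) ≤ N p f + N p h := by
  have hp0 : 0 < p := by linarith
  rw [N_eq_lpNorm hp0 (dM _), N_eq_lpNorm hp0 (dM f), N_eq_lpNorm hp0 (dM h)]
  exact lpNorm_add_le ((dD f).memLp hp0) (by simpa using hp)

lemma N_smul {p : ℝ} (hp : 0 < p) (c : ℝ) (f : DD) : N p (c • f : DD) = |c| * N p f := by
  rw [N_eq_lpNorm hp (dM _), N_eq_lpNorm hp (dM f)]
  exact lpNorm_const_smul c _ _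

lemma N_mono {p : ℝ} (hp : 0 < p) {f h : ℝ × ℝ → ℝ} (hf : IsD f) (hh : IsD h)
    (H : ∀ x, |f x| ≤ |h x|) : N p f ≤ N p h := by
  apply Real.rpow_le_rpow (int_rpow_nonneg _ _) _ (by positivity)
  apply integral_mono (hf.rpow hp).integrable (hh.rpow hp).integrable
  intro x
  exact Real.rpow_le_rpow (abs_nonneg _) (H x) hp.le

lemma N_abs {p : ℝ} (f : ℝ × ℝ → ℝ) : N p (fun x => |f x|) = N p f := by simp [N]

lemma N_zero {p : ℝ} (hp : 0 < p) : N p (0 : DD) = 0 := by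
  have := N_smul hp 0 (0 : DD)
  simpa using this

lemma N_sum_le {p : ℝ} (hp : 1 ≤ p) {ι : Type*} (s : Finset ι) (F : ι → DD) :
    N p (∑ i ∈ s, F i : DD) ≤ ∑ i ∈ s, N p (F i) := by
  classical
  induction s using Finset.induction_on with
  | empty => simpa using (N_zero (lt_of_lt_of_le one_pos hp)).le
  | insert a s ha ih =>
    rw [Finset.sum_insert ha, Finset.sum_insert ha]
    exact (N_add_le hp _ _).trans (by gcongr)

/-- Bilinear pairing. -/
def ip (f h : ℝ × ℝ → ℝ) : ℝ := ∫ x, f x * h x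

lemma ip_comm (f h : ℝ × ℝ → ℝ) : ip f h = ip h f := by simp [ip, mul_comm]

lemma ip_add_left (f f' h : DD) : ip (f + f' : DD) h = ip f h + ip f' h := by
  unfold ip
  rw [← integral_add ((dD f).mul (dD h)).integrable ((dD f').mul (dD h)).integrable]
  simp [add_mul]

lemma ip_smul_left (c : ℝ) (f h : DD) : ip (c • f : DD) h = c * ip f h := by
  unfold ip
  rw [← integral_const_mul]
  simp [mul_assoc]

lemma ip_zero_left (h : DD) : ip (0 : DD) h = 0 := by
  have := ip_smul_left 0 0 h; simpa using this

lemma ip_sub_left (f f' h : DD) : ip (f - f' : DD) h = ip f h - ip f' h := by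
  have := ip_add_left f ((-1 : ℝ) • f') h
  rw [ip_smul_left] at this
  rw [show f - f' = f + (-1 : ℝ) • f' from dext fun x => by simp [sub_eq_add_neg], this]; ring

lemma ip_sum_left {ι : Type*} (s : Finset ι) (F : ι → DD) (h : DD) :
    ip (∑ i ∈ s, F i : DD) h = ∑ i ∈ s, ip (F i) h := by
  classical
  induction s using Finset.induction_on with
  | empty => simpa using ip_zero_left h
  | insert a s ha ih => rw [Finset.sum_insert ha, Finset.sum_insert ha, ip_add_left, ih]

lemma ip_add_right (f f' h : DD) : ip h (f + f' : DD) = ip h f + ip h f' := by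
  rw [ip_comm, ip_add_left, ip_comm f, ip_comm f']
lemma ip_smul_right (c : ℝ) (f h : DD) : ip h (c • f : DD) = c * ip h f := by
  rw [ip_comm, ip_smul_left, ip_comm f]
lemma ip_zero_right (h : DD) : ip h (0 : DD) = 0 := by rw [ip_comm, ip_zero_left]
lemma ip_sub_right (f f' h : DD) : ip h (f - f' : DD) = ip h f - ip h f' := by
  rw [ip_comm, ip_sub_left, ip_comm f, ip_comm f']
lemma ip_sum_right {ι : Type*} (s : Finset ι) (F : ι → DD) (h : DD) :
    ip h (∑ i ∈ s, F i : DD) = ∑ i ∈ s, ip h (F i) := by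
  rw [ip_comm, ip_sum_left]; simp [ip_comm]

/-- Hölder. -/
lemma holder_abs {p q : ℝ} (hpq : p.HolderConjugate q) {f h : ℝ × ℝ → ℝ} (hf : IsD f)
    (hh : IsD h) : ∫ x, |f x| * |h x| ≤ N p f * N q h :=
  integral_mul_norm_le_Lp_mul_Lq hpq (hf.memLp hpq.pos) (hh.memLp hpq.symm.pos)

lemma holder {p q : ℝ} (hpq : p.HolderConjugate q) {f h : ℝ × ℝ → ℝ} (hf : IsD f)
    (hh : IsD h) : |ip f h| ≤ N p f * N q h := by
  refine le_trans ?_ (holder_abs hpq hf hh)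
  unfold ip
  refine (abs_integral_le_integral_abs).trans (le_of_eq ?_)
  simp [abs_mul]

/-- Duality. -/
lemma duality {p q : ℝ} (hpq : p.HolderConjugate q) (f : DD) {C : ℝ} (hC : 0 ≤ C)
    (H : ∀ h : DD, |ip f h| ≤ C * N q h) : N p f ≤ C := by
  have hp := hpq.pos
  have hq := hpq.symm.pos
  have hp1 : 0 < p - 1 := sub_pos.2 hpq.lt
  have hh : IsD (fun x => SignType.sign (f x) * |f x| ^ (p - 1)) := by
    refine ((dD f).rpow hp1).mul_bdd (h := fun x => (SignType.sign (f x) : ℝ)) ?_ 1 ?_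
    · have : Measurable (fun y : ℝ => (SignType.sign y : ℝ)) := by
        have : (fun y : ℝ => (SignType.sign y : ℝ)) = fun y => if 0 < y then 1 else if y < 0 then -1 else 0 := by
          ext y
          simp only [sign_apply]
          split_ifs <;> simp
        rw [this]
        refine Measurable.ite measurableSet_Ioi measurable_const ?_
        exact Measurable.ite measurableSet_Iio measurable_const measurable_const
      exact this.comp (dM f)
    · intro x
      rcases lt_trichotomy (f x) 0 with h | h | h <;> simp [h]
  have h1 := H ⟨_, hh⟩
  set S := ∫ x, |f x| ^ p with hS
  have hS0 : 0 ≤ S := int_rpow_nonneg _ _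
  have e1 : ip f (fun x => SignType.sign (f x) * |f x| ^ (p - 1)) = S := by
    unfold ip
    rw [hS]
    congr 1; ext x
    rw [← mul_assoc, self_mul_sign]
    by_cases hx : |f x| = 0
    · simp [hx, Real.zero_rpow hp.ne']
    · have : 0 < |f x| := lt_of_le_of_ne (abs_nonneg _) (Ne.symm hx)
      nth_rewrite 1 [← Real.rpow_one |f x|]
      rw [← Real.rpow_add this]; congr 1; ring
  have e2 : N q (fun x => SignType.sign (f x) * |f x| ^ (p - 1)) = S ^ (1 / q) := by
    unfold N; congr 1; rw [hS]; congr 1; ext x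
    by_cases hx : f x = 0
    · simp [hx, Real.zero_rpow hp.ne', Real.zero_rpow hq.ne']
    · rw [abs_mul, abs_of_nonneg (by positivity : 0 ≤ |f x| ^ (p - 1))]
      have : |(SignType.sign (f x) : ℝ)| = 1 := by
        rcases lt_or_gt_of_ne hx with h | h <;> simp [h]
      rw [this, one_mul, ← Real.rpow_mul (abs_nonneg _), hpq.sub_one_mul_conj]
  simp only at h1
  rw [e1, e2, abs_of_nonneg hS0] at h1
  have : N p f = S ^ (1 / p) := rfl
  rw [this]
  rcases hS0.eq_or_lt with h0 | h0
  · rw [← h0, Real.zero_rpow (by positivity)]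
    exact hC
  · have h3 : S ^ (1 / p) * S ^ (1 / q) = S := by
      rw [← Real.rpow_add h0]
      have := hpq.inv_add_inv_eq_one
      simp [this]
    have h4 : 0 < S ^ (1 / q) := by positivity
    nlinarith
end TB
end

section
namespace TB

/-- kernel of the layer cake estimate -/
def LK (A B c q r t y : ℝ) : ℝ := if c * t < y then A * t ^ (-q) * y ^ q else B * t ^ (-r) * y ^ r

lemma LK_inner {A B c p q r : ℝ} (hA : 0 ≤ A) (hB : 0 ≤ B) (hc : 0 < c) (hq : 0 < q) (hqp : q < p)
    (hpr : p < r) {y : ℝ} (hy : 0 ≤ y) :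
    ∫⁻ t in Ioi (0:ℝ), ENNReal.ofReal (LK A B c q r t y) * ENNReal.ofReal (t ^ (p - 1)) ≤
      ENNReal.ofReal ((A * c ^ (q - p) / (p - q) + B * c ^ (r - p) / (r - p)) * y ^ p) := by
  have hp0 : 0 < p := by linarith
  rcases hy.eq_or_lt with rfl | hy
  · have : ∀ t ∈ Ioi (0:ℝ), ENNReal.ofReal (LK A B c q r t 0) * ENNReal.ofReal (t ^ (p - 1)) = 0 := by
      intro t ht
      have : ¬ c * t < 0 := by have : 0 < c * t := mul_pos hc ht; linarith
      simp [LK, this, Real.zero_rpow (by linarith : r ≠ 0)]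
    rw [setLIntegral_congr_fun measurableSet_Ioi this]; simp
  have hyc : 0 < y / c := by positivity
  have e : Ioi (0:ℝ) = Ioo 0 (y / c) ∪ Ici (y / c) := by
    ext t; simp only [mem_Ioi, mem_union, mem_Ioo, mem_Ici]
    constructor
    · intro h; rcases lt_or_ge t (y / c) with h' | h' <;> simp [*]
    · rintro (h | h); exact h.1; linarith
  have i1 : ∫⁻ t in Ioo 0 (y / c), ENNReal.ofReal (LK A B c q r t y) * ENNReal.ofReal (t ^ (p - 1))
      = ENNReal.ofReal (A * c ^ (q - p) / (p - q) * y ^ p) := by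
    have h1 : ∀ t ∈ Ioo 0 (y / c), ENNReal.ofReal (LK A B c q r t y) * ENNReal.ofReal (t ^ (p - 1))
        = ENNReal.ofReal (A * y ^ q * t ^ (p - q - 1)) := by
      intro t ht
      have h2 : c * t < y := by have := ht.2; rw [lt_div_iff₀ hc] at this; linarith
      have ht0 := ht.1
      rw [LK, if_pos h2, ← ENNReal.ofReal_mul (by positivity)]
      congr 1
      rw [show p - q - 1 = (-q) + (p - 1) by ring, Real.rpow_add ht0]; ring
    rw [setLIntegral_congr_fun measurableSet_Ioo h1]
    have hI : IntegrableOn (fun t : ℝ => t ^ (p - q - 1)) (Ioo 0 (y / c)) := by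
      rw [intervalIntegral.integrableOn_Ioo_rpow_iff hyc]; linarith
    rw [← ofReal_integral_eq_lintegral_ofReal (hI.const_mul _)]
    · congr 1
      rw [integral_const_mul, ← integral_Ioc_eq_integral_Ioo,
        ← intervalIntegral.integral_of_le hyc.le, integral_rpow (Or.inl (by linarith))]
      rw [show p - q - 1 + 1 = p - q by ring, Real.zero_rpow (by linarith), Real.div_rpow hy.le hc.le]
      rw [show c ^ (q - p) = (c ^ (p - q))⁻¹ by rw [← Real.rpow_neg hc.le]; congr 1; ring]
      have : y ^ p = y ^ q * y ^ (p - q) := by rw [← Real.rpow_add hy]; congr 1; ring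
      rw [this]; field_simp; ring
    · filter_upwards [ae_restrict_mem measurableSet_Ioo] with t ht
      have := ht.1
      simp only [Pi.zero_apply]; positivity
  have i2 : ∫⁻ t in Ici (y / c), ENNReal.ofReal (LK A B c q r t y) * ENNReal.ofReal (t ^ (p - 1))
      = ENNReal.ofReal (B * c ^ (r - p) / (r - p) * y ^ p) := by
    have h1 : ∀ t ∈ Ici (y / c), ENNReal.ofReal (LK A B c q r t y) * ENNReal.ofReal (t ^ (p - 1))
        = ENNReal.ofReal (B * y ^ r * t ^ (p - r - 1)) := by
      intro t ht
      have ht0 : 0 < t := lt_of_lt_of_le hyc ht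
      have h2 : ¬ c * t < y := by
        have : y / c ≤ t := ht
        rw [div_le_iff₀ hc] at this; linarith
      rw [LK, if_neg h2, ← ENNReal.ofReal_mul (by positivity)]
      congr 1
      rw [show p - r - 1 = (-r) + (p - 1) by ring, Real.rpow_add ht0]; ring
    rw [setLIntegral_congr_fun measurableSet_Ici h1]
    have hI : IntegrableOn (fun t : ℝ => t ^ (p - r - 1)) (Ici (y / c)) := by
      rw [integrableOn_Ici_iff_integrableOn_Ioi]
      exact integrableOn_Ioi_rpow_of_lt (by linarith) hyc
    rw [← ofReal_integral_eq_lintegral_ofReal (hI.const_mul _)]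
    · congr 1
      rw [integral_const_mul, integral_Ici_eq_integral_Ioi,
        integral_Ioi_rpow_of_lt (by linarith) hyc]
      rw [show p - r - 1 + 1 = p - r by ring, Real.div_rpow hy.le hc.le]
      rw [show c ^ (r - p) = (c ^ (p - r))⁻¹ by rw [← Real.rpow_neg hc.le]; congr 1; ring]
      have : y ^ p = y ^ r * y ^ (p - r) := by rw [← Real.rpow_add hy]; congr 1; ring
      have h3 : p - r ≠ 0 := by linarith
      have h4 : r - p ≠ 0 := by linarith
      rw [this]; 
      have : (p - r) = - (r - p) := by ring
      field_simp
      rw [this]; field_simp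
    · filter_upwards [ae_restrict_mem measurableSet_Ici] with t ht
      have : 0 < t := lt_of_lt_of_le hyc ht
      simp only [Pi.zero_apply]; positivity
  rw [e, lintegral_union measurableSet_Ici]
  · rw [i1, i2, ← ENNReal.ofReal_add]
    · rw [add_mul]
    · have : 0 < p - q := by linarith
      positivity
    · have : 0 < r - p := by linarith
      positivity
  · rw [Set.disjoint_left]; rintro t h1 h2; exact absurd h1.2 (not_lt.2 h2)

lemma LK_meas (A B c q r : ℝ) : Measurable (fun z : ℝ × ℝ => LK A B c q r z.1 z.2) := by
  unfold LK
  refine Measurable.ite ?_ (by fun_prop) (by fun_prop)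
  exact measurableSet_lt (by fun_prop) (by fun_prop)

lemma LK_nonneg {A B c q r t y : ℝ} (hA : 0 ≤ A) (hB : 0 ≤ B) (ht : 0 < t) (hy : 0 ≤ y) :
    0 ≤ LK A B c q r t y := by
  unfold LK; split_ifs <;> positivity

lemma LK_isD {A B c q r t : ℝ} (hA : 0 ≤ A) (hB : 0 ≤ B) (hq : 0 < q) (hr : 0 < r) (ht : 0 < t)
    {f : ℝ × ℝ → ℝ} (hf : IsD f) :
    IsD (fun x => LK A B c q r t |f x|) := by
  refine hf.comp (fun y => LK A B c q r t |y|) ?_ ?_ ?_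
  · exact (LK_meas A B c q r).comp (by fun_prop : Measurable fun y : ℝ => (t, |y|))
  · simp [LK, Real.zero_rpow hq.ne', Real.zero_rpow hr.ne']
  · intro b
    refine ⟨A * t ^ (-q) * b ^ q + B * t ^ (-r) * b ^ r, fun y hy => ?_⟩
    have hb : 0 ≤ b := (abs_nonneg _).trans hy
    rw [abs_of_nonneg (LK_nonneg hA hB ht (abs_nonneg _))]
    have h1 := Real.rpow_le_rpow (abs_nonneg _) hy hq.le
    have h2 := Real.rpow_le_rpow (abs_nonneg _) hy hr.le
    have h3 : 0 ≤ t ^ (-q) := by positivity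
    have h4 : 0 ≤ t ^ (-r) := by positivity
    unfold LK; split_ifs
    · have : A * t ^ (-q) * |y| ^ q ≤ A * t ^ (-q) * b ^ q := by gcongr
      have : 0 ≤ B * t ^ (-r) * b ^ r := by positivity
      linarith
    · have : B * t ^ (-r) * |y| ^ r ≤ B * t ^ (-r) * b ^ r := by gcongr
      have : 0 ≤ A * t ^ (-q) * b ^ q := by positivity
      linarith

lemma IsD.meas_lt_top {h : ℝ × ℝ → ℝ} (hh : IsD h) {t : ℝ} (ht : 0 ≤ t) :
    volume {x | t < |h x|} < ⊤ := by
  obtain ⟨-, -, R, hR⟩ := hh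
  refine lt_of_le_of_lt (measure_mono (t := Icc (-R) R ×ˢ Icc (-R) R) ?_)
    (isCompact_Icc.prod isCompact_Icc).measure_lt_top
  intro x hx
  have : h x ≠ 0 := by
    intro h0; simp [h0] at hx; linarith
  exact ⟨abs_le.1 (hR x this).1, abs_le.1 (hR x this).2⟩

/-- Layer cake interpolation. -/
lemma layer {A B c p q r : ℝ} (hA : 0 ≤ A) (hB : 0 ≤ B) (hc : 0 < c) (hq : 0 < q) (hqp : q < p)
    (hpr : p < r) {f h : ℝ × ℝ → ℝ} (hf : IsD f) (hh : IsD h)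
    (H : ∀ t, 0 < t → volume.real {x | t < |h x|} ≤ ∫ x, LK A B c q r t |f x|) :
    ∫ x, |h x| ^ p ≤
      p * (A * c ^ (q - p) / (p - q) + B * c ^ (r - p) / (r - p)) * ∫ x, |f x| ^ p := by
  have hp0 : 0 < p := by linarith
  have hr0 : 0 < r := by linarith
  have hd1 : 0 < p - q := by linarith
  have hd2 : 0 < r - p := by linarith
  have key : ∫⁻ x, ENNReal.ofReal (|h x| ^ p) ≤ ENNReal.ofReal p *
      ∫⁻ x, ENNReal.ofReal ((A * c ^ (q - p) / (p - q) + B * c ^ (r - p) / (r - p)) * |f x| ^ p) := by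
    rw [lintegral_rpow_eq_lintegral_meas_lt_mul (μ := volume) (f := fun x => |h x|)
      (Eventually.of_forall fun x => abs_nonneg _) hh.abs.1.aemeasurable hp0]
    gcongr
    calc ∫⁻ t in Ioi (0:ℝ), volume {a | t < |h a|} * ENNReal.ofReal (t ^ (p - 1))
        ≤ ∫⁻ t in Ioi (0:ℝ), ∫⁻ x, ENNReal.ofReal (LK A B c q r t |f x|) * ENNReal.ofReal (t ^ (p - 1)) := by
          refine setLIntegral_mono_ae' measurableSet_Ioi (Eventually.of_forall fun t ht => ?_)
          have ht : 0 < t := ht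
          rw [lintegral_mul_const _ (by
            exact ((LK_meas A B c q r).comp (measurable_const.prodMk hf.abs.1)).ennreal_ofReal)]
          gcongr
          rw [← ofReal_integral_eq_lintegral_ofReal (LK_isD hA hB hq hr0 ht hf).integrable
            (Eventually.of_forall fun x => LK_nonneg hA hB ht (abs_nonneg _))]
          rw [← ENNReal.ofReal_toReal (hh.meas_lt_top ht.le).ne]
          exact ENNReal.ofReal_le_ofReal (H t ht)
      _ = ∫⁻ x, ∫⁻ t in Ioi (0:ℝ), ENNReal.ofReal (LK A B c q r t |f x|) * ENNReal.ofReal (t ^ (p - 1)) := by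
          rw [lintegral_lintegral_swap]
          refine Measurable.aemeasurable ?_
          have h9 : Measurable (fun z : ℝ × (ℝ × ℝ) => ENNReal.ofReal (z.1 ^ (p - 1))) := by fun_prop
          refine Measurable.mul ?_ h9
          exact ((LK_meas A B c q r).comp (measurable_fst.prodMk (hf.abs.1.comp measurable_snd))).ennreal_ofReal
      _ ≤ _ := lintegral_mono fun x => LK_inner hA hB hc hq hqp hpr (abs_nonneg _)
  have h0 : 0 ≤ A * c ^ (q - p) / (p - q) + B * c ^ (r - p) / (r - p) := by positivity
  rw [← ofReal_integral_eq_lintegral_ofReal (hh.rpow hp0).integrable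
    (Eventually.of_forall fun x => by positivity),
    ← ofReal_integral_eq_lintegral_ofReal ((hf.rpow hp0).integrable.const_mul _)
    (Eventually.of_forall fun x => by positivity), ← ENNReal.ofReal_mul hp0.le] at key
  rw [integral_const_mul, ENNReal.ofReal_le_ofReal_iff] at key
  · linarith
  · have := int_rpow_nonneg p f
    positivity

lemma cheb {q t : ℝ} (hq : 0 < q) (ht : 0 < t) {h : ℝ × ℝ → ℝ} (hh : IsD h) :
    volume.real {x | t < |h x|} ≤ t ^ (-q) * ∫ x, |h x| ^ q := by
  have h1 := mul_meas_ge_le_integral_of_nonneg (μ := volume)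
    (Eventually.of_forall fun x => by positivity) (hh.rpow hq).integrable (t ^ q)
  have h2 : volume.real {x | t < |h x|} ≤ volume.real {x | t ^ q ≤ |h x| ^ q} := by
    refine measureReal_mono ?_ ?_
    · intro x hx; exact Real.rpow_le_rpow ht.le (le_of_lt hx) hq.le
    · have := (hh.meas_lt_top (t := t / 2) (by positivity))
      refine ne_top_of_le_ne_top this.ne (measure_mono ?_)
      intro x hx
      have : t ≤ |h x| := (Real.rpow_le_rpow_iff ht.le (abs_nonneg _) hq).1 hx
      simp only [mem_ofPred_eq]; linarith
  rw [Real.rpow_neg ht.le]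
  rw [inv_mul_eq_div, le_div_iff₀ (by positivity)]
  calc _ ≤ volume.real {x | t ^ q ≤ |h x| ^ q} * t ^ q := by gcongr
    _ = _ := mul_comm _ _
    _ ≤ _ := h1

/-- truncation -/
def hi (s : ℝ) (f : DD) : DD := ⟨fun x => if s < |f x| then f x else 0, by
  refine (dD f).of_le ?_ ?_
  · exact Measurable.ite (measurableSet_lt measurable_const (dD f).abs.1) (dM f) measurable_const
  · intro x; split_ifs <;> simp⟩
def lo (s : ℝ) (f : DD) : DD := ⟨fun x => if s < |f x| then 0 else f x, by
  refine (dD f).of_le ?_ ?_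
  · exact Measurable.ite (measurableSet_lt measurable_const (dD f).abs.1) measurable_const (dM f)
  · intro x; split_ifs <;> simp⟩
lemma hi_add_lo (s : ℝ) (f : DD) : hi s f + lo s f = f := by
  refine dext fun x => ?_
  simp only [add_val, hi, lo]; split_ifs <;> simp

lemma int_hi_lo {A B c q r t : ℝ} (hq : 0 < q) (hr : 0 < r) (f : DD) :
    A * t ^ (-q) * (∫ x, |hi (c * t) f x| ^ q) + B * t ^ (-r) * (∫ x, |lo (c * t) f x| ^ r)
      = ∫ x, LK A B c q r t |f x| := by
  rw [← integral_const_mul, ← integral_const_mul, ← integral_add]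
  · congr 1; ext x
    simp only [hi, lo, LK]; split_ifs <;> simp [Real.zero_rpow hq.ne', Real.zero_rpow hr.ne']
  · exact ((dD _).rpow hq).integrable.const_mul _
  · exact ((dD _).rpow hr).integrable.const_mul _

/-- Sublinear operators between weak types. -/
structure SubL (S : DD → DD) : Prop where
  sub : ∀ f g x, |S (f + g) x| ≤ |S f x| + |S g x|

/-- weak type `(q,q)`. -/
def Weak (q A : ℝ) (S : DD → DD) : Prop :=
  ∀ f t, 0 < t → volume.real {x | t < |S f x|} ≤ A * t ^ (-q) * ∫ x, |f x| ^ q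

lemma Weak.of_strong {q A : ℝ} (hq : 0 < q) {S : DD → DD}
    (H : ∀ f, ∫ x, |S f x| ^ q ≤ A * ∫ x, |f x| ^ q) : Weak q A S := by
  intro f t ht
  refine (cheb hq ht (dD (S f))).trans ?_
  have : t ^ (-q) * ∫ x, |S f x| ^ q ≤ t ^ (-q) * (A * ∫ x, |f x| ^ q) := by
    have : 0 ≤ t ^ (-q) := by positivity
    gcongr; exact H f
  linarith

/-- Marcinkiewicz with two finite exponents. -/
lemma marc {A B p q r : ℝ} (hA : 0 ≤ A) (hB : 0 ≤ B) (hq : 0 < q) (hqp : q < p)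
    (hpr : p < r) {S : DD → DD} (hS : SubL S) (h1 : Weak q A S) (h2 : Weak r B S)
    {c : ℝ} (hc : 0 < c) (f : DD) :
    ∫ x, |S f x| ^ p ≤ p * (A * 2 ^ q * c ^ (q - p) / (p - q) + B * 2 ^ r * c ^ (r - p) / (r - p))
      * ∫ x, |f x| ^ p := by
  have hr : 0 < r := by linarith
  refine layer (by positivity) (by positivity) hc hq hqp hpr (dD f) (dD _) fun t ht => ?_
  rw [← int_hi_lo hq hr]
  have ht2 : 0 < t / 2 := by positivity
  have e (q : ℝ) : (t / 2) ^ (-q) = 2 ^ q * t ^ (-q) := by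
    rw [Real.div_rpow ht.le (by norm_num), Real.rpow_neg (by norm_num : (0:ℝ) ≤ 2)]
    field_simp
  have a1 := h1 (hi (c * t) f) (t / 2) ht2
  have a2 := h2 (lo (c * t) f) (t / 2) ht2
  rw [e] at a1 a2
  have : volume.real {x | t < |S f x|} ≤
      volume.real ({x | t / 2 < |S (hi (c * t) f) x|} ∪ {x | t / 2 < |S (lo (c * t) f) x|}) := by
    refine measureReal_mono ?_ ?_
    · intro x hx
      have h3 := hS.sub (hi (c * t) f) (lo (c * t) f) x
      rw [hi_add_lo] at h3
      have hx : t < |S f x| := hx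
      by_contra hcon
      simp only [mem_union, mem_ofPred_eq, not_or, not_lt] at hcon
      linarith
    · exact (measure_union_lt_top ((dD _).meas_lt_top ht2.le) ((dD _).meas_lt_top ht2.le)).ne
  refine this.trans ((measureReal_union_le _ _).trans ?_)
  linarith

/-- Marcinkiewicz between weak `(q,q)` and `L^∞`. -/
lemma marc_top {A p q η : ℝ} (hA : 0 ≤ A) (hη : 0 < η) (hq : 0 < q) (hqp : q < p)
    {S : DD → DD} (hS : SubL S) (h1 : Weak q A S)
    (h2 : ∀ f B, (∀ x, |f x| ≤ B) → ∀ x, |S f x| ≤ η * B) (f : DD) :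
    ∫ x, |S f x| ^ p ≤ p * (A * 2 ^ q * (1 / (2 * η)) ^ (q - p) / (p - q)) * ∫ x, |f x| ^ p := by
  have hr : 0 < p + 1 := by linarith
  have main := layer (A := A * 2 ^ q) (B := 0) (c := 1 / (2 * η)) (p := p) (q := q) (r := p + 1)
    (f := f) (h := S f) (by positivity) le_rfl (by positivity) hq hqp
    (by linarith) (dD f) (dD _) ?_
  · refine main.trans (le_of_eq ?_)
    ring
  · intro t ht
    set c := 1 / (2 * η)
    rw [← int_hi_lo hq hr]
    have ht2 : 0 < t / 2 := by positivity
    have e (q : ℝ) : (t / 2) ^ (-q) = 2 ^ q * t ^ (-q) := by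
      rw [Real.div_rpow ht.le (by norm_num), Real.rpow_neg (by norm_num : (0:ℝ) ≤ 2)]
      field_simp
    have a1 := h1 (hi (c * t) f) (t / 2) ht2
    rw [e] at a1
    have : volume.real {x | t < |S f x|} ≤ volume.real {x | t / 2 < |S (hi (c * t) f) x|} := by
      refine measureReal_mono ?_ ((dD _).meas_lt_top ht2.le).ne
      intro x hx
      have h3 := hS.sub (hi (c * t) f) (lo (c * t) f) x
      rw [hi_add_lo] at h3
      have h4 := h2 (lo (c * t) f) (c * t) (by
        intro x; simp only [lo]; split_ifs with h
        · simp; positivity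
        · exact not_lt.1 h) x
      have h5 : η * (c * t) = t / 2 := by simp only [c]; field_simp
      have hx : t < |S f x| := hx
      simp only [mem_ofPred_eq]; linarith
    linarith

end TB
end

section
namespace TB
open Classical in
/-- sign attached to a subset -/
def sg {ι : Type*} (A : Finset ι) (i : ι) : ℝ := if i ∈ A then 1 else -1

lemma abs_sg {ι : Type*} (A : Finset ι) (i : ι) : |sg A i| = 1 := by
  unfold sg; split_ifs <;> simp

lemma sg_sq {ι : Type*} (A : Finset ι) (i : ι) : sg A i ^ 2 = 1 := by
  unfold sg; split_ifs <;> simp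

/-- average over subsets -/
def av {ι : Type*} (s : Finset ι) (F : Finset ι → ℝ) : ℝ :=
  (1 / 2) ^ s.card * ∑ A ∈ s.powerset, F A

lemma av_mono {ι : Type*} (s : Finset ι) {F G : Finset ι → ℝ} (h : ∀ A, F A ≤ G A) :
    av s F ≤ av s G := by
  unfold av; gcongr; exact h _

lemma av_const {ι : Type*} (s : Finset ι) (c : ℝ) : av s (fun _ => c) = c := by
  unfold av
  rw [Finset.sum_const, Finset.card_powerset]
  simp only [nsmul_eq_mul]; push_cast
  rw [← mul_assoc, ← mul_pow]; norm_num

lemma av_add {ι : Type*} (s : Finset ι) (F G : Finset ι → ℝ) :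
    av s (fun A => F A + G A) = av s F + av s G := by
  unfold av; rw [Finset.sum_add_distrib]; ring

lemma av_mul {ι : Type*} (s : Finset ι) (c : ℝ) (F : Finset ι → ℝ) :
    av s (fun A => c * F A) = c * av s F := by
  unfold av; rw [← Finset.mul_sum]; ring

lemma av_sum {ι κ : Type*} (s : Finset ι) (u : Finset κ) (F : κ → Finset ι → ℝ) :
    av s (fun A => ∑ k ∈ u, F k A) = ∑ k ∈ u, av s (F k) := by
  unfold av; rw [Finset.sum_comm, Finset.mul_sum]

lemma av_insert {ι : Type*} [DecidableEq ι] {s : Finset ι} {a : ι} (ha : a ∉ s) (F : Finset ι → ℝ) :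
    av (insert a s) F = av s (fun A => (F A + F (insert a A)) / 2) := by
  unfold av
  rw [Finset.sum_powerset_insert ha, Finset.card_insert_of_notMem ha, ← Finset.sum_add_distrib,
    ← Finset.sum_div, pow_succ]
  ring

lemma sg_insert {ι : Type*} [DecidableEq ι] {s : Finset ι} {a : ι} (ha : a ∉ s) (x : ι → ℝ) (A : Finset ι) :
    ∑ i ∈ s, sg (insert a A) i * x i = ∑ i ∈ s, sg A i * x i := by
  refine Finset.sum_congr rfl fun i hi => ?_
  have : i ≠ a := fun h => ha (h ▸ hi)
  simp [sg, this]

lemma av_congr {ι : Type*} (s : Finset ι) {F G : Finset ι → ℝ} (h : ∀ A ∈ s.powerset, F A = G A) :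
    av s F = av s G := by
  unfold av; rw [Finset.sum_congr rfl h]

lemma rad_step {ι : Type*} [DecidableEq ι] {s : Finset ι} {a : ι} (ha : a ∉ s) (x : ι → ℝ) (φ : ℝ → ℝ) :
    av (insert a s) (fun A => φ (∑ i ∈ insert a s, sg A i * x i)) =
    av s (fun A => (φ (∑ i ∈ s, sg A i * x i - x a) + φ (∑ i ∈ s, sg A i * x i + x a)) / 2) := by
  rw [av_insert ha]
  refine av_congr _ fun A hA => ?_
  have h1 : a ∉ A := fun h => ha (Finset.mem_powerset.1 hA h)
  simp only [Finset.sum_insert ha]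
  rw [sg_insert ha]
  have s1 : sg A a = -1 := by simp [sg, h1]
  have s2 : sg (insert a A) a = 1 := by simp [sg]
  rw [s1, s2]
  congr 3 <;> ring

lemma rad2 {ι : Type*} (s : Finset ι) (x : ι → ℝ) :
    av s (fun A => (∑ i ∈ s, sg A i * x i) ^ 2) = ∑ i ∈ s, x i ^ 2 := by
  classical
  induction s using Finset.induction_on with
  | empty => simp [av]
  | insert a s ha ih =>
    rw [rad_step ha x (fun y => y ^ 2), Finset.sum_insert ha, ← ih, ← av_const s (x a ^ 2), ← av_add]
    congr 1; ext A; ring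

lemma rad4 {ι : Type*} (s : Finset ι) (x : ι → ℝ) :
    av s (fun A => (∑ i ∈ s, sg A i * x i) ^ 4) ≤ 3 * (∑ i ∈ s, x i ^ 2) ^ 2 := by
  classical
  induction s using Finset.induction_on with
  | empty => simp [av]
  | insert a s ha ih =>
    rw [rad_step ha x (fun y => y ^ 4), Finset.sum_insert ha]
    have : av s (fun A => ((∑ i ∈ s, sg A i * x i - x a) ^ 4 + (∑ i ∈ s, sg A i * x i + x a) ^ 4) / 2)
      = av s (fun A => (∑ i ∈ s, sg A i * x i) ^ 4) +
        (6 * x a ^ 2) * av s (fun A => (∑ i ∈ s, sg A i * x i) ^ 2) + x a ^ 4 := by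
      rw [← av_mul, ← av_add]
      conv_rhs => rw [← av_const s (x a ^ 4), ← av_add]
      congr 1; ext A; ring
    rw [this, rad2]
    nlinarith [sq_nonneg (x a ^ 2)]

/-- double Rademacher sum -/
def dsum {ι κ : Type*} (s : Finset ι) (u : Finset κ) (a : ι → κ → ℝ) (A : Finset ι) (B : Finset κ) : ℝ :=
  ∑ i ∈ s, sg A i * ∑ k ∈ u, sg B k * a i k

lemma drad2 {ι κ : Type*} (s : Finset ι) (u : Finset κ) (a : ι → κ → ℝ) :
    av u (fun B => av s (fun A => dsum s u a A B ^ 2)) = ∑ i ∈ s, ∑ k ∈ u, a i k ^ 2 := by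
  unfold dsum
  simp_rw [rad2]
  rw [av_sum]
  simp_rw [rad2]

lemma drad4 {ι κ : Type*} (s : Finset ι) (u : Finset κ) (a : ι → κ → ℝ) :
    av u (fun B => av s (fun A => dsum s u a A B ^ 4)) ≤ 9 * (∑ i ∈ s, ∑ k ∈ u, a i k ^ 2) ^ 2 := by
  set V : ι → ℝ := fun i => ∑ k ∈ u, a i k ^ 2 with hV
  set b : ι → Finset κ → ℝ := fun i B => ∑ k ∈ u, sg B k * a i k with hb
  have hV0 : ∀ i, 0 ≤ V i := fun i => Finset.sum_nonneg fun k _ => sq_nonneg _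
  have hbV : ∀ i B, V i = 0 → b i B = 0 := by
    intro i B h
    rw [hV] at h
    have h' := (Finset.sum_eq_zero_iff_of_nonneg (fun k _ => sq_nonneg (a i k))).1 h
    refine Finset.sum_eq_zero fun k hk => ?_
    have := h' k hk
    simp at this; simp [this]
  calc av u (fun B => av s (fun A => dsum s u a A B ^ 4))
      ≤ av u (fun B => 3 * (∑ i ∈ s, b i B ^ 2) ^ 2) := by
        refine av_mono _ fun B => ?_
        exact rad4 s (fun i => b i B)
    _ ≤ av u (fun B => (3 * ∑ i ∈ s, V i) * (∑ i ∈ s, (V i)⁻¹ * b i B ^ 4)) := by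
        refine av_mono _ fun B => ?_
        have := Finset.sum_sq_le_sum_mul_sum_of_sq_le_mul s (r := fun i => b i B ^ 2)
          (f := V) (g := fun i => (V i)⁻¹ * b i B ^ 4) (fun i _ => hV0 i)
          (fun i _ => mul_nonneg (inv_nonneg.2 (hV0 i)) (by positivity)) (fun i _ => ?_)
        · rw [mul_assoc]; gcongr
        · by_cases h : V i = 0
          · simp [h, hbV i B h]
          · refine le_of_eq ?_
            field_simp
    _ = (3 * ∑ i ∈ s, V i) * (∑ i ∈ s, (V i)⁻¹ * av u (fun B => b i B ^ 4)) := by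
        rw [av_mul, av_sum]; simp_rw [av_mul]
    _ ≤ (3 * ∑ i ∈ s, V i) * (∑ i ∈ s, 3 * V i) := by
        refine mul_le_mul_of_nonneg_left (Finset.sum_le_sum fun i hi => ?_)
          (mul_nonneg (by norm_num) (Finset.sum_nonneg (s := s) fun i _ => hV0 i))
        · have h4 : av u (fun B => b i B ^ 4) ≤ 3 * V i ^ 2 := rad4 u (a i)
          by_cases h : V i = 0
          · simp [h]
          · have : 0 < V i := lt_of_le_of_ne (hV0 i) (Ne.symm h)
            rw [inv_mul_le_iff₀ this]; nlinarith
    _ = _ := by rw [← Finset.mul_sum]; ring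

lemma khin_pt {p : ℝ} (hp : 0 < p) {u : ℝ} (hu : 0 ≤ u) :
    u ^ 2 ≤ 1 / 4 + u ^ 4 / 36 + 36 * 2 ^ p * u ^ p := by
  have h0 : 0 ≤ 36 * 2 ^ p * u ^ p := by positivity
  rcases le_or_gt u (1/2) with h | h
  · have : 0 ≤ u ^ 4 := by positivity
    nlinarith
  rcases le_or_gt 6 u with h' | h'
  · have h36 : 36 ≤ u ^ 2 := by nlinarith
    have := mul_le_mul_of_nonneg_left h36 (sq_nonneg u)
    have e : u ^ 4 = u ^ 2 * u ^ 2 := by ring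
    linarith
  · have : (2:ℝ) ^ p * (1/2) ^ p = 1 := by
      rw [← Real.mul_rpow (by norm_num) (by norm_num)]; norm_num
    have h2 : (1/2 : ℝ) ^ p ≤ u ^ p := Real.rpow_le_rpow (by norm_num) h.le hp.le
    have h3 : (0:ℝ) < 2 ^ p := by positivity
    have : 1 ≤ 2 ^ p * u ^ p := by rw [← this]; gcongr
    have : 0 ≤ u ^ 4 := by positivity
    nlinarith

/-- Khintchine constant -/
def KC (p : ℝ) : ℝ := 2 * (36 * 2 ^ p)

lemma KC_pos (p : ℝ) : 0 < KC p := by unfold KC; positivity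

/-- Two-parameter Khintchine inequality (lower bound). -/
lemma khin2 {ι κ : Type*} (s : Finset ι) (u : Finset κ) (a : ι → κ → ℝ) {p : ℝ} (hp : 0 < p) :
    √(∑ i ∈ s, ∑ k ∈ u, a i k ^ 2) ^ p ≤
      KC p * av u (fun B => av s (fun A => |dsum s u a A B| ^ p)) := by
  set V := ∑ i ∈ s, ∑ k ∈ u, a i k ^ 2 with hV
  have hV0 : 0 ≤ V := Finset.sum_nonneg fun i _ => Finset.sum_nonneg fun k _ => sq_nonneg _
  rcases hV0.eq_or_lt with h | h
  · rw [← h]; simp only [Real.sqrt_zero, Real.zero_rpow hp.ne']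
    have : 0 ≤ av u (fun B => av s (fun A => |dsum s u a A B| ^ p)) := by
      unfold av
      refine mul_nonneg (by positivity) (Finset.sum_nonneg fun _ _ => mul_nonneg (by positivity)
        (Finset.sum_nonneg fun _ _ => by positivity))
    exact mul_nonneg (KC_pos p).le this
  set y := √V with hy
  have hy0 : 0 < y := Real.sqrt_pos.2 h
  have hyV : y ^ 2 = V := Real.sq_sqrt hV0
  have pt : ∀ z : ℝ, z ^ 2 ≤ V / 4 + (1 / (36 * V)) * z ^ 4 + 36 * 2 ^ p * (V / y ^ p) * |z| ^ p := by
    intro z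
    have := khin_pt hp (u := |z| / y) (by positivity)
    rw [Real.div_rpow (abs_nonneg _) hy0.le] at this
    have h2 : (|z| / y) ^ 2 = z ^ 2 / V := by rw [div_pow, sq_abs, hyV]
    have h4 : (|z| / y) ^ 4 = z ^ 4 / V ^ 2 := by
      rw [show (|z| / y) ^ 4 = ((|z| / y) ^ 2) ^ 2 by ring, h2]; ring
    rw [h2, h4] at this
    have h5 := mul_le_mul_of_nonneg_left this hV0
    have e : V * (z ^ 2 / V) = z ^ 2 := by field_simp
    rw [e] at h5
    refine h5.trans (le_of_eq ?_)
    field_simp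
  have m := av_mono u (fun B => av_mono s (fun A => pt (dsum s u a A B)))
  simp_rw [av_add, av_mul, av_const] at m
  rw [drad2] at m
  have m4 := drad4 s u a
  rw [← hV] at m m4
  set W := av u (fun B => av s (fun A => |dsum s u a A B| ^ p))
  have : 1 / (36 * V) * av u (fun B => av s (fun A => dsum s u a A B ^ 4)) ≤ 1 / (36 * V) * (9 * V ^ 2) := by
    gcongr
  have e2 : 1 / (36 * V) * (9 * V ^ 2) = V / 4 := by field_simp; norm_num
  have m2 : V / 2 ≤ 36 * 2 ^ p * (V / y ^ p) * W := by linarith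
  have hyp : 0 < y ^ p := by positivity
  have m3 : V / 2 * y ^ p ≤ V * (36 * 2 ^ p * W) := by
    have := mul_le_mul_of_nonneg_right m2 hyp.le
    refine this.trans (le_of_eq ?_)
    field_simp
  have m5 : V * (y ^ p / 2) ≤ V * (36 * 2 ^ p * W) := by linarith
  have m6 := le_of_mul_le_mul_left m5 h
  unfold KC; linarith

/-- square function -/
def sqf {ι : Type*} (s : Finset ι) (F : ι → DD) : DD :=
  ⟨fun x => √(∑ i ∈ s, F i x ^ 2), (IsD.sum s fun i _ => (dD (F i)).sq).sqrt⟩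

lemma sqf_val {ι : Type*} (s : Finset ι) (F : ι → DD) (x) : sqf s F x = √(∑ i ∈ s, F i x ^ 2) := rfl

lemma sqf_nonneg {ι : Type*} (s : Finset ι) (F : ι → DD) (x) : 0 ≤ sqf s F x := Real.sqrt_nonneg _

lemma le_sqf {ι : Type*} (s : Finset ι) (F : ι → DD) (x) {i : ι} (hi : i ∈ s) : |F i x| ≤ sqf s F x := by
  rw [sqf_val]
  apply Real.abs_le_sqrt
  exact Finset.single_le_sum (f := fun i => F i x ^ 2) (fun _ _ => sq_nonneg _) hi

/-- constant for square functions -/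
def KN (p : ℝ) : ℝ := KC p ^ (1 / p)
lemma KN_pos (p : ℝ) : 0 < KN p := Real.rpow_pos_of_pos (KC_pos p) _

lemma sqf_le2 {ι κ : Type*} (s : Finset ι) (u : Finset κ) (F : ι → κ → DD) {p b : ℝ} (hp : 0 < p)
    (hb : 0 ≤ b)
    (H : ∀ A B, N p (∑ i ∈ s, ∑ k ∈ u, (sg A i * sg B k) • F i k : DD) ≤ b) :
    N p (sqf (s ×ˢ u) (fun z => F z.1 z.2)) ≤ KN p * b := by
  have h1 : ∫ x, |sqf (s ×ˢ u) (fun z => F z.1 z.2) x| ^ p ≤ KC p * b ^ p := by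
    have hd : ∀ A B x, dsum s u (fun i k => F i k x) A B =
        (∑ i ∈ s, ∑ k ∈ u, (sg A i * sg B k) • F i k : DD) x := by
      intro A B x
      rw [sum_val]; unfold dsum
      refine Finset.sum_congr rfl fun i _ => ?_
      rw [sum_val, Finset.mul_sum]
      refine Finset.sum_congr rfl fun k _ => ?_
      simp; ring
    calc ∫ x, |sqf (s ×ˢ u) (fun z => F z.1 z.2) x| ^ p
        ≤ ∫ x, KC p * av u (fun B => av s (fun A => |dsum s u (fun i k => F i k x) A B| ^ p)) := by
          refine integral_mono ((dD _).rpow hp).integrable ?_ fun x => ?_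
          · refine Integrable.const_mul ?_ _
            refine Integrable.const_mul (integrable_finsetSum _ fun B _ => ?_) _
            refine Integrable.const_mul (integrable_finsetSum _ fun A _ => ?_) _
            simp_rw [hd]
            exact ((dD _).rpow hp).integrable
          · have := khin2 s u (fun i k => F i k x) hp
            rw [abs_of_nonneg (sqf_nonneg _ _ _), sqf_val, Finset.sum_product]
            exact this
      _ = KC p * av u (fun B => av s (fun A => ∫ x, |dsum s u (fun i k => F i k x) A B| ^ p)) := by
          rw [integral_const_mul]; congr 1; unfold av
          rw [integral_const_mul]; congr 1
          rw [integral_finsetSum]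
          · refine Finset.sum_congr rfl fun B _ => ?_
            rw [integral_const_mul]; congr 1
            rw [integral_finsetSum]
            intro A _
            simp_rw [hd]; exact ((dD _).rpow hp).integrable
          · intro B _
            refine Integrable.const_mul (integrable_finsetSum _ fun A _ => ?_) _
            simp_rw [hd]; exact ((dD _).rpow hp).integrable
      _ ≤ KC p * av u (fun B => av s (fun A => b ^ p)) := by
          have := (KC_pos p).le
          gcongr
          refine av_mono _ fun B => av_mono _ fun A => ?_
          simp_rw [hd, ← N_pow hp]
          exact Real.rpow_le_rpow (N_nonneg _ _) (H A B) hp.le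
      _ = _ := by simp_rw [av_const]
  rw [N, KN]
  calc _ ≤ (KC p * b ^ p) ^ (1 / p) := Real.rpow_le_rpow (int_rpow_nonneg _ _) h1 (by positivity)
    _ = _ := by
      rw [Real.mul_rpow (KC_pos p).le (by positivity), ← Real.rpow_mul hb, mul_one_div_cancel hp.ne',
        Real.rpow_one]

lemma sqf_le1 {ι : Type*} (s : Finset ι) (F : ι → DD) {p b : ℝ} (hp : 0 < p) (hb : 0 ≤ b)
    (H : ∀ ε : ι → ℝ, (∀ i, |ε i| = 1) → N p (∑ i ∈ s, ε i • F i : DD) ≤ b) :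
    N p (sqf s F) ≤ KN p * b := by
  have := sqf_le2 s ({()} : Finset Unit) (fun i _ => F i) hp hb (fun A B => by
    have := H (fun i => sg A i * sg B ()) (fun i => by rw [abs_mul, abs_sg, abs_sg, one_mul])
    simpa using this)
  convert this using 2
  ext x; simp [sqf_val]

end TB
end

section
namespace TB
/-- operators -/
abbrev Op := Module.End ℝ DD
instance opRing : Ring Op := inferInstance

lemma ip_self (f : DD) : ip f f = ∫ x, |f x| ^ (2:ℝ) := by
  unfold ip; congr 1; ext x; rw [Real.rpow_two, sq_abs]; ring

lemma ip_self_nonneg (f : DD) : 0 ≤ ip f f := by rw [ip_self]; exact int_rpow_nonneg _ _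

lemma N2_sq (f : DD) : N 2 f ^ 2 = ip f f := by
  rw [ip_self, ← N_pow (by norm_num : (0:ℝ) < 2), Real.rpow_two]

lemma cs (f h : DD) : |ip f h| ≤ N 2 f * N 2 h :=
  holder Real.HolderConjugate.two_two (dD f) (dD h)

lemma N2_le {c : ℝ} (hc : 0 ≤ c) {f : DD} (H : ∀ h : DD, |ip f h| ≤ c * N 2 h) : N 2 f ≤ c :=
  duality Real.HolderConjugate.two_two f hc H

lemma N_neg {p : ℝ} (f : DD) : N p (-f : DD) = N p f := by
  unfold N; simp

lemma N_sub_le {p : ℝ} (hp : 1 ≤ p) (f h : DD) : N p (f - h : DD) ≤ N p f + N p h := by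
  have := N_add_le hp f (-h)
  rw [N_neg, ← sub_eq_add_neg] at this; exact this

/-- restriction to a measurable set -/
def dind {A : Set (ℝ × ℝ)} (hA : MeasurableSet A) (f : DD) : DD :=
  ⟨A.indicator f, (dD f).of_le ((dM f).indicator hA) fun x => by
    by_cases h : x ∈ A <;> simp [h]⟩

lemma dind_val {A : Set (ℝ × ℝ)} (hA : MeasurableSet A) (f : DD) (x) :
    dind hA f x = A.indicator (fun _ => 1) x * f x := by
  by_cases h : x ∈ A <;> simp [dind, h]

lemma meas_fsup {ι : Type*} (s : Finset ι) (F : ι → DD) :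
    Measurable fun x => (s.sup fun i => ‖F i x‖₊ : ℝ≥0) := by
  classical
  induction s using Finset.induction_on with
  | empty => simp
  | insert a s ha ih =>
    simp only [Finset.sup_insert]
    exact (dM (F a)).nnnorm.sup ih

lemma fsup_le {ι : Type*} (s : Finset ι) (a : ι → ℝ) {B : ℝ} (hB : 0 ≤ B) (H : ∀ i ∈ s, |a i| ≤ B) :
    ((s.sup fun i => ‖a i‖₊ : ℝ≥0) : ℝ) ≤ B := by
  have : (s.sup fun i => ‖a i‖₊ : ℝ≥0) ≤ B.toNNReal := Finset.sup_le fun i hi =>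
    NNReal.coe_le_coe.1 (by rw [Real.coe_toNNReal B hB]; simpa using H i hi)
  have := NNReal.coe_le_coe.2 this
  rwa [Real.coe_toNNReal B hB] at this

lemma le_fsup {ι : Type*} (s : Finset ι) (a : ι → ℝ) {i : ι} (hi : i ∈ s) :
    |a i| ≤ ((s.sup fun i => ‖a i‖₊ : ℝ≥0) : ℝ) := by
  have := Finset.le_sup (f := fun i => ‖a i‖₊) hi
  have := NNReal.coe_le_coe.2 this
  simpa using this

/-- finite maximal function -/
def dsup {ι : Type*} (s : Finset ι) (F : ι → DD) : DD :=
  ⟨fun x => ((s.sup fun i => ‖F i x‖₊ : ℝ≥0) : ℝ), by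
    refine IsD.of_le (f := fun x => ∑ i ∈ s, |F i x|) (IsD.sum s fun i _ => (dD (F i)).abs) ?_ ?_
    · exact measurable_coe_nnreal_real.comp (meas_fsup s F)
    · intro x
      rw [abs_of_nonneg (NNReal.coe_nonneg _), abs_of_nonneg (Finset.sum_nonneg fun _ _ => abs_nonneg _)]
      exact fsup_le s _ (Finset.sum_nonneg fun _ _ => abs_nonneg _) fun i hi =>
        Finset.single_le_sum (f := fun i => |F i x|) (fun _ _ => abs_nonneg _) hi⟩

lemma dsup_nonneg {ι : Type*} (s : Finset ι) (F : ι → DD) (x) : 0 ≤ dsup s F x := NNReal.coe_nonneg _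
lemma le_dsup {ι : Type*} (s : Finset ι) (F : ι → DD) (x) {i : ι} (hi : i ∈ s) : |F i x| ≤ dsup s F x :=
  le_fsup s (fun i => F i x) hi
lemma dsup_le {ι : Type*} (s : Finset ι) (F : ι → DD) (x) {B : ℝ} (hB : 0 ≤ B) (H : ∀ i ∈ s, |F i x| ≤ B) :
    dsup s F x ≤ B := fsup_le s _ hB H
lemma lt_dsup {ι : Type*} (s : Finset ι) (F : ι → DD) (x) {t : ℝ} (ht : 0 ≤ t) (h : t < dsup s F x) :
    ∃ i ∈ s, t < |F i x| := by
  by_contra hc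
  push Not at hc
  exact absurd (dsup_le s F x ht hc) (not_le.2 h)

/-- abstract dyadic filtration -/
structure Filt (E : ℕ → Op) (rel : ℕ → ℝ × ℝ → ℝ × ℝ → Prop) : Prop where
  mul : ∀ k m, E k * E m = E (min k m)
  adj : ∀ k (f h : DD), ip (E k f) h = ip f (E k h)
  pos : ∀ k (f : DD), (∀ x, 0 ≤ f x) → ∀ x, 0 ≤ E k f x
  int : ∀ k (f : DD), ∫ x, E k f x = ∫ x, f x
  bdd : ∀ k (f : DD) B, (∀ x, |f x| ≤ B) → ∀ x, |E k f x| ≤ B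
  relE : ∀ k (f : DD) x y, rel k x y → E k f x = E k f y
  relm : ∀ j k x y, j ≤ k → rel k x y → rel j x y
  pull : ∀ k (φ : ℝ × ℝ → ℝ) (f f' : DD), (∀ x y, rel k x y → φ x = φ y) →
    (∀ x, f' x = φ x * f x) → ∀ x, E k f' x = φ x * E k f x
  dbl : ∀ k (f : DD), (∀ x, 0 ≤ f x) → ∀ x, E (k + 1) f x ≤ 2 * E k f x

/-- positive operators -/
def Pos (S : Op) : Prop := ∀ f : DD, (∀ x, 0 ≤ f x) → ∀ x, 0 ≤ S f x

lemma Pos.mono {S : Op} (hS : Pos S) {f h : DD} (H : ∀ x, f x ≤ h x) (x) : S f x ≤ S h x := by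
  have := hS (h - f) (fun x => by simpa using H x) x
  rw [map_sub, sub_val] at this; linarith

lemma Pos.abs {S : Op} (hS : Pos S) (f : DD) (x) : |S f x| ≤ S (dabs f) x := by
  rw [abs_le]
  constructor
  · have := hS.mono (f := -f) (h := dabs f) (fun x => by simpa using neg_le_abs (f x)) x
    rw [map_neg, neg_val] at this; linarith
  · exact hS.mono (fun x => by simpa using le_abs_self (f x)) x

section
variable {E : ℕ → Op} {rel : ℕ → ℝ × ℝ → ℝ × ℝ → Prop}

lemma Filt.mulf (hE : Filt E rel) (k m : ℕ) (f : DD) : E k (E m f) = E (min k m) f := by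
  rw [← hE.mul]; rfl

/-- stopping sets -/
def stp (E : ℕ → Op) (f : DD) (t : ℝ) (k : ℕ) : Set (ℝ × ℝ) :=
  {x | t < E k (dabs f) x ∧ ∀ j < k, E j (dabs f) x ≤ t}

lemma stp_meas (E : ℕ → Op) (f : DD) (t : ℝ) (k : ℕ) : MeasurableSet (stp E f t k) := by
  have : stp E f t k = {x | t < E k (dabs f) x} ∩ ⋂ j ∈ Iio k, {x | E j (dabs f) x ≤ t} := by
    ext x; simp [stp]
  rw [this]
  refine (measurableSet_lt measurable_const (dM _)).inter ?_
  exact MeasurableSet.biInter (to_countable _) fun j _ => measurableSet_le (dM _) measurable_const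

lemma stp_rel (hE : Filt E rel) (f : DD) (t : ℝ) (k : ℕ) (x y) (h : rel k x y) :
    (stp E f t k).indicator (fun _ => (1:ℝ)) x = (stp E f t k).indicator (fun _ => (1:ℝ)) y := by
  have : x ∈ stp E f t k ↔ y ∈ stp E f t k := by
    simp only [stp, mem_ofPred_eq]
    rw [hE.relE k _ x y h]
    refine and_congr_right fun _ => forall₂_congr fun j hj => ?_
    rw [hE.relE j _ x y (hE.relm j k x y hj.le h)]
  by_cases hx : x ∈ stp E f t k
  · simp [hx, this.1 hx]
  · simp [hx, mt this.2 hx]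

lemma stp_disj (f : DD) (t : ℝ) {j k : ℕ} {x} (hj : x ∈ stp E f t j) (hk : x ∈ stp E f t k) : j = k := by
  rcases lt_trichotomy j k with h | h | h
  · exact absurd hj.1 (not_lt.2 (hk.2 j h))
  · exact h
  · exact absurd hk.1 (not_lt.2 (hj.2 k h))

lemma stp_sum (f : DD) (t : ℝ) (s : Finset ℕ) (x) :
    ∑ k ∈ s, (stp E f t k).indicator (fun _ => (1:ℝ)) x ≤ 1 := by
  classical
  by_cases h : ∃ k ∈ s, x ∈ stp E f t k
  · obtain ⟨k, hk, hx⟩ := h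
    rw [Finset.sum_eq_single_of_mem k hk]
    · simp [hx]
    · intro j _ hj
      rw [indicator_of_notMem]
      exact fun h => hj (stp_disj f t h hx)
  · push Not at h
    rw [Finset.sum_eq_zero]
    · norm_num
    · intro k hk; simp [h k hk]

lemma stp_ex (f : DD) (t : ℝ) {K : ℕ} {x} (h : ∃ k ≤ K, t < E k (dabs f) x) :
    ∃ k ≤ K, x ∈ stp E f t k := by
  classical
  have h' : ∃ k, t < E k (dabs f) x := by obtain ⟨k, -, hk⟩ := h; exact ⟨k, hk⟩
  refine ⟨Nat.find h', ?_, Nat.find_spec h', fun j hj => not_lt.1 (Nat.find_min h' hj)⟩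
  obtain ⟨k, hk, hk'⟩ := h
  exact (Nat.find_min' h' hk').trans hk

lemma stp_vol (hE : Filt E rel) (f : DD) {t : ℝ} (ht : 0 < t) (k : ℕ) :
    volume (stp E f t k) < ⊤ ∧
    volume.real (stp E f t k) ≤ t⁻¹ * ∫ x, dind (stp_meas E f t k) (dabs f) x := by
  have sub : stp E f t k ⊆ {x | t < |E k (dabs f) x|} := fun x hx => lt_of_lt_of_le hx.1 (le_abs_self _)
  have fin : volume (stp E f t k) < ⊤ := lt_of_le_of_lt (measure_mono sub) ((dD _).meas_lt_top ht.le)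
  refine ⟨fin, ?_⟩
  have h1 : ∫ x, dind (stp_meas E f t k) (dabs f) x = ∫ x, dind (stp_meas E f t k) (E k (dabs f)) x := by
    rw [← hE.int k]
    congr 1; ext x
    rw [hE.pull k ((stp E f t k).indicator (fun _ => 1)) (dabs f) _ (stp_rel hE f t k) (dind_val _ _),
      dind_val]
  rw [h1, le_inv_mul_iff₀ ht]
  calc t * volume.real (stp E f t k) = ∫ x, (stp E f t k).indicator (fun _ => t) x := by
        rw [integral_indicator (stp_meas E f t k)]; simp [mul_comm]
    _ ≤ _ := by
        refine integral_mono ?_ (dD _).integrable fun x => ?_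
        · exact (integrable_indicator_iff (stp_meas E f t k)).2 (integrableOn_const fin.ne)
        · rw [dind_val]
          by_cases hx : x ∈ stp E f t k
          · simp only [hx, indicator_of_mem, one_mul]; exact hx.1.le
          · simp [hx]

lemma stp_vol_union (hE : Filt E rel) (f : DD) {t : ℝ} (ht : 0 < t) (K : ℕ) :
    volume.real (⋃ k ∈ Finset.range (K + 1), stp E f t k) ≤ t⁻¹ * ∫ x, |f x| ^ (1:ℝ) := by
  calc volume.real (⋃ k ∈ Finset.range (K + 1), stp E f t k)
      ≤ ∑ k ∈ Finset.range (K + 1), volume.real (stp E f t k) :=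
        measureReal_biUnion_finset_le _ _
    _ ≤ ∑ k ∈ Finset.range (K + 1), t⁻¹ * ∫ x, dind (stp_meas E f t k) (dabs f) x :=
        Finset.sum_le_sum fun k _ => (stp_vol hE f ht k).2
    _ = t⁻¹ * ∫ x, ∑ k ∈ Finset.range (K + 1), dind (stp_meas E f t k) (dabs f) x := by
        rw [← Finset.mul_sum, integral_finsetSum]
        exact fun k _ => (dD _).integrable
    _ ≤ _ := by
        gcongr ?_ * ?_
        refine integral_mono (integrable_finsetSum _ fun k _ => (dD _).integrable)
          ((dD f).rpow one_pos).integrable fun x => ?_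
        simp only [Real.rpow_one]
        simp_rw [dind_val, abs_val]
        rw [← Finset.sum_mul]
        exact mul_le_of_le_one_left (abs_nonneg _) (stp_sum f t _ x)

/-- Doob maximal function -/
def doob (E : ℕ → Op) (K : ℕ) (f : DD) : DD := dsup (Finset.range (K + 1)) fun k => E k (dabs f)

lemma Filt.pos' (hE : Filt E rel) (k : ℕ) : Pos (E k) := hE.pos k

lemma le_doob {K k : ℕ} (hk : k ≤ K) (f : DD) (x) : E k (dabs f) x ≤ doob E K f x :=
  (le_abs_self _).trans (le_dsup (Finset.range (K + 1)) (fun k => E k (dabs f)) x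
    (Finset.mem_range.2 (Nat.lt_succ_of_le hk)))

lemma doob_nonneg (K : ℕ) (f : DD) (x) : 0 ≤ doob E K f x := dsup_nonneg _ _ _

lemma doob_sub (hE : Filt E rel) (K : ℕ) : SubL (doob E K) := by
  refine ⟨fun f h x => ?_⟩
  rw [abs_of_nonneg (doob_nonneg _ _ _), abs_of_nonneg (doob_nonneg _ _ _), abs_of_nonneg (doob_nonneg _ _ _)]
  refine dsup_le _ _ _ (add_nonneg (dsup_nonneg _ _ _) (dsup_nonneg _ _ _)) fun k hk => ?_
  rw [abs_of_nonneg (hE.pos k _ (fun x => abs_nonneg _) x)]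
  have h1 := (hE.pos' k).mono (f := dabs (f + h)) (h := dabs f + dabs h)
    (fun x => by simpa using abs_add_le (f x) (h x)) x
  rw [map_add, add_val] at h1
  have hk' : k ≤ K := Nat.lt_succ_iff.1 (Finset.mem_range.1 hk)
  exact h1.trans (add_le_add (le_doob hk' f x) (le_doob hk' h x))

lemma doob_weak (hE : Filt E rel) (K : ℕ) : Weak 1 1 (doob E K) := by
  intro f t ht
  rw [one_mul, Real.rpow_neg_one]
  refine le_trans (measureReal_mono ?_ ?_) (stp_vol_union hE f ht K)
  · intro x hx
    simp only [mem_ofPred_eq] at hx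
    rw [abs_of_nonneg (doob_nonneg _ _ _)] at hx
    obtain ⟨k, hk, h⟩ := lt_dsup _ _ _ ht.le hx
    rw [abs_of_nonneg (hE.pos k _ (fun x => abs_nonneg _) x)] at h
    obtain ⟨j, hj, h'⟩ := stp_ex f t ⟨k, Nat.lt_succ_iff.1 (Finset.mem_range.1 hk), h⟩
    simp only [mem_iUnion]
    exact ⟨j, Finset.mem_range.2 (Nat.lt_succ_of_le hj), h'⟩
  · exact ((measure_biUnion_finset_le _ _).trans_lt
      (ENNReal.sum_lt_top.2 fun k _ => (stp_vol hE f ht k).1)).ne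

/-- generic constant in the interpolation between weak (1,1) and the bounded endpoint -/
def CM (A η p : ℝ) : ℝ := (p * (A * 2 ^ (1:ℝ) * (1 / (2 * η)) ^ (1 - p) / (p - 1))) ^ (1 / p)

lemma CM_nonneg {A η p : ℝ} (hA : 0 ≤ A) (hη : 0 < η) (hp : 1 < p) : 0 ≤ CM A η p := by
  unfold CM
  have : 0 < p - 1 := by linarith
  positivity

lemma N_of_int {p C : ℝ} (hp : 0 < p) (hC : 0 ≤ C) {f h : ℝ × ℝ → ℝ}
    (H : ∫ x, |f x| ^ p ≤ C * ∫ x, |h x| ^ p) : N p f ≤ C ^ (1 / p) * N p h := by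
  refine N_le_of_pow hp (by positivity) ?_
  rwa [← Real.rpow_mul hC, one_div_mul_cancel hp.ne', Real.rpow_one]

lemma marc_topN {A p η : ℝ} (hA : 0 ≤ A) (hη : 0 < η) (hp : 1 < p)
    {S : DD → DD} (hS : SubL S) (h1 : Weak 1 A S)
    (h2 : ∀ f B, (∀ x, |f x| ≤ B) → ∀ x, |S f x| ≤ η * B) (f : DD) :
    N p (S f) ≤ CM A η p * N p f := by
  have : 0 < p - 1 := by linarith
  exact N_of_int (by linarith) (by positivity) (marc_top hA hη one_pos hp hS h1 h2 f)

lemma doob_N (hE : Filt E rel) (K : ℕ) {p : ℝ} (hp : 1 < p) (f : DD) :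
    N p (doob E K f) ≤ CM 1 1 p * N p f := by
  refine marc_topN zero_le_one one_pos hp (doob_sub hE K) (doob_weak hE K) (fun f B hB x => ?_) f
  have hB0 : 0 ≤ B := (abs_nonneg _).trans (hB x)
  rw [one_mul, abs_of_nonneg (doob_nonneg _ _ _)]
  exact dsup_le _ _ _ hB0 fun k _ => hE.bdd k _ B (fun x => by simpa using hB x) x

end
end TB
end

section
namespace TB
section
variable {E : ℕ → Op} {rel : ℕ → ℝ × ℝ → ℝ × ℝ → Prop}

/-- martingale differences -/
def Dl (E : ℕ → Op) : ℕ → Op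
  | 0 => E 0
  | k + 1 => E (k + 1) - E k

lemma sum_Dl (E : ℕ → Op) (K : ℕ) : ∑ k ∈ Finset.range (K + 1), Dl E k = E K := by
  induction K with
  | zero => simp [Dl]
  | succ K ih => rw [Finset.sum_range_succ, ih]; simp [Dl]

lemma E_Dl_le (hE : Filt E rel) {m k : ℕ} (h : m ≤ k) : E k * Dl E m = Dl E m := by
  cases m with
  | zero => simp [Dl, hE.mul]
  | succ m => simp only [Dl, mul_sub, hE.mul]; rw [min_eq_right h, min_eq_right (by omega)]

lemma E_Dl_lt (hE : Filt E rel) {m k : ℕ} (h : k < m) : E k * Dl E m = 0 := by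
  cases m with
  | zero => omega
  | succ m => simp only [Dl, mul_sub, hE.mul]; rw [min_eq_left (by omega), min_eq_left (by omega), sub_self]

lemma E_comm (hE : Filt E rel) (k m : ℕ) : E k * E m = E m * E k := by rw [hE.mul, hE.mul, min_comm]

lemma E_Dl_comm (hE : Filt E rel) (k m : ℕ) : E k * Dl E m = Dl E m * E k := by
  cases m with
  | zero => exact E_comm hE _ _
  | succ m => simp only [Dl, mul_sub, sub_mul, E_comm hE k]

lemma Dl_Dl_ne (hE : Filt E rel) {j k : ℕ} (h : j ≠ k) : Dl E j * Dl E k = 0 := by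
  rcases lt_or_gt_of_ne h with h | h
  · cases j with
    | zero => exact E_Dl_lt hE h
    | succ j =>
      rw [show Dl E (j + 1) = E (j + 1) - E j from rfl, sub_mul, E_Dl_lt hE h, E_Dl_lt hE (by omega), sub_zero]
  · cases j with
    | zero => omega
    | succ j =>
      rw [show Dl E (j + 1) = E (j + 1) - E j from rfl, sub_mul, E_Dl_le hE (by omega), E_Dl_le hE (by omega), sub_self]

lemma Dl_Dl (hE : Filt E rel) (k : ℕ) : Dl E k * Dl E k = Dl E k := by
  cases k with
  | zero => exact E_Dl_le hE le_rfl
  | succ j =>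
    conv_lhs => enter [1]; rw [show Dl E (j + 1) = E (j + 1) - E j from rfl]
    rw [sub_mul, E_Dl_le hE le_rfl, E_Dl_lt hE (by omega), sub_zero]

lemma Dl_adj (hE : Filt E rel) (k : ℕ) (f h : DD) : ip (Dl E k f) h = ip f (Dl E k h) := by
  cases k with
  | zero => exact hE.adj _ _ _
  | succ k => 
    simp only [Dl, LinearMap.sub_apply]
    rw [ip_sub_left, ip_sub_right, hE.adj, hE.adj]

lemma E_N2 (hE : Filt E rel) (k : ℕ) (f : DD) : N 2 (E k f) ≤ N 2 f := by
  have h1 : N 2 (E k f) ^ 2 = ip f (E k f) := by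
    rw [N2_sq, hE.adj, hE.mulf, min_self]
  have h2 := (le_abs_self _).trans (cs f (E k f))
  rw [← h1] at h2
  by_contra hc
  push Not at hc
  have := N_nonneg 2 f
  nlinarith

/-- martingale transform -/
def SS (E : ℕ → Op) (c : ℕ → ℝ) (K : ℕ) : Op := ∑ k ∈ Finset.range (K + 1), c k • Dl E k

lemma SS_apply (c : ℕ → ℝ) (K : ℕ) (f : DD) :
    SS E c K f = ∑ k ∈ Finset.range (K + 1), c k • Dl E k f := by simp [SS]

lemma SS_adj (hE : Filt E rel) (c : ℕ → ℝ) (K : ℕ) (f h : DD) :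
    ip (SS E c K f) h = ip f (SS E c K h) := by
  rw [SS_apply, SS_apply, ip_sum_left, ip_sum_right]
  refine Finset.sum_congr rfl fun k _ => ?_
  rw [ip_smul_left, ip_smul_right, Dl_adj hE]

lemma SS_E (hE : Filt E rel) (c : ℕ → ℝ) (K : ℕ) : SS E c K * E K = SS E c K := by
  unfold SS; rw [Finset.sum_mul]
  refine Finset.sum_congr rfl fun k hk => ?_
  rw [smul_mul_assoc, ← E_Dl_comm hE, E_Dl_le hE (Nat.lt_succ_iff.1 (Finset.mem_range.1 hk))]

lemma sum_Dl_sq (hE : Filt E rel) (K : ℕ) (f : DD) :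
    ∑ k ∈ Finset.range (K + 1), ip (Dl E k f) (Dl E k f) ≤ ip f f := by
  have h : ∀ k, ip (Dl E k f) (Dl E k f) = ip f (Dl E k f) := by
    intro k
    rw [Dl_adj hE]
    congr 2
    exact congrArg (fun S : Op => S f) (Dl_Dl hE k)
  simp_rw [h]
  rw [← ip_sum_right]
  have : ∑ k ∈ Finset.range (K + 1), Dl E k f = E K f := by
    rw [← sum_Dl E K]; simp
  rw [this]
  calc ip f (E K f) ≤ N 2 f * N 2 (E K f) := (le_abs_self _).trans (cs _ _)
    _ ≤ N 2 f * N 2 f := mul_le_mul_of_nonneg_left (E_N2 hE K f) (N_nonneg _ _)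
    _ = _ := by rw [← sq, N2_sq]

lemma SS_L2 (hE : Filt E rel) {c : ℕ → ℝ} (hc : ∀ k, |c k| ≤ 1) (K : ℕ) (f : DD) :
    ip (SS E c K f) (SS E c K f) ≤ ip f f := by
  refine le_trans ?_ (sum_Dl_sq hE K f)
  rw [SS_apply, ip_sum_left]
  refine Finset.sum_le_sum fun k hk => ?_
  rw [ip_sum_right, Finset.sum_eq_single_of_mem k hk]
  · rw [ip_smul_left, ip_smul_right, ← mul_assoc]
    refine mul_le_of_le_one_left (ip_self_nonneg _) ?_
    have := abs_le.1 (hc k)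
    nlinarith
  · intro j _ hj
    rw [ip_smul_left, ip_smul_right, Dl_adj hE, 
      show Dl E k (Dl E j f) = (Dl E k * Dl E j) f from rfl, Dl_Dl_ne hE hj.symm]
    rw [LinearMap.zero_apply, ip_zero_right]; simp

lemma SS_weak (hE : Filt E rel) {c : ℕ → ℝ} (hc : ∀ k, |c k| ≤ 1) (K : ℕ) :
    Weak 1 5 (SS E c K) := by
  intro f t ht
  set f0 := E K f with hf0
  have hS : SS E c K f = SS E c K f0 := by
    conv_lhs => rw [← SS_E hE]
    rfl
  have hIntg : ∫ x, |f0 x| ≤ ∫ x, |f x| := by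
    calc ∫ x, |f0 x| ≤ ∫ x, E K (dabs f) x :=
          integral_mono (dD f0).abs.integrable (dD _).integrable fun x => (hE.pos' K).abs f x
      _ = ∫ x, |f x| := hE.int K _
  set A := stp E f0 t with hA
  have hAm : ∀ k, MeasurableSet (A k) := stp_meas E f0 t
  set I : ℕ → ℝ × ℝ → ℝ := fun k => (A k).indicator (fun _ => 1) with hI
  set b : DD := dind (hAm 0) f0 + ∑ k ∈ Finset.range K, dind (hAm (k + 1)) (f0 - E (k + 1) f0) with hb
  set g : DD := f0 - b with hg
  have gval : ∀ x, g x = f0 x - (I 0 x * f0 x + ∑ k ∈ Finset.range K, I (k+1) x * (f0 x - E (k + 1) f0 x)) := by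
    intro x
    rw [hg, hb, sub_val, add_val, sum_val]
    simp_rw [dind_val, sub_val]
    rfl
  have hI1 : ∀ k x, x ∈ A k → I k x = 1 := fun k x hx => by simp [hI, hx]
  have hI0 : ∀ k x, x ∉ A k → I k x = 0 := fun k x hx => by simp [hI, hx]
  -- pointwise bound
  have gbd : ∀ x, |g x| ≤ 2 * t := by
    intro x
    rw [gval]
    by_cases hx : ∃ k ≤ K, x ∈ A k
    · obtain ⟨k, hk, hxk⟩ := hx
      have hne : ∀ j, j ≠ k → I j x = 0 := fun j hj => hI0 j x fun h => hj (stp_disj f0 t h hxk)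
      cases k with
      | zero =>
        rw [hI1 0 x hxk, Finset.sum_eq_zero fun j _ => by rw [hne (j+1) (by omega), zero_mul]]
        simp; positivity
      | succ k =>
        rw [hne 0 (by omega), Finset.sum_eq_single_of_mem k (Finset.mem_range.2 (by omega)) 
          (fun j _ hj => by rw [hne (j+1) (by omega), zero_mul]), hI1 _ x hxk]
        simp only [zero_mul, one_mul, zero_add, sub_sub_cancel]
        refine ((hE.pos' (k+1)).abs f0 x).trans ((hE.dbl k (dabs f0) (fun x => abs_nonneg _) x).trans ?_)
        have := hxk.2 k (by omega)
        linarith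
    · push Not at hx
      rw [hI0 0 x (hx 0 (by omega)), Finset.sum_eq_zero fun j hj => by
        rw [hI0 (j+1) x (hx (j+1) (by have := Finset.mem_range.1 hj; omega)), zero_mul]]
      simp only [zero_mul, add_zero, sub_zero]
      have h1 : f0 = E K f0 := by rw [hf0, hE.mulf, min_self]
      have h2 : E K (dabs f0) x ≤ t := by
        by_contra hcon
        push Not at hcon
        obtain ⟨k, hk, hk'⟩ := stp_ex f0 t ⟨K, le_rfl, hcon⟩
        exact hx k hk hk'
      have h3 := (hE.pos' K).abs f0 x
      rw [← h1] at h3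
      linarith
  -- integral bound
  have gint : ∫ x, |g x| ≤ 2 * ∫ x, |f0 x| := by
    have p1 : ∀ x, |g x| ≤ |f0 x| + ∑ k ∈ Finset.range K, dind (hAm (k+1)) (E (k+1) (dabs f0)) x := by
      intro x
      rw [gval]
      have e : f0 x - (I 0 x * f0 x + ∑ k ∈ Finset.range K, I (k+1) x * (f0 x - E (k + 1) f0 x))
        = (1 - ∑ k ∈ Finset.range (K + 1), I k x) * f0 x + ∑ k ∈ Finset.range K, I (k+1) x * E (k+1) f0 x := by
        rw [Finset.sum_range_succ']
        simp_rw [mul_sub, Finset.sum_sub_distrib, ← Finset.sum_mul]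
        ring
      rw [e]
      refine (abs_add_le _ _).trans (add_le_add ?_ ?_)
      · rw [abs_mul]
        refine mul_le_of_le_one_left (abs_nonneg _) ?_
        have s1 := stp_sum (E := E) f0 t (Finset.range (K+1)) x
        have s2 : 0 ≤ ∑ k ∈ Finset.range (K + 1), I k x := Finset.sum_nonneg fun k _ =>
          indicator_nonneg (fun _ _ => zero_le_one) x
        change ∑ k ∈ Finset.range (K + 1), I k x ≤ 1 at s1
        rw [abs_of_nonneg (by linarith)]; linarith
      · refine (Finset.abs_sum_le_sum_abs _ _).trans (Finset.sum_le_sum fun k _ => ?_)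
        rw [dind_val, abs_mul, abs_of_nonneg (indicator_nonneg (fun _ _ => zero_le_one) x)]
        exact mul_le_mul_of_nonneg_left ((hE.pos' _).abs f0 x) (indicator_nonneg (fun _ _ => zero_le_one) x)
    calc ∫ x, |g x| ≤ ∫ x, (|f0 x| + ∑ k ∈ Finset.range K, dind (hAm (k+1)) (E (k+1) (dabs f0)) x) := by
          refine integral_mono (dD g).abs.integrable ?_ p1
          exact (dD f0).abs.integrable.add (integrable_finsetSum _ fun k _ => (dD _).integrable)
      _ = (∫ x, |f0 x|) + ∑ k ∈ Finset.range K, ∫ x, dind (hAm (k+1)) (E (k+1) (dabs f0)) x := by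
          rw [integral_add (dD f0).abs.integrable (integrable_finsetSum _ fun k _ => (dD _).integrable),
            integral_finsetSum _ fun k _ => (dD _).integrable]
      _ = (∫ x, |f0 x|) + ∑ k ∈ Finset.range K, ∫ x, dind (hAm (k+1)) (dabs f0) x := by
          congr 1
          refine Finset.sum_congr rfl fun k _ => ?_
          rw [← hE.int (k+1) (dind (hAm (k+1)) (dabs f0))]
          congr 1; ext x
          rw [hE.pull (k+1) (I (k+1)) (dabs f0) _ (stp_rel hE f0 t (k+1)) (dind_val _ _), dind_val]
      _ ≤ (∫ x, |f0 x|) + (∫ x, |f0 x|) := by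
          gcongr
          rw [← integral_finsetSum _ fun k _ => (dD _).integrable]
          refine integral_mono (integrable_finsetSum _ fun k _ => (dD _).integrable) (dD f0).abs.integrable fun x => ?_
          simp_rw [dind_val, abs_val, ← Finset.sum_mul]
          refine mul_le_of_le_one_left (abs_nonneg _) ?_
          have s1 := stp_sum (E := E) f0 t (Finset.range (K+1)) x
          rw [Finset.sum_range_succ'] at s1
          have : 0 ≤ (stp E f0 t 0).indicator (fun _ => (1:ℝ)) x := indicator_nonneg (fun _ _ => zero_le_one) x
          linarith
      _ = _ := by ring
  -- bad part
  have Eb : ∀ x, (∀ k ≤ K, x ∉ A k) → ∀ m, E m b x = 0 := by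
    intro x hx m
    rw [hb, map_add, map_sum, add_val, sum_val]
    have z0 : E m (dind (hAm 0) f0) x = 0 := by
      rw [hE.pull m (I 0) f0 _ (fun x y h => stp_rel hE f0 t 0 x y (hE.relm 0 m x y (Nat.zero_le _) h)) (dind_val _ _),
        hI0 0 x (hx 0 (Nat.zero_le _)), zero_mul]
    rw [z0, zero_add]
    refine Finset.sum_eq_zero fun k hk => ?_
    have hk := Finset.mem_range.1 hk
    rcases le_total m (k+1) with h | h
    · have : E (k+1) (dind (hAm (k+1)) (f0 - E (k+1) f0)) = 0 := by
        refine dext fun y => ?_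
        rw [hE.pull (k+1) (I (k+1)) (f0 - E (k+1) f0) _ (stp_rel hE f0 t (k+1)) (dind_val _ _), map_sub]
        have e : E (k+1) (E (k+1) f0) = E (k+1) f0 := by rw [hE.mulf (k+1) (k+1) f0, min_self]
        rw [e, sub_self]
        simp
      rw [← min_eq_left h, ← hE.mulf, this, map_zero]; rfl
    · rw [hE.pull m (I (k+1)) (f0 - E (k+1) f0) _ (fun x y h' => stp_rel hE f0 t (k+1) x y (hE.relm _ m x y h h')) (dind_val _ _),
        hI0 (k+1) x (hx (k+1) (by omega)), zero_mul]
  have Sb : ∀ x, (∀ k ≤ K, x ∉ A k) → SS E c K b x = 0 := by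
    intro x hx
    rw [SS_apply, sum_val]
    refine Finset.sum_eq_zero fun k _ => ?_
    rw [smul_val]
    cases k with
    | zero => simp only [Dl]; rw [Eb x hx, mul_zero]
    | succ k => simp only [Dl, LinearMap.sub_apply, sub_val]; rw [Eb x hx, Eb x hx]; simp
  have sub : {x | t < |SS E c K f x|} ⊆ (⋃ k ∈ Finset.range (K + 1), A k) ∪ {x | t < |SS E c K g x|} := by
    intro x hx
    by_cases h : ∃ k ≤ K, x ∈ A k
    · left; obtain ⟨k, hk, h⟩ := h
      simp only [mem_iUnion]
      exact ⟨k, Finset.mem_range.2 (by omega), h⟩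
    · right
      push Not at h
      simp only [mem_ofPred_eq] at hx ⊢
      rw [hg, map_sub, sub_val, Sb x h, sub_zero, ← hS]; exact hx
  have m1 := stp_vol_union hE f0 ht K
  simp only [Real.rpow_one] at m1
  have m2 := cheb (q := 2) (by norm_num) ht (dD (SS E c K g))
  rw [← ip_self] at m2
  have m3 : ip g g ≤ 4 * t * ∫ x, |f0 x| := by
    calc ip g g = ∫ x, |g x| * |g x| := by unfold ip; congr 1; ext x; rw [abs_mul_abs_self]
      _ ≤ ∫ x, (2 * t) * |g x| := by
        refine integral_mono ((dD g).abs.mul (dD g).abs).integrable ((dD g).abs.integrable.const_mul _) fun x => ?_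
        exact mul_le_mul_of_nonneg_right (gbd x) (abs_nonneg _)
      _ = (2 * t) * ∫ x, |g x| := by rw [integral_const_mul]
      _ ≤ (2 * t) * (2 * ∫ x, |f0 x|) := by gcongr
      _ = _ := by ring
  have m4 : volume.real {x | t < |SS E c K g x|} ≤ 4 * t⁻¹ * ∫ x, |f0 x| := by
    refine m2.trans ?_
    have : t ^ (-2:ℝ) * ip (SS E c K g) (SS E c K g) ≤ t ^ (-2:ℝ) * (4 * t * ∫ x, |f0 x|) := by
      have := (SS_L2 hE hc K g).trans m3
      gcongr
    refine this.trans (le_of_eq ?_)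
    rw [Real.rpow_neg ht.le, Real.rpow_two]
    field_simp
  calc volume.real {x | t < |SS E c K f x|}
      ≤ volume.real ((⋃ k ∈ Finset.range (K + 1), A k) ∪ {x | t < |SS E c K g x|}) := by
        refine measureReal_mono sub (measure_union_lt_top ?_ ((dD _).meas_lt_top ht.le)).ne
        exact (measure_biUnion_finset_le _ _).trans_lt
          (ENNReal.sum_lt_top.2 fun k _ => (stp_vol hE f0 ht k).1)
    _ ≤ _ := measureReal_union_le _ _
    _ ≤ (t⁻¹ * ∫ x, |f0 x|) + 4 * t⁻¹ * ∫ x, |f0 x| := add_le_add m1 m4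
    _ = 5 * t⁻¹ * ∫ x, |f0 x| := by ring
    _ ≤ 5 * t⁻¹ * ∫ x, |f x| := by gcongr
    _ = _ := by rw [Real.rpow_neg_one]; simp only [Real.rpow_one]

end

/-- sublinearity of linear maps -/
lemma subL_op (S : Op) : SubL S := ⟨fun f g x => by rw [map_add, add_val]; exact abs_add_le _ _⟩

/-- operator bound -/
def Bd (p : ℝ) (S : Op) (c : ℝ) : Prop := ∀ f : DD, N p (S f) ≤ c * N p f

lemma Bd.of_adj {p q : ℝ} (hpq : p.HolderConjugate q) {S S' : Op} {c : ℝ} (hc : 0 ≤ c)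
    (h : ∀ f h : DD, ip (S f) h = ip f (S' h)) (hb : Bd q S' c) : Bd p S c := by
  intro f
  refine duality hpq _ (mul_nonneg hc (N_nonneg _ _)) fun g => ?_
  rw [h]
  refine (holder hpq (dD f) (dD _)).trans ?_
  have := mul_le_mul_of_nonneg_left (hb g) (N_nonneg p f)
  linarith

lemma SS_bd_lt2 {p : ℝ} (hp : 1 < p) (hp2 : p < 2) : ∃ C : ℝ, 0 ≤ C ∧ ∀ (E : ℕ → Op) rel, Filt E rel →
    ∀ c : ℕ → ℝ, (∀ k, |c k| ≤ 1) → ∀ K, Bd p (SS E c K) C := by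
  refine ⟨(p * (5 * 2 ^ (1:ℝ) * 1 ^ (1 - p) / (p - 1) + 1 * 2 ^ (2:ℝ) * 1 ^ (2 - p) / (2 - p))) ^ (1 / p), ?_, ?_⟩
  · have : 0 < p - 1 := by linarith
    have : 0 < 2 - p := by linarith
    positivity
  · intro E rel hE c hc K f
    refine N_of_int (by linarith) ?_ (marc (A := 5) (B := 1) (by norm_num) (by norm_num) one_pos hp hp2 (subL_op _) (SS_weak hE hc K) ?_ one_pos f)
    · have : 0 < p - 1 := by linarith
      have : 0 < 2 - p := by linarith
      positivity
    · refine Weak.of_strong (by norm_num) fun f => ?_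
      rw [← ip_self, ← ip_self, one_mul]
      exact SS_L2 hE hc K f

lemma SS_bd {p : ℝ} (hp : 1 < p) : ∃ C : ℝ, 0 ≤ C ∧ ∀ (E : ℕ → Op) rel, Filt E rel →
    ∀ c : ℕ → ℝ, (∀ k, |c k| ≤ 1) → ∀ K, Bd p (SS E c K) C := by
  rcases lt_trichotomy p 2 with h | rfl | h
  · exact SS_bd_lt2 hp h
  · refine ⟨1, zero_le_one, fun E rel hE c hc K f => ?_⟩
    have := SS_L2 hE hc K f
    rw [← N2_sq, ← N2_sq] at this
    rw [one_mul]
    exact (pow_le_pow_iff_left₀ (N_nonneg _ _) (N_nonneg _ _) two_ne_zero).1 this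
  · have hpq := Real.HolderConjugate.conjExponent hp
    have hq2 : p.conjExponent < 2 := by
      rw [Real.conjExponent, div_lt_iff₀ (by linarith)]; linarith
    obtain ⟨C, hC, H⟩ := SS_bd_lt2 hpq.symm.lt hq2
    exact ⟨C, hC, fun E rel hE c hc K => (H E rel hE c hc K).of_adj hpq hC (SS_adj hE c K)⟩

end TB
end

section
namespace TB

/-- index of dyadic cell -/
def cl (k : ℕ) (a : ℝ) : ℤ := ⌊(2:ℝ) ^ k * a⌋

lemma cl_meas (k : ℕ) : Measurable (cl k) := by
  unfold cl; exact Int.measurable_floor.comp (measurable_const.mul measurable_id)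

lemma cl_mono (k : ℕ) : Monotone (cl k) := fun a b h => Int.floor_le_floor (by gcongr)

lemma cl_iff (k : ℕ) (a : ℝ) (n : ℤ) : cl k a = n ↔ a ∈ Ico (n / 2 ^ k : ℝ) ((n + 1) / 2 ^ k) := by
  have : (0:ℝ) < 2 ^ k := by positivity
  rw [cl, Int.floor_eq_iff, mem_Ico, div_le_iff₀ this, lt_div_iff₀ this, mul_comm]

lemma cl_refine {j k : ℕ} (h : j ≤ k) {a b : ℝ} (e : cl k a = cl k b) : cl j a = cl j b := by
  obtain ⟨m, rfl⟩ := Nat.exists_eq_add_of_le h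
  have key : ∀ a : ℝ, cl j a = cl (j + m) a / (2 ^ m : ℕ) := by
    intro a
    rw [cl, cl, ← Int.floor_div_natCast]
    congr 1
    push_cast
    rw [pow_add]; field_simp
  rw [key, key, e]

lemma cl_dist {k : ℕ} {a b : ℝ} (e : cl k a = cl k b) : |a - b| ≤ (2 ^ k : ℝ)⁻¹ := by
  have h1 := (cl_iff k a _).1 rfl
  have h2 := (cl_iff k b _).1 e.symm
  have e : ((cl k a : ℝ) + 1) / 2 ^ k = cl k a / 2 ^ k + (2 ^ k : ℝ)⁻¹ := by rw [add_div, one_div]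
  rw [mem_Ico, e] at h1 h2
  rw [abs_le]; constructor <;> linarith [h1.1, h1.2, h2.1, h2.2]

lemma cl_dist1 {k : ℕ} {a b : ℝ} (e : cl k a = cl k b) : |a - b| ≤ 1 := 
  (cl_dist e).trans (inv_le_one_of_one_le₀ (one_le_pow₀ one_le_two))

/-- averaging kernel -/
def ker (k : ℕ) (a y : ℝ) : ℝ := if cl k a = cl k y then 2 ^ k else 0

lemma ker_symm (k : ℕ) (a y : ℝ) : ker k a y = ker k y a := by simp [ker, eq_comm]
lemma ker_nonneg (k : ℕ) (a y : ℝ) : 0 ≤ ker k a y := by unfold ker; split_ifs <;> positivity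
lemma ker_le (k : ℕ) (a y : ℝ) : |ker k a y| ≤ 2 ^ k := by
  rw [abs_of_nonneg (ker_nonneg _ _ _)]; unfold ker; split_ifs <;> [exact le_rfl; positivity]
lemma ker_meas (k : ℕ) : Measurable (fun z : ℝ × ℝ => ker k z.1 z.2) := by
  unfold ker
  exact Measurable.ite (measurableSet_eq_fun ((cl_meas k).comp measurable_fst) ((cl_meas k).comp measurable_snd))
    measurable_const measurable_const
lemma ker_rel {k : ℕ} {a b : ℝ} (h : cl k a = cl k b) (y : ℝ) : ker k a y = ker k b y := by simp [ker, h]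
lemma ker_ne {k : ℕ} {a y : ℝ} (h : ker k a y ≠ 0) : cl k a = cl k y := by
  by_contra hc; exact h (by simp [ker, hc])

lemma ker_eq_ind (k : ℕ) (a : ℝ) : ker k a = (Ico (cl k a / 2 ^ k : ℝ) ((cl k a + 1) / 2 ^ k)).indicator (fun _ => 2 ^ k) := by
  ext y
  rw [indicator_apply]
  unfold ker
  simp_rw [← cl_iff, eq_comm]

lemma ker_integrable (k : ℕ) (a : ℝ) : Integrable (ker k a) := by
  rw [ker_eq_ind, integrable_indicator_iff measurableSet_Ico]
  exact integrableOn_const (by simp)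

lemma ker_int (k : ℕ) (a : ℝ) : ∫ y, ker k a y = 1 := by
  rw [ker_eq_ind, integral_indicator_const _ measurableSet_Ico]
  have : ((cl k a : ℝ) + 1) / 2 ^ k = cl k a / 2 ^ k + (2 ^ k : ℝ)⁻¹ := by rw [add_div, one_div]
  rw [Real.volume_real_Ico, this, add_sub_cancel_left, max_eq_left (by positivity), smul_eq_mul, inv_mul_cancel₀ (by positivity)]

/-- one dimensional version of `IsD` -/
def IsD1 (f : ℝ → ℝ) : Prop := Measurable f ∧ (∃ B, ∀ x, |f x| ≤ B) ∧ ∃ R, ∀ x, f x ≠ 0 → |x| ≤ R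

lemma IsD1.integrable {f : ℝ → ℝ} (hf : IsD1 f) : Integrable f := by
  obtain ⟨h1, ⟨B, hB⟩, R, hR⟩ := hf
  have : f = (Icc (-R) R).indicator f := by
    ext x
    by_cases hx : x ∈ Icc (-R) R
    · rw [indicator_of_mem hx]
    · rw [indicator_of_notMem hx]; by_contra h; exact hx (abs_le.1 (hR x h))
  rw [this, integrable_indicator_iff measurableSet_Icc]
  exact Measure.integrableOn_of_bounded (M := B) (by simp) h1.aestronglyMeasurable (Eventually.of_forall hB)

lemma IsD.fib {f : ℝ × ℝ → ℝ} (hf : IsD f) (a : ℝ) : IsD1 (fun y => f (a, y)) := by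
  obtain ⟨h1, ⟨B, hB⟩, R, hR⟩ := hf
  exact ⟨h1.comp measurable_prodMk_left, ⟨B, fun y => hB _⟩, R, fun y h => (hR _ h).2⟩

lemma IsD1.mulb {f h : ℝ → ℝ} (hf : IsD1 f) (hm : Measurable h) (B : ℝ) (hB : ∀ x, |h x| ≤ B) : IsD1 (fun x => h x * f x) := by
  obtain ⟨h1, ⟨B', hB'⟩, R, hR⟩ := hf
  refine ⟨hm.mul h1, ⟨B * B', fun x => ?_⟩, R, fun x hx => hR x ?_⟩
  · rw [abs_mul]
    exact mul_le_mul (hB x) (hB' x) (abs_nonneg _) ((abs_nonneg _).trans (hB x))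
  · intro h; apply hx; simp [h]

lemma ker_meas1 (k : ℕ) (a : ℝ) : Measurable (ker k a) := (ker_meas k).comp measurable_prodMk_left
lemma ker_meas1' (k : ℕ) (a : ℝ) : Measurable (fun z => ker k z a) := (ker_meas k).comp measurable_prodMk_right

lemma IsD1.ker {f : ℝ → ℝ} (hf : IsD1 f) (k : ℕ) (a : ℝ) : IsD1 (fun y => ker k a y * f y) :=
  hf.mulb (ker_meas1 k a) _ (ker_le k a)

lemma IsD1.ker2 {f : ℝ → ℝ} (hf : IsD1 f) (k : ℕ) : IsD (fun z : ℝ × ℝ => TB.ker k z.1 z.2 * f z.2) := by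
  obtain ⟨h1, ⟨B', hB'⟩, R, hR⟩ := hf
  refine ⟨(ker_meas k).mul (h1.comp measurable_snd), ⟨2 ^ k * B', fun x => ?_⟩, R + 1, fun x hx => ?_⟩
  · rw [abs_mul]
    exact mul_le_mul (ker_le _ _ _) (hB' _) (abs_nonneg _) (by positivity)
  · have h1 := hR x.2 (right_ne_zero_of_mul hx)
    have h2 := abs_le.1 (cl_dist1 (ker_ne (left_ne_zero_of_mul hx)))
    have h3 := abs_le.1 h1
    constructor <;> rw [abs_le] <;> constructor <;> linarith [h2.1, h2.2, h3.1, h3.2]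

/-- averages in the second variable -/
def E2f (k : ℕ) (f : DD) : DD := ⟨fun x => ∫ y, ker k x.2 y * f (x.1, y), by
  have hf := dD f
  obtain ⟨h1, ⟨B, hB⟩, R, hR⟩ := hf
  refine ⟨?_, ⟨B, fun x => ?_⟩, R + 1, fun x hx => ?_⟩
  · have : Measurable (fun z : (ℝ × ℝ) × ℝ => ker k z.1.2 z.2 * f (z.1.1, z.2)) := by
      refine Measurable.mul ((ker_meas k).comp (measurable_fst.snd.prodMk measurable_snd)) ?_
      exact h1.comp (measurable_fst.fst.prodMk measurable_snd)
    exact (this.stronglyMeasurable.integral_prod_right (ν := volume)).measurable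
  · refine (abs_integral_le_integral_abs).trans ?_
    calc ∫ y, |ker k x.2 y * f (x.1, y)| ≤ ∫ y, ker k x.2 y * B := by
          refine integral_mono (((dD f).fib x.1).ker k x.2).integrable.abs ((ker_integrable k x.2).mul_const _) fun y => ?_
          simp only
          rw [abs_mul, abs_of_nonneg (ker_nonneg _ _ _)]
          exact mul_le_mul_of_nonneg_left (hB _) (ker_nonneg _ _ _)
      _ = B := by rw [integral_mul_const, ker_int, one_mul]
  · by_contra hc
    apply hx
    have : ∀ y, ker k x.2 y * f (x.1, y) = 0 := by
      intro y
      by_contra h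
      apply hc
      have h1 := hR _ (right_ne_zero_of_mul h)
      have h2 := abs_le.1 (cl_dist1 (ker_ne (left_ne_zero_of_mul h)))
      have h3 := abs_le.1 h1.1
      have h4 := abs_le.1 h1.2
      simp only at h3 h4
      constructor <;> rw [abs_le] <;> constructor <;> linarith [h2.1, h2.2, h3.1, h3.2, h4.1, h4.2]
    simp [this]⟩

lemma E2f_val (k : ℕ) (f : DD) (x) : E2f k f x = ∫ y, ker k x.2 y * f (x.1, y) := rfl

/-- averaging operators in the second variable -/
def E2 (k : ℕ) : Op where
  toFun := E2f k
  map_add' f h := dext fun x => by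
    rw [add_val, E2f_val, E2f_val, E2f_val, ← integral_add (((dD f).fib x.1).ker k x.2).integrable (((dD h).fib x.1).ker k x.2).integrable]
    congr 1; ext y; rw [add_val]; ring
  map_smul' c f := dext fun x => by
    rw [RingHom.id_apply, smul_val, E2f_val, E2f_val, ← integral_const_mul]
    congr 1; ext y; rw [smul_val]; ring

lemma E2_val (k : ℕ) (f : DD) (x) : E2 k f x = ∫ y, ker k x.2 y * f (x.1, y) := rfl

/-- same cell in the second variable -/
def rel2 (k : ℕ) (x y : ℝ × ℝ) : Prop := x.1 = y.1 ∧ cl k x.2 = cl k y.2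

lemma ker_ker_le {k m : ℕ} (h : k ≤ m) (a z y : ℝ) : ker k a z * ker m z y = ker k a y * ker m z y := by
  by_cases hz : cl m z = cl m y
  · rw [ker_symm k a z, ker_rel (cl_refine h hz), ker_symm]
  · simp [ker, hz]

lemma E2_pull (k : ℕ) (φ : ℝ × ℝ → ℝ) (f f' : DD) (hφ : ∀ x y, rel2 k x y → φ x = φ y)
    (h : ∀ x, f' x = φ x * f x) (x) : E2 k f' x = φ x * E2 k f x := by
  rw [E2_val, E2_val, ← integral_const_mul]
  congr 1; ext y
  rw [h]
  by_cases hz : cl k x.2 = cl k y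
  · rw [hφ x (x.1, y) ⟨rfl, hz⟩]; ring
  · simp [ker, hz]

lemma E2_fix {k : ℕ} {f : DD} (hf : ∀ x y, rel2 k x y → f x = f y) : E2 k f = f := by
  refine dext fun x => ?_
  have : ∀ y, ker k x.2 y * f (x.1, y) = ker k x.2 y * f x := by
    intro y
    by_cases hz : cl k x.2 = cl k y
    · rw [hf x (x.1, y) ⟨rfl, hz⟩]
    · simp [ker, hz]
  rw [E2_val]; simp_rw [this]
  rw [integral_mul_const, ker_int, one_mul]

lemma E2_relE (k : ℕ) (f : DD) (x y) (h : rel2 k x y) : E2 k f x = E2 k f y := by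
  rw [E2_val, E2_val, h.1]; simp_rw [ker_rel h.2]

lemma rel2_m (j k : ℕ) (x y) (h : j ≤ k) (hr : rel2 k x y) : rel2 j x y := ⟨hr.1, cl_refine h hr.2⟩

lemma fub1 {k : ℕ} {φ : ℝ → ℝ} (hφ : IsD1 φ) {ψ : ℝ → ℝ} (hm : Measurable ψ) {B : ℝ} (hB : ∀ x, |ψ x| ≤ B) :
    ∫ z, ψ z * ∫ y, ker k z y * φ y = ∫ y, (∫ z, ψ z * ker k z y) * φ y := by
  have hD : IsD (fun z : ℝ × ℝ => ψ z.1 * (ker k z.1 z.2 * φ z.2)) :=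
    (hφ.ker2 k).mul_bdd (hm.comp measurable_fst) B (fun x => hB x.1)
  simp_rw [← integral_const_mul, ← integral_mul_const]
  rw [integral_integral_swap hD.integrable]
  simp_rw [mul_assoc]

lemma E2_mul (k m : ℕ) : E2 k * E2 m = E2 (min k m) := by
  refine LinearMap.ext fun f => ?_
  rw [Module.End.mul_apply]
  rcases le_total k m with h | h
  · rw [min_eq_left h]
    refine dext fun x => ?_
    rw [E2_val]
    have := fub1 (k := m) ((dD f).fib x.1) (ker_meas1 k x.2) (ker_le k x.2)
    rw [show ∫ y, ker k x.2 y * E2 m f (x.1, y) = ∫ z, ker k x.2 z * ∫ y, ker m z y * f (x.1, y) from rfl, this, E2_val]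
    congr 1; ext y
    simp_rw [ker_ker_le h, integral_const_mul]
    simp_rw [fun z => ker_symm m z y]
    rw [ker_int, mul_one]
  · rw [min_eq_right h]
    exact E2_fix fun x y hr => E2_relE m f x y (rel2_m _ _ _ _ h hr)

lemma ip_fib (f h : DD) : ip f h = ∫ a, ∫ b, f (a, b) * h (a, b) :=
  integral_prod (μ := volume) (ν := volume) _ ((dD f).mul (dD h)).integrable

lemma E2_adj (k : ℕ) (f h : DD) : ip (E2 k f) h = ip f (E2 k h) := by
  rw [ip_fib, ip_fib]
  congr 1; ext a
  have hh := (dD h).fib a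
  obtain ⟨h1, ⟨B, hB⟩, -⟩ := hh
  have := fub1 (k := k) ((dD f).fib a) h1 hB
  calc ∫ b, E2 k f (a, b) * h (a, b) = ∫ z, h (a, z) * ∫ y, ker k z y * f (a, y) := by
        congr 1; ext b; rw [mul_comm]; rfl
    _ = _ := this
    _ = _ := by
      congr 1; ext y; rw [mul_comm, E2_val]; congr 2; ext z; rw [mul_comm, ker_symm]

lemma E2_int (k : ℕ) (f : DD) : ∫ x, E2 k f x = ∫ x, f x := by
  rw [Measure.volume_eq_prod, integral_prod (μ := volume) (ν := volume) _ (dD (E2 k f)).integrable, 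
    integral_prod (μ := volume) (ν := volume) _ (dD f).integrable]
  congr 1; ext a
  have := fub1 (k := k) ((dD f).fib a) (ψ := fun _ => 1) measurable_const (B := 1) (by simp)
  simp only [one_mul] at this
  calc ∫ b, E2 k f (a, b) = ∫ z, ∫ y, ker k z y * f (a, y) := rfl
    _ = _ := this
    _ = _ := by simp_rw [fun z y => ker_symm k z y, ker_int, one_mul]

lemma E2_pos (k : ℕ) (f : DD) (hf : ∀ x, 0 ≤ f x) (x) : 0 ≤ E2 k f x :=
  integral_nonneg fun y => mul_nonneg (ker_nonneg _ _ _) (hf _)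

lemma E2_bdd (k : ℕ) (f : DD) (B : ℝ) (hB : ∀ x, |f x| ≤ B) (x) : |E2 k f x| ≤ B := by
  refine (abs_integral_le_integral_abs).trans ?_
  calc ∫ y, |ker k x.2 y * f (x.1, y)| ≤ ∫ y, ker k x.2 y * B := by
        refine integral_mono (((dD f).fib x.1).ker k x.2).integrable.abs ((ker_integrable k x.2).mul_const _) fun y => ?_
        simp only
        rw [abs_mul, abs_of_nonneg (ker_nonneg _ _ _)]
        exact mul_le_mul_of_nonneg_left (hB _) (ker_nonneg _ _ _)
    _ = B := by rw [integral_mul_const, ker_int, one_mul]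

lemma filt2 : Filt E2 rel2 where
  mul := E2_mul
  adj := E2_adj
  pos := E2_pos
  int := E2_int
  bdd := E2_bdd
  relE := E2_relE
  relm := rel2_m
  pull := E2_pull
  dbl := by
    intro k f hf x
    rw [E2_val, E2_val, ← integral_const_mul]
    refine integral_mono (((dD f).fib x.1).ker _ x.2).integrable ((((dD f).fib x.1).ker k x.2).integrable.const_mul _) fun y => ?_
    simp only
    rw [← mul_assoc]
    refine mul_le_mul_of_nonneg_right ?_ (hf _)
    unfold ker
    split_ifs with h1 h2 h2
    · rw [pow_succ]; linarith
    · exact absurd (cl_refine (Nat.le_succ k) h1) h2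
    · positivity
    · simp

/-- swap of the variables -/
def sw : Op where
  toFun f := ⟨fun x => f x.swap, by
    obtain ⟨h1, ⟨B, hB⟩, R, hR⟩ := dD f
    exact ⟨h1.comp measurable_swap, ⟨B, fun x => hB _⟩, R, fun x hx => (hR _ hx).symm⟩⟩
  map_add' f h := rfl
  map_smul' c f := rfl

@[simp] lemma sw_val (f : DD) (x) : sw f x = f x.swap := rfl
lemma sw_sw : sw * sw = 1 := rfl
lemma int_swap (f : ℝ × ℝ → ℝ) : ∫ x : ℝ × ℝ, f x.swap = ∫ x, f x :=
  integral_prod_swap (μ := (volume : Measure ℝ)) (ν := (volume : Measure ℝ)) f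
lemma sw_adj (f h : DD) : ip (sw f) h = ip f (sw h) := by
  have := int_swap (fun x => f x * h x.swap)
  simpa [ip] using this

/-- averages in the first variable -/
def E1 (k : ℕ) : Op := sw * E2 k * sw
/-- same cell in the first variable -/
def rel1 (k : ℕ) (x y : ℝ × ℝ) : Prop := rel2 k x.swap y.swap

lemma E1_app (k : ℕ) (f : DD) (x) : E1 k f x = E2 k (sw f) x.swap := rfl
lemma E1_val (k : ℕ) (f : DD) (x) : E1 k f x = ∫ y, ker k x.1 y * f (y, x.2) := rfl

lemma filt1 : Filt E1 rel1 where
  mul k m := by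
    unfold E1
    rw [show sw * E2 k * sw * (sw * E2 m * sw) = sw * E2 k * (sw * sw) * E2 m * sw by noncomm_ring, sw_sw, mul_one, 
      mul_assoc sw, E2_mul]
  adj k f h := by
    change ip (sw (E2 k (sw f))) h = ip f (sw (E2 k (sw h)))
    rw [sw_adj, E2_adj, sw_adj]
  pos k f hf x := E2_pos k (sw f) (fun x => hf _) _
  int k f := by
    rw [show (∫ x, E1 k f x) = ∫ x : ℝ × ℝ, E2 k (sw f) x.swap from rfl, int_swap, E2_int]
    exact int_swap f
  bdd k f B hB x := E2_bdd k (sw f) B (fun x => hB _) _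
  relE k f x y h := E2_relE k (sw f) _ _ h
  relm j k x y h hr := rel2_m j k _ _ h hr
  pull k φ f f' hφ h x := E2_pull k (fun x => φ x.swap) (sw f) (sw f') (fun x y hr => hφ _ _ hr) (fun x => h _) x.swap
  dbl k f hf x := filt2.dbl k (sw f) (fun x => hf _) _

lemma E12_comm (k m : ℕ) : E1 k * E2 m = E2 m * E1 k := by
  refine LinearMap.ext fun f => dext fun x => ?_
  rw [Module.End.mul_apply, Module.End.mul_apply, E1_val, E2_val]
  simp_rw [E1_val, E2_val, ← integral_const_mul]
  have hD : IsD (fun z : ℝ × ℝ => (ker k x.1 z.1 * ker m x.2 z.2) * f z) := by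
    refine (dD f).mul_bdd (((ker_meas1 _ _).comp measurable_fst).mul ((ker_meas1 _ _).comp measurable_snd)) (2 ^ k * 2 ^ m) fun z => ?_
    rw [abs_mul]
    exact mul_le_mul (ker_le _ _ _) (ker_le _ _ _) (abs_nonneg _) (by positivity)
  have := integral_integral_swap (f := fun a b => (ker k x.1 a * ker m x.2 b) * f (a, b)) hD.integrable
  simp_rw [mul_assoc] at this
  refine this.trans ?_
  congr 1; ext b; congr 1; ext a; ring

end TB
end

section
namespace TB

/-- martingale differences in the second and first variable -/
def D2 (k : ℕ) : Op := Dl E2 k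
/-- first variable -/
def D1 (k : ℕ) : Op := Dl E1 k

lemma D_comm_aux {A : Op} {E : ℕ → Op} (h : ∀ k, A * E k = E k * A) (k : ℕ) : A * Dl E k = Dl E k * A := by
  cases k with
  | zero => exact h 0
  | succ k => rw [show Dl E (k+1) = E (k+1) - E k from rfl, mul_sub, sub_mul, h, h]

lemma E1_D2 (k l : ℕ) : E1 k * D2 l = D2 l * E1 k := D_comm_aux (fun m => E12_comm k m) l
lemma E2_D1 (k l : ℕ) : E2 k * D1 l = D1 l * E2 k := D_comm_aux (fun m => (E12_comm m k).symm) l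
lemma D1_D2 (k l : ℕ) : D1 k * D2 l = D2 l * D1 k := D_comm_aux (fun m => (E2_D1 m k).symm) l

/-- product differences -/
def D21 (k l : ℕ) : Op := D2 k * D1 l

lemma D21_adj (k l : ℕ) (f h : DD) : ip (D21 k l f) h = ip f (D21 k l h) := by
  have e : D21 k l h = D1 l (D2 k h) := by unfold D21; rw [← D1_D2]; rfl
  rw [e]
  change ip (D2 k (D1 l f)) h = _
  rw [D2, Dl_adj filt2, D1, Dl_adj filt1]

lemma D21_idem (k l : ℕ) : D21 k l * D21 k l = D21 k l := by
  unfold D21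
  rw [show D2 k * D1 l * (D2 k * D1 l) = D2 k * (D1 l * D2 k) * D1 l by noncomm_ring, D1_D2,
    show D2 k * (D2 k * D1 l) * D1 l = (D2 k * D2 k) * (D1 l * D1 l) by noncomm_ring, D1, D2, Dl_Dl filt1, Dl_Dl filt2]

lemma ip_D21 (k l : ℕ) (f h : DD) : ip (D21 k l f) h = ip (D21 k l f) (D21 k l h) := by
  rw [← D21_adj, ← Module.End.mul_apply, D21_idem]

/-- product multiplier -/
def MM (c : ℕ → ℕ → ℝ) (K : ℕ) : Op := ∑ k ∈ Finset.range (K + 1), ∑ l ∈ Finset.range (K + 1), c k l • D21 k l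

lemma MM_apply (c : ℕ → ℕ → ℝ) (K : ℕ) (f : DD) : MM c K f = ∑ k ∈ Finset.range (K + 1), ∑ l ∈ Finset.range (K + 1), c k l • D21 k l f := by
  simp [MM]

lemma MM_prod (a b : ℕ → ℝ) (K : ℕ) : MM (fun k l => a k * b l) K = SS E2 a K * SS E1 b K := by
  unfold MM SS
  rw [Finset.sum_mul_sum]
  refine Finset.sum_congr rfl fun k _ => Finset.sum_congr rfl fun l _ => ?_
  rw [smul_mul_smul_comm]; rfl

lemma sq2_bd {p : ℝ} (hp : 1 < p) : ∃ C : ℝ, 0 ≤ C ∧ ∀ K (f : DD),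
    N p (sqf (Finset.range (K + 1) ×ˢ Finset.range (K + 1)) (fun z => D21 z.1 z.2 f)) ≤ C * N p f := by
  obtain ⟨C, hC, H⟩ := SS_bd hp
  refine ⟨KN p * (C * C), mul_nonneg (KN_pos p).le (mul_nonneg hC hC), fun K f => ?_⟩
  rw [mul_assoc]
  refine sqf_le2 _ _ (fun k l => D21 k l f) (by linarith) ?_ fun A B => ?_
  · exact mul_nonneg (mul_nonneg hC hC) (N_nonneg _ _)
  · have : (∑ k ∈ Finset.range (K + 1), ∑ l ∈ Finset.range (K + 1), (sg A k * sg B l) • D21 k l f) = SS E2 (sg A) K (SS E1 (sg B) K f) := by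
      rw [← Module.End.mul_apply, ← MM_prod, MM_apply]
    rw [this]
    refine (H E2 rel2 filt2 _ (fun k => (abs_sg A k).le) K _).trans ?_
    rw [mul_assoc]
    exact mul_le_mul_of_nonneg_left (H E1 rel1 filt1 _ (fun k => (abs_sg B k).le) K _) hC

/-- Cauchy-Schwarz plus Hölder for square functions -/
lemma sum_ip_le {p q : ℝ} (hpq : p.HolderConjugate q) {ι : Type*} (s : Finset ι) (F H : ι → DD) :
    ∑ i ∈ s, |ip (F i) (H i)| ≤ N p (sqf s F) * N q (sqf s H) := by
  have h1 : ∀ i, |ip (F i) (H i)| ≤ ∫ x, |F i x| * |H i x| := by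
    intro i
    refine abs_integral_le_integral_abs.trans (le_of_eq ?_)
    simp_rw [abs_mul]
  have hD : ∀ i, IsD (fun x => |F i x| * |H i x|) := fun i => (dD (F i)).abs.mul (dD (H i)).abs
  calc ∑ i ∈ s, |ip (F i) (H i)| ≤ ∑ i ∈ s, ∫ x, |F i x| * |H i x| := Finset.sum_le_sum fun i _ => h1 i
    _ = ∫ x, ∑ i ∈ s, |F i x| * |H i x| := (integral_finsetSum _ fun i _ => (hD i).integrable).symm
    _ ≤ ∫ x, sqf s F x * sqf s H x := by
      refine integral_mono (integrable_finsetSum _ fun i _ => (hD i).integrable) ((dD _).mul (dD _)).integrable fun x => ?_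
      have := Real.sum_mul_le_sqrt_mul_sqrt s (fun i => |F i x|) (fun i => |H i x|)
      simpa [sqf_val] using this
    _ ≤ _ := (le_abs_self _).trans (holder hpq (dD _) (dD _))

lemma MM_bd {p : ℝ} (hp : 1 < p) : ∃ C : ℝ, 0 ≤ C ∧ ∀ K B (c : ℕ → ℕ → ℝ), 0 ≤ B → (∀ k l, |c k l| ≤ B) → Bd p (MM c K) (C * B) := by
  have hpq := Real.HolderConjugate.conjExponent hp
  obtain ⟨C, hC, H⟩ := sq2_bd hp
  obtain ⟨C', hC', H'⟩ := sq2_bd hpq.symm.lt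
  refine ⟨C * C', mul_nonneg hC hC', fun K B c hB hc f => ?_⟩
  refine duality hpq _ (mul_nonneg (mul_nonneg (mul_nonneg hC hC') hB) (N_nonneg _ _)) fun h => ?_
  have e : ip (MM c K f) h = ∑ z ∈ Finset.range (K + 1) ×ˢ Finset.range (K + 1), c z.1 z.2 * ip (D21 z.1 z.2 f) (D21 z.1 z.2 h) := by
    rw [MM_apply, ip_sum_left, Finset.sum_product]
    refine Finset.sum_congr rfl fun k _ => ?_
    rw [ip_sum_left]
    refine Finset.sum_congr rfl fun l _ => ?_
    rw [ip_smul_left, ip_D21]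
  rw [e]
  refine (Finset.abs_sum_le_sum_abs _ _).trans ?_
  calc _ ≤ ∑ z ∈ Finset.range (K + 1) ×ˢ Finset.range (K + 1), B * |ip (D21 z.1 z.2 f) (D21 z.1 z.2 h)| := by
        refine Finset.sum_le_sum fun z _ => ?_
        rw [abs_mul]
        exact mul_le_mul_of_nonneg_right (hc _ _) (abs_nonneg _)
    _ = B * ∑ z ∈ Finset.range (K + 1) ×ˢ Finset.range (K + 1), |ip (D21 z.1 z.2 f) (D21 z.1 z.2 h)| := by rw [Finset.mul_sum]
    _ ≤ B * (N p (sqf (Finset.range (K + 1) ×ˢ Finset.range (K + 1)) (fun z => D21 z.1 z.2 f)) * N p.conjExponent (sqf (Finset.range (K + 1) ×ˢ Finset.range (K + 1)) (fun z => D21 z.1 z.2 h))) :=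
        mul_le_mul_of_nonneg_left (sum_ip_le hpq _ _ _) hB
    _ ≤ B * ((C * N p f) * (C' * N p.conjExponent h)) := by
        refine mul_le_mul_of_nonneg_left ?_ hB
        exact mul_le_mul (H K f) (H' K h) (N_nonneg _ _) (mul_nonneg hC (N_nonneg _ _))
    _ = _ := by ring

open Classical in
/-- blocks of product differences -/
def QQ (χ : ℕ → ℕ → Prop) (K k : ℕ) : Op := ∑ l ∈ Finset.range (K + 1), if χ k l then D21 k l else 0

open Classical in
lemma QQ_fam {p : ℝ} (hp : 1 < p) (N0 : ℕ) : ∃ C : ℝ, 0 ≤ C ∧ ∀ K (J : Finset ℕ) (χ : ℕ → ℕ → ℕ → Prop),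
    (∀ k l, (J.filter fun j => χ j k l).card ≤ N0) → ∀ f : DD,
    N p (sqf (J ×ˢ Finset.range (K + 1)) (fun z => QQ (χ z.1) K z.2 f)) ≤ C * N p f := by
  obtain ⟨C, hC, H⟩ := MM_bd hp
  refine ⟨KN p * (C * N0), by have := (KN_pos p).le; positivity, fun K J χ hχ f => ?_⟩
  rw [mul_assoc]
  refine sqf_le1 _ _ (by linarith) (by have := N_nonneg p f; positivity) fun ε hε => ?_
  have e : (∑ z ∈ J ×ˢ Finset.range (K + 1), ε z • QQ (χ z.1) K z.2 f) =
      MM (fun k l => ∑ j ∈ J, if χ j k l then ε (j, k) else 0) K f := by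
    rw [MM_apply, Finset.sum_product_right]
    refine Finset.sum_congr rfl fun k _ => ?_
    simp only [QQ, LinearMap.sum_apply, Finset.smul_sum, Finset.sum_smul]
    rw [Finset.sum_comm]
    refine Finset.sum_congr rfl fun l _ => Finset.sum_congr rfl fun j _ => ?_
    split_ifs <;> simp
  rw [e]
  refine H K N0 _ (Nat.cast_nonneg _) (fun k l => ?_) f
  refine (Finset.abs_sum_le_sum_abs _ _).trans ?_
  calc _ = ∑ j ∈ J, if χ j k l then (1:ℝ) else 0 := by
        refine Finset.sum_congr rfl fun j _ => ?_
        split_ifs <;> simp [hε]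
    _ = ((J.filter fun j => χ j k l).card : ℝ) := by rw [Finset.sum_boole]
    _ ≤ _ := by exact_mod_cast hχ k l

/-! convergence -/

lemma N2_sub_E2_cont {g : DD} (hg : Continuous g) (hs : HasCompactSupport g) :
    Tendsto (fun k => N 2 (E2 k g - g : DD)) atTop (nhds 0) := by
  obtain ⟨-, -, R, hR⟩ := dD g
  set χ : DD := dind (A := Icc (-(R+1)) (R+1) ×ˢ Icc (-(R+1)) (R+1)) (measurableSet_Icc.prod measurableSet_Icc)
    ⟨(Icc (-(R+1)) (R+1) ×ˢ Icc (-(R+1)) (R+1)).indicator (fun _ => 1), by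
      refine ⟨measurable_const.indicator (measurableSet_Icc.prod measurableSet_Icc), ⟨1, fun x => ?_⟩, R + 1, fun x hx => ?_⟩
      · rw [indicator_apply]; split_ifs <;> simp
      · have := mem_of_indicator_ne_zero hx
        exact ⟨abs_le.2 this.1, abs_le.2 this.2⟩⟩ with hχ
  have χ1 : ∀ x : ℝ × ℝ, |x.1| ≤ R + 1 → |x.2| ≤ R + 1 → χ x = 1 := by
    intro x h1 h2
    have : x ∈ Icc (-(R+1)) (R+1) ×ˢ Icc (-(R+1)) (R+1) := ⟨abs_le.1 h1, abs_le.1 h2⟩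
    rw [hχ, dind_val]
    change _ * (Icc (-(R+1)) (R+1) ×ˢ Icc (-(R+1)) (R+1)).indicator (fun _ => (1:ℝ)) x = 1
    rw [indicator_of_mem this]; simp
  have uc := hs.uniformContinuous_of_continuous hg
  rw [Metric.tendsto_atTop]
  intro ε hε
  set η := ε / (N 2 χ + 1) with hη
  have hN := N_nonneg 2 χ
  have hη0 : 0 < η := by positivity
  obtain ⟨δ, hδ, hu⟩ := Metric.uniformContinuous_iff.1 uc η hη0
  obtain ⟨n, hn⟩ := exists_pow_lt_of_lt_one hδ (show (1/2:ℝ) < 1 by norm_num)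
  refine ⟨n, fun k hk => ?_⟩
  rw [Real.dist_0_eq_abs, abs_of_nonneg (N_nonneg _ _)]
  have pt : ∀ x, |(E2 k g - g : DD) x| ≤ |(η • χ : DD) x| := by
    intro x
    rw [sub_val, smul_val]
    by_cases hx : |x.1| ≤ R + 1 ∧ |x.2| ≤ R + 1
    · rw [χ1 x hx.1 hx.2, mul_one, abs_of_pos hη0]
      have e : E2 k g x - g x = ∫ y, ker k x.2 y * (g (x.1, y) - g x) := by
        simp_rw [mul_sub]
        rw [integral_sub (((dD g).fib x.1).ker k x.2).integrable ((ker_integrable k x.2).mul_const _), integral_mul_const, ker_int, one_mul, E2_val]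
      rw [e]
      refine abs_integral_le_integral_abs.trans ?_
      calc ∫ y, |ker k x.2 y * (g (x.1, y) - g x)| ≤ ∫ y, ker k x.2 y * η := by
            refine integral_mono_of_nonneg (Eventually.of_forall fun y => abs_nonneg _) ((ker_integrable k x.2).mul_const _) (Eventually.of_forall fun y => ?_)
            simp only
            rw [abs_mul, abs_of_nonneg (ker_nonneg _ _ _)]
            by_cases hy : cl k x.2 = cl k y
            · refine mul_le_mul_of_nonneg_left ?_ (ker_nonneg _ _ _)
              have : dist (x.1, y) x < δ := by
                rw [Prod.dist_eq, dist_self, max_lt_iff]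
                refine ⟨hδ, ?_⟩
                rw [Real.dist_eq, abs_sub_comm]
                refine (cl_dist hy).trans_lt (lt_of_le_of_lt ?_ hn)
                rw [← inv_pow, one_div]
                exact pow_le_pow_of_le_one (by norm_num) (by norm_num) hk
              exact (hu this).le
            · simp [ker, hy]
        _ = η := by rw [integral_mul_const, ker_int, one_mul]
    · have z : ∀ y, |x.2 - y| ≤ 1 → g (x.1, y) = 0 := by
        intro y hy
        by_contra h
        have := hR _ h
        apply hx
        have h3 := abs_le.1 this.1
        have h4 := abs_le.1 this.2
        have h5 := abs_le.1 hy
        simp only at h3 h4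
        constructor <;> rw [abs_le] <;> constructor <;> linarith [h3.1, h3.2, h4.1, h4.2, h5.1, h5.2]
      have z1 : g x = 0 := z x.2 (by simp)
      have z2 : E2 k g x = 0 := by
        rw [E2_val]
        have : ∀ y, ker k x.2 y * g (x.1, y) = 0 := by
          intro y
          by_cases hy : cl k x.2 = cl k y
          · rw [z y (cl_dist1 hy), mul_zero]
          · simp [ker, hy]
        simp [this]
      rw [z1, z2, sub_zero, abs_zero]; exact abs_nonneg _
  have h1 := N_mono (p := 2) two_pos (dD _) (dD _) pt
  rw [N_smul two_pos, abs_of_pos hη0] at h1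
  refine h1.trans_lt ?_
  rw [hη, div_mul_eq_mul_div, div_lt_iff₀ (by positivity)]
  nlinarith

lemma N2_approx (f : DD) {ε : ℝ} (hε : 0 < ε) : ∃ g : DD, Continuous g ∧ HasCompactSupport g ∧ N 2 (f - g : DD) ≤ ε := by
  have hf := (dD f).memLp (p := 2) two_pos
  obtain ⟨g, hg, hle, hc, hm⟩ := hf.exists_hasCompactSupport_eLpNorm_sub_le (by simp) (ε := ENNReal.ofReal ε) (by simpa using hε)
  obtain ⟨B, hB⟩ := hg.exists_bound_of_continuous hc
  obtain ⟨R, hR⟩ := hg.isCompact.isBounded.exists_norm_le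
  refine ⟨⟨g, hc.measurable, ⟨B, fun x => by simpa using hB x⟩, R, fun x hx => ?_⟩, hc, hg, ?_⟩
  · have := hR x (subset_tsupport _ hx)
    rw [Prod.norm_def, max_le_iff] at this
    simpa using this
  · rw [N_eq_lpNorm two_pos (dM _)]
    refine (ENNReal.ofReal_le_ofReal_iff hε.le).1 (le_trans (le_of_eq ?_) hle)
    exact ofReal_lpNorm (hf.sub hm)

lemma E2_tendsto (f : DD) : Tendsto (fun k => N 2 (E2 k f - f : DD)) atTop (nhds 0) := by
  rw [Metric.tendsto_atTop]
  intro ε hε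
  obtain ⟨g, hgc, hgs, hg⟩ := N2_approx f (ε := ε / 4) (by positivity)
  obtain ⟨n, hn⟩ := Metric.tendsto_atTop.1 (N2_sub_E2_cont hgc hgs) (ε / 4) (by positivity)
  refine ⟨n, fun k hk => ?_⟩
  have := hn k hk
  rw [Real.dist_0_eq_abs, abs_of_nonneg (N_nonneg _ _)] at this ⊢
  have e : E2 k f - f = E2 k (f - g) + (E2 k g - g) - (f - g) := by rw [map_sub]; abel
  rw [e]
  have h1 := N_sub_le (p := 2) one_le_two (E2 k (f - g) + (E2 k g - g)) (f - g)
  have h2 := N_add_le (p := 2) one_le_two (E2 k (f - g)) (E2 k g - g)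
  have h3 := E_N2 filt2 k (f - g)
  linarith

lemma N_sw (p : ℝ) (f : DD) : N p (sw f) = N p f := by
  unfold N
  congr 1
  exact int_swap (fun x => |f x| ^ p)

lemma E1_tendsto (f : DD) : Tendsto (fun k => N 2 (E1 k f - f : DD)) atTop (nhds 0) := by
  refine (E2_tendsto (sw f)).congr fun k => ?_
  rw [← N_sw]; rfl

/-- joint projection -/
def EE (K : ℕ) : Op := E2 K * E1 K

lemma EE_tendsto (f : DD) : Tendsto (fun k => N 2 (EE k f - f : DD)) atTop (nhds 0) := by
  have := (E1_tendsto f).add (E2_tendsto f)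
  rw [add_zero] at this
  refine squeeze_zero (fun k => N_nonneg _ _) (fun k => ?_) this
  have e : EE k f - f = E2 k (E1 k f - f) + (E2 k f - f) := by rw [map_sub]; change E2 k (E1 k f) - f = _; abel
  rw [e]
  refine (N_add_le one_le_two _ _).trans ?_
  gcongr
  exact E_N2 filt2 k _

lemma EE_N2 (K : ℕ) (f : DD) : N 2 (EE K f) ≤ N 2 f := (E_N2 filt2 K _).trans (E_N2 filt1 K f)

lemma weak_lim {S : Op} {c : ℝ} (hc : 0 ≤ c) (hS : Bd 2 S c) (f h : DD) :
    Tendsto (fun K => ip (S (EE K f)) (EE K h)) atTop (nhds (ip (S f) h)) := by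
  rw [tendsto_iff_dist_tendsto_zero]
  have hz : Tendsto (fun K => c * N 2 (EE K f - f : DD) * N 2 h + c * N 2 f * N 2 (EE K h - h : DD)) atTop (nhds 0) := by
    have := (((EE_tendsto f).const_mul c).mul_const (N 2 h)).add ((EE_tendsto h).const_mul (c * N 2 f))
    simpa using this
  refine squeeze_zero (fun _ => dist_nonneg) (fun K => ?_) hz
  rw [Real.dist_eq]
  have e : ip (S (EE K f)) (EE K h) - ip (S f) h = ip (S (EE K f - f)) (EE K h) + ip (S f) (EE K h - h : DD) := by
    rw [map_sub, ip_sub_left, ip_sub_right]; ring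
  rw [e]
  refine (abs_add_le _ _).trans (add_le_add ((cs _ _).trans ?_) ((cs _ _).trans ?_))
  · exact mul_le_mul (hS _) (EE_N2 K h) (N_nonneg _ _) (mul_nonneg hc (N_nonneg _ _))
  · exact mul_le_mul_of_nonneg_right (hS _) (N_nonneg _ _)

lemma sum_D21 (K : ℕ) : ∑ k ∈ Finset.range (K + 1), ∑ l ∈ Finset.range (K + 1), D21 k l = EE K := by
  unfold D21
  rw [← Finset.sum_mul_sum, EE]
  unfold D1 D2
  rw [sum_Dl, sum_Dl]

end TB
end

section
namespace TB

lemma E1_D21_le {L k l : ℕ} (h : l ≤ L) : E1 L * D21 k l = D21 k l := by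
  unfold D21; rw [← mul_assoc, E1_D2, mul_assoc, D1, E_Dl_le filt1 h]
lemma E1_D21_lt {L k l : ℕ} (h : L < l) : E1 L * D21 k l = 0 := by
  unfold D21; rw [← mul_assoc, E1_D2, mul_assoc, D1, E_Dl_lt filt1 h, mul_zero]
lemma E2_D21_le {L k l : ℕ} (h : k ≤ L) : E2 L * D21 k l = D21 k l := by
  unfold D21; rw [← mul_assoc, D2, E_Dl_le filt2 h]
lemma E2_D21_lt {L k l : ℕ} (h : L < k) : E2 L * D21 k l = 0 := by
  unfold D21; rw [← mul_assoc, D2, E_Dl_lt filt2 h, zero_mul]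

lemma E1_QQ_le {χ : ℕ → ℕ → Prop} {K k L : ℕ} (h : ∀ l, χ k l → l ≤ L) : E1 L * QQ χ K k = QQ χ K k := by
  classical
  unfold QQ; rw [Finset.mul_sum]
  refine Finset.sum_congr rfl fun l _ => ?_
  split_ifs with hc
  · exact E1_D21_le (h l hc)
  · exact mul_zero _

lemma E1_QQ_lt {χ : ℕ → ℕ → Prop} {K k L : ℕ} (h : ∀ l, χ k l → L < l) : E1 L * QQ χ K k = 0 := by
  classical
  unfold QQ; rw [Finset.mul_sum]
  refine Finset.sum_eq_zero fun l _ => ?_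
  split_ifs with hc
  · exact E1_D21_lt (h l hc)
  · exact mul_zero _

lemma E1_QQ {χ : ℕ → ℕ → Prop} {K k L : ℕ} : E1 L * QQ χ K k = QQ (fun k l => χ k l ∧ l ≤ L) K k := by
  classical
  unfold QQ; rw [Finset.mul_sum]
  refine Finset.sum_congr rfl fun l _ => ?_
  by_cases hc : χ k l
  · by_cases hl : l ≤ L
    · simp only [hc, hl, and_self, if_true]; exact E1_D21_le hl
    · simp only [hc, hl, and_false, if_true, if_false]; exact E1_D21_lt (not_le.1 hl)
  · simp [hc]

lemma E1_QQ' {χ : ℕ → ℕ → Prop} {K k L : ℕ} : QQ χ K k - E1 L * QQ χ K k = QQ (fun k l => χ k l ∧ L < l) K k := by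
  classical
  rw [E1_QQ]
  unfold QQ; rw [← Finset.sum_sub_distrib]
  refine Finset.sum_congr rfl fun l _ => ?_
  by_cases hc : χ k l <;> by_cases hl : l ≤ L
  · simp [hc, hl]
  · simp [hc, hl, not_le.1 hl]
  · simp [hc]
  · simp [hc]

lemma E2_QQ_le {χ : ℕ → ℕ → Prop} {K k L : ℕ} (h : k ≤ L) : E2 L * QQ χ K k = QQ χ K k := by
  classical
  unfold QQ; rw [Finset.mul_sum]
  refine Finset.sum_congr rfl fun l _ => ?_
  split_ifs with hc
  · exact E2_D21_le h
  · exact mul_zero _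

lemma E2_QQ_lt {χ : ℕ → ℕ → Prop} {K k L : ℕ} (h : L < k) : E2 L * QQ χ K k = 0 := by
  classical
  unfold QQ; rw [Finset.mul_sum]
  refine Finset.sum_eq_zero fun l _ => ?_
  split_ifs with hc
  · exact E2_D21_lt h
  · exact mul_zero _

lemma QQ_adj (χ : ℕ → ℕ → Prop) (K k : ℕ) (f h : DD) : ip (QQ χ K k f) h = ip f (QQ χ K k h) := by
  classical
  simp only [QQ, LinearMap.sum_apply]
  rw [ip_sum_left, ip_sum_right]
  refine Finset.sum_congr rfl fun l _ => ?_
  split_ifs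
  · exact D21_adj _ _ _ _
  · rw [LinearMap.zero_apply, LinearMap.zero_apply, ip_zero_left, ip_zero_right]

/-- decay base -/
def rr : ℝ := (2:ℝ) ^ (-(1/2) : ℝ)
lemma rr_pos : 0 < rr := by unfold rr; positivity
lemma rr_lt : rr < 1 := Real.rpow_lt_one_of_one_lt_of_neg one_lt_two (by norm_num)
lemma rr_pow_le {a b : ℕ} (h : a ≤ b) : rr ^ b ≤ rr ^ a := pow_le_pow_of_le_one rr_pos.le rr_lt.le h
lemma rr_sub_one (a : ℕ) : rr ^ (a - 1) ≤ 2 * rr ^ a := by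
  have h2 : 1 / 2 ≤ rr := by
    unfold rr
    rw [one_div, ← Real.rpow_neg_one]
    exact Real.rpow_le_rpow_of_exponent_le one_le_two (by norm_num)
  cases a with
  | zero => simp
  | succ a =>
    simp only [Nat.add_sub_cancel, pow_succ]
    nlinarith [pow_pos rr_pos a]

/-- conditions on the exponents -/
structure Lam (s J0 : ℕ) (lam : ℕ → ℕ) : Prop where
  mono : ∀ i j, J0 ≤ i → i ≤ j → lam i ≤ lam j
  inc : ∀ j, J0 ≤ j → lam j + 1 ≤ lam (j + s)

/-- all estimates for the dyadic operators -/
structure Sys (c : ℝ) (s J0 : ℕ) (lam : ℕ → ℕ) (T T' W W' : ℕ → Op) : Prop where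
  c0 : 0 ≤ c
  hlam : Lam s J0 lam
  adjT : ∀ j, J0 ≤ j → ∀ f h : DD, ip (T j f) h = ip f (T' j h)
  adjW : ∀ j, J0 ≤ j → ∀ f h : DD, ip (W j f) h = ip f (W' j h)
  posT : ∀ j, J0 ≤ j → Pos (T j)
  l1T : ∀ j, J0 ≤ j → ∀ f : DD, ∫ x, |T j f x| ≤ c * ∫ x, |f x|
  bdT : ∀ j, J0 ≤ j → Bd 2 (T j) c
  bdT' : ∀ j, J0 ≤ j → Bd 2 (T' j) c
  e1 : ∀ j, J0 ≤ j → ∀ k' k, k' ≤ k → Bd 2 (E2 k' * T j * (1 - E2 k)) (c * rr ^ (k - k'))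
  e1' : ∀ j, J0 ≤ j → ∀ k' k, k' ≤ k → Bd 2 (E2 k' * T' j * (1 - E2 k)) (c * rr ^ (k - k'))
  e2 : ∀ j, J0 ≤ j → ∀ k, k ≤ j + lam j → Bd 2 ((T j - W j) * E2 k) (c * rr ^ (j + lam j - k))
  e3 : ∀ j, J0 ≤ j → ∀ l m, j ≤ l → l ≤ m → Bd 2 (T j * (1 - E2 (m + lam (j + s))) * E1 l) (c * rr ^ (m - l))
  e3' : ∀ j, J0 ≤ j → ∀ l m, j ≤ l → l ≤ m → Bd 2 (T' j * (1 - E2 (m + lam (j + s))) * E1 l) (c * rr ^ (m - l))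
  e4 : ∀ j, J0 ≤ j → ∀ l m, j ≤ m → m ≤ l → Bd 2 (T j * E2 (m + lam j) * (1 - E1 l)) (c * rr ^ (l - m))
  e4' : ∀ j, J0 ≤ j → ∀ l m, j ≤ m → m ≤ l → Bd 2 (T' j * E2 (m + lam j) * (1 - E1 l)) (c * rr ^ (l - m))
  w1 : ∀ j, J0 ≤ j → ∀ m, m ≤ j → Bd 2 ((W j - Real.log 2 • 1) * E1 m) (c * rr ^ (j - m))
  w1' : ∀ j, J0 ≤ j → ∀ m, m ≤ j → Bd 2 ((W' j - Real.log 2 • 1) * E1 m) (c * rr ^ (j - m))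
  w2 : ∀ j, J0 ≤ j → ∀ m, j ≤ m → Bd 2 (W j * (1 - E1 m)) (c * rr ^ (m - j))
  w2' : ∀ j, J0 ≤ j → ∀ m, j ≤ m → Bd 2 (W' j * (1 - E1 m)) (c * rr ^ (m - j))

/-- frequency code -/
def dcode (s : ℕ) (lam : ℕ → ℕ) (j k l : ℕ) : ℕ :=
  if k ≤ j + lam j then min (j + lam j - k) (max (j - l) (l - j))
  else if k ≤ j + lam (j + s) then 0
  else (k - lam (j + s) - max l j) + (max l j - (k - lam j))

lemma card_close (S : Finset ℕ) (n : ℕ) (h : ∀ a ∈ S, ∀ b ∈ S, b < a + n) : S.card ≤ n := by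
  rcases S.eq_empty_or_nonempty with rfl | hS
  · simp
  · have : S ⊆ Finset.Ico (S.min' hS) (S.min' hS + n) := fun b hb => 
      Finset.mem_Ico.2 ⟨S.min'_le b hb, h _ (S.min'_mem hS) b hb⟩
    simpa using Finset.card_le_card this

lemma Lam.inj {s J0 : ℕ} {lam : ℕ → ℕ} (H : Lam s J0 lam) {i j : ℕ} (hi : J0 ≤ i) (hj : i + s ≤ j) : lam i < lam j := by
  have := H.inc i hi
  have := H.mono (i + s) j (by omega) hj
  omega

lemma dcode_card {s J0 : ℕ} {lam : ℕ → ℕ} (H : Lam s J0 lam) (J : Finset ℕ) (hJ : ∀ j ∈ J, J0 ≤ j) (d k l : ℕ) :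
    (J.filter fun j => dcode s lam j k l = d).card ≤ 5 * s + 4 := by
  classical
  have sub : (J.filter fun j => dcode s lam j k l = d) ⊆
      ((J.filter fun j => j + lam j = k + d) ∪ ({l - d, l + d} : Finset ℕ) ∪
      (J.filter fun j => j + lam j < k ∧ k ≤ j + lam (j + s))) ∪
      ((J.filter fun j => lam j + l = k + d) ∪ (J.filter fun j => lam (j + s) + l + d = k) ∪ (J.filter fun j => j + lam (j + s) + d = k) ∪
      (J.filter fun j => lam j + l ≤ k ∧ k ≤ lam (j + s) + l)) := by
    intro j hj
    rw [Finset.mem_filter] at hj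
    obtain ⟨hjJ, hd⟩ := hj
    have := H.mono j (j + s) (hJ j hjJ) (by omega)
    simp only [Finset.mem_union, Finset.mem_filter, Finset.mem_insert, Finset.mem_singleton, hjJ, true_and]
    unfold dcode at hd
    split_ifs at hd with h1 h2 <;> omega
  have inj1 : ∀ i ∈ J, ∀ j ∈ J, i < j → i + lam i < j + lam j := fun i hi j hj h => by
    have := H.mono i j (hJ i hi) h.le; omega
  have inj1' : ∀ i ∈ J, ∀ j ∈ J, i < j → i + lam (i + s) < j + lam (j + s) := fun i hi j hj h => by
    have := H.mono (i + s) (j + s) (by have := hJ i hi; omega) (by omega); omega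
  have inj2 : ∀ i ∈ J, ∀ j ∈ J, i + s ≤ j → lam i < lam j := fun i hi j hj h => H.inj (hJ i hi) h
  have inj2' : ∀ i ∈ J, ∀ j ∈ J, i + s ≤ j → lam (i + s) < lam (j + s) := fun i hi j hj h => H.inj (by have := hJ i hi; omega) (by omega)
  have mon2 : ∀ i ∈ J, ∀ j ∈ J, i + s ≤ j → lam (i + s) ≤ lam j := fun i hi j hj h => H.mono (i + s) j (by have := hJ i hi; omega) h
  have mon3 : ∀ i ∈ J, ∀ j ∈ J, i + 2 * s ≤ j → lam (i + s) < lam j := fun i hi j hj h => H.inj (by have := hJ i hi; omega) (by omega)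
  have c1 : (J.filter fun j => j + lam j = k + d).card ≤ 1 := card_close _ _ fun a ha b hb => by
    simp only [Finset.mem_filter] at ha hb
    by_contra hc
    have := inj1 a ha.1 b hb.1 (by omega); omega
  have c2 : ({l - d, l + d} : Finset ℕ).card ≤ 2 := Finset.card_le_two
  have c3 : (J.filter fun j => j + lam j < k ∧ k ≤ j + lam (j + s)).card ≤ s := card_close _ _ fun a ha b hb => by
    simp only [Finset.mem_filter] at ha hb
    by_contra hc
    have := mon2 a ha.1 b hb.1 (by omega); omega
  have c4 : (J.filter fun j => lam j + l = k + d).card ≤ s := card_close _ _ fun a ha b hb => by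
    simp only [Finset.mem_filter] at ha hb
    by_contra hc
    have := inj2 a ha.1 b hb.1 (by omega); omega
  have c5 : (J.filter fun j => lam (j + s) + l + d = k).card ≤ s := card_close _ _ fun a ha b hb => by
    simp only [Finset.mem_filter] at ha hb
    by_contra hc
    have := inj2' a ha.1 b hb.1 (by omega); omega
  have c6 : (J.filter fun j => j + lam (j + s) + d = k).card ≤ 1 := card_close _ _ fun a ha b hb => by
    simp only [Finset.mem_filter] at ha hb
    by_contra hc
    have := inj1' a ha.1 b hb.1 (by omega); omega
  have c7 : (J.filter fun j => lam j + l ≤ k ∧ k ≤ lam (j + s) + l).card ≤ 2 * s := card_close _ _ fun a ha b hb => by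
    simp only [Finset.mem_filter] at ha hb
    by_contra hc
    have := mon3 a ha.1 b hb.1 (by omega); omega
  refine (Finset.card_le_card sub).trans ?_
  refine (Finset.card_union_le _ _).trans ?_
  have d1 := Finset.card_union_le ((J.filter fun j => j + lam j = k + d) ∪ ({l - d, l + d} : Finset ℕ)) (J.filter fun j => j + lam j < k ∧ k ≤ j + lam (j + s))
  have d2 := Finset.card_union_le (J.filter fun j => j + lam j = k + d) ({l - d, l + d} : Finset ℕ)
  have d3 := Finset.card_union_le ((J.filter fun j => lam j + l = k + d) ∪ (J.filter fun j => lam (j + s) + l + d = k) ∪ (J.filter fun j => j + lam (j + s) + d = k)) (J.filter fun j => lam j + l ≤ k ∧ k ≤ lam (j + s) + l)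
  have d4 := Finset.card_union_le ((J.filter fun j => lam j + l = k + d) ∪ (J.filter fun j => lam (j + s) + l + d = k)) (J.filter fun j => j + lam (j + s) + d = k)
  have d5 := Finset.card_union_le (J.filter fun j => lam j + l = k + d) (J.filter fun j => lam (j + s) + l + d = k)
  omega
end TB
end

section
namespace TB

lemma QQ_false {χ : ℕ → ℕ → Prop} {K k : ℕ} (h : ∀ l, ¬ χ k l) : QQ χ K k = 0 := by
  classical
  unfold QQ
  refine Finset.sum_eq_zero fun l _ => ?_
  rw [if_neg (h l)]

/-- the error operator -/
def UU (lam : ℕ → ℕ) (T : ℕ → Op) (j : ℕ) : Op := T j - Real.log 2 • (E1 j * E2 (j + lam j))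

lemma UU_app (lam : ℕ → ℕ) (T : ℕ → Op) (j : ℕ) (f : DD) :
    UU lam T j f = T j f - Real.log 2 • E1 j (E2 (j + lam j) f) := rfl

lemma PP_adj (j a : ℕ) (f h : DD) : ip (Real.log 2 • E1 j (E2 a f) : DD) h = ip f (Real.log 2 • E1 j (E2 a h) : DD) := by
  rw [ip_smul_left, ip_smul_right, filt1.adj, filt2.adj, ← Module.End.mul_apply, ← E12_comm, Module.End.mul_apply]

lemma UU_adj {c : ℝ} {s J0 : ℕ} {lam : ℕ → ℕ} {T T' W W' : ℕ → Op} (S : Sys c s J0 lam T T' W W') {j : ℕ} (hj : J0 ≤ j)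
    (f h : DD) : ip (UU lam T j f) h = ip f (UU lam T' j h) := by
  rw [UU_app, UU_app, ip_sub_left, ip_sub_right, S.adjT j hj, PP_adj]

lemma log2_le : Real.log 2 ≤ 1 := by have := Real.log_two_lt_d9; linarith
lemma log2_nonneg : 0 ≤ Real.log 2 := Real.log_nonneg one_le_two

lemma PP_N2 (j a : ℕ) (f : DD) : N 2 (Real.log 2 • E1 j (E2 a f) : DD) ≤ N 2 f := by
  rw [N_smul (by norm_num), abs_of_nonneg log2_nonneg]
  have h1 := (E_N2 filt1 j (E2 a f)).trans (E_N2 filt2 a f)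
  have := N_nonneg 2 (E1 j (E2 a f))
  nlinarith [log2_le, log2_nonneg]

lemma UU_bd {lam : ℕ → ℕ} {T : ℕ → Op} {j : ℕ} {c : ℝ} (h : Bd 2 (T j) c) : Bd 2 (UU lam T j) (c + 1) := fun f => by
  rw [UU_app]
  refine (N_sub_le (by norm_num) _ _).trans ?_
  have := h f
  have := PP_N2 j (j + lam j) f
  linarith

/-- frequency localized in the second variable -/
def Loc (k : ℕ) (F : DD) : Prop := E2 k F = F ∧ ∀ L, L < k → E2 L F = 0

lemma Loc_QQ (χ : ℕ → ℕ → Prop) (K k : ℕ) (f : DD) : Loc k (QQ χ K k f) :=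
  ⟨by rw [← Module.End.mul_apply, E2_QQ_le le_rfl], fun L hL => by rw [← Module.End.mul_apply, E2_QQ_lt hL]; rfl⟩

lemma key1_aux {c : ℝ} {lam : ℕ → ℕ} {T : ℕ → Op} {j : ℕ} (hc : 0 ≤ c)
    (e1 : ∀ k' k, k' ≤ k → Bd 2 (E2 k' * T j * (1 - E2 k)) (c * rr ^ (k - k')))
    {k k' : ℕ} (hk : k' < k) {F H : DD} (hF : Loc k F) (hH : Loc k' H) :
    |ip (UU lam T j F) H| ≤ 2 * c * rr ^ (k - k') * (N 2 F * N 2 H) := by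
  have z : ip (Real.log 2 • E1 j (E2 (j + lam j) F) : DD) H = 0 := by
    rw [PP_adj, ← hH.1, ← Module.End.mul_apply (E2 _) (E2 k'), ← Module.End.mul_apply (E1 j)]
    have : E1 j * (E2 (j + lam j) * E2 k') = E2 k' * (E1 j * E2 (j + lam j)) := by
      rw [filt2.mul, min_comm, ← filt2.mul, ← mul_assoc, E12_comm, mul_assoc]
    rw [this, Module.End.mul_apply, ← map_smul, ← filt2.adj, hF.2 k' hk, ip_zero_left]
  rw [UU_app, ip_sub_left, z, sub_zero]
  have h1 : ip (T j F) H = ip ((E2 k' * T j * (1 - E2 (k-1))) F) H := by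
    rw [Module.End.mul_apply, Module.End.mul_apply, filt2.adj, hH.1, LinearMap.sub_apply, Module.End.one_apply, hF.2 (k-1) (by omega), sub_zero]
  rw [h1]
  refine (cs _ _).trans ?_
  have h2 := e1 k' (k-1) (by omega) F
  have h3 : rr ^ (k - 1 - k') ≤ 2 * rr ^ (k - k') := by
    have := rr_sub_one (k - k')
    rwa [show k - k' - 1 = k - 1 - k' by omega] at this
  have n1 := N_nonneg 2 F
  have n2 := N_nonneg 2 H
  calc _ ≤ (c * rr ^ (k - 1 - k') * N 2 F) * N 2 H := mul_le_mul_of_nonneg_right h2 n2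
    _ ≤ (c * (2 * rr ^ (k - k')) * N 2 F) * N 2 H := by gcongr
    _ = _ := by ring

lemma key1 {c : ℝ} {s J0 : ℕ} {lam : ℕ → ℕ} {T T' W W' : ℕ → Op} (S : Sys c s J0 lam T T' W W') {j : ℕ} (hj : J0 ≤ j)
    {k k' : ℕ} {F H : DD} (hF : Loc k F) (hH : Loc k' H) :
    |ip (UU lam T j F) H| ≤ 16 * (c + 1) * rr ^ ((k - k') + (k' - k)) * (N 2 F * N 2 H) := by
  have n1 := N_nonneg 2 F
  have n2 := N_nonneg 2 H
  have hc := S.c0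
  have n3 := pow_pos rr_pos ((k - k') + (k' - k))
  have fin : ∀ a, a ≤ 2 * (c + 1) * rr ^ ((k - k') + (k' - k)) * (N 2 F * N 2 H) → a ≤ 16 * (c + 1) * rr ^ ((k - k') + (k' - k)) * (N 2 F * N 2 H) := 
    fun a ha => ha.trans (by gcongr; norm_num)
  apply fin
  rcases lt_trichotomy k' k with h | h | h
  · refine (key1_aux hc (S.e1 j hj) h hF hH).trans ?_
    rw [show k' - k = 0 by omega, add_zero]
    gcongr; exact (pow_pos rr_pos _).le
    linarith
  · subst h
    refine (cs _ _).trans ?_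
    have := UU_bd (lam := lam) (S.bdT j hj) F
    simp only [Nat.sub_self, add_zero, pow_zero, mul_one]
    nlinarith [mul_nonneg n1 n2]
  · rw [UU_adj S hj, ip_comm]
    refine (key1_aux hc (S.e1' j hj) h hH hF).trans ?_
    rw [show k - k' = 0 by omega, zero_add, mul_comm (N 2 H)]
    gcongr; exact (pow_pos rr_pos _).le
    linarith

lemma N_E1_le (L : ℕ) (F : DD) : N 2 (E1 L F) ≤ N 2 F := E_N2 filt1 L F
lemma N_E1_sub (L : ℕ) (F : DD) : N 2 (F - E1 L F : DD) ≤ 2 * N 2 F := by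
  have := N_sub_le (p := 2) (by norm_num) F (E1 L F)
  linarith [N_E1_le L F]

/-- bound above the critical frequencies -/
lemma key_hi {c : ℝ} {s J0 : ℕ} {lam : ℕ → ℕ} {T : ℕ → Op} {j : ℕ} (hc : 0 ≤ c) (hj : J0 ≤ j) (hlam : Lam s J0 lam)
    (e3 : ∀ l m, j ≤ l → l ≤ m → Bd 2 (T j * (1 - E2 (m + lam (j + s))) * E1 l) (c * rr ^ (m - l)))
    (e4 : ∀ l m, j ≤ m → m ≤ l → Bd 2 (T j * E2 (m + lam j) * (1 - E1 l)) (c * rr ^ (l - m)))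
    {k K d : ℕ} (hk : j + lam (j + s) < k) (hd : 1 ≤ d) (f : DD) :
    N 2 (UU lam T j (QQ (fun k l => dcode s lam j k l = d) K k f)) ≤
      6 * c * rr ^ d * N 2 (QQ (fun k l => dcode s lam j k l = d) K k f) := by
  have hla := hlam.mono j (j + s) hj (by omega)
  set χ : ℕ → ℕ → Prop := fun k l => dcode s lam j k l = d with hχ
  set F := QQ χ K k f with hF
  have loc : Loc k F := Loc_QQ _ _ _ _
  rw [UU_app, loc.2 (j + lam j) (by omega), map_zero, smul_zero, sub_zero]
  obtain ⟨m, hm⟩ : ∃ m, m = k - lam (j + s) := ⟨_, rfl⟩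
  obtain ⟨m', hm'⟩ : ∃ m', m' = k - lam j := ⟨_, rfl⟩
  have hcode : ∀ l, χ k l ↔ (m - max l j) + (max l j - m') = d := fun l => by
    rw [hχ]; simp only [dcode]; rw [if_neg (by omega), if_neg (by omega), ← hm, ← hm']
  have e : F = E1 m F + (F - E1 m F) := by abel
  have hd2 := rr_sub_one d
  have n0 := N_nonneg 2 F
  have pd := pow_pos rr_pos d
  have b1 : N 2 (T j (E1 m F)) ≤ 2 * c * rr ^ d * N 2 F := by
    have q : E1 m F = QQ (fun k l => χ k l ∧ l ≤ m) K k f := by rw [hF, ← Module.End.mul_apply, E1_QQ]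
    by_cases hmd : j ≤ m - d ∧ d ≤ m
    · have h1 : E1 (m - d) (E1 m F) = E1 m F := by
        rw [q, ← Module.End.mul_apply, E1_QQ_le]
        rintro l ⟨h, h'⟩
        have := (hcode l).1 h; omega
      have h2 : E2 (m - 1 + lam (j + s)) (E1 m F) = 0 := by
        rw [q]; exact (Loc_QQ _ _ _ _).2 _ (by omega)
      have := e3 (m - d) (m - 1) (by omega) (by omega) (E1 m F)
      rw [Module.End.mul_apply, Module.End.mul_apply, h1, LinearMap.sub_apply, h2, sub_zero, Module.End.one_apply] at this
      rw [show m - 1 - (m - d) = d - 1 by omega] at this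
      calc _ ≤ _ := this
        _ ≤ c * (2 * rr ^ d) * N 2 F := by
          have := N_E1_le m F
          have := N_nonneg 2 (E1 m F)
          gcongr
        _ = _ := by ring
    · have : E1 m F = 0 := by
        rw [q, QQ_false]; rfl
        rintro l ⟨h, h'⟩
        have := (hcode l).1 h; omega
      rw [this, map_zero, N_zero (by norm_num)]
      have := pow_pos rr_pos d
      positivity
  have b2 : N 2 (T j (F - E1 m F)) ≤ 4 * c * rr ^ d * N 2 F := by
    have q : F - E1 m F = QQ (fun k l => χ k l ∧ m < l) K k f := by 
      rw [hF, ← Module.End.mul_apply, ← LinearMap.sub_apply, E1_QQ']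
    have h1 : E1 (m' + d - 1) (F - E1 m F) = 0 := by
      rw [q, ← Module.End.mul_apply, E1_QQ_lt]; rfl
      rintro l ⟨h, h'⟩
      have := (hcode l).1 h; omega
    have h2 : E2 (m' + lam j) (F - E1 m F) = F - E1 m F := by
      rw [q, show m' + lam j = k by omega]; exact (Loc_QQ _ _ _ _).1
    have := e4 (m' + d - 1) m' (by omega) (by omega) (F - E1 m F)
    rw [Module.End.mul_apply, Module.End.mul_apply, LinearMap.sub_apply, h1, sub_zero, Module.End.one_apply, h2] at this
    rw [show m' + d - 1 - m' = d - 1 by omega] at this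
    calc _ ≤ _ := this
      _ ≤ c * (2 * rr ^ d) * (2 * N 2 F) := by
        have := N_E1_sub m F
        have := N_nonneg 2 (F - E1 m F : DD)
        gcongr
      _ = _ := by ring
  calc N 2 (T j F) = N 2 (T j (E1 m F) + T j (F - E1 m F) : DD) := by rw [← map_add, ← e]
    _ ≤ _ := N_add_le (by norm_num) _ _
    _ ≤ _ := by linarith

lemma key_W {c : ℝ} {s : ℕ} {lam : ℕ → ℕ} {W : ℕ → Op} {j : ℕ} (hc : 0 ≤ c) 
    (w1 : ∀ m, m ≤ j → Bd 2 ((W j - Real.log 2 • 1) * E1 m) (c * rr ^ (j - m)))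
    (w2 : ∀ m, j ≤ m → Bd 2 (W j * (1 - E1 m)) (c * rr ^ (m - j)))
    {k K d : ℕ} (hk : k ≤ j + lam j) (hd : 1 ≤ d) (f : DD) :
    N 2 (W j (QQ (fun k l => dcode s lam j k l = d) K k f) - Real.log 2 • E1 j (QQ (fun k l => dcode s lam j k l = d) K k f) : DD) ≤
      6 * c * rr ^ d * N 2 (QQ (fun k l => dcode s lam j k l = d) K k f) := by
  set χ : ℕ → ℕ → Prop := fun k l => dcode s lam j k l = d with hχ
  set F := QQ χ K k f with hF
  have hcode : ∀ l, χ k l → d ≤ max (j - l) (l - j) := fun l => by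
    rw [hχ]; simp only [dcode]; rw [if_pos hk]; omega
  have e : F = E1 j F + (F - E1 j F) := by abel
  have hd2 := rr_sub_one d
  have n0 := N_nonneg 2 F
  have pd := pow_pos rr_pos d
  have ejj : E1 j (E1 j F) = E1 j F := by rw [filt1.mulf, min_self]
  have b1 : N 2 (W j (E1 j F) - Real.log 2 • E1 j F : DD) ≤ 2 * c * rr ^ d * N 2 F := by
    have q : E1 j F = QQ (fun k l => χ k l ∧ l ≤ j) K k f := by rw [hF, ← Module.End.mul_apply, E1_QQ]
    by_cases hmd : d ≤ j
    · have h1 : E1 (j - d) (E1 j F) = E1 j F := by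
        rw [q, ← Module.End.mul_apply, E1_QQ_le]
        rintro l ⟨h, h'⟩
        have := hcode l h; omega
      have := w1 (j - d) (by omega) (E1 j F)
      rw [Module.End.mul_apply, h1, LinearMap.sub_apply, LinearMap.smul_apply, Module.End.one_apply] at this
      rw [show j - (j - d) = d by omega] at this
      calc _ ≤ _ := this
        _ ≤ (2 * c) * rr ^ d * N 2 F := by
          have := N_E1_le j F
          have := N_nonneg 2 (E1 j F)
          gcongr; linarith
    · have : E1 j F = 0 := by
        rw [q, QQ_false]; rfl
        rintro l ⟨h, h'⟩
        have := hcode l h; omega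
      rw [this, map_zero, smul_zero, sub_zero, N_zero (by norm_num)]
      positivity
  have b2 : N 2 (W j (F - E1 j F)) ≤ 4 * c * rr ^ d * N 2 F := by
    have q : F - E1 j F = QQ (fun k l => χ k l ∧ j < l) K k f := by 
      rw [hF, ← Module.End.mul_apply, ← LinearMap.sub_apply, E1_QQ']
    have h1 : E1 (j + d - 1) (F - E1 j F) = 0 := by
      rw [q, ← Module.End.mul_apply, E1_QQ_lt]; rfl
      rintro l ⟨h, h'⟩
      have := hcode l h; omega
    have := w2 (j + d - 1) (by omega) (F - E1 j F)
    rw [Module.End.mul_apply, LinearMap.sub_apply, h1, sub_zero, Module.End.one_apply] at this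
    rw [show j + d - 1 - j = d - 1 by omega] at this
    calc _ ≤ _ := this
      _ ≤ c * (2 * rr ^ d) * (2 * N 2 F) := by
        have := N_E1_sub j F
        have := N_nonneg 2 (F - E1 j F : DD)
        gcongr
      _ = _ := by ring
  have e2 : W j F - Real.log 2 • E1 j F = (W j (E1 j F) - Real.log 2 • E1 j F) + W j (F - E1 j F) := by
    rw [map_sub]; abel
  rw [e2]
  refine (N_add_le (by norm_num) _ _).trans (by linarith)

lemma UU_split {lam : ℕ → ℕ} {T W : ℕ → Op} {j k : ℕ} (hk : k ≤ j + lam j) {F : DD} (hF : Loc k F) :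
    UU lam T j F = ((T j - W j) * E2 k) F + (W j F - Real.log 2 • E1 j F) := by
  have : E2 (j + lam j) F = F := by rw [← hF.1, filt2.mulf, min_eq_right hk]
  rw [UU_app, this, Module.End.mul_apply, hF.1, LinearMap.sub_apply]; abel

lemma key2 {c : ℝ} {s J0 : ℕ} {lam : ℕ → ℕ} {T T' W W' : ℕ → Op} (S : Sys c s J0 lam T T' W W') {j : ℕ} (hj : J0 ≤ j)
    {k K d : ℕ} (f : DD) :
    N 2 (UU lam T j (QQ (fun k l => dcode s lam j k l = d) K k f)) ≤
      16 * (c + 1) * rr ^ d * N 2 (QQ (fun k l => dcode s lam j k l = d) K k f) := by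
  have hc := S.c0
  have n0 := N_nonneg 2 (QQ (fun k l => dcode s lam j k l = d) K k f)
  have pd := pow_pos rr_pos d
  rcases Nat.eq_zero_or_pos d with h0 | hd
  · refine (UU_bd (S.bdT j hj) _).trans ?_
    rw [h0, pow_zero]; rw [h0] at n0; nlinarith
  by_cases hk : k ≤ j + lam j
  · by_cases hdk : d ≤ j + lam j - k
    · have loc : Loc k (QQ (fun k l => dcode s lam j k l = d) K k f) := Loc_QQ _ _ _ _
      rw [UU_split (W := W) hk loc]
      refine (N_add_le (by norm_num) _ _).trans ?_
      have h1 := S.e2 j hj k hk (QQ (fun k l => dcode s lam j k l = d) K k f)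
      have h2 := key_W (s := s) hc (S.w1 j hj) (S.w2 j hj) (K := K) hk hd f
      have h3 : c * rr ^ (j + lam j - k) * N 2 (QQ (fun k l => dcode s lam j k l = d) K k f) ≤ c * rr ^ d * N 2 (QQ (fun k l => dcode s lam j k l = d) K k f) := by
        gcongr c * ?_ * _; exact rr_pow_le hdk
      nlinarith [mul_nonneg (mul_nonneg hc pd.le) n0, mul_nonneg pd.le n0]
    · rw [QQ_false]
      · rw [LinearMap.zero_apply, map_zero, N_zero (by norm_num), mul_zero]
      · intro l h
        simp only [dcode] at h; rw [if_pos hk] at h; omega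
  · by_cases hk2 : k ≤ j + lam (j + s)
    · rw [QQ_false]
      · rw [LinearMap.zero_apply, map_zero, N_zero (by norm_num), mul_zero]
      · intro l h
        simp only [dcode] at h; rw [if_neg hk, if_pos hk2] at h; omega
    · refine (key_hi hc hj S.hlam (S.e3 j hj) (S.e4 j hj) (not_le.1 hk2) hd f).trans ?_
      nlinarith [mul_nonneg (mul_nonneg hc pd.le) n0, mul_nonneg pd.le n0]

lemma key3 {c : ℝ} {s J0 : ℕ} {lam : ℕ → ℕ} {T T' W W' : ℕ → Op} (S : Sys c s J0 lam T T' W W') {j : ℕ} (hj : J0 ≤ j)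
    {k k' K d : ℕ} {F : DD} (hF : Loc k F) (h : DD) :
    |ip (UU lam T j F) (QQ (fun k l => dcode s lam j k l = d) K k' h)| ≤
      16 * (c + 1) * rr ^ (d / 2) * (N 2 F * N 2 (QQ (fun k l => dcode s lam j k l = d) K k' h)) := by
  have hc := S.c0
  have locH : Loc k' (QQ (fun k l => dcode s lam j k l = d) K k' h) := Loc_QQ _ _ _ _
  set H := QQ (fun k l => dcode s lam j k l = d) K k' h with hH
  have nF := N_nonneg 2 F
  have nH := N_nonneg 2 H
  have nn := mul_nonneg nF nH
  have pd := pow_pos rr_pos (d/2)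
  rcases Nat.eq_zero_or_pos d with h0 | hd
  · refine (cs _ _).trans ?_
    have := UU_bd (lam := lam) (S.bdT j hj) F
    rw [h0]; simp only [Nat.zero_div, pow_zero]
    nlinarith [mul_le_mul_of_nonneg_right this nH]
  by_cases hk : k' ≤ j + lam j
  · by_cases hdk : d ≤ j + lam j - k'
    · by_cases hn : d / 2 ≤ (k - k') + (k' - k)
      · refine (key1 S hj hF locH).trans ?_
        gcongr 16 * (c+1) * ?_ * _
        exact rr_pow_le hn
      · have hk1 : k ≤ j + lam j := by omega
        rw [UU_split (W := W) hk1 hF, ip_add_left]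
        have h1 : |ip (((T j - W j) * E2 k) F) H| ≤ c * rr ^ (d/2) * (N 2 F * N 2 H) := by
          refine (cs _ _).trans ?_
          have := S.e2 j hj k hk1 F
          calc _ ≤ (c * rr ^ (j + lam j - k) * N 2 F) * N 2 H := mul_le_mul_of_nonneg_right this nH
            _ ≤ (c * rr ^ (d/2) * N 2 F) * N 2 H := by
              gcongr ?_ * _
              gcongr ?_ * _
              gcongr c * ?_
              exact rr_pow_le (by omega)
            _ = _ := by ring
        have h2 : |ip (W j F - Real.log 2 • E1 j F : DD) H| ≤ 6 * c * rr ^ (d/2) * (N 2 F * N 2 H) := by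
          have : ip (W j F - Real.log 2 • E1 j F : DD) H = ip F (W' j H - Real.log 2 • E1 j H : DD) := by
            rw [ip_sub_left, ip_sub_right, S.adjW j hj, ip_smul_left, ip_smul_right, filt1.adj]
          rw [this]
          refine (cs _ _).trans ?_
          have := key_W (s := s) hc (S.w1' j hj) (S.w2' j hj) (K := K) hk hd h
          calc _ ≤ N 2 F * (6 * c * rr ^ d * N 2 H) := mul_le_mul_of_nonneg_left this nF
            _ ≤ N 2 F * (6 * c * rr ^ (d/2) * N 2 H) := by
              gcongr ?_ * (6 * c * ?_ * _)
              exact rr_pow_le (by omega)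
            _ = _ := by ring
        refine (abs_add_le _ _).trans ?_
        nlinarith [mul_nonneg (mul_nonneg hc pd.le) nn, mul_nonneg pd.le nn]
    · have : H = 0 := by
        rw [hH, QQ_false]
        · rfl
        · intro l h
          simp only [dcode] at h; rw [if_pos hk] at h; omega
      rw [this, ip_zero_right, N_zero (by norm_num)]; simp
  · by_cases hk2 : k' ≤ j + lam (j + s)
    · have : H = 0 := by
        rw [hH, QQ_false]
        · rfl
        · intro l h
          simp only [dcode] at h; rw [if_neg hk, if_pos hk2] at h; omega
      rw [this, ip_zero_right, N_zero (by norm_num)]; simp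
    · rw [UU_adj S hj]
      refine (cs _ _).trans ?_
      have := key_hi hc hj S.hlam (S.e3' j hj) (S.e4' j hj) (K := K) (not_le.1 hk2) hd h
      calc _ ≤ N 2 F * (6 * c * rr ^ d * N 2 H) := mul_le_mul_of_nonneg_left this nF
        _ ≤ N 2 F * ((16 * (c + 1)) * rr ^ (d/2) * N 2 H) := by
          have q1 : 6 * c ≤ 16 * (c + 1) := by linarith
          have q2 : rr ^ d ≤ rr ^ (d/2) := rr_pow_le (by omega)
          have q3 := pow_pos rr_pos d
          exact mul_le_mul_of_nonneg_left (mul_le_mul_of_nonneg_right (mul_le_mul q1 q2 q3.le (by linarith)) nH) nF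
        _ = _ := by ring

/-- final decay base -/
def tau : ℝ := (2:ℝ) ^ (-(1/8) : ℝ)
lemma tau_pos : 0 < tau := by unfold tau; positivity
lemma tau_lt : tau < 1 := Real.rpow_lt_one_of_one_lt_of_neg one_lt_two (by norm_num)
lemma tau4 : tau ^ 4 = rr := by
  unfold tau rr
  rw [← Real.rpow_natCast, ← Real.rpow_mul (by norm_num)]; norm_num
lemma half_le_tau : 1 / 2 ≤ tau := by
  unfold tau
  rw [one_div, ← Real.rpow_neg_one]
  exact Real.rpow_le_rpow_of_exponent_le one_le_two (by norm_num)

lemma rr_tau {e n : ℕ} (h : n ≤ 4 * e + 1) : rr ^ e ≤ 2 * tau ^ n := by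
  rw [← tau4, ← pow_mul]
  have h1 : tau ^ (4 * e + 1) ≤ tau ^ n := pow_le_pow_of_le_one tau_pos.le tau_lt.le h
  rw [pow_succ] at h1
  have := pow_pos tau_pos (4 * e)
  nlinarith [half_le_tau]

lemma key {c : ℝ} {s J0 : ℕ} {lam : ℕ → ℕ} {T T' W W' : ℕ → Op} (S : Sys c s J0 lam T T' W W') {j : ℕ} (hj : J0 ≤ j)
    {k k' K d d' : ℕ} (f h : DD) :
    |ip (UU lam T j (QQ (fun k l => dcode s lam j k l = d) K k f)) (QQ (fun k l => dcode s lam j k l = d') K k' h)| ≤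
      32 * (c + 1) * tau ^ ((k - k') + (k' - k) + d + d') * 
      (N 2 (QQ (fun k l => dcode s lam j k l = d) K k f) * N 2 (QQ (fun k l => dcode s lam j k l = d') K k' h)) := by
  have hc := S.c0
  have locF : Loc k (QQ (fun k l => dcode s lam j k l = d) K k f) := Loc_QQ _ _ _ _
  have locH : Loc k' (QQ (fun k l => dcode s lam j k l = d') K k' h) := Loc_QQ _ _ _ _
  have r1 := key1 S hj locF locH
  have r2 := (cs _ _).trans (mul_le_mul_of_nonneg_right (key2 S hj (k := k) (K := K) (d := d) f) (N_nonneg 2 (QQ (fun k l => dcode s lam j k l = d') K k' h)))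
  have r3 := key3 S hj (K := K) (k' := k') (d := d') locF h
  set F := QQ (fun k l => dcode s lam j k l = d) K k f
  set H := QQ (fun k l => dcode s lam j k l = d') K k' h
  have nn := mul_nonneg (N_nonneg 2 F) (N_nonneg 2 H)
  obtain ⟨e, he, hX⟩ : ∃ e, (k - k') + (k' - k) + d + d' ≤ 4 * e + 1 ∧ |ip (UU lam T j F) H| ≤ 16 * (c + 1) * rr ^ e * (N 2 F * N 2 H) := by
    rcases le_total ((k - k') + (k' - k)) d with h1 | h1 <;> rcases le_total (d'/2) d with h2 | h2 <;> rcases le_total (d'/2) ((k - k') + (k' - k)) with h3 | h3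
    on_goal 1 => exact ⟨d, by omega, by linarith⟩
    on_goal 1 => exact ⟨d, by omega, by linarith⟩
    on_goal 1 => exact ⟨d'/2, by omega, r3⟩
    on_goal 1 => exact ⟨d'/2, by omega, r3⟩
    on_goal 1 => exact ⟨_, by omega, r1⟩
    on_goal 1 => exact ⟨_, by omega, r1⟩
    on_goal 1 => exact ⟨_, by omega, r1⟩
    exact ⟨d'/2, by omega, r3⟩
  refine hX.trans ?_
  have := rr_tau he
  calc _ ≤ 16 * (c + 1) * (2 * tau ^ ((k - k') + (k' - k) + d + d')) * (N 2 F * N 2 H) := by gcongr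
    _ = _ := by ring
end TB
end

section
namespace TB

lemma N2_sqf {ι : Type*} (s : Finset ι) (F : ι → DD) : ∑ i ∈ s, N 2 (F i) ^ 2 = N 2 (sqf s F) ^ 2 := by
  simp_rw [N2_sq, ip]
  rw [← integral_finsetSum _ fun i _ => ((dD (F i)).mul (dD (F i))).integrable]
  congr 1; ext x
  rw [sqf_val, Real.mul_self_sqrt (Finset.sum_nonneg fun i _ => sq_nonneg _)]
  exact Finset.sum_congr rfl fun i _ => by ring

lemma sum_N2_le {ι : Type*} (s : Finset ι) (F H : ι → DD) :
    ∑ i ∈ s, N 2 (F i) * N 2 (H i) ≤ N 2 (sqf s F) * N 2 (sqf s H) := by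
  refine (Real.sum_mul_le_sqrt_mul_sqrt _ _ _).trans ?_
  rw [N2_sqf, N2_sqf, Real.sqrt_sq (N_nonneg _ _), Real.sqrt_sq (N_nonneg _ _)]

lemma sqf_inj {ι κ : Type*} (s : Finset ι) (u : Finset κ) (G : κ → DD) (π : ι → κ) (hm : ∀ i ∈ s, π i ∈ u)
    (hi : Set.InjOn π s) {p : ℝ} (hp : 0 < p) : N p (sqf s fun i => G (π i)) ≤ N p (sqf u G) := by
  classical
  refine N_mono hp (dD _) (dD _) fun x => ?_
  rw [abs_of_nonneg (sqf_nonneg _ _ _), abs_of_nonneg (sqf_nonneg _ _ _), sqf_val, sqf_val]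
  apply Real.sqrt_le_sqrt
  rw [← Finset.sum_image (s := s) (g := π) (f := fun k => G k x ^ 2) (fun a ha b hb h => hi ha hb h)]
  exact Finset.sum_le_sum_of_subset_of_nonneg (Finset.image_subset_iff.2 hm) fun i _ _ => sq_nonneg _

/-- localization at code `d` -/
def QX (s : ℕ) (lam : ℕ → ℕ) (K j d k : ℕ) : Op := QQ (fun k l => dcode s lam j k l = d) K k

/-- index set -/
def ZZ (J : Finset ℕ) (K : ℕ) (n : ℤ) : Finset (ℕ × ℕ × ℕ) :=
  (J ×ˢ (Finset.range (K+1) ×ˢ Finset.range (K+1))).filter fun z => (z.2.2 : ℤ) - z.2.1 = n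

lemma mem_ZZ {J : Finset ℕ} {K : ℕ} {n : ℤ} {z : ℕ × ℕ × ℕ} (h : z ∈ ZZ J K n) : 
    z.1 ∈ J ∧ z.2.1 ∈ Finset.range (K+1) ∧ z.2.2 ∈ Finset.range (K+1) ∧ (z.2.2 : ℤ) - z.2.1 = n := by
  simp only [ZZ, Finset.mem_filter, Finset.mem_product] at h
  exact ⟨h.1.1, h.1.2.1, h.1.2.2, h.2⟩

/-- the pieces -/
def LL (s : ℕ) (lam : ℕ → ℕ) (T : ℕ → Op) (J : Finset ℕ) (ε : ℕ → ℝ) (K : ℕ) (n : ℤ) (d d' : ℕ) : Op :=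
  ∑ z ∈ ZZ J K n, ε z.1 • (QX s lam K z.1 d' z.2.2 * UU lam T z.1 * QX s lam K z.1 d z.2.1)

lemma ip_LL (s : ℕ) (lam : ℕ → ℕ) (T : ℕ → Op) (J : Finset ℕ) (ε : ℕ → ℝ) (K : ℕ) (n : ℤ) (d d' : ℕ) (f h : DD) :
    ip (LL s lam T J ε K n d d' f) h = ∑ z ∈ ZZ J K n, ε z.1 * ip (UU lam T z.1 (QX s lam K z.1 d z.2.1 f)) (QX s lam K z.1 d' z.2.2 h) := by
  rw [LL, LinearMap.sum_apply, ip_sum_left]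
  refine Finset.sum_congr rfl fun z _ => ?_
  rw [LinearMap.smul_apply, ip_smul_left, Module.End.mul_apply, Module.End.mul_apply, QX, QQ_adj]

lemma ip_LL_le (s : ℕ) (lam : ℕ → ℕ) (T : ℕ → Op) (J : Finset ℕ) (ε : ℕ → ℝ) (hε : ∀ j, |ε j| = 1) (K : ℕ) (n : ℤ) (d d' : ℕ) (f h : DD) :
    |ip (LL s lam T J ε K n d d' f) h| ≤ ∑ z ∈ ZZ J K n, |ip (UU lam T z.1 (QX s lam K z.1 d z.2.1 f)) (QX s lam K z.1 d' z.2.2 h)| := by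
  rw [ip_LL]
  refine (Finset.abs_sum_le_sum_abs _ _).trans (Finset.sum_le_sum fun z _ => ?_)
  rw [abs_mul, hε, one_mul]

lemma QX_fam (s : ℕ) {p : ℝ} (hp : 1 < p) : ∃ C : ℝ, 0 ≤ C ∧ ∀ J0 lam, Lam s J0 lam → ∀ (J : Finset ℕ), (∀ j ∈ J, J0 ≤ j) →
    ∀ K n d f, N p (sqf (ZZ J K n) fun z => QX s lam K z.1 d z.2.1 f) ≤ C * N p f ∧ 
      N p (sqf (ZZ J K n) fun z => QX s lam K z.1 d z.2.2 f) ≤ C * N p f := by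
  classical
  obtain ⟨C, hC, H⟩ := QQ_fam hp (5 * s + 4)
  refine ⟨C, hC, fun J0 lam hl J hJ K n d f => ?_⟩
  have h0 := H K J (fun j k l => dcode s lam j k l = d) (fun k l => by convert dcode_card hl J hJ d k l) f
  constructor
  · refine le_trans ?_ h0
    refine sqf_inj (ZZ J K n) (J ×ˢ Finset.range (K+1)) (fun z => QX s lam K z.1 d z.2 f) (fun z => (z.1, z.2.1)) ?_ ?_ (by linarith)
    · intro z hz; have := mem_ZZ hz; exact Finset.mem_product.2 ⟨this.1, this.2.1⟩
    · intro a ha b hb h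
      have h1 := (mem_ZZ (Finset.mem_coe.1 ha)).2.2.2
      have h2 := (mem_ZZ (Finset.mem_coe.1 hb)).2.2.2
      simp only [Prod.mk.injEq] at h
      ext
      · exact h.1
      · exact h.2
      · have := h.2; omega
  · refine le_trans ?_ h0
    refine sqf_inj (ZZ J K n) (J ×ˢ Finset.range (K+1)) (fun z => QX s lam K z.1 d z.2 f) (fun z => (z.1, z.2.2)) ?_ ?_ (by linarith)
    · intro z hz; have := mem_ZZ hz; exact Finset.mem_product.2 ⟨this.1, this.2.2.1⟩
    · intro a ha b hb h
      have h1 := (mem_ZZ (Finset.mem_coe.1 ha)).2.2.2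
      have h2 := (mem_ZZ (Finset.mem_coe.1 hb)).2.2.2
      simp only [Prod.mk.injEq] at h
      ext
      · exact h.1
      · have := h.2; omega
      · exact h.2

/-- uniform boundedness of the pieces with decay -/
def LBd (c : ℝ) (s : ℕ) (p : ℝ) : Prop := ∃ C σ : ℝ, 0 ≤ C ∧ 0 < σ ∧ σ < 1 ∧ ∀ J0 lam T T' W W', Sys c s J0 lam T T' W W' →
  ∀ (J : Finset ℕ), (∀ j ∈ J, J0 ≤ j) → ∀ ε : ℕ → ℝ, (∀ j, |ε j| = 1) → ∀ K n d d', Bd p (LL s lam T J ε K n d d') (C * σ ^ (n.natAbs + d + d'))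

/-- uniform boundedness of the randomized sums -/
def Main (c : ℝ) (s : ℕ) (p : ℝ) : Prop := ∃ C : ℝ, 0 ≤ C ∧ ∀ J0 lam T T' W W', Sys c s J0 lam T T' W W' →
  ∀ (J : Finset ℕ), (∀ j ∈ J, J0 ≤ j) → ∀ ε : ℕ → ℝ, (∀ j, |ε j| = 1) → Bd p (∑ j ∈ J, ε j • UU lam T j) C

/-- vector valued bound -/
def Vec (c : ℝ) (s : ℕ) (q : ℝ) : Prop := ∃ C : ℝ, 0 ≤ C ∧ ∀ J0 lam T T' W W', Sys c s J0 lam T T' W W' →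
  ∀ (Z : Finset (ℕ × ℕ × ℕ)), (∀ z ∈ Z, J0 ≤ z.1) → ∀ F : ℕ × ℕ × ℕ → DD, 
    N q (sqf Z fun z => UU lam T z.1 (F z)) ≤ C * N q (sqf Z F)

lemma LBd_two (c : ℝ) (s : ℕ) : LBd c s 2 := by
  obtain ⟨C, hC, H⟩ := QX_fam s (p := 2) (by norm_num)
  by_cases hc : 0 ≤ c
  swap
  · exact ⟨0, 1/2, le_rfl, by norm_num, by norm_num, fun J0 lam T T' W W' S => absurd S.c0 hc⟩
  refine ⟨32 * (c + 1) * (C * C), tau, by positivity, tau_pos, tau_lt, fun J0 lam T T' W W' S J hJ ε hε K n d d' f => ?_⟩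
  have n1 := N_nonneg 2 f
  have := tau_pos
  refine N2_le (by positivity) fun h => ?_
  refine (ip_LL_le _ _ _ _ _ hε _ _ _ _ _ _).trans ?_
  have h1 : ∀ z ∈ ZZ J K n, |ip (UU lam T z.1 (QX s lam K z.1 d z.2.1 f)) (QX s lam K z.1 d' z.2.2 h)| ≤
      32 * (c + 1) * tau ^ (n.natAbs + d + d') * (N 2 (QX s lam K z.1 d z.2.1 f) * N 2 (QX s lam K z.1 d' z.2.2 h)) := by
    intro z hz
    obtain ⟨a1, a2, a3, a4⟩ := mem_ZZ hz
    have := key S (hJ _ a1) (K := K) (k := z.2.1) (k' := z.2.2) (d := d) (d' := d') f h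
    rw [show (z.2.1 - z.2.2) + (z.2.2 - z.2.1) = n.natAbs by omega] at this
    exact this
  refine (Finset.sum_le_sum h1).trans ?_
  rw [← Finset.mul_sum]
  have h2 := sum_N2_le (ZZ J K n) (fun z => QX s lam K z.1 d z.2.1 f) (fun z => QX s lam K z.1 d' z.2.2 h)
  have h3 := (H J0 lam S.hlam J hJ K n d f).1
  have h4 := (H J0 lam S.hlam J hJ K n d' h).2
  have n2 := N_nonneg 2 h
  calc _ ≤ 32 * (c + 1) * tau ^ (n.natAbs + d + d') * ((C * N 2 f) * (C * N 2 h)) := by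
        gcongr
        refine h2.trans (mul_le_mul h3 h4 (N_nonneg _ _) (by positivity))
    _ = _ := by ring

lemma conj_ex {p : ℝ} (hp : 1 < p) : ∃ q, p.HolderConjugate q ∧ 1 < q :=
  ⟨_, Real.HolderConjugate.conjExponent hp, (Real.HolderConjugate.conjExponent hp).symm.lt⟩

lemma LBd_Vec {c : ℝ} {s : ℕ} {q : ℝ} (hq : 1 < q) (V : Vec c s q) : ∃ C : ℝ, 0 ≤ C ∧ ∀ J0 lam T T' W W', Sys c s J0 lam T T' W W' →
  ∀ (J : Finset ℕ), (∀ j ∈ J, J0 ≤ j) → ∀ ε : ℕ → ℝ, (∀ j, |ε j| = 1) → ∀ K n d d', Bd q (LL s lam T J ε K n d d') C := by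
  obtain ⟨q', hqq, hq'⟩ := conj_ex hq
  obtain ⟨C1, hC1, H1⟩ := QX_fam s hq
  obtain ⟨C2, hC2, H2⟩ := QX_fam s hq'
  obtain ⟨C3, hC3, H3⟩ := V
  refine ⟨C3 * C1 * C2, by positivity, fun J0 lam T T' W W' S J hJ ε hε K n d d' f => ?_⟩
  have n1 := N_nonneg q f
  refine duality hqq _ (by positivity) fun h => ?_
  refine (ip_LL_le _ _ _ _ _ hε _ _ _ _ _ _).trans ?_
  refine (sum_ip_le hqq (ZZ J K n) (fun z => UU lam T z.1 (QX s lam K z.1 d z.2.1 f)) (fun z => QX s lam K z.1 d' z.2.2 h)).trans ?_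
  have h3 := (H1 J0 lam S.hlam J hJ K n d f).1
  have h4 := (H2 J0 lam S.hlam J hJ K n d' h).2
  have h5 := H3 J0 lam T T' W W' S (ZZ J K n) (fun z hz => hJ _ (mem_ZZ hz).1) (fun z => QX s lam K z.1 d z.2.1 f)
  have n2 := N_nonneg q' h
  calc _ ≤ (C3 * (C1 * N q f)) * (C2 * N q' h) := by
        exact mul_le_mul (h5.trans (mul_le_mul_of_nonneg_left h3 hC3)) h4 (N_nonneg _ _) (by positivity)
    _ = _ := by ring

lemma interp {p q A B : ℝ} (hq : 0 < q) (hqp : q < p) (hp2 : p < 2) (hA : 0 ≤ A) (hB : 0 ≤ B) : 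
    ∃ C θ : ℝ, 0 ≤ C ∧ 0 < θ ∧ ∀ (S : Op) η, 0 < η → Bd q S A → Bd 2 S (B * η) → Bd p S (C * η ^ θ) := by
  have h1 : 0 < p - q := by linarith
  have h2 : 0 < 2 - p := by linarith
  have h3 : 0 < 2 - q := by linarith
  have hp : 0 < p := by linarith
  refine ⟨(p * (A ^ q * 2 ^ q / (p - q) + B ^ (2:ℝ) * 2 ^ (2:ℝ) / (2 - p))) ^ (1/p), (2 * (p - q) / (2 - q)) * (1/p), by positivity, by positivity, 
    fun S η hη b1 b2 f => ?_⟩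
  have m := marc (A := A ^ q) (B := (B * η) ^ (2:ℝ)) (by positivity) (by positivity) hq hqp hp2 (subL_op S)
    (Weak.of_strong hq fun f => pow_le_of_N hq hA (b1 f)) (Weak.of_strong two_pos fun f => pow_le_of_N two_pos (by positivity) (b2 f))
    (c := η ^ (-2/(2-q))) (by positivity) f
  have e1 : (η ^ (-2/(2-q))) ^ (q - p) = η ^ (2 * (p - q) / (2 - q)) := by
    rw [← Real.rpow_mul hη.le]; congr 1; ring
  have e2 : (B * η) ^ (2:ℝ) * 2 ^ (2:ℝ) * (η ^ (-2/(2-q))) ^ (2 - p) = B ^ (2:ℝ) * 2 ^ (2:ℝ) * η ^ (2 * (p - q) / (2 - q)) := by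
    rw [← Real.rpow_mul hη.le, Real.mul_rpow hB hη.le, show 2 * (p - q) / (2 - q) = 2 + -2 / (2-q) * (2 - p) by field_simp; ring, Real.rpow_add hη]
    ring
  rw [e1, e2] at m
  have m' : ∫ x, |S f x| ^ p ≤ ((p * (A ^ q * 2 ^ q / (p - q) + B ^ (2:ℝ) * 2 ^ (2:ℝ) / (2 - p))) * η ^ (2 * (p - q) / (2 - q))) * ∫ x, |f x| ^ p := by
    refine m.trans (le_of_eq ?_); ring
  have := N_of_int hp (by positivity) m'
  rwa [Real.mul_rpow (by positivity) (by positivity), ← Real.rpow_mul hη.le] at this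

lemma LBd_of_Vec {c : ℝ} {s : ℕ} {p q : ℝ} (hq : 1 < q) (hqp : q < p) (hp : p < 2) (V : Vec c s q) : LBd c s p := by
  obtain ⟨A, hA, H1⟩ := LBd_Vec hq V
  obtain ⟨B, σ, hB, hσ, hσ1, H2⟩ := LBd_two c s
  obtain ⟨C, θ, hC, hθ, H3⟩ := interp (by linarith) hqp hp hA hB
  refine ⟨C, σ ^ θ, hC, by positivity, Real.rpow_lt_one hσ.le hσ1 hθ, fun J0 lam T T' W W' S J hJ ε hε K n d d' => ?_⟩
  have := H3 _ (σ ^ (n.natAbs + d + d')) (by positivity) (H1 J0 lam T T' W W' S J hJ ε hε K n d d') (H2 J0 lam T T' W W' S J hJ ε hε K n d d')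
  rwa [← Real.rpow_natCast, ← Real.rpow_mul hσ.le, mul_comm ((n.natAbs + d + d' : ℕ) : ℝ), Real.rpow_mul hσ.le, Real.rpow_natCast] at this

lemma geo_le {σ : ℝ} (h0 : 0 < σ) (h1 : σ < 1) (m : ℕ) : ∑ d ∈ Finset.range m, σ ^ d ≤ 1 / (1 - σ) := by
  rw [one_div, ← tsum_geometric_of_lt_one h0.le h1]
  exact (summable_geometric_of_lt_one h0.le h1).sum_le_tsum _ fun i _ => by positivity

lemma geo_int {σ : ℝ} (h0 : 0 < σ) (h1 : σ < 1) (K : ℕ) : ∑ n ∈ Finset.Icc (-(K:ℤ)) K, σ ^ n.natAbs ≤ 2 * (1 / (1 - σ)) := by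
  classical
  have hs : Finset.Icc (-(K:ℤ)) K ⊆ (Finset.range (K+1)).image (fun n : ℕ => (n:ℤ)) ∪ (Finset.range (K+1)).image (fun n : ℕ => -(n:ℤ)) := by
    intro n hn
    rw [Finset.mem_Icc] at hn
    simp only [Finset.mem_union, Finset.mem_image, Finset.mem_range]
    rcases le_total 0 n with h | h
    · exact Or.inl ⟨n.natAbs, by omega, by omega⟩
    · exact Or.inr ⟨n.natAbs, by omega, by omega⟩
  refine (Finset.sum_le_sum_of_subset_of_nonneg hs fun _ _ _ => by positivity).trans ?_
  have e := Finset.sum_union_inter (s₁ := (Finset.range (K+1)).image (fun n : ℕ => (n:ℤ))) (s₂ := (Finset.range (K+1)).image (fun n : ℕ => -(n:ℤ))) (f := fun n : ℤ => σ ^ n.natAbs)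
  rw [Finset.sum_image (by intro a _ b _ h; simpa using h), Finset.sum_image (by intro a _ b _ h; simpa using h)] at e
  have h3 : 0 ≤ ∑ x ∈ (Finset.range (K+1)).image (fun n : ℕ => (n:ℤ)) ∩ (Finset.range (K+1)).image (fun n : ℕ => -(n:ℤ)), σ ^ x.natAbs :=
    Finset.sum_nonneg fun _ _ => by positivity
  simp only [Int.natAbs_neg, Int.natAbs_natCast] at e
  have := geo_le h0 h1 (K+1)
  linarith

lemma sum_QX (s : ℕ) (lam : ℕ → ℕ) (K j D : ℕ) (hD : ∀ k ∈ Finset.range (K+1), ∀ l ∈ Finset.range (K+1), dcode s lam j k l < D) :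
    EE K = ∑ d ∈ Finset.range D, ∑ k ∈ Finset.range (K+1), QX s lam K j d k := by
  classical
  rw [← sum_D21, Finset.sum_comm (s := Finset.range D)]
  refine Finset.sum_congr rfl fun k hk => ?_
  simp only [QX, QQ]
  rw [Finset.sum_comm]
  refine Finset.sum_congr rfl fun l hl => ?_
  symm
  refine (Finset.sum_eq_single (dcode s lam j k l) (fun d _ h => if_neg h.symm) (fun h => absurd (Finset.mem_range.2 (hD k hk l hl)) h)).trans (if_pos rfl)

lemma ip_EE (s : ℕ) (lam : ℕ → ℕ) (T : ℕ → Op) (J : Finset ℕ) (ε : ℕ → ℝ) (K : ℕ) : ∃ D : ℕ, ∀ (f h : DD), 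
    ip ((∑ j ∈ J, ε j • UU lam T j) (EE K f)) (EE K h) = 
      ∑ d ∈ Finset.range D, ∑ d' ∈ Finset.range D, ∑ n ∈ Finset.Icc (-(K:ℤ)) K, ip (LL s lam T J ε K n d d' f) h := by
  classical
  let D := (J ×ˢ (Finset.range (K+1) ×ˢ Finset.range (K+1))).sup (fun z => dcode s lam z.1 z.2.1 z.2.2) + 1
  have hD : ∀ j ∈ J, ∀ k ∈ Finset.range (K+1), ∀ l ∈ Finset.range (K+1), dcode s lam j k l < D := fun j hj k hk l hl => by
    have := Finset.le_sup (s := J ×ˢ (Finset.range (K+1) ×ˢ Finset.range (K+1))) (f := fun z => dcode s lam z.1 z.2.1 z.2.2) (b := (j, k, l)) (by simp [hj, hk, hl])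
    dsimp only at this; simp only [D]; omega
  refine ⟨D, fun f h => ?_⟩
  have h1 : ∀ d d', ∑ n ∈ Finset.Icc (-(K:ℤ)) K, ip (LL s lam T J ε K n d d' f) h = 
      ∑ z ∈ J ×ˢ (Finset.range (K+1) ×ˢ Finset.range (K+1)), ε z.1 * ip (UU lam T z.1 (QX s lam K z.1 d z.2.1 f)) (QX s lam K z.1 d' z.2.2 h) := fun d d' => by
    simp only [ip_LL, ZZ]
    refine Finset.sum_fiberwise_of_maps_to (fun z hz => ?_) _
    simp only [Finset.mem_product, Finset.mem_range] at hz
    rw [Finset.mem_Icc]; omega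
  simp_rw [h1]
  rw [LinearMap.sum_apply, ip_sum_left]
  have h2 : ∀ j ∈ J, ip ((ε j • UU lam T j) (EE K f)) (EE K h) = ∑ d ∈ Finset.range D, ∑ d' ∈ Finset.range D, ∑ y ∈ Finset.range (K+1) ×ˢ Finset.range (K+1), ε j * ip (UU lam T j (QX s lam K j d y.1 f)) (QX s lam K j d' y.2 h) := by
    intro j hj
    rw [sum_QX s lam K j D (hD j hj), LinearMap.smul_apply, ip_smul_left]
    simp only [LinearMap.sum_apply, map_sum, ip_sum_left, ip_sum_right, Finset.mul_sum, Finset.sum_product]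
    conv_rhs => rw [Finset.sum_comm]
    refine Finset.sum_congr rfl fun d _ => ?_
    rw [Finset.sum_comm]
    refine Finset.sum_congr rfl fun d' _ => ?_
    rw [Finset.sum_comm]
  rw [Finset.sum_congr rfl h2]
  rw [Finset.sum_comm]
  refine Finset.sum_congr rfl fun d _ => ?_
  rw [Finset.sum_comm]
  refine Finset.sum_congr rfl fun d' _ => ?_
  rw [Finset.sum_product]

lemma sum_UU_bd2 {c : ℝ} {s J0 : ℕ} {lam : ℕ → ℕ} {T T' W W' : ℕ → Op} (S : Sys c s J0 lam T T' W W') (J : Finset ℕ) (hJ : ∀ j ∈ J, J0 ≤ j)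
    (ε : ℕ → ℝ) : ∃ C, 0 ≤ C ∧ Bd 2 (∑ j ∈ J, ε j • UU lam T j) C := by
  have hc := S.c0
  refine ⟨∑ j ∈ J, |ε j| * (c + 1), by positivity, fun f => ?_⟩
  rw [LinearMap.sum_apply, Finset.sum_mul]
  refine (N_sum_le (by norm_num) _ _).trans (Finset.sum_le_sum fun j hj => ?_)
  rw [LinearMap.smul_apply, N_smul two_pos, mul_assoc]
  exact mul_le_mul_of_nonneg_left (UU_bd (S.bdT j (hJ j hj)) f) (abs_nonneg _)

lemma Main_of_LBd {c : ℝ} {s : ℕ} {p : ℝ} (hp : 1 < p) (H : LBd c s p) : Main c s p := by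
  obtain ⟨C, σ, hC, h0, h1, H⟩ := H
  obtain ⟨q, hpq, hq⟩ := conj_ex hp
  have h1' : 0 < 1 - σ := by linarith
  refine ⟨C * (2 * (1 / (1-σ)) * (1/(1-σ)) * (1/(1-σ))), by positivity, fun J0 lam T T' W W' S J hJ ε hε f => ?_⟩
  have n1 := N_nonneg p f
  refine duality hpq _ (by positivity) fun h => ?_
  have n2 := N_nonneg q h
  obtain ⟨C2, hC2, b2⟩ := sum_UU_bd2 S J hJ ε
  have lim := (weak_lim hC2 b2 f h).abs
  refine le_of_tendsto lim (Eventually.of_forall fun K => ?_)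
  obtain ⟨D, hD⟩ := ip_EE s lam T J ε K
  rw [hD f h]
  have hL : ∀ n d d', |ip (LL s lam T J ε K n d d' f) h| ≤ C * (σ ^ n.natAbs * σ ^ d' * σ ^ d) * (N p f * N q h) := fun n d d' => by
    refine (holder hpq (dD _) (dD _)).trans ?_
    refine (mul_le_mul_of_nonneg_right (H J0 lam T T' W W' S J hJ ε hε K n d d' f) n2).trans (le_of_eq ?_)
    rw [pow_add, pow_add]; ring
  calc _ ≤ ∑ d ∈ Finset.range D, ∑ d' ∈ Finset.range D, ∑ n ∈ Finset.Icc (-(K:ℤ)) K, C * (σ ^ n.natAbs * σ ^ d' * σ ^ d) * (N p f * N q h) := by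
        refine (Finset.abs_sum_le_sum_abs _ _).trans (Finset.sum_le_sum fun d _ => ?_)
        refine (Finset.abs_sum_le_sum_abs _ _).trans (Finset.sum_le_sum fun d' _ => ?_)
        exact (Finset.abs_sum_le_sum_abs _ _).trans (Finset.sum_le_sum fun n _ => hL n d d')
    _ = C * ((∑ n ∈ Finset.Icc (-(K:ℤ)) K, σ ^ n.natAbs) * (∑ d' ∈ Finset.range D, σ ^ d') * (∑ d ∈ Finset.range D, σ ^ d)) * (N p f * N q h) := by
        simp only [← Finset.sum_mul, ← Finset.mul_sum]
    _ ≤ C * (2 * (1 / (1-σ)) * (1/(1-σ)) * (1/(1-σ))) * (N p f * N q h) := by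
        have g1 := geo_int h0 h1 K
        have g2 := geo_le h0 h1 D
        gcongr
    _ = _ := by ring

end TB
end

section
namespace TB

/-- positive majorant of `UU` -/
def AA (lam : ℕ → ℕ) (T : ℕ → Op) (j : ℕ) : Op := T j + E1 j * E2 (j + lam j)

lemma AA_app (lam : ℕ → ℕ) (T : ℕ → Op) (j : ℕ) (f : DD) (x) : AA lam T j f x = T j f x + E1 j (E2 (j + lam j) f) x := by
  simp [AA, LinearMap.add_apply, add_val, Module.End.mul_apply]

section
variable {c : ℝ} {s J0 : ℕ} {lam : ℕ → ℕ} {T T' W W' : ℕ → Op}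

lemma AA_pos (S : Sys c s J0 lam T T' W W') {j : ℕ} (hj : J0 ≤ j) : Pos (AA lam T j) := fun f hf x => by
  rw [AA_app]
  exact add_nonneg (S.posT j hj f hf x) (filt1.pos _ _ (filt2.pos _ _ hf) x)

lemma AA_int (S : Sys c s J0 lam T T' W W') {j : ℕ} (hj : J0 ≤ j) (f : DD) (hf : ∀ x, 0 ≤ f x) :
    ∫ x, AA lam T j f x ≤ (c + 1) * ∫ x, f x := by
  have h1 := S.l1T j hj f
  have e : ∫ x, AA lam T j f x = (∫ x, T j f x) + ∫ x, E1 j (E2 (j + lam j) f) x := by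
    rw [← integral_add (dD _).integrable (dD _).integrable]
    exact integral_congr_ae (.of_forall fun x => AA_app _ _ _ _ _)
  have h2 := filt1.int j (E2 (j + lam j) f)
  have h3 := filt2.int (j + lam j) f
  have e2 : ∫ x, |f x| = ∫ x, f x := by congr 1; ext x; exact abs_of_nonneg (hf x)
  have e3 : ∫ x, |T j f x| = ∫ x, T j f x := by congr 1; ext x; exact abs_of_nonneg (S.posT j hj f hf x)
  rw [e2, e3] at h1
  rw [e]; rw [h2, h3]; linarith

lemma UU_le (S : Sys c s J0 lam T T' W W') {j : ℕ} (hj : J0 ≤ j) (f : DD) (x) : |UU lam T j f x| ≤ AA lam T j (dabs f) x := by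
  rw [UU_app, AA_app]
  have h1 := (S.posT j hj).abs f x
  have h2 : |E1 j (E2 (j + lam j) f) x| ≤ E1 j (E2 (j + lam j) (dabs f)) x := by
    have : Pos (E1 j * E2 (j + lam j)) := fun f hf x => filt1.pos _ _ (filt2.pos _ _ hf) x
    exact this.abs f x
  have h3 := log2_le
  have h4 := log2_nonneg
  simp only [sub_val, smul_val]
  refine (abs_sub _ _).trans (add_le_add h1 ?_)
  rw [abs_mul, abs_of_nonneg h4]
  nlinarith [abs_nonneg (E1 j (E2 (j + lam j) f) x)]
end

/-- maximal bound -/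
def Pm (c : ℝ) (s : ℕ) (p : ℝ) : Prop := ∃ C : ℝ, 0 ≤ C ∧ ∀ J0 lam T T' W W', Sys c s J0 lam T T' W W' →
  ∀ (J : Finset ℕ), (∀ j ∈ J, J0 ≤ j) → ∀ f : DD, ∃ m : DD, (∀ x, 0 ≤ m x) ∧ (∀ j ∈ J, ∀ x, AA lam T j (dabs f) x ≤ m x) ∧
    N p m ≤ C * N p f

lemma Pm_of_Main {c : ℝ} {s : ℕ} {p : ℝ} (hp : 1 < p) (H : Main c s p) : Pm c s p := by
  obtain ⟨C, hC, H⟩ := H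
  have hC1 : 0 ≤ CM 1 1 p := CM_nonneg zero_le_one one_pos hp
  have hp0 : 0 < p := by linarith
  have hK := (KN_pos p).le
  refine ⟨KN p * C + 2 * (CM 1 1 p * CM 1 1 p), by positivity, fun J0 lam T T' W W' S J hJ f => ?_⟩
  set K := J.sup fun j => j + lam j with hKd
  have hle : ∀ j ∈ J, j + lam j ≤ K := fun j hj => Finset.le_sup (f := fun j => j + lam j) hj
  refine ⟨sqf J (fun j => UU lam T j (dabs f)) + (2:ℝ) • doob E1 K (doob E2 K f), fun x => ?_, fun j hj x => ?_, ?_⟩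
  · rw [add_val, smul_val]
    have := sqf_nonneg J (fun j => UU lam T j (dabs f)) x
    have := doob_nonneg (E := E1) K (doob E2 K f) x
    positivity
  · have h1 := le_sqf J (fun j => UU lam T j (dabs f)) x hj
    have h0 := le_abs_self (UU lam T j (dabs f) x)
    have h2 : E1 j (E2 (j + lam j) (dabs f)) x ≤ doob E1 K (doob E2 K f) x := by
      have hh := le_doob (E := E1) (K := K) (k := j) (by have := hle j hj; omega) (doob E2 K f) x
      refine le_trans ?_ hh
      refine (filt1.pos' j).mono (fun y => ?_) x
      rw [abs_val]
      exact (le_doob (hle j hj) f y).trans (le_abs_self _)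
    have h3 : 0 ≤ E1 j (E2 (j + lam j) (dabs f)) x := filt1.pos _ _ (filt2.pos _ _ fun x => by simp) x
    have h4 := log2_le
    rw [AA_app, add_val, smul_val]
    rw [UU_app] at h0 h1
    simp only [sub_val, smul_val] at h0 h1
    nlinarith
  · refine (N_add_le hp.le _ _).trans ?_
    rw [N_smul hp0, add_mul, abs_of_pos (by norm_num : (0:ℝ) < 2)]
    have n0 := N_nonneg p f
    refine add_le_add ?_ ?_
    · rw [mul_assoc]
      refine sqf_le1 J _ hp0 (by positivity) fun ε hε => ?_
      have := H J0 lam T T' W W' S J hJ ε hε (dabs f)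
      have e : N p (dabs f) = N p f := N_abs _
      rw [e] at this
      convert this using 2
      rw [LinearMap.sum_apply]; simp
    · have h1 := doob_N filt1 K hp (doob E2 K f)
      have h2 := doob_N filt2 K hp f
      calc _ ≤ 2 * (CM 1 1 p * (CM 1 1 p * N p f)) := by gcongr; exact h1.trans (by gcongr)
        _ = _ := by ring

lemma sq_le_of_lam {a b c : ℝ} (ha : 0 ≤ a) (hb : 0 ≤ b) (hc : 0 ≤ c) (H : ∀ l > 0, c ≤ (l * a + l⁻¹ * b) / 2) : c ^ 2 ≤ a * b := by
  have := discrim_le_zero (a := a) (b := -2 * c) (c := b) (fun x => by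
    rcases le_or_gt x 0 with hx | hx
    · have : 0 ≤ a * (x * x) := mul_nonneg ha (mul_self_nonneg x)
      nlinarith [mul_nonneg hc (neg_nonneg.2 hx)]
    · have := mul_le_mul_of_nonneg_left (H x hx) hx.le
      have e : x * ((x * a + x⁻¹ * b) / 2) = (a * (x * x) + b) / 2 := by field_simp
      rw [e] at this; linarith)
  rw [discrim] at this; nlinarith

lemma Vec_of_Pm {c : ℝ} {s : ℕ} {q : ℝ} (hq : 1 < q) (hq2 : q < 2) (H : Pm c s (q / (2 - q))) : Vec c s q := by
  obtain ⟨C, hC, H⟩ := H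
  by_cases hc : 0 ≤ c
  swap
  · exact ⟨0, le_rfl, fun J0 lam T T' W W' S => absurd S.c0 hc⟩
  have h2q : 0 < 2 - q := by linarith
  have hq0 : 0 < q := by linarith
  set r := q / (2 - q) with hr
  have hr0 : 0 < r := by positivity
  refine ⟨((c + 1) * C) ^ (1/2 : ℝ), by positivity, fun J0 lam T T' W W' S Z hZ F => ?_⟩
  set G : DD := sqf Z F with hG
  have hG0 : ∀ x, 0 ≤ G x := sqf_nonneg Z F
  have hGm : Measurable G := dM G
  -- the weights
  have hu : ∀ z, z ∈ Z → IsD (fun x => F z x ^ 2 * G x ^ (q - 2)) := fun z hz => by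
    refine ((dD G).rpow hq0).of_le (((dM (F z)).pow_const 2).mul (hGm.pow_const _)) fun x => ?_
    have h1 := le_sqf Z F x hz
    have h2 : F z x ^ 2 ≤ G x ^ 2 := by rw [← sq_abs]; gcongr
    rw [abs_of_nonneg (by have := hG0 x; positivity), abs_of_nonneg (by positivity), abs_of_nonneg (hG0 x)]
    rcases (hG0 x).eq_or_lt with h | h
    · rw [← h, Real.zero_rpow (by linarith : q - 2 ≠ 0), Real.zero_rpow hq0.ne', mul_zero]
    · calc _ ≤ G x ^ 2 * G x ^ (q - 2) := by gcongr
        _ = G x ^ q := by rw [← Real.rpow_natCast, ← Real.rpow_add h]; norm_num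
  classical
  let u : ℕ × ℕ × ℕ → DD := fun z => if hz : z ∈ Z then ⟨_, hu z hz⟩ else 0
  have huv : ∀ z, z ∈ Z → ∀ x, u z x = F z x ^ 2 * G x ^ (q - 2) := fun z hz x => by
    simp only [u, dif_pos hz]
  let v : DD := ⟨fun x => |G x| ^ (2 - q), (dD G).rpow h2q⟩
  have hv : ∀ x, v x = G x ^ (2 - q) := fun x => by
    change |G x| ^ (2 - q) = _; rw [abs_of_nonneg (hG0 x)]
  have hu0 : ∀ z, z ∈ Z → ∀ x, 0 ≤ u z x := fun z hz x => by rw [huv z hz]; have := hG0 x; positivity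
  have hv0 : ∀ x, 0 ≤ v x := fun x => by rw [hv]; have := hG0 x; positivity
  have hFuv : ∀ z, z ∈ Z → ∀ x, F z x ^ 2 = u z x * v x := fun z hz x => by
    rw [huv z hz, hv]
    rcases (hG0 x).eq_or_lt with h | h
    · have := le_sqf Z F x hz
      rw [← hG, ← h] at this
      have : F z x = 0 := abs_nonpos_iff.1 this
      rw [this]; simp
    · rw [mul_assoc, ← Real.rpow_add h]; simp
  obtain ⟨m, hm0, hm1, hm2⟩ := H J0 lam T T' W W' S (Z.image fun z => z.1) (fun j hj => by
    obtain ⟨z, hz, rfl⟩ := Finset.mem_image.1 hj; exact hZ z hz) v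
  have dv : dabs v = v := dext fun x => by rw [abs_val, abs_of_nonneg (hv0 x)]
  rw [dv] at hm1
  have point : ∀ z ∈ Z, ∀ x, UU lam T z.1 (F z) x ^ 2 ≤ AA lam T z.1 (u z) x * m x := fun z hz x => by
    have hj := hZ z hz
    have hP := AA_pos S hj
    have a1 := UU_le S hj (F z) x
    have a2 : AA lam T z.1 (dabs (F z)) x ^ 2 ≤ AA lam T z.1 (u z) x * AA lam T z.1 v x := by
      refine sq_le_of_lam (hP _ (hu0 z hz) x) (hP _ hv0 x) (hP _ (fun x => by simp) x) fun l hl => ?_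
      have := hP.mono (f := dabs (F z)) (h := (1/2:ℝ) • (l • u z + l⁻¹ • v)) (fun y => by
        simp only [abs_val, smul_val, add_val]
        have h1 := hFuv z hz y
        have h2 := hu0 z hz y
        have h3 := hv0 y
        refine abs_le_of_sq_le_sq ?_ (by positivity)
        rw [h1]
        have e : l * u z y * (l⁻¹ * v y) = u z y * v y := by field_simp
        nlinarith [sq_nonneg (l * u z y - l⁻¹ * v y)]) x
      simp only [map_smul, map_add, smul_val, add_val] at this
      linarith
    have a3 := hm1 z.1 (Finset.mem_image_of_mem _ hz) x
    have a4 := hP _ (hu0 z hz) x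
    calc _ = |UU lam T z.1 (F z) x| ^ 2 := (sq_abs _).symm
      _ ≤ AA lam T z.1 (dabs (F z)) x ^ 2 := by gcongr
      _ ≤ _ := a2
      _ ≤ _ := by gcongr
  set w : DD := ∑ z ∈ Z, AA lam T z.1 (u z) with hw
  have hw0 : ∀ x, 0 ≤ w x := fun x => by
    rw [hw, sum_val]; exact Finset.sum_nonneg fun z hz => AA_pos S (hZ z hz) _ (hu0 z hz) x
  have hwi : ∫ x, w x ≤ (c + 1) * ∫ x, |G x| ^ q := by
    have e1 : ∫ x, w x = ∑ z ∈ Z, ∫ x, AA lam T z.1 (u z) x := by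
      rw [← integral_finsetSum _ fun i _ => (dD _).integrable]
      congr 1; ext x; rw [hw, sum_val]
    have e2 : ∫ x, |G x| ^ q = ∑ z ∈ Z, ∫ x, u z x := by
      rw [← integral_finsetSum _ fun i _ => (dD _).integrable]
      congr 1; ext x
      rw [Finset.sum_congr rfl fun z hz => huv z hz x, ← Finset.sum_mul, abs_of_nonneg (hG0 x)]
      have : ∑ z ∈ Z, F z x ^ 2 = G x ^ 2 := by
        rw [hG, sqf_val, Real.sq_sqrt (Finset.sum_nonneg fun i _ => sq_nonneg _)]
      rw [this]
      rcases (hG0 x).eq_or_lt with h | h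
      · rw [← h]; simp [Real.zero_rpow hq0.ne']
      · rw [← Real.rpow_natCast, ← Real.rpow_add h]; norm_num
    rw [e1, e2, Finset.mul_sum]
    exact Finset.sum_le_sum fun z hz => AA_int S (hZ z hz) _ (hu0 z hz)
  have I0 : 0 ≤ ∫ x, |G x| ^ q := int_rpow_nonneg _ _
  refine N_le_of_pow hq0 (by positivity) ?_
  have hconj : (2 / q).HolderConjugate (2 / (2 - q)) := by
    rw [Real.holderConjugate_iff]
    refine ⟨by rw [lt_div_iff₀ hq0]; linarith, by field_simp; ring⟩
  have hq2' : 0 < q / 2 := by positivity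
  have step1 : ∫ x, |sqf Z (fun z => UU lam T z.1 (F z)) x| ^ q ≤ ∫ x, |(|w x| ^ (q/2))| * |(|m x| ^ (q/2))| := by
    refine integral_mono ((dD _).rpow hq0).integrable ((((dD w).rpow hq2').abs.mul ((dD m).rpow hq2').abs)).integrable fun x => ?_
    have hw0x := hw0 x
    have hm0x := hm0 x
    change |sqf Z (fun z => UU lam T z.1 (F z)) x| ^ q ≤ |(|w x| ^ (q/2))| * |(|m x| ^ (q/2))|
    rw [abs_of_nonneg (by positivity : 0 ≤ |w x| ^ (q/2)), abs_of_nonneg (by positivity : 0 ≤ |m x| ^ (q/2)), abs_of_nonneg hw0x, abs_of_nonneg hm0x, 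
      abs_of_nonneg (sqf_nonneg _ _ _), sqf_val, Real.sqrt_eq_rpow, ← Real.rpow_mul (Finset.sum_nonneg fun i _ => sq_nonneg _),
      show 1 / 2 * q = q / 2 by ring, ← Real.mul_rpow hw0x hm0x]
    apply Real.rpow_le_rpow (Finset.sum_nonneg fun i _ => sq_nonneg _) _ hq2'.le
    rw [hw, sum_val, Finset.sum_mul]
    exact Finset.sum_le_sum fun z hz => point z hz x
  have step2 := holder_abs hconj ((dD w).rpow hq2') ((dD m).rpow hq2')
  have e1 : N (2/q) (fun x => |w x| ^ (q/2)) = (∫ x, w x) ^ (q/2) := by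
    rw [N, one_div_div]; congr 2; ext x
    rw [abs_of_nonneg (by positivity : 0 ≤ |w x| ^ (q/2)), ← Real.rpow_mul (abs_nonneg _), show q / 2 * (2 / q) = 1 by field_simp, Real.rpow_one, abs_of_nonneg (hw0 x)]
  have e2 : N (2/(2-q)) (fun x => |m x| ^ (q/2)) = N r m ^ (q/2) := by
    rw [N, N, one_div_div, ← Real.rpow_mul (int_rpow_nonneg _ _), show 1 / r * (q/2) = (2 - q)/2 by rw [hr]; field_simp]
    congr 2; ext x
    rw [abs_of_nonneg (by positivity : 0 ≤ |m x| ^ (q/2)), ← Real.rpow_mul (abs_nonneg _), show q / 2 * (2 / (2 - q)) = r by rw [hr]; field_simp]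
  have e3 : N r v = (∫ x, |G x| ^ q) ^ (1 / r) := by
    rw [N]; congr 2; ext x
    rw [abs_of_nonneg (hv0 x), hv, abs_of_nonneg (hG0 x), ← Real.rpow_mul (hG0 x), show (2 - q) * r = q by rw [hr]; field_simp]
  rw [e1, e2] at step2
  refine (step1.trans step2).trans ?_
  rw [e3] at hm2
  have hw00 : 0 ≤ ∫ x, w x := integral_nonneg hw0
  calc (∫ x, w x) ^ (q/2) * N r m ^ (q/2) ≤ ((c + 1) * ∫ x, |G x| ^ q) ^ (q/2) * (C * (∫ x, |G x| ^ q) ^ (1 / r)) ^ (q/2) := by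
        have := N_nonneg r m
        gcongr
    _ = ((((c + 1) * C) ^ (1/2 : ℝ)) ^ q) * ∫ x, |G x| ^ q := by
        set I := ∫ x, |G x| ^ q
        rw [Real.mul_rpow (by positivity) I0, Real.mul_rpow hC (by positivity), ← Real.rpow_mul I0, ← Real.rpow_mul (by positivity : 0 ≤ (c+1)*C),
          show 1 / 2 * q = q / 2 by ring, Real.mul_rpow (by positivity) hC,
          show 1 / r * (q / 2) = 1 - q/2 by rw [hr]; field_simp]
        have : I ^ (q/2) * I ^ (1 - q/2) = I := by
          rw [← Real.rpow_add_of_nonneg I0 (by positivity) (by linarith)]; simp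
        calc _ = (c+1)^(q/2) * C^(q/2) * (I ^ (q/2) * I ^ (1 - q/2)) := by ring
          _ = _ := by rw [this]

lemma boot {c : ℝ} {s : ℕ} {x p : ℝ} (hx : 0 < x) (H : Pm c s (1 + x)) (hp : 1 + x / (2 + x) < p) (hp2 : p < 2) : Main c s p := by
  have h0 : 0 < x / (2 + x) := by positivity
  have h1 : x / (2 + x) < 1 := by rw [div_lt_one (by positivity)]; linarith
  have V : Vec c s (1 + x / (2 + x)) := Vec_of_Pm (by linarith) (by linarith) (by
    convert H using 1
    have h3 : 2 - (1 + x / (2 + x)) ≠ 0 := by linarith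
    rw [div_eq_iff h3]; field_simp; ring)
  exact Main_of_LBd (by linarith) (LBd_of_Vec (by linarith) hp hp2 V)

lemma Main_two (c : ℝ) (s : ℕ) : Main c s 2 := Main_of_LBd (by norm_num) (LBd_two c s)

lemma Pm_pow (c : ℝ) (s n : ℕ) : Pm c s (1 + (2/3:ℝ) ^ n) := by
  induction n with
  | zero =>
    have := Pm_of_Main (by norm_num) (Main_two c s)
    convert this using 1; norm_num
  | succ n ih =>
    have h0 : 0 < (2/3:ℝ) ^ n := by positivity
    have h1 : (2/3:ℝ) ^ n ≤ 1 := pow_le_one₀ (by norm_num) (by norm_num)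
    refine Pm_of_Main (by have : 0 < (2/3:ℝ) ^ (n+1) := by positivity
                          linarith) (boot h0 ih ?_ ?_)
    · rw [pow_succ]
      have : (2/3:ℝ)^n / (2 + (2/3:ℝ)^n) < (2/3:ℝ)^n * (2/3) := by
        rw [div_lt_iff₀ (by positivity)]; nlinarith
      linarith
    · rw [pow_succ]; linarith

theorem Main_all (c : ℝ) (s : ℕ) {p : ℝ} (hp : 1 < p) (hp2 : p ≤ 2) : Main c s p := by
  rcases hp2.eq_or_lt with rfl | h2
  · exact Main_two c s
  obtain ⟨n, hn⟩ := exists_pow_lt_of_lt_one (show 0 < p - 1 by linarith) (show (2/3:ℝ) < 1 by norm_num)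
  have h0 : 0 < (2/3:ℝ) ^ n := by positivity
  refine boot h0 (Pm_pow c s n) ?_ h2
  have : (2/3:ℝ)^n / (2 + (2/3:ℝ)^n) ≤ (2/3:ℝ)^n := div_le_self h0.le (by linarith)
  linarith

theorem Pm_all (c : ℝ) (s : ℕ) {p : ℝ} (hp : 1 < p) (hp2 : p ≤ 2) : Pm c s p := Pm_of_Main hp (Main_all c s hp hp2)

end TB
end

section
namespace TB

/-- bounded, mean zero on dyadic cells -/
structure MZ (k : ℕ) (B : ℝ) (F : ℝ → ℝ) : Prop where
  meas : Measurable F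
  bdd : ∀ y, |F y| ≤ B
  mz : ∀ a, ∫ y, ker k a y * F y = 0

/-- integrals over subintervals are small -/
def Osc (s : Set ℝ) (f : ℝ → ℝ) (η : ℝ) : Prop := IntegrableOn f s ∧ ∀ S ⊆ s, S.OrdConnected → |∫ t in S, f t| ≤ η

lemma bdd_ii {F : ℝ → ℝ} {B : ℝ} (hm : Measurable F) (hB : ∀ y, |F y| ≤ B) (a b : ℝ) : IntervalIntegrable F volume a b := by
  rw [intervalIntegrable_iff]
  exact Measure.integrableOn_of_bounded (by simp) hm.aestronglyMeasurable (M := B) (.of_forall fun x => hB x)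

lemma MZ.cell {k : ℕ} {B : ℝ} {F : ℝ → ℝ} (h : MZ k B F) (n : ℤ) : ∫ y in (n / 2 ^ k : ℝ)..((n + 1) / 2 ^ k : ℝ), F y = 0 := by
  have hle : (n / 2 ^ k : ℝ) ≤ (n + 1) / 2 ^ k := by gcongr; linarith
  have hlt : (n / 2 ^ k : ℝ) < (n + 1) / 2 ^ k := by gcongr; linarith
  have hn : cl k (n / 2 ^ k : ℝ) = n := (cl_iff k _ n).2 ⟨le_rfl, hlt⟩
  have := h.mz (n / 2 ^ k : ℝ)
  rw [ker_eq_ind, hn] at this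
  rw [intervalIntegral.integral_of_le hle, ← integral_Ico_eq_integral_Ioc, ← integral_indicator measurableSet_Ico]
  have e : (fun y => (Ico (n / 2 ^ k : ℝ) ((n + 1) / 2 ^ k)).indicator (fun _ => (2:ℝ) ^ k) y * F y) = fun y => 2 ^ k * (Ico (n / 2 ^ k : ℝ) ((n + 1) / 2 ^ k)).indicator F y := by
    ext y; by_cases hy : y ∈ Ico (n / 2 ^ k : ℝ) ((n + 1) / 2 ^ k) <;> simp [hy]
  rw [e, integral_const_mul] at this
  exact (mul_eq_zero.1 this).resolve_left (by positivity)

lemma MZ.prim {k : ℕ} {B : ℝ} {F : ℝ → ℝ} (h : MZ k B F) (u : ℝ) : |∫ y in (0:ℝ)..u, F y| ≤ B / 2 ^ k := by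
  have ii := bdd_ii h.meas h.bdd
  have z : ∀ n : ℤ, ∫ y in (0:ℝ)..(n / 2 ^ k : ℝ), F y = 0 := by
    intro n
    induction n using Int.induction_on with
    | zero => simp
    | succ i ih =>
      have := h.cell (i:ℤ)
      push_cast at *
      rw [← intervalIntegral.integral_add_adjacent_intervals (ii _ _) (ii _ _), ih, this, add_zero]
    | pred i ih =>
      have := h.cell (-(i:ℤ) - 1)
      push_cast at *
      rw [sub_add_cancel] at this
      rw [← intervalIntegral.integral_add_adjacent_intervals (ii 0 ((-i - 1) / 2 ^ k)) (ii _ (-i / 2 ^ k)), this, add_zero] at ih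
      exact ih
  have h1 := (cl_iff k u _).1 rfl
  rw [← intervalIntegral.integral_add_adjacent_intervals (ii 0 (cl k u / 2 ^ k : ℝ)) (ii _ u), z, zero_add]
  have := intervalIntegral.norm_integral_le_of_norm_le_const (a := (cl k u / 2 ^ k : ℝ)) (b := u) (C := B) (f := F) fun x _ => h.bdd x
  rw [Real.norm_eq_abs] at this
  refine this.trans ?_
  have hB : 0 ≤ B := (abs_nonneg _).trans (h.bdd 0)
  rw [div_eq_mul_inv B]
  refine mul_le_mul_of_nonneg_left ?_ hB
  rw [abs_of_nonneg (by linarith [h1.1])]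
  have := h1.2
  rw [add_div, one_div] at this
  linarith

lemma ord_ae {S : Set ℝ} (hS : S.OrdConnected) {a b : ℝ} (hb : S ⊆ Icc a b) : ∃ u v, u ≤ v ∧ S =ᵐ[volume] Ioc u v := by
  rcases S.eq_empty_or_nonempty with rfl | hne
  · exact ⟨0, 0, le_rfl, by simp⟩
  have ba : BddAbove S := ⟨b, fun x hx => (hb hx).2⟩
  have bb : BddBelow S := ⟨a, fun x hx => (hb hx).1⟩
  have hle : sInf S ≤ sSup S := csInf_le_csSup hne bb ba
  refine ⟨sInf S, sSup S, hle, ?_⟩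
  have h1 : Ioo (sInf S) (sSup S) ⊆ S := by
    intro x hx
    obtain ⟨y, hy, hyx⟩ := exists_lt_of_csInf_lt hne hx.1
    obtain ⟨z, hz, hzx⟩ := exists_lt_of_lt_csSup hne hx.2
    exact hS.out hy hz ⟨hyx.le, hzx.le⟩
  have h2 : S ⊆ Icc (sInf S) (sSup S) := fun x hx => ⟨csInf_le bb hx, le_csSup ba hx⟩
  have e1 := (Ioo_ae_eq_Ioc (μ := volume) (a := sInf S) (b := sSup S))
  have e2 := (Ioc_ae_eq_Icc (μ := volume) (a := sInf S) (b := sSup S))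
  filter_upwards [e1, e2] with x hx1 hx2
  apply propext
  constructor
  · intro h; exact hx2.symm.mp (h2 h)
  · intro h; exact h1 (hx1.symm.mp h)

lemma MZ.ord {k : ℕ} {B : ℝ} {F : ℝ → ℝ} (h : MZ k B F) {S : Set ℝ} (hS : S.OrdConnected) {a b : ℝ} (hb : S ⊆ Icc a b) : 
    |∫ y in S, F y| ≤ 2 * B / 2 ^ k := by
  obtain ⟨u, v, huv, e⟩ := ord_ae hS hb
  have ii := bdd_ii h.meas h.bdd
  rw [setIntegral_congr_set e, ← intervalIntegral.integral_of_le huv, ← intervalIntegral.integral_interval_sub_left (ii 0 v) (ii 0 u)]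
  refine (abs_sub _ _).trans ?_
  have h1 := h.prim u
  have h2 := h.prim v
  rw [mul_div_assoc]; linarith

/-- base case with substitution -/
lemma MZ.subst {k : ℕ} {B : ℝ} {F : ℝ → ℝ} (h : MZ k B F) {s : Set ℝ} (hs : s.OrdConnected) {φ φ' : ℝ → ℝ} 
    (hd : ∀ t ∈ s, HasDerivAt φ (φ' t) t) (hi : InjOn φ s) {a' b' : ℝ} (hb' : ∀ t ∈ s, φ t ∈ Icc a' b') : 
    Osc s (fun t => |φ' t| * F (φ t)) (2 * B / 2 ^ k) := by
  constructor
  · have := (integrableOn_image_iff_integrableOn_abs_deriv_smul hs.measurableSet (fun t ht => (hd t ht).hasDerivWithinAt) hi F).1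
      (Measure.integrableOn_of_bounded ((measure_mono (image_subset_iff.2 fun t ht => hb' t ht : φ '' s ⊆ Icc a' b')).trans_lt measure_Icc_lt_top).ne h.meas.aestronglyMeasurable (M := B) (.of_forall fun x => h.bdd x))
    exact this
  · intro S hS hSo
    have := integral_image_eq_integral_abs_deriv_smul hSo.measurableSet (fun t ht => (hd t (hS ht)).hasDerivWithinAt) (hi.mono hS) F
    simp only [smul_eq_mul] at this
    rw [← this]
    refine h.ord ?_ (image_subset_iff.2 fun t ht => hb' t (hS ht))
    have := (hSo.isPreconnected).image φ (fun t ht => (hd t (hS ht)).continuousAt.continuousWithinAt)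
    exact this.ordConnected

lemma Osc.mono {s s' : Set ℝ} {f : ℝ → ℝ} {η : ℝ} (h : Osc s f η) (hs : s' ⊆ s) : Osc s' f η :=
  ⟨h.1.mono_set hs, fun S hS => h.2 S (hS.trans hs)⟩

lemma Osc.congr {s : Set ℝ} {f f' : ℝ → ℝ} {η : ℝ} (hs : MeasurableSet s) (h : Osc s f η) (H : ∀ t ∈ s, f' t = f t) : Osc s f' η := by
  refine ⟨(integrableOn_congr_fun H hs).2 h.1, fun S hS hSo => ?_⟩
  rw [setIntegral_congr_fun hSo.measurableSet fun t ht => H t (hS ht)]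
  exact h.2 S hS hSo

lemma Osc.sub {s : Set ℝ} {f f' : ℝ → ℝ} {η η' : ℝ} (h : Osc s f η) (h' : Osc s f' η') : Osc s (fun t => f t - f' t) (η + η') := by
  refine ⟨h.1.sub h'.1, fun S hS hSo => ?_⟩
  rw [integral_sub (h.1.mono_set hS) (h'.1.mono_set hS)]
  exact (abs_sub _ _).trans (add_le_add (h.2 S hS hSo) (h'.2 S hS hSo))

/-- antitone weights -/
lemma Osc.anti {s : Set ℝ} (hs : s.OrdConnected) {f w : ℝ → ℝ} {η B : ℝ} (h : Osc s f η) (hm : Measurable w) (ha : AntitoneOn w s) (h0 : ∀ t ∈ s, 0 ≤ w t)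
    (hB : ∀ t ∈ s, w t ≤ B) (hB0 : 0 ≤ B) : Osc s (fun t => w t * f t) (B * η) := by
  constructor
  · refine Integrable.bdd_mul (c := B) h.1 hm.aestronglyMeasurable ?_
    refine (ae_restrict_mem hs.measurableSet).mono fun t ht => ?_
    rw [Real.norm_eq_abs, abs_of_nonneg (h0 t ht)]; exact hB t ht
  intro S hS hSo
  have hSm := hSo.measurableSet
  have e1 : ∫ t in S, w t * f t = ∫ t in S, ∫ u in Ioc 0 B, (if u < w t then f t else 0) := by
    refine setIntegral_congr_fun hSm fun t ht => ?_
    have a0 := h0 t (hS ht)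
    have a1 := hB t (hS ht)
    have : ∀ u, (if u < w t then f t else 0) = (Iio (w t)).indicator (fun _ => f t) u := fun u => by
      simp [indicator_apply]
    simp_rw [this]
    rw [setIntegral_indicator measurableSet_Iio, setIntegral_const]
    have : (Ioc 0 B ∩ Iio (w t) : Set ℝ) =ᵐ[volume] (Ioc 0 (w t) : Set ℝ) := by
      have := (Ioo_ae_eq_Ioc (μ := volume) (a := 0) (b := w t))
      refine EventuallyEq.trans (Eq.eventuallyEq ?_) this
      ext u
      constructor
      · rintro ⟨⟨h1, h2⟩, h3⟩; exact ⟨h1, h3⟩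
      · rintro ⟨h1, h3⟩; exact ⟨⟨h1, by linarith⟩, h3⟩
    rw [measureReal_congr this]
    simp [a0]
  have hIntg : Integrable (fun z : ℝ × ℝ => if z.2 < w z.1 then f z.1 else 0) ((volume.restrict S).prod (volume.restrict (Ioc 0 B))) := by
    have h1 : Integrable (fun z : ℝ × ℝ => f z.1) ((volume.restrict S).prod (volume.restrict (Ioc 0 B))) :=
      (h.1.mono_set hS).comp_fst _
    have hms : MeasurableSet {z : ℝ × ℝ | z.2 < w z.1} := measurableSet_lt measurable_snd (hm.comp measurable_fst)
    refine (h1.indicator hms).congr (.of_forall fun z => ?_)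
    simp [indicator_apply]
  rw [e1, integral_integral_swap hIntg]
  have : ∀ u, |∫ t in S, (if u < w t then f t else 0)| ≤ η := fun u => by
    have : ∀ t, (if u < w t then f t else 0) = {t | u < w t}.indicator f t := fun t => by simp [indicator_apply]
    simp_rw [this]
    rw [setIntegral_indicator (measurableSet_lt measurable_const hm)]
    refine h.2 _ (inter_subset_left.trans hS) ⟨fun x hx y hy z hz => ?_⟩
    have zS := hSo.out hx.1 hy.1 hz
    exact ⟨zS, lt_of_lt_of_le hy.2 (ha (hS zS) (hS hy.1) hz.2)⟩
  have := norm_setIntegral_le_of_norm_le_const (μ := volume) (s := Ioc 0 B) (C := η) (f := fun u => ∫ t in S, (if u < w t then f t else 0)) (by simp) (fun u _ => this u)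
  rw [Real.norm_eq_abs] at this
  refine this.trans_eq ?_
  simp [hB0]; ring

/-- Lipschitz weights -/
lemma Osc.lip {s : Set ℝ} (hs : s.OrdConnected) {f w : ℝ → ℝ} {η R L a b : ℝ} (h : Osc s f η) (hm : Measurable w) (hab : s ⊆ Icc a b) (hL0 : 0 ≤ L)
    (hL : ∀ t ∈ s, ∀ t' ∈ s, |w t - w t'| ≤ L * |t - t'|) (h0 : ∀ t ∈ s, 0 ≤ w t)
    (hB : ∀ t ∈ s, w t ≤ R) (hR : 0 ≤ R) (hab' : a ≤ b) : Osc s (fun t => w t * f t) ((R + 2 * L * (b - a)) * η) := by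
  have hba : 0 ≤ b - a := by linarith
  have h1 := h.anti hs (w := fun t => w t + L * (b - t)) (B := R + L * (b - a)) (by fun_prop) (fun t ht t' ht' htt => by
      have := hL t ht t' ht'
      rw [abs_sub_comm t t', abs_of_nonneg (sub_nonneg.2 htt), abs_sub_comm] at this
      have := (le_abs_self _).trans this
      change w t' + L * (b - t') ≤ w t + L * (b - t)
      linarith) (fun t ht => add_nonneg (h0 t ht) (mul_nonneg hL0 (by linarith [(hab ht).2]))) (fun t ht => by
      have := hB t ht
      have h2 : L * (b - t) ≤ L * (b - a) := by gcongr; exact (hab ht).1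
      change w t + L * (b - t) ≤ _
      linarith) (by positivity)
  have h2 := h.anti hs (w := fun t => L * (b - t)) (B := L * (b - a)) (by fun_prop) (fun t ht t' ht' htt => by
      change L * (b - t') ≤ L * (b - t); gcongr) (fun t ht => (mul_nonneg hL0 (by linarith [(hab ht).2]))) (fun t ht => by
      gcongr; exact (hab ht).1) (by positivity)
  have h3 := h1.sub h2
  convert h3 using 2
  · ring
  · ring

/-- pieces -/
lemma pieces {s : Set ℝ} (hs : MeasurableSet s) {f : ℝ → ℝ} {η : ℝ} (hf : IntegrableOn f s) {n : ℝ → ℤ} (hn : Measurable n) (P : Finset ℤ) (hP : ∀ t ∈ s, n t ∈ P)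
    (H : ∀ i ∈ P, |∫ t in s ∩ n ⁻¹' {i}, f t| ≤ η) : |∫ t in s, f t| ≤ P.card * η := by
  have e : s = ⋃ i ∈ P, (s ∩ n ⁻¹' {i}) := by
    ext t; simp only [mem_iUnion, mem_inter_iff, mem_preimage, mem_singleton_iff, exists_prop]
    constructor
    · intro ht; exact ⟨n t, hP t ht, ht, rfl⟩
    · rintro ⟨i, -, ht, -⟩; exact ht
  have hmi : ∀ i ∈ P, MeasurableSet (s ∩ n ⁻¹' {i}) := fun i _ => hs.inter (hn (measurableSet_singleton i))
  have := integral_biUnion_finset (μ := volume) (f := f) P hmi (by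
    intro i _ j _ hij
    refine Set.disjoint_left.2 fun t h1 h2 => hij ?_
    have a : n t = i := h1.2
    have b : n t = j := h2.2
    rw [← a, b]) (fun i _ => hf.mono_set inter_subset_left)
  rw [← e] at this
  rw [this]
  refine (Finset.abs_sum_le_sum_abs _ _).trans ?_
  rw [← nsmul_eq_mul]
  exact Finset.sum_le_card_nsmul _ _ _ H

/-- shifted intervals -/
lemma shift_bound {h : ℝ → ℝ} {B d : ℝ} (hm : Measurable h) (hB : ∀ y, |h y| ≤ B) {a b a' b' : ℝ} (ha : |a' - a| ≤ d) (hb : |b' - b| ≤ d) :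
    |(∫ y in a'..b', h y) - ∫ y in a..b, h y| ≤ 2 * d * B := by
  have ii := bdd_ii hm hB
  have hB0 : 0 ≤ B := (abs_nonneg _).trans (hB 0)
  rw [intervalIntegral.integral_interval_sub_interval_comm (ii _ _) (ii _ _) (ii _ _)]
  have h1 := intervalIntegral.norm_integral_le_of_norm_le_const (a := a') (b := a) (C := B) (f := h) fun x _ => hB x
  have h2 := intervalIntegral.norm_integral_le_of_norm_le_const (a := b') (b := b) (C := B) (f := h) fun x _ => hB x
  rw [Real.norm_eq_abs] at h1 h2
  refine (abs_sub _ _).trans ?_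
  rw [abs_sub_comm] at ha hb
  nlinarith

end TB
end

section
namespace TB

/-- dyadic interval -/
def Ij (j : ℕ) : Set ℝ := Ico ((1/2:ℝ) ^ (j+1)) ((1/2:ℝ) ^ j)

lemma Ij_meas (j : ℕ) : MeasurableSet (Ij j) := measurableSet_Ico
lemma Ij_ord (j : ℕ) : (Ij j).OrdConnected := ordConnected_Ico
lemma Ij_lo (j : ℕ) {t : ℝ} (h : t ∈ Ij j) : (1/2:ℝ) ^ (j+1) ≤ t := h.1
lemma Ij_hi (j : ℕ) {t : ℝ} (h : t ∈ Ij j) : t < (1/2:ℝ) ^ j := h.2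
lemma Ij_pos (j : ℕ) {t : ℝ} (h : t ∈ Ij j) : 0 < t := lt_of_lt_of_le (by positivity) h.1
lemma Ij_inv (j : ℕ) {t : ℝ} (h : t ∈ Ij j) : t⁻¹ ≤ 2 ^ (j+1) := by
  have := inv_anti₀ (by positivity) (Ij_lo j h)
  simpa using this

lemma Ij_int (j : ℕ) : ∫ t in Ij j, t⁻¹ = Real.log 2 := by
  have h1 : (0:ℝ) < (1/2:ℝ) ^ (j+1) := by positivity
  have h2 : (1/2:ℝ) ^ (j+1) ≤ (1/2:ℝ) ^ j := pow_le_pow_of_le_one (by norm_num) (by norm_num) (by omega)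
  rw [Ij, integral_Ico_eq_integral_Ioc, ← intervalIntegral.integral_of_le h2, integral_inv_of_pos h1 (by positivity)]
  congr 1; rw [pow_succ]; field_simp

lemma Ij_intble (j : ℕ) : IntegrableOn (fun t : ℝ => t⁻¹) (Ij j) := by
  refine Measure.integrableOn_of_bounded (by simp [Ij]) measurable_inv.aestronglyMeasurable (M := 2 ^ (j+1)) ?_
  refine (ae_restrict_mem (Ij_meas j)).mono fun t ht => ?_
  rw [Real.norm_eq_abs, abs_of_pos (inv_pos.2 (Ij_pos j ht))]; exact Ij_inv j ht

/-- admissible averaging data -/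
structure AvOK (j : ℕ) (ρ : ℝ × ℝ → ℝ → ℝ) (Φ : ℝ × ℝ → ℝ → ℝ × ℝ) : Prop where
  mρ : Measurable fun q : (ℝ × ℝ) × ℝ => ρ q.1 q.2
  mΦ : Measurable fun q : (ℝ × ℝ) × ℝ => Φ q.1 q.2
  bρ : ∃ B, ∀ x, ∀ t ∈ Ij j, |ρ x t| ≤ B
  b1 : ∀ x, ∀ t ∈ Ij j, |(Φ x t).1 - x.1| ≤ 1
  b2 : ∀ x, ∀ t ∈ Ij j, |(Φ x t).2 - x.2| ≤ 1

section
variable {j : ℕ} {ρ : ℝ × ℝ → ℝ → ℝ} {Φ : ℝ × ℝ → ℝ → ℝ × ℝ}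

lemma AvOK.mm (h : AvOK j ρ Φ) (f : DD) : Measurable fun q : (ℝ × ℝ) × ℝ => q.2⁻¹ * (ρ q.1 q.2 * f (Φ q.1 q.2)) :=
  measurable_snd.inv.mul (h.mρ.mul ((dM f).comp h.mΦ))

lemma AvOK.bb (h : AvOK j ρ Φ) (f : DD) : ∃ B, 0 ≤ B ∧ ∀ x, ∀ t ∈ Ij j, |t⁻¹ * (ρ x t * f (Φ x t))| ≤ B := by
  obtain ⟨B, hB⟩ := h.bρ
  obtain ⟨-, ⟨C, hC⟩, -⟩ := dD f
  refine ⟨2 ^ (j+1) * (|B| * |C|), by positivity, fun x t ht => ?_⟩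
  rw [abs_mul, abs_mul, abs_of_pos (inv_pos.2 (Ij_pos j ht))]
  have := Ij_inv j ht
  exact mul_le_mul this (mul_le_mul ((hB x t ht).trans (le_abs_self _)) ((hC _).trans (le_abs_self _)) (abs_nonneg _) (abs_nonneg _)) (by positivity) (by positivity)

lemma AvOK.intble (h : AvOK j ρ Φ) (f : DD) (x) : IntegrableOn (fun t => t⁻¹ * (ρ x t * f (Φ x t))) (Ij j) := by
  obtain ⟨B, -, hB⟩ := h.bb f
  refine Measure.integrableOn_of_bounded (by simp [Ij]) ((h.mm f).comp (measurable_prodMk_left (x := x))).aestronglyMeasurable (M := B) ?_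
  exact (ae_restrict_mem (Ij_meas j)).mono fun t ht => hB x t ht

lemma AvOK.isD (h : AvOK j ρ Φ) (f : DD) : IsD (fun x => ∫ t in Ij j, t⁻¹ * (ρ x t * f (Φ x t))) := by
  obtain ⟨B, hB0, hB⟩ := h.bb f
  refine ⟨?_, ⟨B * volume.real (Ij j), fun x => ?_⟩, ?_⟩
  · exact ((h.mm f).stronglyMeasurable.integral_prod_right' (ν := volume.restrict (Ij j))).measurable
  · exact norm_setIntegral_le_of_norm_le_const (μ := volume) (s := Ij j) (C := B) (f := fun t => t⁻¹ * (ρ x t * f (Φ x t))) (by simp [Ij]) fun t ht => hB x t ht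
  · obtain ⟨-, -, R, hR⟩ := dD f
    refine ⟨R + 1, fun x hx => ?_⟩
    by_contra hc
    refine hx (setIntegral_eq_zero_of_forall_eq_zero fun t ht => ?_)
    have : f (Φ x t) = 0 := by
      by_contra hne
      have := hR _ hne
      have h1 := h.b1 x t ht
      have h2 := h.b2 x t ht
      refine hc ⟨?_, ?_⟩
      · have := abs_sub_abs_le_abs_sub x.1 (Φ x t).1
        rw [abs_sub_comm] at this; linarith
      · have := abs_sub_abs_le_abs_sub x.2 (Φ x t).2
        rw [abs_sub_comm] at this; linarith
    rw [this]; simp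

end

open Classical in
/-- averaging operator -/
def mkAv (j : ℕ) (ρ : ℝ × ℝ → ℝ → ℝ) (Φ : ℝ × ℝ → ℝ → ℝ × ℝ) : Op :=
  if h : AvOK j ρ Φ then
    { toFun := fun f => ⟨_, h.isD f⟩
      map_add' := fun f g => dext fun x => by
        rw [add_val]
        change ∫ t in Ij j, t⁻¹ * (ρ x t * (f + g : DD) (Φ x t)) = (∫ t in Ij j, t⁻¹ * (ρ x t * f (Φ x t))) + ∫ t in Ij j, t⁻¹ * (ρ x t * g (Φ x t))
        rw [← integral_add (h.intble f x) (h.intble g x)]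
        congr 1; ext t; rw [add_val]; ring
      map_smul' := fun c f => dext fun x => by
        rw [RingHom.id_apply, smul_val]
        change ∫ t in Ij j, t⁻¹ * (ρ x t * (c • f : DD) (Φ x t)) = c * (∫ t in Ij j, t⁻¹ * (ρ x t * f (Φ x t)))
        rw [← integral_const_mul]
        congr 1; ext t; rw [smul_val]; ring }
  else 0

section
variable {j : ℕ} {ρ : ℝ × ℝ → ℝ → ℝ} {Φ : ℝ × ℝ → ℝ → ℝ × ℝ}

lemma mkAv_val (h : AvOK j ρ Φ) (f : DD) (x) : mkAv j ρ Φ f x = ∫ t in Ij j, t⁻¹ * (ρ x t * f (Φ x t)) := by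
  unfold mkAv; rw [dif_pos h]; rfl

lemma mkAv_le (h : AvOK j ρ Φ) (f : DD) (x) {B : ℝ} (hB : ∀ t ∈ Ij j, |ρ x t * f (Φ x t)| ≤ B) : |mkAv j ρ Φ f x| ≤ B := by
  have ht0 : ((1/2:ℝ) ^ (j+1)) ∈ Ij j := ⟨le_rfl, pow_lt_pow_right_of_lt_one₀ (by norm_num) (by norm_num) (by omega)⟩
  have hB0 : 0 ≤ B := (abs_nonneg _).trans (hB _ ht0)
  rw [mkAv_val h]
  have h1 : |∫ t in Ij j, t⁻¹ * (ρ x t * f (Φ x t))| ≤ ∫ t in Ij j, t⁻¹ * B := by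
    rw [← Real.norm_eq_abs]
    refine norm_integral_le_of_norm_le ((Ij_intble j).mul_const B) ?_
    refine (ae_restrict_mem (Ij_meas j)).mono fun t ht => ?_
    rw [Real.norm_eq_abs, abs_mul, abs_of_pos (inv_pos.2 (Ij_pos j ht))]
    exact mul_le_mul_of_nonneg_left (hB t ht) (inv_pos.2 (Ij_pos j ht)).le
  refine h1.trans ?_
  rw [integral_mul_const, Ij_int]
  have := log2_le
  nlinarith

lemma mkAv_fub (h : AvOK j ρ Φ) (f : DD) {α : Type*} [MeasurableSpace α] (μ : Measure α) [SFinite μ] {e : α → ℝ × ℝ} (he : Measurable e)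
    {ψ : α → ℝ} (hψ : Integrable ψ μ) : 
    ∫ a, ψ a * mkAv j ρ Φ f (e a) ∂μ = ∫ t in Ij j, t⁻¹ * ∫ a, ψ a * (ρ (e a) t * f (Φ (e a) t)) ∂μ := by
  obtain ⟨B, hB0, hB⟩ := h.bb f
  have hIntg : Integrable (fun z : α × ℝ => ψ z.1 * (z.2⁻¹ * (ρ (e z.1) z.2 * f (Φ (e z.1) z.2)))) (μ.prod (volume.restrict (Ij j))) := by
    have : IsFiniteMeasure (volume.restrict (Ij j) : Measure ℝ) := ⟨by simp [Ij]⟩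
    have h1 : Integrable (fun z : α × ℝ => ψ z.1) (μ.prod (volume.restrict (Ij j))) := hψ.comp_fst _
    refine Integrable.mul_bdd (c := B) h1 ?_ ?_
    · exact ((h.mm f).comp ((he.comp measurable_fst).prodMk measurable_snd)).aestronglyMeasurable
    · have : ∀ᵐ z ∂(μ.prod (volume.restrict (Ij j))), z.2 ∈ Ij j := by
        have := (Measure.quasiMeasurePreserving_snd (μ := μ) (ν := volume.restrict (Ij j))).ae (ae_restrict_mem (Ij_meas j))
        exact this
      exact this.mono fun z hz => hB _ _ hz
  simp_rw [mkAv_val h]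
  have e1 : ∀ a, ψ a * ∫ t in Ij j, t⁻¹ * (ρ (e a) t * f (Φ (e a) t)) = ∫ t in Ij j, ψ a * (t⁻¹ * (ρ (e a) t * f (Φ (e a) t))) := fun a => by
    rw [integral_const_mul]
  simp_rw [e1]
  rw [integral_integral_swap hIntg]
  congr 1; ext t
  rw [← integral_const_mul]
  congr 1; ext a; ring

/-- bound for a double average -/
lemma mkAv_fub_le (h : AvOK j ρ Φ) (f : DD) {α : Type*} [MeasurableSpace α] (μ : Measure α) [SFinite μ] {e : α → ℝ × ℝ} (he : Measurable e)
    {ψ : α → ℝ} (hψ : Integrable ψ μ) {B : ℝ} (hB : ∀ t ∈ Ij j, |∫ a, ψ a * (ρ (e a) t * f (Φ (e a) t)) ∂μ| ≤ B) : 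
    |∫ a, ψ a * mkAv j ρ Φ f (e a) ∂μ| ≤ B := by
  have ht0 : ((1/2:ℝ) ^ (j+1)) ∈ Ij j := ⟨le_rfl, pow_lt_pow_right_of_lt_one₀ (by norm_num) (by norm_num) (by omega)⟩
  have hB0 : 0 ≤ B := (abs_nonneg _).trans (hB _ ht0)
  rw [mkAv_fub h f μ he hψ]
  have h1 : |∫ t in Ij j, t⁻¹ * ∫ a, ψ a * (ρ (e a) t * f (Φ (e a) t)) ∂μ| ≤ ∫ t in Ij j, t⁻¹ * B := by
    rw [← Real.norm_eq_abs]
    refine norm_integral_le_of_norm_le ((Ij_intble j).mul_const B) ?_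
    refine (ae_restrict_mem (Ij_meas j)).mono fun t ht => ?_
    rw [Real.norm_eq_abs, abs_mul, abs_of_pos (inv_pos.2 (Ij_pos j ht))]
    exact mul_le_mul_of_nonneg_left (hB t ht) (inv_pos.2 (Ij_pos j ht)).le
  refine h1.trans ?_
  rw [integral_mul_const, Ij_int]
  have := log2_le
  nlinarith

lemma mkAv_pos (h : AvOK j ρ Φ) (h0 : ∀ x, ∀ t ∈ Ij j, 0 ≤ ρ x t) : Pos (mkAv j ρ Φ) := fun f hf x => by
  rw [mkAv_val h]
  exact setIntegral_nonneg (Ij_meas j) fun t ht => mul_nonneg (inv_pos.2 (Ij_pos j ht)).le (mul_nonneg (h0 x t ht) (hf _))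

/-- fixed-time functions -/
lemma AvOK.slice (h : AvOK j ρ Φ) (f : DD) {t : ℝ} (ht : t ∈ Ij j) : IsD (fun x => ρ x t * f (Φ x t)) := by
  obtain ⟨B, hB⟩ := h.bρ
  obtain ⟨-, ⟨C, hC⟩, R, hR⟩ := dD f
  refine ⟨(h.mρ.mul ((dM f).comp h.mΦ)).comp measurable_prodMk_right, ⟨|B| * |C|, fun x => ?_⟩, R + 1, fun x hx => ?_⟩
  · rw [abs_mul]
    exact mul_le_mul ((hB x t ht).trans (le_abs_self _)) ((hC _).trans (le_abs_self _)) (abs_nonneg _) (abs_nonneg _)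
  · have := hR _ (right_ne_zero_of_mul hx)
    have h1 := h.b1 x t ht
    have h2 := h.b2 x t ht
    refine ⟨?_, ?_⟩
    · have := abs_sub_abs_le_abs_sub x.1 (Φ x t).1
      rw [abs_sub_comm] at this; linarith
    · have := abs_sub_abs_le_abs_sub x.2 (Φ x t).2
      rw [abs_sub_comm] at this; linarith

/-- `L^1` bound -/
lemma mkAv_l1 (h : AvOK j ρ Φ) (h0 : ∀ x, ∀ t ∈ Ij j, 0 ≤ ρ x t) {c : ℝ} (H : ∀ t ∈ Ij j, ∀ f : DD, (∀ x, 0 ≤ f x) → ∫ x, ρ x t * f (Φ x t) ≤ c * ∫ x, f x) (f : DD) : 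
    ∫ x, |mkAv j ρ Φ f x| ≤ c * ∫ x, |f x| := by
  have hp := mkAv_pos h h0
  have h1 : ∫ x, |mkAv j ρ Φ f x| ≤ ∫ x, mkAv j ρ Φ (dabs f) x := integral_mono (dD _).abs.integrable (dD _).integrable fun x => hp.abs f x
  refine h1.trans ?_
  obtain ⟨-, -, R, hR⟩ := dD (mkAv j ρ Φ (dabs f))
  let ψ : ℝ × ℝ → ℝ := (Icc (-R) R ×ˢ Icc (-R) R).indicator fun _ => 1
  have hψ : Integrable ψ := by
    rw [integrable_indicator_iff (measurableSet_Icc.prod measurableSet_Icc)]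
    exact integrableOn_const (by
      rw [Measure.volume_eq_prod, Measure.prod_prod]; simp [ENNReal.mul_eq_top])
  have hψ1 : ∀ x, 0 ≤ ψ x ∧ ψ x ≤ 1 := fun x => by
    simp only [ψ, indicator_apply]; split_ifs <;> norm_num
  have e : ∀ x, ψ x * mkAv j ρ Φ (dabs f) x = mkAv j ρ Φ (dabs f) x := fun x => by
    by_cases hx : mkAv j ρ Φ (dabs f) x = 0
    · rw [hx, mul_zero]
    · have := hR x hx
      have hm : x ∈ Icc (-R) R ×ˢ Icc (-R) R := ⟨abs_le.1 this.1, abs_le.1 this.2⟩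
      simp only [ψ, indicator_of_mem hm, one_mul]
  have := mkAv_fub_le h (dabs f) volume measurable_id hψ (B := c * ∫ x, |f x|) (fun t ht => by
    have hs := h.slice (dabs f) ht
    have h2 := H t ht (dabs f) (fun x => abs_nonneg _)
    simp only [id]
    have hn : ∀ x, 0 ≤ ρ x t * (dabs f) (Φ x t) := fun x => mul_nonneg (h0 x t ht) (abs_nonneg _)
    rw [abs_of_nonneg (integral_nonneg fun x => mul_nonneg (hψ1 x).1 (hn x))]
    refine le_trans ?_ h2
    refine integral_mono_of_nonneg (.of_forall fun x => mul_nonneg (hψ1 x).1 (hn x)) hs.integrable (.of_forall fun x => ?_)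
    exact mul_le_of_le_one_left (hn x) (hψ1 x).2)
  simp only [id, e] at this
  exact (le_abs_self _).trans this

end

lemma CM2 {A c η : ℝ} (n : ℕ) (hA : 0 ≤ A) (hc : 0 < c) (hη : η = c * (1/2) ^ n) : CM A η 2 = √(8 * A * c) * rr ^ n := by
  have h0 : 0 < η := by rw [hη]; positivity
  unfold CM
  rw [← Real.sqrt_eq_rpow]
  have e : 2 * (A * 2 ^ (1:ℝ) * (1 / (2 * η)) ^ ((1:ℝ) - 2) / (2 - 1)) = 8 * A * c * (rr ^ n) ^ 2 := by
    rw [Real.rpow_one, show (1:ℝ) - 2 = -1 by norm_num, Real.rpow_neg_one, one_div, inv_inv]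
    have : rr ^ 2 = 1/2 := by
      rw [rr, ← Real.rpow_natCast, ← Real.rpow_mul (by norm_num)]; norm_num
    rw [← pow_mul, mul_comm n 2, pow_mul, this, hη]; ring
  rw [e, Real.sqrt_mul (by positivity), Real.sqrt_sq (pow_nonneg rr_pos.le n)]

/-- `L^2` bound from `L^1` bound and a gain in the sup norm -/
lemma bd_of_sup {S : Op} {A c : ℝ} (n : ℕ) (hA : 0 ≤ A) (hc : 0 < c) (h1 : ∀ f : DD, ∫ x, |S f x| ≤ A * ∫ x, |f x|)
    (h2 : ∀ (f : DD) B, (∀ x, |f x| ≤ B) → ∀ x, |S f x| ≤ c * (1/2) ^ n * B) : Bd 2 S (√(8 * A * c) * rr ^ n) := by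
  intro f
  rw [← CM2 n hA hc rfl]
  refine marc_topN hA (by positivity) (by norm_num) (subL_op S) (Weak.of_strong one_pos fun f => ?_) h2 f
  simpa using h1 f

end TB
end

section
namespace TB

/-- curve map -/
def Gm (σ : ℝ) (γ : ℝ × ℝ → ℝ → ℝ) (x : ℝ × ℝ) (t : ℝ) : ℝ × ℝ := (x.1 - σ * t, γ x t)

/-- one sided normalized curves -/
structure Crv (κ M : ℝ) (s J0 : ℕ) (lam : ℕ → ℕ) (γ γd γ2 : ℝ × ℝ → ℝ → ℝ) : Prop where
  κ0 : 0 ≤ κ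
  M0 : 0 ≤ M
  cont : Continuous fun q : (ℝ × ℝ) × ℝ => γ q.1 q.2
  cont2 : Continuous fun q : (ℝ × ℝ) × ℝ => γ2 q.1 q.2
  ini0 : ∀ x, γ x 0 = x.2
  d1 : ∀ x, ∀ t ∈ Icc (0:ℝ) ((1/2) ^ J0), HasDerivAt (γ x) (γd x t) t
  d2 : ∀ (x : ℝ × ℝ), ∀ t ∈ Icc (0:ℝ) ((1/2) ^ J0), HasDerivAt (fun v => γ (x.1, v) t) (γ2 x t) x.2
  dc : ∀ x, ContinuousOn (γd x) (Icc (0:ℝ) ((1/2) ^ J0))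
  lo2 : ∀ x, ∀ t ∈ Icc (0:ℝ) ((1/2) ^ J0), 1/2 ≤ γ2 x t
  hi2 : ∀ x, ∀ t ∈ Icc (0:ℝ) ((1/2) ^ J0), γ2 x t ≤ 2
  lipv : ∀ a v w, ∀ t ∈ Icc (0:ℝ) ((1/2) ^ J0), |γ2 (a, v) t - γ2 (a, w) t| ≤ M * |v - w|
  lipt : ∀ x, ∀ t ∈ Icc (0:ℝ) ((1/2) ^ J0), ∀ u ∈ Icc (0:ℝ) ((1/2) ^ J0), |γ2 x t - γ2 x u| ≤ M * |t - u|
  one : ∀ x, γ2 x 0 = 1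
  sgn : ∀ x, (∀ t ∈ Ioc (0:ℝ) ((1/2) ^ J0), 0 < γd x t) ∨ (∀ t ∈ Ioc (0:ℝ) ((1/2) ^ J0), γd x t < 0)
  qm : ∀ x, ∀ t ∈ Ioc (0:ℝ) ((1/2) ^ J0), ∀ u ∈ Ioc (0:ℝ) ((1/2) ^ J0), t ≤ u → Real.exp (κ * t) * |γd x t| ≤ Real.exp (κ * u) * |γd x u|
  up : ∀ j, J0 ≤ j → ∀ x, ∀ t ∈ Icc (0:ℝ) ((1/2) ^ j), |γd x t| ≤ (1/2) ^ lam j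
  low : ∀ j, J0 ≤ j → ∀ x, ∀ t ∈ Ij j, (1/2) ^ lam (j + s) ≤ |γd x t|

/-- admissible weights -/
structure Wt (M : ℝ) (J0 : ℕ) (ρ : ℝ × ℝ → ℝ → ℝ) : Prop where
  cont : Continuous fun q : (ℝ × ℝ) × ℝ => ρ q.1 q.2
  nn : ∀ x, ∀ t ∈ Icc (0:ℝ) ((1/2) ^ J0), 0 ≤ ρ x t
  le : ∀ x, ∀ t ∈ Icc (0:ℝ) ((1/2) ^ J0), ρ x t ≤ 2
  lip : ∀ x, ∀ t ∈ Icc (0:ℝ) ((1/2) ^ J0), ∀ u ∈ Icc (0:ℝ) ((1/2) ^ J0), |ρ x t - ρ x u| ≤ M * |t - u|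

lemma Wt.one {M : ℝ} (J0 : ℕ) (hM : 0 ≤ M) : Wt M J0 (fun _ _ => 1) where
  cont := continuous_const
  nn := fun _ _ _ => zero_le_one
  le := fun _ _ _ => one_le_two
  lip := fun _ t _ u _ => by simpa using mul_nonneg hM (abs_nonneg _)

lemma half_pow_anti {i j : ℕ} (h : i ≤ j) : (1/2:ℝ) ^ j ≤ (1/2) ^ i := pow_le_pow_of_le_one (by norm_num) (by norm_num) h
lemma half_pow_le (i : ℕ) : (1/2:ℝ) ^ i ≤ 1 := pow_le_one₀ (by norm_num) (by norm_num)
lemma Ij_sub {J0 j : ℕ} (h : J0 ≤ j) {t : ℝ} (ht : t ∈ Ij j) : t ∈ Icc (0:ℝ) ((1/2) ^ J0) := 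
  ⟨(Ij_pos j ht).le, (Ij_hi j ht).le.trans (half_pow_anti h)⟩
lemma Ij_sub' {J0 j : ℕ} (h : J0 ≤ j) {t : ℝ} (ht : t ∈ Ij j) : t ∈ Ioc (0:ℝ) ((1/2) ^ J0) := 
  ⟨Ij_pos j ht, (Ij_hi j ht).le.trans (half_pow_anti h)⟩

section
variable {κ M : ℝ} {s J0 : ℕ} {lam : ℕ → ℕ} {γ γd γ2 ρ : ℝ × ℝ → ℝ → ℝ}

lemma Crv.wt (h : Crv κ M s J0 lam γ γd γ2) : Wt M J0 γ2 where
  cont := h.cont2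
  nn := fun x t ht => (by norm_num : (0:ℝ) ≤ 1/2).trans (h.lo2 x t ht)
  le := h.hi2
  lip := h.lipt

lemma Crv.near (h : Crv κ M s J0 lam γ γd γ2) {j : ℕ} (hj : J0 ≤ j) (x : ℝ × ℝ) {t : ℝ} (ht : t ∈ Icc (0:ℝ) ((1/2) ^ j)) : |γ x t - x.2| ≤ (1/2) ^ (j + lam j) := by
  have h1 := norm_image_sub_le_of_norm_deriv_le_segment' (f := γ x) (f' := γd x) (a := 0) (b := (1/2:ℝ) ^ j) (C := (1/2) ^ lam j)
    (fun u hu => (h.d1 x u ⟨hu.1, hu.2.trans (half_pow_anti hj)⟩).hasDerivWithinAt) (fun u hu => h.up j hj x u ⟨hu.1, hu.2.le⟩) t ht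
  rw [h.ini0, sub_zero, Real.norm_eq_abs] at h1
  refine h1.trans ?_
  rw [pow_add, mul_comm]
  exact mul_le_mul_of_nonneg_right ht.2 (by positivity)

lemma Crv.near1 (h : Crv κ M s J0 lam γ γd γ2) (x : ℝ × ℝ) {t : ℝ} (ht : t ∈ Icc (0:ℝ) ((1/2) ^ J0)) : |γ x t - x.2| ≤ 1 := 
  (h.near le_rfl x ht).trans (half_pow_le _)

lemma Crv.ok (h : Crv κ M s J0 lam γ γd γ2) (hρ : Wt M J0 ρ) {σ : ℝ} (hσ : |σ| = 1) {j : ℕ} (hj : J0 ≤ j) : AvOK j ρ (Gm σ γ) where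
  mρ := hρ.cont.measurable
  mΦ := by
    unfold Gm
    exact ((measurable_fst.comp measurable_fst).sub (measurable_const.mul measurable_snd)).prodMk h.cont.measurable
  bρ := ⟨2, fun x t ht => by
    rw [abs_of_nonneg (hρ.nn x t (Ij_sub hj ht))]; exact hρ.le x t (Ij_sub hj ht)⟩
  b1 := fun x t ht => by
    have : |t| ≤ 1 := by rw [abs_of_pos (Ij_pos j ht)]; exact (Ij_hi j ht).le.trans (half_pow_le _)
    simpa [Gm, abs_mul, hσ] using this
  b2 := fun x t ht => h.near1 x (Ij_sub hj ht)

lemma Crv.smono (h : Crv κ M s J0 lam γ γd γ2) (a : ℝ) {t : ℝ} (ht : t ∈ Icc (0:ℝ) ((1/2) ^ J0)) : StrictMono fun v => γ (a, v) t := by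
  refine strictMono_of_deriv_pos fun v => ?_
  rw [(h.d2 (a, v) t ht).deriv]
  linarith [h.lo2 (a, v) t ht]

lemma Crv.surj (h : Crv κ M s J0 lam γ γd γ2) (a : ℝ) {t : ℝ} (ht : t ∈ Icc (0:ℝ) ((1/2) ^ J0)) : Function.Surjective fun v => γ (a, v) t := by
  have hb : ∀ v, |γ (a, v) t - v| ≤ 1 := fun v => h.near1 (a, v) ht
  refine Continuous.surjective (h.cont.comp (by fun_prop : Continuous fun v : ℝ => (((a, v), t) : (ℝ × ℝ) × ℝ))) ?_ ?_
  · refine tendsto_atTop_mono (f := fun v : ℝ => v - 1) (fun v => ?_) (tendsto_atTop_add_const_right _ _ tendsto_id)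
    have := abs_le.1 (hb v)
    linarith
  · refine tendsto_atBot_mono (g := fun v : ℝ => γ (a, v) t) (f := fun v : ℝ => v + 1) (fun v => ?_) (tendsto_atBot_add_const_right _ _ tendsto_id)
    have := abs_le.1 (hb v)
    linarith

lemma Crv.cov1 (h : Crv κ M s J0 lam γ γd γ2) (a : ℝ) {t : ℝ} (ht : t ∈ Icc (0:ℝ) ((1/2) ^ J0)) (F : ℝ → ℝ) : 
    ∫ v, γ2 (a, v) t * F (γ (a, v) t) = ∫ v, F v := by
  have := integral_image_eq_integral_abs_deriv_smul (s := univ) MeasurableSet.univ (fun v _ => (h.d2 (a, v) t ht).hasDerivWithinAt) (h.smono a ht).injective.injOn F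
  rw [image_univ, (h.surj a ht).range_eq, setIntegral_univ, setIntegral_univ] at this
  rw [this]
  congr 1; ext v
  rw [abs_of_nonneg (h.wt.nn _ t ht), smul_eq_mul]

lemma Crv.cov (h : Crv κ M s J0 lam γ γd γ2) {σ : ℝ} (hσ : |σ| = 1) {j : ℕ} (hj : J0 ≤ j) {t : ℝ} (ht : t ∈ Ij j) (f : DD) : 
    ∫ x, γ2 x t * f (Gm σ γ x t) = ∫ x, f x := by
  rw [Measure.volume_eq_prod, integral_prod (μ := volume) (ν := volume) _ ((h.ok h.wt hσ hj).slice f ht).integrable,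
    integral_prod (μ := volume) (ν := volume) _ (dD f).integrable]
  simp only [Gm]
  have := fun a => h.cov1 a (Ij_sub hj ht) (fun v => f (a - σ * t, v))
  simp only [this]
  exact integral_sub_right_eq_self (fun a => ∫ v, f (a, v)) (σ * t)

lemma Crv.l1 (h : Crv κ M s J0 lam γ γd γ2) (hρ : Wt M J0 ρ) {σ : ℝ} (hσ : |σ| = 1) {j : ℕ} (hj : J0 ≤ j) (f : DD) : 
    ∫ x, |mkAv j ρ (Gm σ γ) f x| ≤ 4 * ∫ x, |f x| := by
  have hok := h.ok hρ hσ hj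
  refine mkAv_l1 hok (fun x t ht => hρ.nn x t (Ij_sub hj ht)) (fun t ht f hf => ?_) f
  rw [← h.cov hσ hj ht f, ← integral_const_mul]
  refine integral_mono (hok.slice f ht).integrable (((h.ok h.wt hσ hj).slice f ht).integrable.const_mul 4) fun x => ?_
  have h1 := hρ.le x t (Ij_sub hj ht)
  have h2 := h.lo2 x t (Ij_sub hj ht)
  have h3 := hf (Gm σ γ x t)
  simp only
  nlinarith

lemma Crv.sup (h : Crv κ M s J0 lam γ γd γ2) (hρ : Wt M J0 ρ) {σ : ℝ} (hσ : |σ| = 1) {j : ℕ} (hj : J0 ≤ j) (f : DD) {B : ℝ} (hB : ∀ x, |f x| ≤ B) (x) : 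
    |mkAv j ρ (Gm σ γ) f x| ≤ 2 * B := by
  refine mkAv_le (h.ok hρ hσ hj) f x fun t ht => ?_
  rw [abs_mul, abs_of_nonneg (hρ.nn x t (Ij_sub hj ht))]
  exact mul_le_mul (hρ.le x t (Ij_sub hj ht)) (hB _) (abs_nonneg _) zero_le_two

end

/-- a curve and its inverse -/
structure Pair (κ M : ℝ) (s J0 : ℕ) (lam : ℕ → ℕ) (σ : ℝ) (γ γd γ2 γs γsd γs2 : ℝ × ℝ → ℝ → ℝ) : Prop where
  hσ : |σ| = 1
  l : Lam s J0 lam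
  c : Crv κ M s J0 lam γ γd γ2
  cs : Crv κ M s J0 lam γs γsd γs2
  inv : ∀ x : ℝ × ℝ, ∀ t ∈ Icc (0:ℝ) ((1/2) ^ J0), γs (x.1 - σ * t, γ x t) t = x.2
  inv' : ∀ y : ℝ × ℝ, ∀ t ∈ Icc (0:ℝ) ((1/2) ^ J0), γ (y.1 + σ * t, γs y t) t = y.2

section
variable {κ M : ℝ} {s J0 : ℕ} {lam : ℕ → ℕ} {σ : ℝ} {γ γd γ2 γs γsd γs2 : ℝ × ℝ → ℝ → ℝ}

lemma Pair.swap (h : Pair κ M s J0 lam σ γ γd γ2 γs γsd γs2) : Pair κ M s J0 lam (-σ) γs γsd γs2 γ γd γ2 where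
  hσ := by rw [abs_neg]; exact h.hσ
  l := h.l
  c := h.cs
  cs := h.c
  inv := fun x t ht => by simpa using h.inv' x t ht
  inv' := fun x t ht => by simpa [sub_eq_add_neg] using h.inv x t ht

lemma Pair.adj (h : Pair κ M s J0 lam σ γ γd γ2 γs γsd γs2) {j : ℕ} (hj : J0 ≤ j) (f k : DD) : 
    ip (mkAv j (fun _ _ => 1) (Gm σ γ) f) k = ip f (mkAv j γs2 (Gm (-σ) γs) k) := by
  have hσ' := h.swap.hσ
  have ok1 := h.c.ok (Wt.one J0 h.c.M0) h.hσ hj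
  have ok2 := h.cs.ok h.cs.wt hσ' hj
  have e1 := mkAv_fub ok1 f volume measurable_id (dD k).integrable
  have e2 := mkAv_fub ok2 k volume measurable_id (dD f).integrable
  simp only [id] at e1 e2
  rw [ip_comm]
  unfold ip
  rw [e1, e2]
  refine setIntegral_congr_fun (Ij_meas j) fun t ht => ?_
  congr 1
  have hD : IsD (fun x => k x * (1 * f (Gm σ γ x t))) := (dD k).mul (ok1.slice f ht)
  rw [← h.cs.cov hσ' hj ht ⟨_, hD⟩]
  congr 1; ext y
  change γs2 y t * (k (Gm (-σ) γs y t) * (1 * f (Gm σ γ (Gm (-σ) γs y t) t))) = _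
  have : Gm σ γ (Gm (-σ) γs y t) t = y := by
    unfold Gm
    refine Prod.ext (by simp) ?_
    have := h.inv' y t (Ij_sub hj ht)
    simpa using this
  rw [this]; ring

end
end TB
end

section
namespace TB

/-- `L^1` bounds -/
def L1 (S : Op) (A : ℝ) : Prop := ∀ f : DD, ∫ x, |S f x| ≤ A * ∫ x, |f x|

lemma L1.mul {S S' : Op} {A A' : ℝ} (hA : 0 ≤ A) (h : L1 S A) (h' : L1 S' A') : L1 (S * S') (A * A') := fun f => by
  rw [mul_assoc]
  exact (h (S' f)).trans (mul_le_mul_of_nonneg_left (h' f) hA)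

lemma L1.sub {S S' : Op} {A A' : ℝ} (h : L1 S A) (h' : L1 S' A') : L1 (S - S') (A + A') := fun f => by
  rw [add_mul]
  refine le_trans ?_ (add_le_add (h f) (h' f))
  rw [← integral_add (dD _).abs.integrable (dD _).abs.integrable]
  refine integral_mono (dD _).abs.integrable ((dD _).abs.integrable.add (dD _).abs.integrable) fun x => ?_
  change |(S f - S' f : DD) x| ≤ _
  rw [sub_val]; exact abs_sub _ _

lemma L1_E {E : ℕ → Op} {rel} (hE : Filt E rel) (k : ℕ) : L1 (E k) 1 := fun f => by
  have hp : Pos (E k) := hE.pos k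
  rw [one_mul]
  calc ∫ x, |E k f x| ≤ ∫ x, E k (dabs f) x := integral_mono (dD _).abs.integrable (dD _).integrable fun x => hp.abs f x
    _ = ∫ x, |f x| := hE.int k _

lemma L1_one : L1 1 1 := fun f => by rw [one_mul]; rfl

lemma L1_oE {E : ℕ → Op} {rel} (hE : Filt E rel) (k : ℕ) : L1 (1 - E k) 2 := by
  have := L1_one.sub (L1_E hE k)
  norm_num at this; exact this

lemma oE_bdd {E : ℕ → Op} {rel} (hE : Filt E rel) (k : ℕ) (f : DD) {B : ℝ} (hB : ∀ x, |f x| ≤ B) (x) : |(1 - E k) f x| ≤ 2 * B := by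
  change |(f - E k f : DD) x| ≤ _
  rw [sub_val]
  refine (abs_sub _ _).trans ?_
  linarith [hB x, hE.bdd k f B hB x]

lemma E_oE {E : ℕ → Op} {rel} (hE : Filt E rel) (k : ℕ) : E k * (1 - E k) = 0 := by
  rw [mul_sub, mul_one, hE.mul, min_self, sub_self]

lemma MZ2 (k : ℕ) (f : DD) {B : ℝ} (hB : ∀ x, |f x| ≤ B) (a : ℝ) : MZ k (2 * B) (fun y => (1 - E2 k) f (a, y)) where
  meas := (dM _).comp measurable_prodMk_left
  bdd := fun y => oE_bdd filt2 k f hB _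
  mz := fun v => by
    have : E2 k ((1 - E2 k) f) (a, v) = 0 := by
      rw [← Module.End.mul_apply, E_oE filt2]; rfl
    rwa [E2_val] at this

lemma MZ1 (k : ℕ) (f : DD) {B : ℝ} (hB : ∀ x, |f x| ≤ B) (b : ℝ) : MZ k (2 * B) (fun y => (1 - E1 k) f (y, b)) where
  meas := (dM _).comp measurable_prodMk_right
  bdd := fun y => oE_bdd filt1 k f hB _
  mz := fun v => by
    have : E1 k ((1 - E1 k) f) (v, b) = 0 := by
      rw [← Module.End.mul_apply, E_oE filt1]; rfl
    rwa [E1_val] at this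

lemma Osc.nn {s : Set ℝ} {f : ℝ → ℝ} {η : ℝ} (h : Osc s f η) : 0 ≤ η := by
  simpa using h.2 ∅ (empty_subset _) ordConnected_empty

/-- exponential weights -/
lemma Osc.exp {s : Set ℝ} (hs : s.OrdConnected) {f : ℝ → ℝ} {η κ : ℝ} (h : Osc s f η) (hκ : 0 ≤ κ) (h1 : ∀ t ∈ s, t ≤ 1) :
    Osc s (fun t => Real.exp (κ * t) * f t) (2 * Real.exp κ * η) := by
  have a1 := h.anti hs (w := fun _ => Real.exp κ) measurable_const (fun _ _ _ _ _ => le_rfl) (fun _ _ => (Real.exp_pos _).le) (fun _ _ => le_rfl) (Real.exp_pos _).le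
  have a2 := h.anti hs (w := fun t => Real.exp κ - Real.exp (κ * t)) (B := Real.exp κ) (by fun_prop) (fun t _ u _ htu => by
      have : Real.exp (κ * t) ≤ Real.exp (κ * u) := Real.exp_le_exp.2 (mul_le_mul_of_nonneg_left htu hκ)
      simp only; linarith) (fun t ht => by
      have : Real.exp (κ * t) ≤ Real.exp κ := Real.exp_le_exp.2 (mul_le_of_le_one_right hκ (h1 t ht))
      linarith) (fun t _ => by linarith [Real.exp_pos (κ * t)]) (Real.exp_pos _).le
  have := a1.sub a2
  have e : (fun t => Real.exp κ * f t - (Real.exp κ - Real.exp (κ * t)) * f t) = fun t => Real.exp (κ * t) * f t := by ext t; ring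
  rw [e] at this
  convert this using 1; ring

lemma card_cl (l : ℕ) (c d : ℝ) : ((Finset.Icc (cl l (c - d)) (cl l (c + d))).card : ℝ) ≤ max (2 ^ l * (2 * d) + 2) 0 := by
  rw [Int.card_Icc]
  have h1 : ((cl l (c + d) : ℤ) : ℝ) ≤ 2 ^ l * (c + d) := Int.floor_le _
  have h2 : 2 ^ l * (c - d) < (cl l (c - d) : ℤ) + 1 := Int.lt_floor_add_one _
  have h3 : (((cl l (c + d) + 1 - cl l (c - d)).toNat : ℤ) : ℝ) = ((max (cl l (c + d) + 1 - cl l (c - d)) 0 : ℤ) : ℝ) := by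
    rw [Int.toNat_eq_max]
  rw [Int.cast_natCast] at h3
  rw [h3]; push_cast
  refine max_le_max ?_ le_rfl
  nlinarith

lemma ord_pre {s : Set ℝ} (hs : s.OrdConnected) {n : ℝ → ℤ} (hn : MonotoneOn n s ∨ AntitoneOn n s) (i : ℤ) : (s ∩ n ⁻¹' {i}).OrdConnected := by
  refine ⟨fun a ha b hb c hc => ?_⟩
  have hcs := hs.out ha.1 hb.1 hc
  refine ⟨hcs, ?_⟩
  have h1 : n a = i := ha.2
  have h2 : n b = i := hb.2
  simp only [mem_preimage, mem_singleton_iff]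
  rcases hn with hn | hn
  · have := hn ha.1 hcs hc.1
    have := hn hcs hb.1 hc.2
    omega
  · have := hn ha.1 hcs hc.1
    have := hn hcs hb.1 hc.2
    omega

/-- splitting the time integral -/
lemma split_bound {j : ℕ} {f : ℝ → ℝ} (hf : IntegrableOn f (Ij j)) {l : ℕ} {φ : ℝ → ℝ} (hφ : Measurable φ) 
    (hmo : MonotoneOn φ (Ij j) ∨ AntitoneOn φ (Ij j)) {c d D η : ℝ} (hd : ∀ t ∈ Ij j, |φ t - c| ≤ d) (hd0 : 0 ≤ d) (hη : 0 ≤ η) (hD : 2 ^ l * (2 * d) + 2 ≤ D)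
    (H : ∀ t0 ∈ Ij j, ∃ f' : ℝ → ℝ, Osc (Ij j) f' η ∧ ∀ t ∈ Ij j, cl l (φ t) = cl l (φ t0) → f t = f' t) : 
    |∫ t in Ij j, f t| ≤ D * η := by
  have hn : MonotoneOn (fun t => cl l (φ t)) (Ij j) ∨ AntitoneOn (fun t => cl l (φ t)) (Ij j) := by
    rcases hmo with h | h
    · exact Or.inl fun a ha b hb hab => cl_mono l (h ha hb hab)
    · exact Or.inr fun a ha b hb hab => cl_mono l (h ha hb hab)
  have := pieces (Ij_meas j) hf (n := fun t => cl l (φ t)) ((cl_meas l).comp hφ) (Finset.Icc (cl l (c - d)) (cl l (c + d))) (η := η) (fun t ht => by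
      have := abs_le.1 (hd t ht)
      exact Finset.mem_Icc.2 ⟨cl_mono l (by linarith), cl_mono l (by linarith)⟩) (fun i _ => by
      rcases (Ij j ∩ (fun t => cl l (φ t)) ⁻¹' {i}).eq_empty_or_nonempty with he | ⟨t0, h0, hi⟩
      · rw [he]; simpa using hη
      · obtain ⟨f', hf', he⟩ := H t0 h0
        have ho := ord_pre (Ij_ord j) hn i
        rw [setIntegral_congr_fun ho.measurableSet (g := f') fun t ht => he t ht.1 (by
          have h1 : cl l (φ t) = i := ht.2
          have h2 : cl l (φ t0) = i := hi
          rw [h1, h2])]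
        exact hf'.2 _ inter_subset_left ho)
  refine this.trans (mul_le_mul_of_nonneg_right ((card_cl l c d).trans (max_le hD ?_)) hη)
  exact le_trans (by positivity) hD

lemma Wt.osc {M : ℝ} {J0 : ℕ} {ρ : ℝ × ℝ → ℝ → ℝ} (h : Wt M J0 ρ) (hM : 0 ≤ M) {j : ℕ} (hj : J0 ≤ j) (x) {f : ℝ → ℝ} {η : ℝ} (hf : Osc (Ij j) f η) :
    Osc (Ij j) (fun t => ρ x t * f t) ((2 + 2 * M) * η) := by
  have := hf.lip (Ij_ord j) (w := ρ x) (R := 2) (L := M) (a := 0) (b := 1) (h.cont.comp (by fun_prop : Continuous fun t : ℝ => ((x, t) : (ℝ × ℝ) × ℝ))).measurable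
    (fun t ht => ⟨(Ij_pos j ht).le, (Ij_hi j ht).le.trans (half_pow_le j)⟩) hM (fun t ht u hu => h.lip x t (Ij_sub hj ht) u (Ij_sub hj hu))
    (fun t ht => h.nn x t (Ij_sub hj ht)) (fun t ht => h.le x t (Ij_sub hj ht)) zero_le_two zero_le_one
  convert this using 1; ring

lemma Ij_osc {j : ℕ} {f : ℝ → ℝ} {η : ℝ} (hf : Osc (Ij j) f η) : Osc (Ij j) (fun t => t⁻¹ * f t) (2 ^ (j+1) * η) := 
  hf.anti (Ij_ord j) measurable_inv (fun t ht u _ htu => inv_anti₀ (Ij_pos j ht) htu) (fun t ht => (inv_pos.2 (Ij_pos j ht)).le) (fun t ht => Ij_inv j ht) (by positivity)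

lemma lin_mono {σ : ℝ} (hσ : |σ| = 1) (a : ℝ) (s : Set ℝ) : MonotoneOn (fun t => a - σ * t) s ∨ AntitoneOn (fun t => a - σ * t) s := by
  rcases (abs_eq zero_le_one).1 hσ with rfl | rfl
  · exact Or.inr fun t _ u _ h => by simp only; linarith
  · exact Or.inl fun t _ u _ h => by simp only; linarith

lemma lin_inj {σ : ℝ} (hσ : |σ| = 1) (a : ℝ) (s : Set ℝ) : InjOn (fun t => a - σ * t) s := by
  have : σ ≠ 0 := by rintro rfl; simp at hσ
  intro t _ u _ h
  simp only [sub_right_inj] at h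
  exact mul_left_cancel₀ this h

lemma lin_near {σ : ℝ} (hσ : |σ| = 1) (a : ℝ) {j : ℕ} {t : ℝ} (ht : t ∈ Ij j) : |a - σ * t - a| ≤ (1/2) ^ j := by
  rw [sub_sub_cancel_left, abs_neg, abs_mul, hσ, one_mul, abs_of_pos (Ij_pos j ht)]; exact (Ij_hi j ht).le

/-- oscillation in the first variable -/
lemma lin_osc {σ : ℝ} (hσ : |σ| = 1) (a : ℝ) (j : ℕ) {k : ℕ} {B : ℝ} {F : ℝ → ℝ} (h : MZ k B F) : Osc (Ij j) (fun t => F (a - σ * t)) (2 * B / 2 ^ k) := by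
  have := h.subst (Ij_ord j) (φ := fun t => a - σ * t) (φ' := fun _ => -σ) (fun t _ => by
    simpa using ((hasDerivAt_id t).const_mul σ).const_sub a) (lin_inj hσ a _) (a' := a - (1/2) ^ j) (b' := a + (1/2) ^ j) (fun t ht => by
      have := abs_le.1 (lin_near hσ a ht)
      exact ⟨by linarith, by linarith⟩)
  simpa [hσ] using this

section
variable {κ M : ℝ} {s J0 : ℕ} {lam : ℕ → ℕ} {γ γd γ2 ρ : ℝ × ℝ → ℝ → ℝ}

lemma Crv.mono (h : Crv κ M s J0 lam γ γd γ2) (x) : StrictMonoOn (γ x) (Icc (0:ℝ) ((1/2) ^ J0)) ∨ StrictAntiOn (γ x) (Icc (0:ℝ) ((1/2) ^ J0)) := by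
  have hc : ContinuousOn (γ x) (Icc (0:ℝ) ((1/2) ^ J0)) := fun t ht => (h.d1 x t ht).continuousAt.continuousWithinAt
  rcases h.sgn x with hs | hs
  · refine Or.inl (strictMonoOn_of_deriv_pos (convex_Icc _ _) hc fun t ht => ?_)
    rw [interior_Icc] at ht
    rw [(h.d1 x t (Ioo_subset_Icc_self ht)).deriv]
    exact hs t (Ioo_subset_Ioc_self ht)
  · refine Or.inr (strictAntiOn_of_deriv_neg (convex_Icc _ _) hc fun t ht => ?_)
    rw [interior_Icc] at ht
    rw [(h.d1 x t (Ioo_subset_Icc_self ht)).deriv]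
    exact hs t (Ioo_subset_Ioc_self ht)

lemma Crv.injOn (h : Crv κ M s J0 lam γ γd γ2) (x) {j : ℕ} (hj : J0 ≤ j) : InjOn (γ x) (Ij j) := by
  have hs : Ij j ⊆ Icc (0:ℝ) ((1/2) ^ J0) := fun t ht => Ij_sub hj ht
  rcases h.mono x with hm | hm
  · exact hm.injOn.mono hs
  · exact hm.injOn.mono hs

lemma Crv.monoIj (h : Crv κ M s J0 lam γ γd γ2) (x) {j : ℕ} (hj : J0 ≤ j) : MonotoneOn (γ x) (Ij j) ∨ AntitoneOn (γ x) (Ij j) := by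
  have hs : Ij j ⊆ Icc (0:ℝ) ((1/2) ^ J0) := fun t ht => Ij_sub hj ht
  rcases h.mono x with hm | hm
  · exact Or.inl (hm.monotoneOn.mono hs)
  · exact Or.inr (hm.antitoneOn.mono hs)

lemma Crv.mt (h : Crv κ M s J0 lam γ γd γ2) (x) : Measurable (γ x) := 
  (h.cont.comp (by fun_prop : Continuous fun t : ℝ => ((x, t) : (ℝ × ℝ) × ℝ))).measurable

/-- oscillation along the curve -/
lemma Crv.osc (h : Crv κ M s J0 lam γ γd γ2) (x) {j : ℕ} (hj : J0 ≤ j) {k : ℕ} {B : ℝ} {F : ℝ → ℝ} (hF : MZ k B F) : 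
    Osc (Ij j) (fun t => t⁻¹ * F (γ x t)) (2 * Real.exp κ * (2 ^ (j+1) * 2 ^ lam (j+s) * (2 * B / 2 ^ k))) := by
  have h1 := hF.subst (Ij_ord j) (φ := γ x) (φ' := γd x) (fun t ht => h.d1 x t (Ij_sub hj ht)) (h.injOn x hj) (a' := x.2 - 1) (b' := x.2 + 1) (fun t ht => by
      have := abs_le.1 (h.near1 x (Ij_sub hj ht))
      exact ⟨by linarith, by linarith⟩)
  have hpos : ∀ t ∈ Ij j, 0 < |γd x t| := fun t ht => lt_of_lt_of_le (by positivity) (h.low j hj x t ht)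
  let v : ℝ → ℝ := (Ij j).indicator fun t => (t * (Real.exp (κ * t) * |γd x t|))⁻¹
  have hv : ∀ t ∈ Ij j, v t = (t * (Real.exp (κ * t) * |γd x t|))⁻¹ := fun t ht => indicator_of_mem ht _
  have hvm : Measurable v := by
    have : ContinuousOn (fun t => (t * (Real.exp (κ * t) * |γd x t|))⁻¹) (Ij j) := by
      refine ContinuousOn.inv₀ (continuousOn_id.mul (ContinuousOn.mul (by fun_prop) ((h.dc x).mono fun t ht => Ij_sub hj ht).abs)) fun t ht => ?_
      exact (mul_pos (Ij_pos j ht) (mul_pos (Real.exp_pos _) (hpos t ht))).ne'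
    classical
    have h2 := ContinuousOn.measurable_piecewise this (continuousOn_const (c := (0:ℝ)) (s := (Ij j)ᶜ)) (Ij_meas j)
    rwa [show v = (Ij j).piecewise (fun t => (t * (Real.exp (κ * t) * |γd x t|))⁻¹) (fun _ => 0) by
      ext t; simp only [v, piecewise, indicator]]
  have h2 := h1.anti (Ij_ord j) (w := v) (B := 2 ^ (j+1) * 2 ^ lam (j+s)) hvm (fun t ht u hu htu => by
      rw [hv t ht, hv u hu]
      refine inv_anti₀ (mul_pos (Ij_pos j ht) (mul_pos (Real.exp_pos _) (hpos t ht))) ?_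
      exact mul_le_mul htu (h.qm x t (Ij_sub' hj ht) u (Ij_sub' hj hu) htu) (by positivity) (Ij_pos j hu).le) (fun t ht => by
      rw [hv t ht]; exact inv_nonneg.2 (mul_nonneg (Ij_pos j ht).le (by positivity))) (fun t ht => by
      rw [hv t ht, mul_inv]
      refine mul_le_mul (Ij_inv j ht) ?_ (by positivity) (by positivity)
      have h3 : ((1/2:ℝ) ^ lam (j+s)) ≤ Real.exp (κ * t) * |γd x t| := (h.low j hj x t ht).trans 
        (le_mul_of_one_le_left (abs_nonneg _) (Real.one_le_exp (mul_nonneg h.κ0 (Ij_pos j ht).le)))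
      have := inv_anti₀ (by positivity) h3
      simpa using this) (by positivity)
  have h3 := h2.exp (Ij_ord j) h.κ0 (fun t ht => (Ij_hi j ht).le.trans (half_pow_le j))
  refine h3.congr (Ij_meas j) fun t ht => ?_
  rw [hv t ht]
  have := (hpos t ht).ne'
  have := (Ij_pos j ht).ne'
  have := (Real.exp_pos (κ * t)).ne'
  field_simp

/-- third estimate -/
lemma Crv.e3sup (h : Crv κ M s J0 lam γ γd γ2) (hρ : Wt M J0 ρ) {σ : ℝ} (hσ : |σ| = 1) {j : ℕ} (hj : J0 ≤ j) {l m : ℕ} (hl : j ≤ l) (hm : l ≤ m) (f : DD) {B : ℝ}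
    (hB : ∀ x, |f x| ≤ B) (x) : 
    |(mkAv j ρ (Gm σ γ) * (1 - E2 (m + lam (j + s))) * E1 l) f x| ≤ (128 * ((1 + M) * Real.exp κ)) * (1/2) ^ (m - l) * B := by
  set K := m + lam (j + s) with hK
  have hB0 : 0 ≤ B := (abs_nonneg _).trans (hB 0)
  have hM := h.M0
  have ok := h.ok hρ hσ hj
  have hc : (1 - E2 K) * E1 l = E1 l * (1 - E2 K) := by
    rw [sub_mul, mul_sub, one_mul, mul_one, E12_comm]
  rw [mul_assoc, Module.End.mul_apply]
  set g : DD := ((1 - E2 K) * E1 l) f with hg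
  have g1 : g = E1 l ((1 - E2 K) f) := by rw [hg, hc, Module.End.mul_apply]
  have g2 : g = (1 - E2 K) (E1 l f) := rfl
  have hinv : ∀ a a' y, cl l a = cl l a' → g (a, y) = g (a', y) := fun a a' y e => by
    rw [g1]; exact filt1.relE l _ _ _ ⟨rfl, e⟩
  have hmz : ∀ a, MZ K (2 * B) (fun y => g (a, y)) := fun a => by
    rw [g2]; exact MZ2 K _ (filt1.bdd l f B hB) a
  rw [mkAv_val ok]
  have := split_bound (ok.intble g x) (l := l) (φ := fun t => x.1 - σ * t) (by fun_prop) (lin_mono hσ _ _) (c := x.1) (d := (1/2) ^ j) (D := 4 * 2 ^ (l - j))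
    (η := (2 + 2 * M) * (2 * Real.exp κ * (2 ^ (j+1) * 2 ^ lam (j+s) * (2 * (2 * B) / 2 ^ K))))
    (fun t ht => lin_near hσ _ ht) (by positivity) (by positivity) (by
      obtain ⟨n, rfl⟩ := Nat.exists_eq_add_of_le hl
      rw [Nat.add_sub_cancel_left, pow_add]
      have : (2:ℝ) ^ j * (1/2) ^ j = 1 := by rw [← mul_pow]; norm_num
      have h1 : (1:ℝ) ≤ 2 ^ n := one_le_pow₀ one_le_two
      nlinarith) (fun t0 _ => by
      have h1 := hρ.osc hM hj x (h.osc x hj (hmz (x.1 - σ * t0)))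
      refine ⟨_, h1, fun t ht e => ?_⟩
      simp only [Gm]
      rw [hinv _ _ _ e]; ring)
  refine this.trans (le_of_eq ?_)
  obtain ⟨n, rfl⟩ := Nat.exists_eq_add_of_le hl
  obtain ⟨i, rfl⟩ := Nat.exists_eq_add_of_le hm
  rw [hK, Nat.add_sub_cancel_left, Nat.add_sub_cancel_left, pow_add, pow_add, pow_add, pow_add, one_div, inv_pow]
  field_simp
  ring

/-- fourth estimate -/
lemma Crv.e4sup (h : Crv κ M s J0 lam γ γd γ2) (hρ : Wt M J0 ρ) {σ : ℝ} (hσ : |σ| = 1) {j : ℕ} (hj : J0 ≤ j) {l m : ℕ} (hm : j ≤ m) (hl : m ≤ l) (f : DD) {B : ℝ}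
    (hB : ∀ x, |f x| ≤ B) (x) : 
    |(mkAv j ρ (Gm σ γ) * E2 (m + lam j) * (1 - E1 l)) f x| ≤ (64 * (1 + M)) * (1/2) ^ (l - m) * B := by
  set K := m + lam j with hK
  have hB0 : 0 ≤ B := (abs_nonneg _).trans (hB 0)
  have hM := h.M0
  have ok := h.ok hρ hσ hj
  have hc : E2 K * (1 - E1 l) = (1 - E1 l) * E2 K := by
    rw [sub_mul, mul_sub, one_mul, mul_one, E12_comm]
  rw [mul_assoc, Module.End.mul_apply]
  set g : DD := (E2 K * (1 - E1 l)) f with hg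
  have g1 : g = (1 - E1 l) (E2 K f) := by rw [hg, hc, Module.End.mul_apply]
  have g2 : g = E2 K ((1 - E1 l) f) := rfl
  have hinv : ∀ a y y', cl K y = cl K y' → g (a, y) = g (a, y') := fun a y y' e => by
    rw [g2]; exact filt2.relE K _ _ _ ⟨rfl, e⟩
  have hmz : ∀ y, MZ l (2 * B) (fun a => g (a, y)) := fun y => by
    rw [g1]; exact MZ1 l _ (filt2.bdd K f B hB) y
  rw [mkAv_val ok]
  have := split_bound (ok.intble g x) (l := K) (φ := γ x) (h.mt x) (h.monoIj x hj) (c := x.2) (d := (1/2) ^ (j + lam j)) (D := 4 * 2 ^ (m - j))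
    (η := (2 + 2 * M) * (2 ^ (j+1) * (2 * (2 * B) / 2 ^ l)))
    (fun t ht => h.near hj x ⟨(Ij_pos j ht).le, (Ij_hi j ht).le⟩) (by positivity) (by positivity) (by
      obtain ⟨n, rfl⟩ := Nat.exists_eq_add_of_le hm
      rw [Nat.add_sub_cancel_left, hK, show j + n + lam j = (j + lam j) + n by ring, pow_add 2 (j + lam j) n]
      have : (2:ℝ) ^ (j + lam j) * (1/2) ^ (j + lam j) = 1 := by rw [← mul_pow]; norm_num
      have h1 : (1:ℝ) ≤ 2 ^ n := one_le_pow₀ one_le_two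
      nlinarith) (fun t0 _ => by
      have h1 := hρ.osc hM hj x (Ij_osc (lin_osc hσ x.1 j (hmz (γ x t0))))
      refine ⟨_, h1, fun t ht e => ?_⟩
      simp only [Gm]
      rw [hinv _ _ _ e]; ring)
  refine this.trans (le_of_eq ?_)
  obtain ⟨n, rfl⟩ := Nat.exists_eq_add_of_le hm
  obtain ⟨i, rfl⟩ := Nat.exists_eq_add_of_le hl
  rw [Nat.add_sub_cancel_left, Nat.add_sub_cancel_left, pow_add, pow_add, pow_add, one_div, inv_pow]
  field_simp
  ring

end
end TB
end

section
namespace TB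

lemma mkAv_fub_int {j : ℕ} {ρ : ℝ × ℝ → ℝ → ℝ} {Φ : ℝ × ℝ → ℝ → ℝ × ℝ} (h : AvOK j ρ Φ) (f : DD) {e : ℝ → ℝ × ℝ} (he : Measurable e)
    {ψ : ℝ → ℝ} (hψ : Integrable ψ) : 
    IntegrableOn (fun t => t⁻¹ * ∫ a, ψ a * (ρ (e a) t * f (Φ (e a) t))) (Ij j) := by
  obtain ⟨B, hB0, hB⟩ := h.bb f
  have hIntg : Integrable (fun z : ℝ × ℝ => ψ z.1 * (z.2⁻¹ * (ρ (e z.1) z.2 * f (Φ (e z.1) z.2)))) ((volume : Measure ℝ).prod (volume.restrict (Ij j))) := by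
    have : IsFiniteMeasure (volume.restrict (Ij j) : Measure ℝ) := ⟨by simp [Ij]⟩
    have h1 : Integrable (fun z : ℝ × ℝ => ψ z.1) ((volume : Measure ℝ).prod (volume.restrict (Ij j))) := hψ.comp_fst _
    refine Integrable.mul_bdd (c := B) h1 ?_ ?_
    · exact ((h.mm f).comp ((he.comp measurable_fst).prodMk measurable_snd)).aestronglyMeasurable
    · have : ∀ᵐ z ∂((volume : Measure ℝ).prod (volume.restrict (Ij j))), z.2 ∈ Ij j := by
        have := (Measure.quasiMeasurePreserving_snd (μ := (volume : Measure ℝ)) (ν := volume.restrict (Ij j))).ae (ae_restrict_mem (Ij_meas j))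
        exact this
      exact this.mono fun z hz => hB _ _ hz
  refine hIntg.integral_prod_right.congr (.of_forall fun t => ?_)
  simp only
  rw [← integral_const_mul]
  congr 1; ext a; ring

/-- bound for a difference of double averages -/
lemma mkAv_fub2_le {j : ℕ} {ρ ρ' : ℝ × ℝ → ℝ → ℝ} {Φ Φ' : ℝ × ℝ → ℝ → ℝ × ℝ} (h : AvOK j ρ Φ) (h' : AvOK j ρ' Φ') (f : DD) {e : ℝ → ℝ × ℝ} (he : Measurable e)
    {ψ : ℝ → ℝ} (hψ : Integrable ψ) {B : ℝ} (hB : ∀ t ∈ Ij j, |(∫ a, ψ a * (ρ (e a) t * f (Φ (e a) t))) - ∫ a, ψ a * (ρ' (e a) t * f (Φ' (e a) t))| ≤ B) : 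
    |(∫ a, ψ a * mkAv j ρ Φ f (e a)) - ∫ a, ψ a * mkAv j ρ' Φ' f (e a)| ≤ B := by
  have ht0 : ((1/2:ℝ) ^ (j+1)) ∈ Ij j := ⟨le_rfl, pow_lt_pow_right_of_lt_one₀ (by norm_num) (by norm_num) (by omega)⟩
  have hB0 : 0 ≤ B := (abs_nonneg _).trans (hB _ ht0)
  rw [mkAv_fub h f volume he hψ, mkAv_fub h' f volume he hψ, ← integral_sub (mkAv_fub_int h f he hψ) (mkAv_fub_int h' f he hψ)]
  have h1 : ‖∫ t in Ij j, (t⁻¹ * (∫ a, ψ a * (ρ (e a) t * f (Φ (e a) t))) - t⁻¹ * ∫ a, ψ a * (ρ' (e a) t * f (Φ' (e a) t)))‖ ≤ ∫ t in Ij j, t⁻¹ * B := by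
    refine norm_integral_le_of_norm_le ((Ij_intble j).mul_const B) ?_
    refine (ae_restrict_mem (Ij_meas j)).mono fun t ht => ?_
    rw [← mul_sub, Real.norm_eq_abs, abs_mul, abs_of_pos (inv_pos.2 (Ij_pos j ht))]
    exact mul_le_mul_of_nonneg_left (hB t ht) (inv_pos.2 (Ij_pos j ht)).le
  refine h1.trans ?_
  rw [integral_mul_const, Ij_int]
  have := log2_le
  nlinarith

lemma ker_mul_int (k : ℕ) (a : ℝ) (F : ℝ → ℝ) : ∫ y, ker k a y * F y = 2 ^ k * ∫ y in Ico (cl k a / 2 ^ k : ℝ) ((cl k a + 1) / 2 ^ k), F y := by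
  rw [← integral_const_mul, ← integral_indicator measurableSet_Ico, ker_eq_ind]
  congr 1; ext y
  simp only [indicator_apply]
  split_ifs <;> simp

lemma Ico_int (F : ℝ → ℝ) {a b : ℝ} (h : a ≤ b) : ∫ y in Ico a b, F y = ∫ y in a..b, F y := by
  rw [intervalIntegral.integral_of_le h, integral_Ico_eq_integral_Ioc]

lemma cell_le (k : ℕ) (n : ℤ) : (n / 2 ^ k : ℝ) ≤ (n + 1) / 2 ^ k := by gcongr; linarith

lemma cell_len (k : ℕ) (n : ℤ) : ((n + 1) / 2 ^ k - n / 2 ^ k : ℝ) ≤ 1 := by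
  rw [← sub_div, add_sub_cancel_left]
  exact div_le_one_of_le₀ (one_le_pow₀ one_le_two) (by positivity)

section
variable {κ M : ℝ} {s J0 : ℕ} {lam : ℕ → ℕ} {γ γd γ2 ρ : ℝ × ℝ → ℝ → ℝ}

/-- first estimate -/
lemma Crv.e1sup (h : Crv κ M s J0 lam γ γd γ2) (hρ : Wt M J0 ρ) {L : ℝ} (hL : 0 ≤ L) (hρL : ∀ a v w, ∀ t ∈ Icc (0:ℝ) ((1/2) ^ J0), 
    |ρ (a, v) t / γ2 (a, v) t - ρ (a, w) t / γ2 (a, w) t| ≤ L * |v - w|) {σ : ℝ} (hσ : |σ| = 1) {j : ℕ} (hj : J0 ≤ j) {k' k : ℕ} (hk : k' ≤ k) (f : DD) {B : ℝ}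
    (hB : ∀ x, |f x| ≤ B) (x) : 
    |(E2 k' * mkAv j ρ (Gm σ γ) * (1 - E2 k)) f x| ≤ (16 + 8 * L) * (1/2) ^ (k - k') * B := by
  have hB0 : 0 ≤ B := (abs_nonneg _).trans (hB 0)
  have ok := h.ok hρ hσ hj
  rw [Module.End.mul_apply, Module.End.mul_apply, E2_val]
  refine mkAv_fub_le ok _ volume (e := fun v => (x.1, v)) (by fun_prop) (ker_integrable k' x.2) fun t ht => ?_
  have ht' := Ij_sub hj ht
  simp only [Gm]
  rw [ker_mul_int]
  set c := Ico (cl k' x.2 / 2 ^ k' : ℝ) ((cl k' x.2 + 1) / 2 ^ k') with hc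
  have hmz := MZ2 k f hB (x.1 - σ * t)
  have hsm := h.smono x.1 ht'
  have h1 := hmz.subst (s := c) ordConnected_Ico (φ := fun v => γ (x.1, v) t) (φ' := fun v => γ2 (x.1, v) t) (fun v _ => h.d2 (x.1, v) t ht') hsm.injective.injOn
    (a' := γ (x.1, cl k' x.2 / 2 ^ k') t) (b' := γ (x.1, (cl k' x.2 + 1) / 2 ^ k') t) (fun v hv => ⟨hsm.monotone hv.1, hsm.monotone hv.2.le⟩)
  have h2 := h1.lip ordConnected_Ico (w := fun v => ρ (x.1, v) t / γ2 (x.1, v) t) (R := 4) (L := L) (a := cl k' x.2 / 2 ^ k') (b := (cl k' x.2 + 1) / 2 ^ k') (by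
      exact (hρ.cont.comp (by fun_prop : Continuous fun v : ℝ => (((x.1, v), t) : (ℝ × ℝ) × ℝ))).measurable.div (h.cont2.comp (by fun_prop : Continuous fun v : ℝ => (((x.1, v), t) : (ℝ × ℝ) × ℝ))).measurable)
    Ico_subset_Icc_self hL (fun v _ w _ => hρL x.1 v w t ht') (fun v _ => div_nonneg (hρ.nn _ t ht') (h.wt.nn _ t ht')) (fun v _ => by
      have := h.lo2 (x.1, v) t ht'
      rw [div_le_iff₀ (by linarith)]
      have := hρ.le (x.1, v) t ht'
      linarith) (by norm_num) (cell_le _ _)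
  have h3 := h2.2 c subset_rfl ordConnected_Ico
  have e : ∫ v in c, ρ (x.1, v) t / γ2 (x.1, v) t * (|γ2 (x.1, v) t| * (1 - E2 k) f (x.1 - σ * t, γ (x.1, v) t)) = ∫ v in c, ρ (x.1, v) t * (1 - E2 k) f (x.1 - σ * t, γ (x.1, v) t) := by
    congr 1; ext v
    have := h.lo2 (x.1, v) t ht'
    have h0 : 0 < γ2 (x.1, v) t := by linarith
    rw [abs_of_pos h0]; field_simp
  rw [e] at h3
  rw [abs_mul, abs_of_pos (by positivity)]
  have hlen := cell_len k' (cl k' x.2)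
  calc (2:ℝ) ^ k' * |∫ v in c, ρ (x.1, v) t * (1 - E2 k) f (x.1 - σ * t, γ (x.1, v) t)| ≤ 2 ^ k' * ((4 + 2 * L * 1) * (2 * (2 * B) / 2 ^ k)) := by
        refine mul_le_mul_of_nonneg_left (h3.trans ?_) (by positivity)
        refine mul_le_mul_of_nonneg_right ?_ (by positivity)
        have := mul_le_mul_of_nonneg_left hlen (by positivity : 0 ≤ 2 * L)
        linarith
    _ = _ := by
        obtain ⟨n, rfl⟩ := Nat.exists_eq_add_of_le hk
        rw [Nat.add_sub_cancel_left, pow_add, one_div, inv_pow]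
        field_simp
        ring

/-- interval change of variables -/
lemma Crv.cov_Ico (h : Crv κ M s J0 lam γ γd γ2) (a : ℝ) {t : ℝ} (ht : t ∈ Icc (0:ℝ) ((1/2) ^ J0)) (F : ℝ → ℝ) {u v : ℝ} (huv : u ≤ v) : 
    ∫ y in Ico u v, γ2 (a, y) t * F (γ (a, y) t) = ∫ y in (γ (a, u) t)..(γ (a, v) t), F y := by
  have hsm := h.smono a ht
  have := integral_image_eq_integral_abs_deriv_smul (s := Ico u v) measurableSet_Ico (fun v _ => (h.d2 (a, v) t ht).hasDerivWithinAt) hsm.injective.injOn F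
  have im : (fun y => γ (a, y) t) '' Ico u v = Ico (γ (a, u) t) (γ (a, v) t) := by
    ext z; constructor
    · rintro ⟨y, hy, rfl⟩; exact ⟨hsm.monotone hy.1, hsm hy.2⟩
    · rintro hz
      obtain ⟨y, rfl⟩ := h.surj a ht z
      exact ⟨y, ⟨hsm.le_iff_le.1 hz.1, hsm.lt_iff_lt.1 hz.2⟩, rfl⟩
  rw [im, Ico_int F (hsm.monotone huv)] at this
  rw [this]
  refine setIntegral_congr_fun measurableSet_Ico fun y _ => ?_
  rw [abs_of_nonneg (h.wt.nn _ t ht), smul_eq_mul]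

end

/-- straight averages -/
def WW (σ : ℝ) (j : ℕ) : Op := mkAv j (fun _ _ => 1) (Gm σ fun x _ => x.2)

lemma WW_ok {σ : ℝ} (hσ : |σ| = 1) (j : ℕ) : AvOK j (fun _ _ => 1) (Gm σ fun x _ => x.2) where
  mρ := measurable_const
  mΦ := by unfold Gm; fun_prop
  bρ := ⟨1, fun _ _ _ => by simp⟩
  b1 := fun x t ht => by
    have : |t| ≤ 1 := by rw [abs_of_pos (Ij_pos j ht)]; exact (Ij_hi j ht).le.trans (half_pow_le _)
    simpa [Gm, abs_mul, hσ] using this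
  b2 := fun x t ht => by simp [Gm]

lemma id_ok (j : ℕ) : AvOK j (fun _ _ => 1) (fun x _ => x) where
  mρ := measurable_const
  mΦ := by fun_prop
  bρ := ⟨1, fun _ _ _ => by simp⟩
  b1 := fun x t ht => by simp
  b2 := fun x t ht => by simp

lemma id_av (j : ℕ) : mkAv j (fun _ _ => 1) (fun x _ => x) = Real.log 2 • (1 : Op) := by
  refine LinearMap.ext fun f => dext fun x => ?_
  rw [mkAv_val (id_ok j)]
  change _ = (Real.log 2 • f : DD) x
  rw [integral_mul_const, Ij_int, smul_val, one_mul]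

lemma int_tr (f : DD) (a : ℝ) : ∫ x : ℝ × ℝ, f (x.1 - a, x.2) = ∫ x, f x := by
  have := integral_sub_right_eq_self (μ := (volume : Measure (ℝ × ℝ))) (fun x : ℝ × ℝ => f x) ((a, 0) : ℝ × ℝ)
  rw [← this]; congr 1; ext x
  have hx : x - ((a, 0) : ℝ × ℝ) = (x.1 - a, x.2) := Prod.ext rfl (by simp)
  rw [hx]

lemma WW_l1 {σ : ℝ} (hσ : |σ| = 1) (j : ℕ) : L1 (WW σ j) 1 := 
  mkAv_l1 (WW_ok hσ j) (fun _ _ _ => zero_le_one) fun t ht f hf => by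
    simp only [Gm, one_mul]; exact (int_tr f (σ * t)).le

lemma WW_adj {σ : ℝ} (hσ : |σ| = 1) (j : ℕ) (f k : DD) : ip (WW σ j f) k = ip f (WW (-σ) j k) := by
  have hσ' : |-σ| = 1 := by rw [abs_neg]; exact hσ
  have e1 := mkAv_fub (WW_ok hσ j) f volume measurable_id (dD k).integrable
  have e2 := mkAv_fub (WW_ok hσ' j) k volume measurable_id (dD f).integrable
  simp only [id] at e1 e2
  rw [ip_comm]
  unfold ip WW
  rw [e1, e2]
  refine setIntegral_congr_fun (Ij_meas j) fun t ht => ?_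
  congr 1
  have hD : IsD (fun x => f x * (1 * k (Gm (-σ) (fun x _ => x.2) x t))) := (dD f).mul ((WW_ok hσ' j).slice k ht)
  have := int_tr ⟨_, hD⟩ (σ * t)
  change (∫ x : ℝ × ℝ, f (x.1 - σ * t, x.2) * (1 * k (x.1 - σ * t - -σ * t, x.2))) = ∫ x, f x * (1 * k (Gm (-σ) (fun x _ => x.2) x t)) at this
  rw [← this]
  congr 1; ext x
  simp only [Gm, one_mul]
  rw [show x.1 - σ * t - -σ * t = x.1 by ring]; ring

lemma w2sup {σ : ℝ} (hσ : |σ| = 1) {j m : ℕ} (hm : j ≤ m) (f : DD) {B : ℝ} (hB : ∀ x, |f x| ≤ B) (x) : |(WW σ j * (1 - E1 m)) f x| ≤ 8 * (1/2) ^ (m - j) * B := by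
  have := Ij_osc (lin_osc hσ x.1 j (MZ1 m f hB x.2))
  have h2 := this.2 _ subset_rfl (Ij_ord j)
  rw [Module.End.mul_apply, WW, mkAv_val (WW_ok hσ j)]
  simp only [Gm, one_mul]
  refine h2.trans (le_of_eq ?_)
  obtain ⟨n, rfl⟩ := Nat.exists_eq_add_of_le hm
  rw [Nat.add_sub_cancel_left, pow_add, pow_add, one_div, inv_pow]
  field_simp
  ring

lemma w1sup {σ : ℝ} (hσ : |σ| = 1) {j m : ℕ} (hm : m ≤ j) (f : DD) {B : ℝ} (hB : ∀ x, |f x| ≤ B) (x) : 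
    |(E1 m * (WW σ j - Real.log 2 • 1)) f x| ≤ 2 * (1/2) ^ (j - m) * B := by
  rw [← id_av j, mul_sub]
  change |(E1 m (WW σ j f) - E1 m (mkAv j (fun _ _ => 1) (fun x _ => x) f) : DD) x| ≤ _
  have hB0 : 0 ≤ B := (abs_nonneg _).trans (hB 0)
  rw [sub_val, E1_val, E1_val, WW]
  refine mkAv_fub2_le (WW_ok hσ j) (id_ok j) f (e := fun v => (v, x.2)) (by fun_prop) (ker_integrable m x.1) fun t ht => ?_
  simp only [Gm, one_mul]
  rw [ker_mul_int, ker_mul_int, Ico_int _ (cell_le _ _), Ico_int _ (cell_le _ _), ← mul_sub, abs_mul, abs_of_pos (by positivity)]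
  have hM : Measurable fun y => f (y, x.2) := (dM f).comp (by fun_prop)
  rw [intervalIntegral.integral_comp_sub_right (fun y => f (y, x.2))]
  have hs := shift_bound hM (fun y => hB _) (a := cl m x.1 / 2 ^ m) (b := (cl m x.1 + 1) / 2 ^ m) (lin_near hσ (cl m x.1 / 2 ^ m) ht) (lin_near hσ ((cl m x.1 + 1) / 2 ^ m) ht)
  refine (mul_le_mul_of_nonneg_left hs (by positivity)).trans (le_of_eq ?_)
  obtain ⟨n, rfl⟩ := Nat.exists_eq_add_of_le hm
  rw [Nat.add_sub_cancel_left, pow_add, one_div, inv_pow]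
  field_simp

section
variable {κ M : ℝ} {s J0 : ℕ} {lam : ℕ → ℕ} {γ γd γ2 : ℝ × ℝ → ℝ → ℝ}

/-- second estimate -/
lemma Crv.e2sup (h : Crv κ M s J0 lam γ γd γ2) {σ : ℝ} (hσ : |σ| = 1) {j k : ℕ} (hj : J0 ≤ j) (hk : k ≤ j + lam j) (f : DD) {B : ℝ} (hB : ∀ x, |f x| ≤ B) (x) : 
    |(E2 k * (mkAv j γ2 (Gm σ γ) - WW σ j)) f x| ≤ 2 * (1/2) ^ (j + lam j - k) * B := by
  rw [mul_sub]
  change |(E2 k (mkAv j γ2 (Gm σ γ) f) - E2 k (WW σ j f) : DD) x| ≤ _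
  have hB0 : 0 ≤ B := (abs_nonneg _).trans (hB 0)
  rw [sub_val, E2_val, E2_val, WW]
  refine mkAv_fub2_le (h.ok h.wt hσ hj) (WW_ok hσ j) f (e := fun v => (x.1, v)) (by fun_prop) (ker_integrable k x.2) fun t ht => ?_
  simp only [Gm, one_mul]
  have ht' := Ij_sub hj ht
  have hn := fun v => h.near hj (x.1, v) (t := t) ⟨(Ij_pos j ht).le, (Ij_hi j ht).le⟩
  rw [ker_mul_int, ker_mul_int, h.cov_Ico x.1 ht' (fun y => f (x.1 - σ * t, y)) (cell_le _ _), Ico_int _ (cell_le _ _), ← mul_sub, abs_mul, abs_of_pos (by positivity)]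
  have hM : Measurable fun y => f (x.1 - σ * t, y) := (dM f).comp (by fun_prop)
  have hs := shift_bound hM (fun y => hB _) (hn (cl k x.2 / 2 ^ k)) (hn ((cl k x.2 + 1) / 2 ^ k))
  refine (mul_le_mul_of_nonneg_left hs (by positivity)).trans (le_of_eq ?_)
  obtain ⟨n, hn⟩ := Nat.exists_eq_add_of_le hk
  rw [hn, Nat.add_sub_cancel_left, pow_add, one_div, inv_pow]
  field_simp

end

end TB
end

section
namespace TB

/-- base constant -/
def c00 (κ M : ℝ) : ℝ := 128 * ((1 + M) * Real.exp κ)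
/-- system constant -/
def cSys (κ M : ℝ) : ℝ := √(8 * 8 * c00 κ M) + 4

lemma Bd.mono' {p : ℝ} {S : Op} {c c' : ℝ} (h : Bd p S c) (hc : c ≤ c') : Bd p S c' := fun f => (h f).trans (mul_le_mul_of_nonneg_right hc (N_nonneg _ _))

lemma c00_ge {κ M : ℝ} (hκ : 0 ≤ κ) (hM : 0 ≤ M) : 128 * (1 + M) ≤ c00 κ M := by
  unfold c00
  have := Real.one_le_exp hκ
  nlinarith

lemma L1.mono' {S : Op} {c c' : ℝ} (h : L1 S c) (hc : c ≤ c') : L1 S c' := fun f => 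
  (h f).trans (mul_le_mul_of_nonneg_right hc (integral_nonneg fun _ => abs_nonneg _))

lemma bd_uni {κ M : ℝ} (hκ : 0 ≤ κ) (hM : 0 ≤ M) {S : Op} {A c : ℝ} (n : ℕ) (h1 : L1 S A) (hA : A ≤ 8) (hc : c ≤ c00 κ M)
    (h2 : ∀ (f : DD) (B : ℝ), (∀ x, |f x| ≤ B) → ∀ x, |S f x| ≤ c * (1/2) ^ n * B) : Bd 2 S (cSys κ M * rr ^ n) := by
  have h0 := c00_ge hκ hM
  have hpos : 0 < c00 κ M := by linarith
  have := bd_of_sup (S := S) (A := 8) (c := c00 κ M) n (by norm_num) hpos (h1.mono' hA) (fun f B hB x => (h2 f B hB x).trans (by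
    have hB0 : 0 ≤ B := (abs_nonneg _).trans (hB 0)
    gcongr))
  refine this.mono' ?_
  unfold cSys
  have := pow_pos rr_pos n
  nlinarith

lemma L1_log : L1 (Real.log 2 • (1 : Op)) 1 := fun f => by
  have e : ∀ x, |(Real.log 2 • (1 : Op)) f x| = Real.log 2 * |f x| := fun x => by
    change |(Real.log 2 • f : DD) x| = _
    rw [smul_val, abs_mul, abs_of_nonneg log2_nonneg]
  simp only [e]
  rw [integral_const_mul]
  exact mul_le_mul_of_nonneg_right log2_le (integral_nonneg fun _ => abs_nonneg _)

lemma ip_comp_adj {S S' R R' : Op} (h : ∀ f h : DD, ip (S f) h = ip f (S' h)) (h' : ∀ f h : DD, ip (R f) h = ip f (R' h)) (f k : DD) : 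
    ip ((S * R) f) k = ip f ((R' * S') k) := by
  rw [Module.End.mul_apply, Module.End.mul_apply, h, h']

lemma ip_sub_adj {S S' R R' : Op} (h : ∀ f h : DD, ip (S f) h = ip f (S' h)) (h' : ∀ f h : DD, ip (R f) h = ip f (R' h)) (f k : DD) : 
    ip ((S - R) f) k = ip f ((S' - R') k) := by
  rw [LinearMap.sub_apply, LinearMap.sub_apply, ip_sub_left, ip_sub_right, h, h']

lemma log_adj (f k : DD) : ip ((Real.log 2 • (1 : Op)) f) k = ip f ((Real.log 2 • (1 : Op)) k) := by
  rw [LinearMap.smul_apply, LinearMap.smul_apply, ip_smul_left, ip_smul_right]; rfl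

lemma w1_bd {κ M : ℝ} (hκ : 0 ≤ κ) (hM : 0 ≤ M) {σ : ℝ} (hσ : |σ| = 1) {j m : ℕ} (hm : m ≤ j) : Bd 2 ((WW σ j - Real.log 2 • 1) * E1 m) (cSys κ M * rr ^ (j - m)) := by
  have hσ' : |-σ| = 1 := by rw [abs_neg]; exact hσ
  have h0 := c00_ge hκ hM
  refine Bd.of_adj (S' := E1 m * (WW (-σ) j - Real.log 2 • 1)) Real.HolderConjugate.two_two (mul_nonneg (by unfold cSys; positivity) (pow_nonneg rr_pos.le _)) 
    (ip_comp_adj (ip_sub_adj (WW_adj hσ j) log_adj) (filt1.adj m)) ?_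
  exact bd_uni hκ hM (j - m) ((L1_E filt1 m).mul zero_le_one ((WW_l1 hσ' j).sub L1_log)) (by norm_num) (by linarith) fun f B hB x => w1sup hσ' hm f hB x

lemma w2_bd {κ M : ℝ} (hκ : 0 ≤ κ) (hM : 0 ≤ M) {σ : ℝ} (hσ : |σ| = 1) {j m : ℕ} (hm : j ≤ m) : Bd 2 (WW σ j * (1 - E1 m)) (cSys κ M * rr ^ (m - j)) := by
  have h0 := c00_ge hκ hM
  exact bd_uni hκ hM (m - j) ((WW_l1 hσ j).mul zero_le_one (L1_oE filt1 m)) (by norm_num) (by linarith) fun f B hB x => w2sup hσ hm f hB x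

section
variable {κ M : ℝ} {s J0 : ℕ} {lam : ℕ → ℕ} {σ : ℝ} {γ γd γ2 γs γsd γs2 ρ : ℝ × ℝ → ℝ → ℝ}

lemma Crv.one_lip (h : Crv κ M s J0 lam γ γd γ2) (a v w : ℝ) (t : ℝ) (ht : t ∈ Icc (0:ℝ) ((1/2) ^ J0)) : 
    |1 / γ2 (a, v) t - 1 / γ2 (a, w) t| ≤ 4 * M * |v - w| := by
  have h1 := h.lo2 (a, v) t ht
  have h2 := h.lo2 (a, w) t ht
  have h3 := h.lipv a v w t ht
  have p1 : 0 < γ2 (a, v) t := by linarith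
  have p2 : 0 < γ2 (a, w) t := by linarith
  rw [div_sub_div _ _ p1.ne' p2.ne', abs_div, abs_of_pos (mul_pos p1 p2), div_le_iff₀ (mul_pos p1 p2), one_mul, mul_one, abs_sub_comm]
  have h4 : 1/4 ≤ γ2 (a, v) t * γ2 (a, w) t := by nlinarith
  have h5 : 0 ≤ M * |v - w| := mul_nonneg h.M0 (abs_nonneg _)
  nlinarith

lemma Crv.self_lip (h : Crv κ M s J0 lam γ γd γ2) (a v w : ℝ) (t : ℝ) (ht : t ∈ Icc (0:ℝ) ((1/2) ^ J0)) : 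
    |γ2 (a, v) t / γ2 (a, v) t - γ2 (a, w) t / γ2 (a, w) t| ≤ 4 * M * |v - w| := by
  have h1 := h.lo2 (a, v) t ht
  have h2 := h.lo2 (a, w) t ht
  have p1 : 0 < γ2 (a, v) t := by linarith
  have p2 : 0 < γ2 (a, w) t := by linarith
  rw [div_self p1.ne', div_self p2.ne', sub_self, abs_zero]
  exact mul_nonneg (by linarith [h.M0]) (abs_nonneg _)

lemma Crv.bd (h : Crv κ M s J0 lam γ γd γ2) (hρ : Wt M J0 ρ) (hσ : |σ| = 1) {j : ℕ} (hj : J0 ≤ j) : Bd 2 (mkAv j ρ (Gm σ γ)) (cSys κ M) := by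
  have h0 := c00_ge h.κ0 h.M0
  have hM := h.M0
  have := bd_uni h.κ0 h.M0 (S := mkAv j ρ (Gm σ γ)) 0 (h.l1 hρ hσ hj) (by norm_num) (c := 2) (by linarith) (fun f B hB x => by
    simpa using h.sup hρ hσ hj f hB x)
  simpa using this

lemma Crv.b1 (h : Crv κ M s J0 lam γ γd γ2) (hρ : Wt M J0 ρ) (hρL : ∀ a v w, ∀ t ∈ Icc (0:ℝ) ((1/2) ^ J0), 
    |ρ (a, v) t / γ2 (a, v) t - ρ (a, w) t / γ2 (a, w) t| ≤ 4 * M * |v - w|) (hσ : |σ| = 1) {j : ℕ} (hj : J0 ≤ j) {k' k : ℕ} (hk : k' ≤ k) : 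
    Bd 2 (E2 k' * mkAv j ρ (Gm σ γ) * (1 - E2 k)) (cSys κ M * rr ^ (k - k')) := by
  have h0 := c00_ge h.κ0 h.M0
  have hM := h.M0
  exact bd_uni h.κ0 h.M0 (k - k') (((L1_E filt2 k').mul zero_le_one (h.l1 hρ hσ hj)).mul (by norm_num) (L1_oE filt2 k)) (by norm_num) (by linarith) 
    fun f B hB x => h.e1sup hρ (by linarith) hρL hσ hj hk f hB x

lemma Crv.b3 (h : Crv κ M s J0 lam γ γd γ2) (hρ : Wt M J0 ρ) (hσ : |σ| = 1) {j : ℕ} (hj : J0 ≤ j) {l m : ℕ} (hl : j ≤ l) (hm : l ≤ m) : 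
    Bd 2 (mkAv j ρ (Gm σ γ) * (1 - E2 (m + lam (j + s))) * E1 l) (cSys κ M * rr ^ (m - l)) :=
  bd_uni h.κ0 h.M0 (m - l) (((L1.mul (by norm_num) (h.l1 hρ hσ hj) (L1_oE filt2 _)).mul (by norm_num) (L1_E filt1 l))) (by norm_num) le_rfl 
    fun f B hB x => h.e3sup hρ hσ hj hl hm f hB x

lemma Crv.b4 (h : Crv κ M s J0 lam γ γd γ2) (hρ : Wt M J0 ρ) (hσ : |σ| = 1) {j : ℕ} (hj : J0 ≤ j) {l m : ℕ} (hm : j ≤ m) (hl : m ≤ l) : 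
    Bd 2 (mkAv j ρ (Gm σ γ) * E2 (m + lam j) * (1 - E1 l)) (cSys κ M * rr ^ (l - m)) := by
  have h0 := c00_ge h.κ0 h.M0
  have hM := h.M0
  exact bd_uni h.κ0 h.M0 (l - m) (((L1.mul (by norm_num) (h.l1 hρ hσ hj) (L1_E filt2 _)).mul (by norm_num) (L1_oE filt1 l))) (by norm_num) (by linarith)
    fun f B hB x => h.e4sup hρ hσ hj hm hl f hB x

lemma Pair.b2 (h : Pair κ M s J0 lam σ γ γd γ2 γs γsd γs2) {j : ℕ} (hj : J0 ≤ j) {k : ℕ} (hk : k ≤ j + lam j) : 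
    Bd 2 ((mkAv j (fun _ _ => 1) (Gm σ γ) - WW σ j) * E2 k) (cSys κ M * rr ^ (j + lam j - k)) := by
  have hM := h.c.M0
  have h0 := c00_ge h.c.κ0 h.c.M0
  have hσ' := h.swap.hσ
  refine Bd.of_adj (S' := E2 k * (mkAv j γs2 (Gm (-σ) γs) - WW (-σ) j)) Real.HolderConjugate.two_two (mul_nonneg (by unfold cSys; positivity) (pow_nonneg rr_pos.le _)) 
    (ip_comp_adj (ip_sub_adj (h.adj hj) (WW_adj h.hσ j)) (filt2.adj k)) ?_
  exact bd_uni h.c.κ0 h.c.M0 (j + lam j - k) ((L1_E filt2 k).mul zero_le_one (L1.sub (h.cs.l1 h.cs.wt hσ' hj) (WW_l1 hσ' j))) (by norm_num) (by linarith) 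
    fun f B hB x => h.cs.e2sup hσ' hj hk f hB x

/-- all estimates hold -/
theorem Pair.sys (h : Pair κ M s J0 lam σ γ γd γ2 γs γsd γs2) : 
    Sys (cSys κ M) s J0 lam (fun j => mkAv j (fun _ _ => 1) (Gm σ γ)) (fun j => mkAv j γs2 (Gm (-σ) γs)) (WW σ) (WW (-σ)) where
  c0 := by unfold cSys; positivity
  hlam := h.l
  adjT := fun j hj => h.adj hj
  adjW := fun j _ => WW_adj h.hσ j
  posT := fun j hj => mkAv_pos (h.c.ok (Wt.one J0 h.c.M0) h.hσ hj) fun _ _ _ => zero_le_one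
  l1T := fun j hj => L1.mono' (h.c.l1 (Wt.one J0 h.c.M0) h.hσ hj) (by unfold cSys; linarith [Real.sqrt_nonneg (8 * 8 * c00 κ M)])
  bdT := fun j hj => h.c.bd (Wt.one J0 h.c.M0) h.hσ hj
  bdT' := fun j hj => h.cs.bd h.cs.wt h.swap.hσ hj
  e1 := fun j hj k' k hk => h.c.b1 (Wt.one J0 h.c.M0) h.c.one_lip h.hσ hj hk
  e1' := fun j hj k' k hk => h.cs.b1 h.cs.wt h.cs.self_lip h.swap.hσ hj hk
  e2 := fun j hj k hk => h.b2 hj hk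
  e3 := fun j hj l m hl hm => h.c.b3 (Wt.one J0 h.c.M0) h.hσ hj hl hm
  e3' := fun j hj l m hl hm => h.cs.b3 h.cs.wt h.swap.hσ hj hl hm
  e4 := fun j hj l m hl hm => h.c.b4 (Wt.one J0 h.c.M0) h.hσ hj hl hm
  e4' := fun j hj l m hl hm => h.cs.b4 h.cs.wt h.swap.hσ hj hl hm
  w1 := fun j _ m hm => w1_bd h.c.κ0 h.c.M0 h.hσ hm
  w1' := fun j _ m hm => w1_bd h.c.κ0 h.c.M0 h.swap.hσ hm
  w2 := fun j _ m hm => w2_bd h.c.κ0 h.c.M0 h.hσ hm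
  w2' := fun j _ m hm => w2_bd h.c.κ0 h.c.M0 h.swap.hσ hm

end
end TB
end

section
namespace TB

/-- unweighted averages -/
abbrev TT (σ : ℝ) (γ : ℝ × ℝ → ℝ → ℝ) (j : ℕ) : Op := mkAv j (fun _ _ => 1) (Gm σ γ)

lemma Bd.sub {p a b : ℝ} (hp : 1 ≤ p) {S R : Op} (h : Bd p S a) (h' : Bd p R b) : Bd p (S - R) (a + b) := fun f => by
  rw [LinearMap.sub_apply, add_mul]
  exact (N_sub_le hp _ _).trans (add_le_add (h f) (h' f))

lemma Bd.add {p a b : ℝ} (hp : 1 ≤ p) {S R : Op} (h : Bd p S a) (h' : Bd p R b) : Bd p (S + R) (a + b) := fun f => by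
  rw [LinearMap.add_apply, add_mul]
  exact (N_add_le hp _ _).trans (add_le_add (h f) (h' f))

lemma half_sum (J : Finset ℕ) : ∑ j ∈ J, (1/2:ℝ) ^ j ≤ 2 := by
  have := Summable.sum_le_tsum (f := fun j : ℕ => (1/2:ℝ) ^ j) J (fun i _ => by positivity) summable_geometric_two
  rwa [tsum_geometric_two] at this

section
variable {κ M : ℝ} {s J0 : ℕ} {lam : ℕ → ℕ} {σ : ℝ} {γ γd γ2 γs γsd γs2 : ℝ × ℝ → ℝ → ℝ}

lemma Crv.tbd (h : Crv κ M s J0 lam γ γd γ2) (hσ : |σ| = 1) {j : ℕ} (hj : J0 ≤ j) {p : ℝ} (hp : 1 < p) : Bd p (TT σ γ j) (CM 4 2 p) := fun f =>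
  marc_topN (by norm_num) (by norm_num) hp (subL_op _) (Weak.of_strong one_pos fun f => by simpa using h.l1 (Wt.one J0 h.M0) hσ hj f)
    (fun f B hB x => h.sup (Wt.one J0 h.M0) hσ hj f hB x) f

lemma Crv.err (h : Crv κ M s J0 lam γ γd γ2) (hσ : |σ| = 1) {j : ℕ} (hj : J0 ≤ j) {p : ℝ} (hp : 1 < p) :
    Bd p (mkAv j γ2 (Gm σ γ) - TT σ γ j) (M * CM 4 2 p * (1/2) ^ j) := fun f => by
  have ok1 := h.ok (Wt.one J0 h.M0) hσ hj
  have ok2 := h.ok h.wt hσ hj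
  have hM := h.M0
  have key : N p ((mkAv j γ2 (Gm σ γ) - TT σ γ j) f) ≤ N p ((M * (1/2) ^ j) • TT σ γ j (dabs f) : DD) := by
    refine N_mono (by linarith) (dD _) (dD _) fun x => ?_
    refine le_trans ?_ (le_abs_self _)
    rw [LinearMap.sub_apply, sub_val, smul_val, mkAv_val ok1, mkAv_val ok2, mkAv_val ok1,
      ← integral_sub (ok2.intble f x) (ok1.intble f x), ← integral_const_mul, ← Real.norm_eq_abs]
    refine norm_integral_le_of_norm_le ((ok1.intble (dabs f) x).const_mul _) ((ae_restrict_mem (Ij_meas j)).mono fun t ht => ?_)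
    have h1 := h.lipt x t (Ij_sub hj ht) 0 ⟨le_rfl, by positivity⟩
    rw [h.one, sub_zero, abs_of_pos (Ij_pos j ht)] at h1
    have h2 : |γ2 x t - 1| ≤ M * (1/2) ^ j := h1.trans (mul_le_mul_of_nonneg_left (Ij_hi j ht).le hM)
    have e : t⁻¹ * (γ2 x t * f (Gm σ γ x t)) - t⁻¹ * (1 * f (Gm σ γ x t)) = t⁻¹ * ((γ2 x t - 1) * f (Gm σ γ x t)) := by ring
    rw [e, Real.norm_eq_abs, abs_mul, abs_mul, abs_val, abs_of_pos (inv_pos.2 (Ij_pos j ht))]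
    have h3 : 0 ≤ t⁻¹ := (inv_pos.2 (Ij_pos j ht)).le
    calc t⁻¹ * (|γ2 x t - 1| * |f (Gm σ γ x t)|) ≤ t⁻¹ * ((M * (1/2) ^ j) * |f (Gm σ γ x t)|) :=
          mul_le_mul_of_nonneg_left (mul_le_mul_of_nonneg_right h2 (abs_nonneg _)) h3
      _ = _ := by ring
  refine key.trans ?_
  have hMj : 0 ≤ M * (1/2:ℝ) ^ j := by positivity
  rw [N_smul (by linarith), abs_of_nonneg hMj]
  have h4 := h.tbd hσ hj hp (dabs f)
  have h5 : N p (dabs f) = N p f := N_abs _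
  rw [h5] at h4
  calc _ ≤ M * (1/2) ^ j * (CM 4 2 p * N p f) := mul_le_mul_of_nonneg_left h4 hMj
    _ = _ := by ring

lemma Crv.errs (h : Crv κ M s J0 lam γ γd γ2) (hσ : |σ| = 1) (J : Finset ℕ) (hJ : ∀ j ∈ J, J0 ≤ j) {p : ℝ} (hp : 1 < p) :
    Bd p (∑ j ∈ J, (mkAv j γ2 (Gm σ γ) - TT σ γ j)) (2 * M * CM 4 2 p) := fun f => by
  rw [LinearMap.sum_apply]
  have h0 : 0 ≤ M * CM 4 2 p := mul_nonneg h.M0 (CM_nonneg (by norm_num) (by norm_num) hp)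
  calc _ ≤ ∑ j ∈ J, N p ((mkAv j γ2 (Gm σ γ) - TT σ γ j) f) := N_sum_le hp.le _ _
    _ ≤ ∑ j ∈ J, M * CM 4 2 p * (1/2) ^ j * N p f := Finset.sum_le_sum fun j hj => h.err hσ (hJ j hj) hp f
    _ = M * CM 4 2 p * (∑ j ∈ J, (1/2:ℝ) ^ j) * N p f := by rw [Finset.mul_sum, Finset.sum_mul]
    _ ≤ M * CM 4 2 p * 2 * N p f := mul_le_mul_of_nonneg_right (mul_le_mul_of_nonneg_left (half_sum J) h0) (N_nonneg _ _)
    _ = _ := by ring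

/-- Hilbert transform bound for pairs of one-sided curves -/
def Hil (κ M : ℝ) (s : ℕ) (p : ℝ) : Prop := ∃ C : ℝ, 0 ≤ C ∧ ∀ (J0 : ℕ) (lam : ℕ → ℕ) (σ σ' : ℝ) (γ γd γ2 γs γsd γs2 η ηd η2 ηs ηsd ηs2 : ℝ × ℝ → ℝ → ℝ),
  Pair κ M s J0 lam σ γ γd γ2 γs γsd γs2 → Pair κ M s J0 lam σ' η ηd η2 ηs ηsd ηs2 → ∀ J : Finset ℕ, (∀ j ∈ J, J0 ≤ j) →
    Bd p (∑ j ∈ J, (TT σ γ j - TT σ' η j)) C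

lemma Hil_low {κ M : ℝ} {s : ℕ} {p : ℝ} (hp : 1 < p) (hp2 : p ≤ 2) : Hil κ M s p := by
  obtain ⟨C, hC, H⟩ := Main_all (cSys κ M) s hp hp2
  refine ⟨C + C, by positivity, fun J0 lam σ σ' γ γd γ2 γs γsd γs2 η ηd η2 ηs ηsd ηs2 h h' J hJ => ?_⟩
  have h1 := H _ _ _ _ _ _ h.sys J hJ (fun _ => 1) (fun _ => abs_one)
  have h2 := H _ _ _ _ _ _ h'.sys J hJ (fun _ => 1) (fun _ => abs_one)
  have h3 := h1.sub hp.le h2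
  convert h3 using 1
  rw [← Finset.sum_sub_distrib]
  refine Finset.sum_congr rfl fun j _ => ?_
  simp only [one_smul, UU, sub_sub_sub_cancel_right]

lemma ip_sum_adj {J : Finset ℕ} {S S' : ℕ → Op} (h : ∀ j ∈ J, ∀ f h : DD, ip (S j f) h = ip f (S' j h)) (f k : DD) :
    ip ((∑ j ∈ J, S j) f) k = ip f ((∑ j ∈ J, S' j) k) := by
  rw [LinearMap.sum_apply, LinearMap.sum_apply, ip_sum_left, ip_sum_right]
  exact Finset.sum_congr rfl fun j hj => h j hj f k

theorem Hil_all {κ M : ℝ} (hM : 0 ≤ M) (s : ℕ) {p : ℝ} (hp : 1 < p) : Hil κ M s p := by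
  rcases le_total p 2 with h2 | h2
  · exact Hil_low hp h2
  obtain ⟨q, hpq, hq⟩ := conj_ex hp
  have hq2 : q ≤ 2 := by
    have := hpq.inv_add_inv_eq_one
    have h3 : p⁻¹ ≤ 2⁻¹ := inv_anti₀ (by norm_num) h2
    have h4 : (2:ℝ)⁻¹ ≤ q⁻¹ := by norm_num at h3 ⊢; linarith
    exact (inv_le_inv₀ (by norm_num) (by linarith)).1 h4
  obtain ⟨C, hC, H⟩ := Hil_low (κ := κ) (M := M) (s := s) hq hq2
  have hcm : 0 ≤ CM 4 2 q := CM_nonneg (by norm_num) (by norm_num) hq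
  refine ⟨C + (2 * M * CM 4 2 q + 2 * M * CM 4 2 q), by positivity, fun J0 lam σ σ' γ γd γ2 γs γsd γs2 η ηd η2 ηs ηsd ηs2 h h' J hJ => ?_⟩
  refine Bd.of_adj hpq (by positivity) (ip_sum_adj (S' := fun j => mkAv j γs2 (Gm (-σ) γs) - mkAv j ηs2 (Gm (-σ') ηs)) 
    fun j hj => ip_sub_adj (h.adj (hJ j hj)) (h'.adj (hJ j hj))) ?_
  have b1 := H _ _ _ _ _ _ _ _ _ _ _ _ _ _ _ _ h.swap h'.swap J hJ
  have b2 := (h.cs.errs h.swap.hσ J hJ hq).sub hq.le (h'.cs.errs h'.swap.hσ J hJ hq)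
  have b3 := b1.add hq.le b2
  convert b3 using 1
  rw [← Finset.sum_sub_distrib, ← Finset.sum_add_distrib]
  refine Finset.sum_congr rfl fun j _ => ?_
  abel

/-- Maximal bound for one-sided curves -/
def Mxl (κ M : ℝ) (s : ℕ) (p : ℝ) : Prop := ∃ C : ℝ, 0 ≤ C ∧ ∀ (J0 : ℕ) (lam : ℕ → ℕ) (σ : ℝ) (γ γd γ2 γs γsd γs2 : ℝ × ℝ → ℝ → ℝ),
  Pair κ M s J0 lam σ γ γd γ2 γs γsd γs2 → ∀ J : Finset ℕ, (∀ j ∈ J, J0 ≤ j) → ∀ f : DD,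
    N p (dsup J fun j => TT σ γ j (dabs f)) ≤ C * N p f

lemma Pair.tpos (h : Pair κ M s J0 lam σ γ γd γ2 γs γsd γs2) {j : ℕ} (hj : J0 ≤ j) : Pos (TT σ γ j) := h.sys.posT j hj

lemma Mxl_low {κ M : ℝ} {s : ℕ} {p : ℝ} (hp : 1 < p) (hp2 : p ≤ 2) : Mxl κ M s p := by
  obtain ⟨C, hC, H⟩ := Pm_all (cSys κ M) s hp hp2
  refine ⟨C, hC, fun J0 lam σ γ γd γ2 γs γsd γs2 h J hJ f => ?_⟩
  obtain ⟨m, m0, hm, hN⟩ := H _ _ _ _ _ _ h.sys J hJ f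
  refine le_trans (N_mono (by linarith) (dD _) (dD m) fun x => ?_) hN
  rw [abs_of_nonneg (dsup_nonneg _ _ _), abs_of_nonneg (m0 x)]
  refine dsup_le _ _ _ (m0 x) fun j hj => ?_
  rw [abs_of_nonneg (h.tpos (hJ j hj) _ (fun x => abs_nonneg _) x)]
  refine le_trans ?_ (hm j hj x)
  rw [AA_app]
  exact le_add_of_nonneg_right (filt1.pos _ _ (filt2.pos _ _ fun x => abs_nonneg _) x)

theorem Mxl_all {κ M : ℝ} (s : ℕ) {p : ℝ} (hp : 1 < p) : Mxl κ M s p := by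
  rcases le_or_gt p 2 with h2 | h2
  · exact Mxl_low hp h2
  obtain ⟨C, hC, H⟩ := Mxl_low (κ := κ) (M := M) (s := s) one_lt_two le_rfl
  have h20 : 0 < p - 2 := by linarith
  refine ⟨(p * (C ^ (2:ℝ) * 2 ^ (2:ℝ) * (1 / (2 * 2)) ^ (2 - p) / (p - 2))) ^ (1 / p), by positivity, fun J0 lam σ γ γd γ2 γs γsd γs2 h J hJ f => ?_⟩
  refine N_of_int (by linarith) (by positivity) ?_
  refine marc_top (S := fun f => dsup J fun j => TT σ γ j (dabs f)) (by positivity) (by norm_num) (by norm_num) h2 ⟨fun f k x => ?_⟩ 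
    (Weak.of_strong (by norm_num) fun f => pow_le_of_N (by norm_num) hC (H _ _ _ _ _ _ _ _ _ h J hJ f)) (fun f B hB x => ?_) f
  · rw [abs_of_nonneg (dsup_nonneg _ _ _), abs_of_nonneg (dsup_nonneg _ _ _), abs_of_nonneg (dsup_nonneg _ _ _)]
    refine dsup_le _ _ _ (add_nonneg (dsup_nonneg _ _ _) (dsup_nonneg _ _ _)) fun j hj => ?_
    have hp := h.tpos (hJ j hj)
    rw [abs_of_nonneg (hp _ (fun x => abs_nonneg _) x)]
    have h1 := hp.mono (f := dabs (f + k)) (h := dabs f + dabs k) (fun x => by simpa using abs_add_le (f x) (k x)) x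
    rw [map_add, add_val] at h1
    exact h1.trans (add_le_add ((le_abs_self _).trans (le_dsup J (fun j => TT σ γ j (dabs f)) x hj)) ((le_abs_self _).trans (le_dsup J (fun j => TT σ γ j (dabs k)) x hj)))
  · rw [abs_of_nonneg (dsup_nonneg _ _ _)]
    have hB0 : 0 ≤ B := (abs_nonneg _).trans (hB x)
    exact dsup_le _ _ _ (by positivity) fun j hj => h.c.sup (Wt.one J0 h.c.M0) h.hσ (hJ j hj) (dabs f) (fun x => by simpa using hB x) x

end
end TB
end

section
namespace TB

/-- increasing majorant -/
def GG (g : ℝ → ℝ) (t : ℝ) : ℝ := sSup (g '' Icc 0 t)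

section
variable {g : ℝ → ℝ} {A : ℝ}

lemma GG_up (hg : IsDoubling g A) {t s : ℝ} (hs : s ∈ Icc 0 t) : 2 * g s ≤ g (A * t) :=
  hg.dbl s (A * t) hs.1 (mul_le_mul_of_nonneg_left hs.2 (by linarith [hg.A_ge_one]))

lemma GG_bdd (hg : IsDoubling g A) (t : ℝ) : BddAbove (g '' Icc 0 t) := 
  ⟨g (A * t) / 2, by rintro _ ⟨s, hs, rfl⟩; linarith [GG_up hg hs]⟩

lemma GG_ge (hg : IsDoubling g A) {t : ℝ} (ht : 0 ≤ t) : g t ≤ GG g t := 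
  le_csSup (GG_bdd hg t) ⟨t, ⟨ht, le_rfl⟩, rfl⟩

lemma GG_le (hg : IsDoubling g A) {t : ℝ} (ht : 0 ≤ t) : 2 * GG g t ≤ g (A * t) := by
  have : GG g t ≤ g (A * t) / 2 := csSup_le ⟨_, ⟨0, ⟨le_rfl, ht⟩, rfl⟩⟩ (by rintro _ ⟨s, hs, rfl⟩; linarith [GG_up hg hs])
  linarith

lemma GG_mono (hg : IsDoubling g A) {t u : ℝ} (ht : 0 ≤ t) (h : t ≤ u) : GG g t ≤ GG g u :=
  csSup_le_csSup (GG_bdd hg u) ⟨_, ⟨0, ⟨le_rfl, ht⟩, rfl⟩⟩ (image_mono (Icc_subset_Icc_right h))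

lemma GG_pos (hg : IsDoubling g A) {t : ℝ} (ht : 0 < t) : 0 < GG g t := (hg.pos t ht).trans_le (GG_ge hg ht.le)

lemma GG_pow (hg : IsDoubling g A) (n : ℕ) {t : ℝ} (ht : 0 ≤ t) : 2 ^ n * GG g t ≤ GG g (A ^ n * t) := by
  have hA := hg.A_ge_one
  induction n with
  | zero => simp
  | succ n ih =>
    have h0 : 0 ≤ A ^ n * t := by positivity
    have h1 := GG_le hg h0
    have h2 := GG_ge hg (t := A * (A ^ n * t)) (by positivity)
    rw [show A ^ (n+1) * t = A * (A ^ n * t) by ring, pow_succ]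
    linarith

lemma lam_ex (hg : IsDoubling g A) {C₀ : ℝ} (hC : 1 ≤ C₀) : ∃ (s J1 : ℕ) (lam : ℕ → ℕ), ∀ J0, J1 ≤ J0 → Lam s J0 lam ∧
    (∀ j, J0 ≤ j → ∀ r ∈ Icc (0:ℝ) ((1/2) ^ j), C₀ * g (A * r) ≤ (1/2) ^ lam j) ∧
    (∀ j, J0 ≤ j → ∀ t ∈ Ij j, (1/2) ^ lam (j + s) ≤ C₀⁻¹ * g (A⁻¹ * t)) := by
  have hA := hg.A_ge_one
  have hA0 : 0 < A := by linarith
  obtain ⟨n, hn⟩ := pow_unbounded_of_one_lt (C₀ ^ 2) (one_lt_two)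
  obtain ⟨s, hs⟩ := pow_unbounded_of_one_lt (2 * A ^ (n + 3)) (one_lt_two)
  set u : ℕ → ℝ := fun j => C₀ * GG g (A * (1/2) ^ j) with hu
  have upos : ∀ j, 0 < u j := fun j => mul_pos (by linarith) (GG_pos hg (by positivity))
  have uanti : ∀ i j, i ≤ j → u j ≤ u i := fun i j h => 
    mul_le_mul_of_nonneg_left (GG_mono hg (by positivity) (mul_le_mul_of_nonneg_left (half_pow_anti h) hA0.le)) (by linarith)
  obtain ⟨J1, hJ1⟩ : ∃ J1, u J1 ≤ 1 := by
    have h1 : Tendsto g (nhdsWithin 0 (Ici 0)) (nhds 0) := by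
      have := hg.cont 0 (mem_Ici.2 le_rfl)
      rwa [ContinuousWithinAt, hg.zero] at this
    have h2 : Tendsto (fun j : ℕ => A * (A * (1/2:ℝ) ^ j)) atTop (nhdsWithin 0 (Ici 0)) := by
      refine tendsto_nhdsWithin_iff.2 ⟨?_, Eventually.of_forall fun j => mem_Ici.2 (by positivity)⟩
      have := (tendsto_pow_atTop_nhds_zero_of_lt_one (r := (1/2:ℝ)) (by norm_num) (by norm_num)).const_mul (A * A)
      simpa [mul_assoc] using this
    have h3 := (h1.comp h2).eventually (gt_mem_nhds (show 0 < C₀⁻¹ by positivity))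
    obtain ⟨J, hJ⟩ := h3.exists
    refine ⟨J, ?_⟩
    have h4 := GG_le hg (t := A * (1/2) ^ J) (by positivity)
    have h5 := (upos J)
    simp only [Function.comp] at hJ
    have h6 := GG_pos hg (t := A * (1/2) ^ J) (by positivity)
    have : GG g (A * (1/2) ^ J) ≤ C₀⁻¹ := by linarith
    calc u J ≤ C₀ * C₀⁻¹ := mul_le_mul_of_nonneg_left this (by linarith)
      _ = 1 := mul_inv_cancel₀ (by linarith)
  have ex : ∀ j, ∃ m : ℕ, J1 ≤ j → (1/2:ℝ) ^ (m + 1) < u j ∧ u j ≤ (1/2) ^ m := fun j => by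
    by_cases h : J1 ≤ j
    · obtain ⟨m, hm⟩ := exists_nat_pow_near_of_lt_one (upos j) ((uanti _ _ h).trans hJ1) (by norm_num : (0:ℝ) < 1/2) (by norm_num)
      exact ⟨m, fun _ => hm⟩
    · exact ⟨0, fun h' => absurd h' h⟩
  choose lam hlam using ex
  have hs2 : A ^ (n+3) * (1/2:ℝ) ^ s ≤ 1/2 := by
    rw [one_div, inv_pow, ← div_eq_mul_inv, div_le_iff₀ (by positivity)]; linarith
  refine ⟨s, J1, lam, fun J0 hJ0 => ⟨⟨fun i j hi hij => ?_, fun j hj => ?_⟩, fun j hj r hr => ?_, fun j hj t ht => ?_⟩⟩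
  · have h1 := (hlam j (by omega)).1
    have h2 := (hlam i (by omega)).2
    have h3 := h1.trans_le ((uanti i j hij).trans h2)
    have := (pow_lt_pow_iff_right_of_lt_one₀ (by norm_num : (0:ℝ) < 1/2) (by norm_num)).1 h3
    omega
  · have h1 := (hlam (j + s) (by omega)).1
    have h2 := (hlam j (by omega)).2
    have h3 : 2 * u (j + s) ≤ u j := by
      have e1 := GG_pow hg 1 (t := A * (1/2) ^ (j + s)) (by positivity)
      have e2 : GG g (A ^ 1 * (A * (1/2) ^ (j + s))) ≤ GG g (A * (1/2) ^ j) := by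
        refine GG_mono hg (by positivity) ?_
        have : A * (1/2:ℝ) ^ s ≤ 1 := by
          have h8 : A ^ 1 ≤ A ^ (n + 3) := pow_le_pow_right₀ hA (by omega)
          have h9 : A ^ 1 * (1/2:ℝ) ^ s ≤ A ^ (n+3) * (1/2:ℝ) ^ s := mul_le_mul_of_nonneg_right h8 (by positivity)
          rw [pow_one] at h9; linarith
        calc A ^ 1 * (A * (1/2) ^ (j + s)) = A * (1/2) ^ j * (A * (1/2) ^ s) := by rw [pow_add]; ring
          _ ≤ A * (1/2) ^ j * 1 := mul_le_mul_of_nonneg_left this (by positivity)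
          _ = _ := mul_one _
      calc 2 * u (j + s) = C₀ * (2 ^ 1 * GG g (A * (1/2) ^ (j + s))) := by simp only [hu]; ring
        _ ≤ u j := mul_le_mul_of_nonneg_left (e1.trans e2) (by linarith)
    have h4 : (1/2:ℝ) ^ (lam (j + s)) < (1/2) ^ lam j := by
      rw [pow_succ] at h1; linarith
    have := (pow_lt_pow_iff_right_of_lt_one₀ (by norm_num : (0:ℝ) < 1/2) (by norm_num)).1 h4
    omega
  · refine le_trans (mul_le_mul_of_nonneg_left ?_ (by linarith)) (hlam j (by omega)).2
    exact (GG_ge hg (mul_nonneg hA0.le hr.1)).trans (GG_mono hg (mul_nonneg hA0.le hr.1) (mul_le_mul_of_nonneg_left hr.2 hA0.le))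
  · have h1 := (hlam (j + s) (by omega)).1
    have ht1 := Ij_lo j ht
    have ht0 := Ij_pos j ht
    have e1 := GG_le hg (t := A⁻¹ * (A⁻¹ * t)) (by positivity)
    rw [mul_inv_cancel_left₀ hA0.ne'] at e1
    have e2 := GG_pow hg n (t := A * (1/2) ^ (j + s)) (by positivity)
    have e3 : GG g (A ^ n * (A * (1/2) ^ (j + s))) ≤ GG g (A⁻¹ * (A⁻¹ * t)) := by
      refine GG_mono hg (by positivity) ?_
      have : A ^ n * (A * (1/2) ^ (j + s)) * (A * A) ≤ t := by
        calc A ^ n * (A * (1/2) ^ (j + s)) * (A * A) = (A ^ (n+3) * (1/2) ^ s) * (1/2) ^ j := by rw [pow_add, pow_add]; ring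
          _ ≤ (1/2) * (1/2) ^ j := mul_le_mul_of_nonneg_right hs2 (by positivity)
          _ = (1/2) ^ (j+1) := by rw [pow_succ]; ring
          _ ≤ t := ht1
      rw [inv_mul_eq_div, inv_mul_eq_div, div_div, le_div_iff₀ (by positivity)]; exact this
    have e4 : C₀ ^ 2 * GG g (A * (1/2) ^ (j + s)) ≤ 2 ^ n * GG g (A * (1/2) ^ (j + s)) := 
      mul_le_mul_of_nonneg_right hn.le (GG_pos hg (by positivity)).le
    have e5 : 2 * (C₀ ^ 2 * GG g (A * (1/2) ^ (j + s))) ≤ g (A⁻¹ * t) := by linarith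
    have e6 : (1/2:ℝ) ^ lam (j + s) ≤ 2 * u (j + s) := by rw [pow_succ] at h1; linarith
    refine e6.trans ?_
    rw [inv_mul_eq_div, le_div_iff₀ (by linarith)]
    refine le_trans (le_of_eq ?_) e5
    simp only [hu]; ring

end

lemma qmono_pos {φ φ' a E : ℝ → ℝ} {c κ : ℝ} (hc : 0 < c) (hκ : 0 ≤ κ) (hd : ∀ t ∈ Icc (0:ℝ) c, HasDerivAt φ (φ' t) t) (h0 : φ 0 = 0)
    (hp : ∀ t ∈ Ioc (0:ℝ) c, 0 < φ t) (he : ∀ t ∈ Icc (0:ℝ) c, φ' t = a t + E t) (hE : ∀ t ∈ Icc (0:ℝ) c, |E t| ≤ κ * |φ t|)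
    (ha : (∀ t ∈ Ioc (0:ℝ) c, 0 ≤ a t) ∨ (∀ t ∈ Ioc (0:ℝ) c, a t ≤ 0)) : MonotoneOn (fun t => Real.exp (κ * t) * φ t) (Icc 0 c) := by
  have key : ∀ k : ℝ, ∀ t ∈ Icc (0:ℝ) c, HasDerivAt (fun t => Real.exp (k * t) * φ t) (Real.exp (k * t) * (k * φ t + φ' t)) t := fun k t ht => by
    have h1 : HasDerivAt (fun t => Real.exp (k * t)) (Real.exp (k * t) * (k * 1)) t := ((hasDerivAt_id t).const_mul k).exp
    exact (h1.mul (hd t ht)).congr_deriv (by ring)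
  have hsub : interior (Icc (0:ℝ) c) ⊆ Ioc 0 c := by rw [interior_Icc]; exact Ioo_subset_Ioc_self
  have hsub' : Ioc (0:ℝ) c ⊆ Icc 0 c := Ioc_subset_Icc_self
  rcases ha with ha | ha
  · refine monotoneOn_of_deriv_nonneg (convex_Icc _ _) (fun t ht => (key κ t ht).continuousAt.continuousWithinAt) 
      (fun t ht => (key κ t (hsub' (hsub ht))).differentiableAt.differentiableWithinAt) fun t ht => ?_
    have ht' := hsub ht
    rw [(key κ t (hsub' ht')).deriv, he t (hsub' ht')]
    have h1 := (abs_le.1 (hE t (hsub' ht'))).1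
    rw [abs_of_pos (hp t ht')] at h1
    exact mul_nonneg (Real.exp_pos _).le (by linarith [ha t ht'])
  · exfalso
    have : AntitoneOn (fun t => Real.exp (-κ * t) * φ t) (Icc 0 c) := by
      refine antitoneOn_of_deriv_nonpos (convex_Icc _ _) (fun t ht => (key (-κ) t ht).continuousAt.continuousWithinAt) 
        (fun t ht => (key (-κ) t (hsub' (hsub ht))).differentiableAt.differentiableWithinAt) fun t ht => ?_
      have ht' := hsub ht
      rw [(key (-κ) t (hsub' ht')).deriv, he t (hsub' ht')]
      have h1 := (abs_le.1 (hE t (hsub' ht'))).2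
      rw [abs_of_pos (hp t ht')] at h1
      exact mul_nonpos_of_nonneg_of_nonpos (Real.exp_pos _).le (by linarith [ha t ht'])
    have h2 := this ⟨le_rfl, hc.le⟩ ⟨hc.le, le_rfl⟩ hc.le
    simp only [h0, mul_zero] at h2
    have := mul_pos (Real.exp_pos (-κ * c)) (hp c ⟨hc, le_rfl⟩)
    linarith

lemma qmono {φ φ' a E : ℝ → ℝ} {c κ : ℝ} (hc : 0 < c) (hκ : 0 ≤ κ) (hd : ∀ t ∈ Icc (0:ℝ) c, HasDerivAt φ (φ' t) t) (h0 : φ 0 = 0)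
    (hp : ∀ t ∈ Ioc (0:ℝ) c, φ t ≠ 0) (he : ∀ t ∈ Icc (0:ℝ) c, φ' t = a t + E t) (hE : ∀ t ∈ Icc (0:ℝ) c, |E t| ≤ κ * |φ t|)
    (ha : (∀ t ∈ Ioc (0:ℝ) c, 0 ≤ a t) ∨ (∀ t ∈ Ioc (0:ℝ) c, a t ≤ 0)) : 
    ((∀ t ∈ Ioc (0:ℝ) c, 0 < φ t) ∨ (∀ t ∈ Ioc (0:ℝ) c, φ t < 0)) ∧
      ∀ t ∈ Ioc (0:ℝ) c, ∀ u ∈ Ioc (0:ℝ) c, t ≤ u → Real.exp (κ * t) * |φ t| ≤ Real.exp (κ * u) * |φ u| := by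
  have hsub' : Ioc (0:ℝ) c ⊆ Icc 0 c := Ioc_subset_Icc_self
  have hcont : ContinuousOn φ (Ioc 0 c) := fun t ht => (hd t (hsub' ht)).continuousAt.continuousWithinAt
  have hs : (∀ t ∈ Ioc (0:ℝ) c, 0 < φ t) ∨ (∀ t ∈ Ioc (0:ℝ) c, φ t < 0) := by
    by_contra hcon
    push Not at hcon
    obtain ⟨⟨t, ht, h1⟩, ⟨u, hu, h2⟩⟩ := hcon
    obtain ⟨w, hw, h3⟩ := isPreconnected_Ioc.intermediate_value ht hu hcont (show (0:ℝ) ∈ Icc (φ t) (φ u) from ⟨h1, h2⟩)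
    exact hp w hw h3
  refine ⟨hs, fun t ht u hu htu => ?_⟩
  rcases hs with hs | hs
  · rw [abs_of_pos (hs t ht), abs_of_pos (hs u hu)]
    exact qmono_pos hc hκ hd h0 hs he hE ha (hsub' ht) (hsub' hu) htu
  · rw [abs_of_neg (hs t ht), abs_of_neg (hs u hu)]
    exact qmono_pos (φ := fun t => - φ t) (φ' := fun t => - φ' t) (a := fun t => - a t) (E := fun t => - E t) hc hκ (fun t ht => (hd t ht).neg) (by simp [h0]) 
      (fun t ht => by linarith [hs t ht]) (fun t ht => by rw [he t ht]; ring) (fun t ht => by simpa using hE t ht) 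
      (ha.symm.imp (fun h t ht => by linarith [h t ht]) (fun h t ht => by linarith [h t ht])) (hsub' ht) (hsub' hu) htu

/-- globally defined vertical derivative -/
def Dv (γ : ℝ × ℝ → ℝ → ℝ) (x : ℝ × ℝ) (t : ℝ) : ℝ := fderiv ℝ (fun p : (ℝ × ℝ) × ℝ => γ p.1 p.2) (x, t) ((0, 1), 0)

section
variable {c₀ A C₀ κ c₁ M : ℝ} {g : ℝ → ℝ} {γ γd γdd γ2 γs γsd γsdd γs2 : ℝ × ℝ → ℝ → ℝ}

lemma Dv_sm (H : CurveHyp c₀ A C₀ κ c₁ M g γ γd γdd γ2) : ContDiff ℝ 1 fun p : (ℝ × ℝ) × ℝ => Dv γ p.1 p.2 := by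
  have h1 : ContDiff ℝ 1 (fderiv ℝ (fun p : (ℝ × ℝ) × ℝ => γ p.1 p.2)) := H.smooth.fderiv_right (m := 1) (by norm_cast)
  exact h1.clm_apply contDiff_const

lemma Dv_der (H : CurveHyp c₀ A C₀ κ c₁ M g γ γd γdd γ2) (x : ℝ × ℝ) (t : ℝ) : HasDerivAt (fun v => γ (x.1, v) t) (Dv γ x t) x.2 := by
  have h1 : HasFDerivAt (fun p : (ℝ × ℝ) × ℝ => γ p.1 p.2) (fderiv ℝ (fun p : (ℝ × ℝ) × ℝ => γ p.1 p.2) (x, t)) ((x.1, x.2), t) := 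
    (H.smooth.differentiable (by simp) _).hasFDerivAt
  have h2 : HasDerivAt (fun v : ℝ => (((x.1, v), t) : (ℝ × ℝ) × ℝ)) ((0, 1), 0) x.2 := 
    ((hasDerivAt_const _ _).prodMk (hasDerivAt_id _)).prodMk (hasDerivAt_const _ _)
  exact HasFDerivAt.comp_hasDerivAt (x.2) h1 h2

lemma Dv_eq (H : CurveHyp c₀ A C₀ κ c₁ M g γ γd γdd γ2) (x : ℝ × ℝ) {t : ℝ} (ht : |t| ≤ c₀) : Dv γ x t = γ2 x t :=
  (Dv_der H x t).unique (H.derivx2 x t ht)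

lemma Dv_one (H : CurveHyp c₀ A C₀ κ c₁ M g γ γd γdd γ2) (x : ℝ × ℝ) : Dv γ x 0 = 1 := by
  refine (Dv_der H x 0).unique ?_
  simp only [CurveHyp.init H]; exact hasDerivAt_id _

lemma Dv_lip (H : CurveHyp c₀ A C₀ κ c₁ M g γ γd γdd γ2) (x y : ℝ × ℝ) {t u : ℝ} (ht : |t| < c₀) (hu : |u| < c₀) : 
    |Dv γ x t - Dv γ y u| ≤ M * ‖((x, t) : (ℝ × ℝ) × ℝ) - (y, u)‖ := by
  have hcv : Convex ℝ ((univ : Set (ℝ × ℝ)) ×ˢ Ioo (-c₀) c₀) := convex_univ.prod (convex_Ioo _ _)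
  have := hcv.norm_image_sub_le_of_norm_fderiv_le (𝕜 := ℝ) (f := fun p : (ℝ × ℝ) × ℝ => Dv γ p.1 p.2) (C := M) (x := (y, u)) (y := (x, t))
    (fun p _ => (Dv_sm H).differentiable one_ne_zero p) (fun p hp => ?_) ⟨mem_univ _, abs_lt.1 hu⟩ ⟨mem_univ _, abs_lt.1 ht⟩
  · exact this
  · obtain ⟨z, w⟩ := p
    have hw : |w| < c₀ := abs_lt.2 hp.2
    have e : (fun p : (ℝ × ℝ) × ℝ => Dv γ p.1 p.2) =ᶠ[nhds (z, w)] fun p => γ2 p.1 p.2 := by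
      have : ∀ᶠ p : (ℝ × ℝ) × ℝ in nhds (z, w), |p.2| < c₀ := 
        (continuous_snd.abs.tendsto (z, w)).eventually (gt_mem_nhds hw)
      exact this.mono fun p hp => Dv_eq H p.1 hp.le
    rw [e.fderiv_eq]
    exact H.g2_grad z w hw.le

lemma M_nn (H : CurveHyp c₀ A C₀ κ c₁ M g γ γd γdd γ2) : 0 ≤ M := 
  (abs_nonneg _).trans (H.g2_upper 0 0 (by simpa using H.c₀_pos.le))

lemma crv_mk (hg : IsDoubling g A) (hC : 1 ≤ C₀) (hκ : 0 ≤ κ) {s J0 : ℕ} {lam : ℕ → ℕ}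
    (hup : ∀ j, J0 ≤ j → ∀ r ∈ Icc (0:ℝ) ((1/2) ^ j), C₀ * g (A * r) ≤ (1/2) ^ lam j)
    (hlow : ∀ j, J0 ≤ j → ∀ t ∈ Ij j, (1/2) ^ lam (j + s) ≤ C₀⁻¹ * g (A⁻¹ * t))
    (hJc : (1/2) ^ J0 < c₀) (hJM : M * (1/2) ^ J0 ≤ 1/2)
    (H : CurveHyp c₀ A C₀ κ c₁ M g γ γd γdd γ2) {σ : ℝ} (hσ : σ = 1 ∨ σ = -1) : 
    Crv κ M s J0 lam (fun x t => γ x (σ * t)) (fun x t => σ * γd x (σ * t)) (fun x t => Dv γ x (σ * t)) := by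
  have hσ1 : |σ| = 1 := by rcases hσ with rfl | rfl <;> simp
  have hab : ∀ t : ℝ, |σ * t| = |t| := fun t => by rw [abs_mul, hσ1, one_mul]
  have hin : ∀ t ∈ Icc (0:ℝ) ((1/2) ^ J0), |σ * t| < c₀ := fun t ht => by
    rw [hab, abs_of_nonneg ht.1]; exact ht.2.trans_lt hJc
  have hM := M_nn H
  have hD : ∀ x, ∀ t ∈ Icc (0:ℝ) ((1/2) ^ J0), |Dv γ x (σ * t) - 1| ≤ 1/2 := fun x t ht => by
    have h1 := Dv_lip H x x (hin t ht) (u := 0) (by simpa using H.c₀_pos)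
    rw [Dv_one H] at h1
    refine h1.trans (le_trans (mul_le_mul_of_nonneg_left ?_ hM) hJM)
    simp only [Prod.mk_sub_mk, sub_self, sub_zero, Prod.norm_mk, norm_zero, Real.norm_eq_abs, hab, abs_of_nonneg ht.1]
    exact max_le (by positivity) ht.2
  have hA0 : 0 < A := by linarith [hg.A_ge_one]
  obtain ⟨a, E, q1, q2, q3, q4⟩ := H.qm
  have hτ : (0:ℝ) < (1/2) ^ J0 := by positivity
  have hqm := fun x : ℝ × ℝ => qmono (φ := fun t => σ * γd x (σ * t)) (φ' := fun t => γdd x (σ * t)) (a := fun t => a x (σ * t)) (E := fun t => E x (σ * t))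
    (c := (1/2) ^ J0) (κ := κ) hτ hκ (fun t ht => by
      have h1 := (H.deriv2 x (σ * t) (hin t ht).le)
      have h2 : HasDerivAt (fun t => σ * t) σ t := by simpa using (hasDerivAt_id t).const_mul σ
      have h3 := (HasDerivAt.comp t h1 h2).const_mul σ
      exact h3.congr_deriv (by rcases hσ with rfl | rfl <;> ring)) (by simp [H.initd]) (fun t ht => by
      have h1 := (H.dbl x (σ * t) (hin t (Ioc_subset_Icc_self ht)).le).1
      have h2 : 0 < C₀⁻¹ * g (A⁻¹ * |σ * t|) := by
        refine mul_pos (by positivity) (hg.pos _ ?_)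
        rw [hab, abs_of_pos ht.1]; exact mul_pos (by positivity) ht.1
      have h3 := abs_pos.1 (h2.trans_le h1)
      refine mul_ne_zero ?_ h3
      rcases hσ with rfl | rfl <;> norm_num) (fun t ht => q1 x _ (hin t ht).le) (fun t ht => by
        rw [abs_mul, hσ1, one_mul]; exact q2 x _ (hin t ht).le) (by
      rcases hσ with rfl | rfl
      · refine (q3 x).imp (fun h t ht => ?_) (fun h t ht => ?_)
        · simpa using h t ⟨ht.1, ht.2.trans hJc.le⟩
        · simpa using h t ⟨ht.1, ht.2.trans hJc.le⟩
      · refine (q4 x).imp (fun h t ht => ?_) (fun h t ht => ?_)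
        · exact h (-1 * t) ⟨by linarith [ht.2], by linarith [ht.1]⟩
        · exact h (-1 * t) ⟨by linarith [ht.2], by linarith [ht.1]⟩)
  exact {
    κ0 := hκ
    M0 := hM
    cont := H.smooth.continuous.comp (by fun_prop : Continuous fun q : (ℝ × ℝ) × ℝ => (q.1, σ * q.2))
    cont2 := (Dv_sm H).continuous.comp (by fun_prop : Continuous fun q : (ℝ × ℝ) × ℝ => (q.1, σ * q.2))
    ini0 := fun x => by simp [CurveHyp.init H]
    d1 := fun x t ht => by
      have h2 : HasDerivAt (fun t => σ * t) σ t := by simpa using (hasDerivAt_id t).const_mul σ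
      have h3 := HasDerivAt.comp t (H.deriv1 x (σ * t) (hin t ht).le) h2
      exact h3.congr_deriv (by ring)
    d2 := fun x t ht => Dv_der H x (σ * t)
    dc := fun x => by
      refine ContinuousOn.mul continuousOn_const fun t ht => ?_
      exact ((H.deriv2 x (σ * t) (hin t ht).le).continuousAt.comp (f := fun t => σ * t) (by fun_prop)).continuousWithinAt
    lo2 := fun x t ht => by linarith [(abs_le.1 (hD x t ht)).1]
    hi2 := fun x t ht => by linarith [(abs_le.1 (hD x t ht)).2]
    lipv := fun b v w t ht => by
      have h1 := Dv_lip H (b, v) (b, w) (hin t ht) (hin t ht)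
      simpa [Prod.norm_mk] using h1
    lipt := fun x t ht u hu => by
      have h1 := Dv_lip H x x (hin t ht) (hin u hu)
      simpa [Prod.norm_mk, ← mul_sub, abs_mul, hσ1] using h1
    one := fun x => by simp [Dv_one H]
    sgn := fun x => (hqm x).1
    qm := fun x => (hqm x).2
    up := fun j hj x t ht => by
      rw [abs_mul, hσ1, one_mul]
      refine le_trans (H.dbl x (σ * t) (hin t ⟨ht.1, ht.2.trans (half_pow_anti hj)⟩).le).2 ?_
      rw [hab, abs_of_nonneg ht.1]; exact hup j hj t ht
    low := fun j hj x t ht => by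
      rw [abs_mul, hσ1, one_mul]
      refine le_trans ?_ (H.dbl x (σ * t) (hin t (Ij_sub hj ht)).le).1
      rw [hab, abs_of_pos (Ij_pos j ht)]; exact hlow j hj t ht }

/-- everything packed -/
theorem pair_ex (hg : IsDoubling g A) (hC : 1 ≤ C₀) (hκ : 0 ≤ κ) (hc : 0 < c₀) (M c₁ : ℝ) {ε : ℝ} (hε : 0 < ε) : ∃ (s J0 : ℕ) (lam : ℕ → ℕ), (1/2) ^ J0 < c₀ ∧ (1/2) ^ J0 < ε ∧
    ∀ γ γd γdd γ2 γs γsd γsdd γs2, CurveHyp c₀ A C₀ κ c₁ M g γ γd γdd γ2 → CurveHyp c₀ A C₀ κ c₁ M g γs γsd γsdd γs2 → 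
    (∀ (x : ℝ × ℝ) (t : ℝ), |t| ≤ c₀ → γs (x.1 - t, γ x t) t = x.2) →
    (∀ (y : ℝ × ℝ) (t : ℝ), |t| ≤ c₀ → γ (y.1 + t, γs y t) t = y.2) → ∀ σ : ℝ, σ = 1 ∨ σ = -1 →
    Pair κ M s J0 lam σ (fun x t => γ x (σ * t)) (fun x t => σ * γd x (σ * t)) (fun x t => Dv γ x (σ * t)) 
      (fun x t => γs x (σ * t)) (fun x t => σ * γsd x (σ * t)) (fun x t => Dv γs x (σ * t)) := by
  obtain ⟨s, J1, lam, h⟩ := lam_ex hg hC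
  have hpos : 0 < min (min c₀ ε) (1 / (2 * (|M| + 1))) := by positivity
  obtain ⟨J2, hJ2⟩ := exists_pow_lt_of_lt_one hpos (show (1/2:ℝ) < 1 by norm_num)
  obtain ⟨h1, h2, h3⟩ := h (max J1 J2) (le_max_left _ _)
  have h4 : (1/2:ℝ) ^ max J1 J2 < min (min c₀ ε) (1 / (2 * (|M| + 1))) := (half_pow_anti (le_max_right _ _)).trans_lt hJ2
  have h5 := h4.trans_le (min_le_left _ _)
  have h6 := h4.trans_le (min_le_right _ _)
  have hJc := h5.trans_le (min_le_left _ _)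
  have hJM : M * (1/2:ℝ) ^ max J1 J2 ≤ 1/2 := by
    have h7 : M * (1/2:ℝ) ^ max J1 J2 ≤ |M| * (1/2:ℝ) ^ max J1 J2 := mul_le_mul_of_nonneg_right (le_abs_self _) (by positivity)
    rw [lt_div_iff₀ (by positivity)] at h6
    have h8 : 0 < (1/2:ℝ) ^ max J1 J2 := by positivity
    nlinarith
  refine ⟨s, max J1 J2, lam, hJc, h5.trans_le (min_le_right _ _), fun γ γd γdd γ2 γs γsd γsdd γs2 H Hs i1 i2 σ hσ => ?_⟩
  have hσ1 : |σ| = 1 := by rcases hσ with rfl | rfl <;> simp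
  have hin : ∀ t ∈ Icc (0:ℝ) ((1/2) ^ max J1 J2), |σ * t| ≤ c₀ := fun t ht => by
    rw [abs_mul, hσ1, one_mul, abs_of_nonneg ht.1]; exact ht.2.trans hJc.le
  exact {
    hσ := hσ1
    l := h1
    c := crv_mk hg hC hκ h2 h3 hJc hJM H hσ
    cs := crv_mk hg hC hκ h2 h3 hJc hJM Hs hσ
    inv := fun x t ht => i1 x (σ * t) (hin t ht)
    inv' := fun y t ht => i2 y (σ * t) (hin t ht) }

end
end TB
end

section
namespace TB

/-- extended `L^p` norm -/
def EN (p : ℝ) (k : ℝ × ℝ → ℝ≥0∞) : ℝ≥0∞ := (∫⁻ x, k x ^ p) ^ (1 / p)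

lemma EN_mono {p : ℝ} (hp : 0 < p) {k l : ℝ × ℝ → ℝ≥0∞} (h : ∀ x, k x ≤ l x) : EN p k ≤ EN p l :=
  ENNReal.rpow_le_rpow (lintegral_mono fun x => ENNReal.rpow_le_rpow (h x) hp.le) (by positivity)

lemma EN_add {p : ℝ} (hp : 1 ≤ p) {k l : ℝ × ℝ → ℝ≥0∞} (hk : Measurable k) (hl : Measurable l) :
    EN p (fun x => k x + l x) ≤ EN p k + EN p l :=
  ENNReal.lintegral_Lp_add_le hk.aemeasurable hl.aemeasurable hp

lemma EN_cmul {p : ℝ} (hp : 0 < p) (c : ℝ≥0∞) {k : ℝ × ℝ → ℝ≥0∞} (hk : Measurable k) :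
    EN p (fun x => c * k x) = c * EN p k := by
  unfold EN
  simp_rw [ENNReal.mul_rpow_of_nonneg _ _ hp.le]
  rw [lintegral_const_mul _ (hk.pow_const p), ENNReal.mul_rpow_of_nonneg _ _ (by positivity), ← ENNReal.rpow_mul,
    mul_one_div_cancel hp.ne', ENNReal.rpow_one]

lemma EN_dd {p : ℝ} (hp : 0 < p) (u : DD) : EN p (fun x => ENNReal.ofReal |u x|) = ENNReal.ofReal (N p u) := by
  unfold EN N
  rw [← ENNReal.ofReal_rpow_of_nonneg (int_rpow_nonneg p u) (by positivity),
    ofReal_integral_eq_lintegral_ofReal ((dD u).rpow hp).integrable (Eventually.of_forall fun x => Real.rpow_nonneg (abs_nonneg _) _)]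
  congr 1
  refine lintegral_congr fun x => ?_
  rw [ENNReal.ofReal_rpow_of_nonneg (abs_nonneg _) hp.le]

lemma EN_iSup {p : ℝ} (hp : 0 < p) {k : ℕ → ℝ × ℝ → ℝ≥0∞} (hk : ∀ n, Measurable (k n)) (hm : Monotone k) {c : ℝ≥0∞}
    (h : ∀ n, EN p (k n) ≤ c) : EN p (fun x => ⨆ n, k n x) ≤ c := by
  have e : ∀ x, (⨆ n, k n x) ^ p = ⨆ n, k n x ^ p := fun x => by
    have := (ENNReal.orderIsoRpow p hp).map_iSup (fun n => k n x)
    exact this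
  unfold EN at *
  simp_rw [e]
  rw [lintegral_iSup (fun n => (hk n).pow_const p) (fun a b hab x => ENNReal.rpow_le_rpow (hm hab x) hp.le)]
  rw [one_div, ENNReal.rpow_inv_le_iff hp]
  refine iSup_le fun n => ?_
  have := h n
  rwa [one_div, ENNReal.rpow_inv_le_iff hp] at this

section
variable {c₀ A C₀ κ c₁ M : ℝ} {g : ℝ → ℝ} {γ γd γdd γ2 γs γsd γsdd γs2 : ℝ × ℝ → ℝ → ℝ}

lemma curve_cont (H : CurveHyp c₀ A C₀ κ c₁ M g γ γd γdd γ2) : Continuous fun q : (ℝ × ℝ) × ℝ => (q.1.1 - q.2, γ q.1 q.2) := 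
  (by fun_prop : Continuous fun q : (ℝ × ℝ) × ℝ => q.1.1 - q.2).prodMk H.smooth.continuous

lemma jac (H : CurveHyp c₀ A C₀ κ c₁ M g γ γd γdd γ2) (Hs : CurveHyp c₀ A C₀ κ c₁ M g γs γsd γsdd γs2)
    (i1 : ∀ (x : ℝ × ℝ) (t : ℝ), |t| ≤ c₀ → γs (x.1 - t, γ x t) t = x.2)
    (i2 : ∀ (y : ℝ × ℝ) (t : ℝ), |t| ≤ c₀ → γ (y.1 + t, γs y t) t = y.2) {t : ℝ} (ht : |t| ≤ c₀)
    {k : ℝ × ℝ → ℝ≥0∞} (hk : Measurable k) : 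
    ∫⁻ x : ℝ × ℝ, k (x.1 - t, γ x t) ≤ ENNReal.ofReal M * ∫⁻ x, k x := by
  have hm : Measurable fun x : ℝ × ℝ => k (x.1 - t, γ x t) := hk.comp
    ((curve_cont H).comp (continuous_id.prodMk continuous_const)).measurable
  rw [Measure.volume_eq_prod, lintegral_prod _ hm.aemeasurable, lintegral_prod _ hk.aemeasurable]
  have step : ∀ a : ℝ, ∫⁻ v, k (a - t, γ (a, v) t) ≤ ENNReal.ofReal M * ∫⁻ w, k (a - t, w) := fun a => by
    have hinj : InjOn (fun w => γs (a - t, w) t) univ := fun w _ w' _ h => by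
      have e1 := i2 (a - t, w) t ht
      have e2 := i2 (a - t, w') t ht
      simp only at h e1 e2
      rw [← e1, h, e2]
    have himg : (fun w => γs (a - t, w) t) '' univ = univ := by
      rw [image_univ, range_eq_univ]
      exact fun v => ⟨γ (a, v) t, i1 (a, v) t ht⟩
    have h1 := lintegral_image_eq_lintegral_abs_deriv_mul (s := univ) (f := fun w => γs (a - t, w) t) (f' := fun w => γs2 (a - t, w) t) MeasurableSet.univ
      (fun w _ => (Hs.derivx2 (a - t, w) t ht).hasDerivWithinAt) hinj (fun v => k (a - t, γ (a, v) t))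
    rw [himg, Measure.restrict_univ] at h1
    rw [h1, ← lintegral_const_mul' _ _ ENNReal.ofReal_ne_top]
    refine lintegral_mono fun w => ?_
    have e1 := i2 (a - t, w) t ht
    simp only [sub_add_cancel] at e1
    simp only [e1]
    gcongr
    exact Hs.g2_upper _ _ ht
  refine (lintegral_mono step).trans ?_
  rw [lintegral_const_mul' _ _ ENNReal.ofReal_ne_top]
  refine mul_le_mul_right ?_ _
  exact (lintegral_sub_right_eq_self (μ := (volume : Measure ℝ)) (fun a => ∫⁻ w, k (a, w)) t).le

/-- the averaged operator over the whole interval -/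
def Pav (ε : ℝ) (γ : ℝ × ℝ → ℝ → ℝ) (k : ℝ × ℝ → ℝ≥0∞) (x : ℝ × ℝ) : ℝ≥0∞ := ∫⁻ t in Icc (-ε) ε, k (x.1 - t, γ x t)

lemma Pav_meas (H : CurveHyp c₀ A C₀ κ c₁ M g γ γd γdd γ2) {k : ℝ × ℝ → ℝ≥0∞} (hk : Measurable k) (ε : ℝ) : Measurable (Pav ε γ k) := 
  Measurable.lintegral_prod_right' (f := fun q : (ℝ × ℝ) × ℝ => k (q.1.1 - q.2, γ q.1 q.2)) (hk.comp (curve_cont H).measurable)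

lemma Pav_bd (H : CurveHyp c₀ A C₀ κ c₁ M g γ γd γdd γ2) (Hs : CurveHyp c₀ A C₀ κ c₁ M g γs γsd γsdd γs2)
    (i1 : ∀ (x : ℝ × ℝ) (t : ℝ), |t| ≤ c₀ → γs (x.1 - t, γ x t) t = x.2)
    (i2 : ∀ (y : ℝ × ℝ) (t : ℝ), |t| ≤ c₀ → γ (y.1 + t, γs y t) t = y.2) {ε : ℝ} (hεc : ε ≤ c₀)
    {k : ℝ × ℝ → ℝ≥0∞} (hk : Measurable k) {p : ℝ} (hp : 1 < p) : 
    EN p (Pav ε γ k) ≤ (ENNReal.ofReal (2 * ε) ^ (p - 1) * (ENNReal.ofReal M * ENNReal.ofReal (2 * ε))) ^ (1 / p) * EN p k := by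
  have hp0 : 0 < p := by linarith
  have hvol : (volume.restrict (Icc (-ε) ε)) univ = ENNReal.ofReal (2 * ε) := by
    rw [Measure.restrict_apply_univ, Real.volume_Icc]; congr 1; ring
  have hmk : Measurable fun q : (ℝ × ℝ) × ℝ => k (q.1.1 - q.2, γ q.1 q.2) := hk.comp (curve_cont H).measurable
  have hpq : p.HolderConjugate (Real.conjExponent p) := Real.HolderConjugate.conjExponent hp
  have h1 : ∀ x, Pav ε γ k x ^ p ≤ ENNReal.ofReal (2 * ε) ^ (p - 1) * ∫⁻ t in Icc (-ε) ε, k (x.1 - t, γ x t) ^ p := fun x => by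
    have h2 := ENNReal.lintegral_mul_le_Lp_mul_Lq (volume.restrict (Icc (-ε) ε)) hpq
      (f := fun t => k (x.1 - t, γ x t)) (g := fun _ => 1) (hmk.comp measurable_prodMk_left).aemeasurable aemeasurable_const
    simp only [Pi.mul_apply, mul_one, ENNReal.one_rpow, lintegral_const, one_mul, hvol] at h2
    have h3 := ENNReal.rpow_le_rpow h2 hp0.le
    rw [ENNReal.mul_rpow_of_nonneg _ _ hp0.le, ← ENNReal.rpow_mul, ← ENNReal.rpow_mul, one_div_mul_cancel hp0.ne', ENNReal.rpow_one, mul_comm] at h3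
    refine h3.trans (le_of_eq ?_)
    congr 2
    have := hpq.sub_one_mul_conj
    have hq := hpq.symm.pos.ne'
    field_simp
    linarith
  unfold EN
  rw [← ENNReal.mul_rpow_of_nonneg _ _ (by positivity)]
  refine ENNReal.rpow_le_rpow ?_ (by positivity)
  refine (lintegral_mono h1).trans ?_
  rw [lintegral_const_mul' _ _ (ENNReal.rpow_ne_top_of_nonneg (by linarith) ENNReal.ofReal_ne_top), mul_assoc]
  gcongr
  rw [lintegral_lintegral_swap (f := fun (x : ℝ × ℝ) t => k (x.1 - t, γ x t) ^ p) (hmk.pow_const p).aemeasurable]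
  have h4 : ∀ t ∈ Icc (-ε) ε, ∫⁻ x : ℝ × ℝ, k (x.1 - t, γ x t) ^ p ≤ ENNReal.ofReal M * ∫⁻ x, k x ^ p := fun t ht =>
    jac H Hs i1 i2 ((abs_le.2 ht).trans hεc) (hk.pow_const p)
  refine (setLIntegral_mono' measurableSet_Icc h4).trans ?_
  rw [lintegral_const, hvol]
  exact le_of_eq (by ring)

end
end TB
end

section
namespace TB

lemma dy_sum {u : ℝ → ℝ≥0∞} {m : ℝ≥0∞} {J0 : ℕ} (hu : ∀ j, J0 ≤ j → ∫⁻ t in Ij j, u t ≤ ENNReal.ofReal ((1/2) ^ j) * m)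
    {h : ℝ} (h0 : 0 < h) (h1 : h < (1/2) ^ J0) : ∫⁻ t in Ioo 0 h, u t ≤ ENNReal.ofReal (4 * h) * m := by
  obtain ⟨j, hj1, hj2⟩ := exists_nat_pow_near_of_lt_one h0 (h1.le.trans (half_pow_le _)) (show (0:ℝ) < 1/2 by norm_num) (show (1/2:ℝ) < 1 by norm_num)
  have hj : J0 ≤ j := by
    by_contra hc
    push Not at hc
    exact absurd (hj1.trans h1) (not_lt.2 (half_pow_anti hc))
  have hsub : Ioo 0 h ⊆ ⋃ i : ℕ, Ij (j + i) := fun t ht => by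
    have ht1 : t < (1/2) ^ j := ht.2.trans_le hj2
    obtain ⟨n, hn1, hn2⟩ := exists_nat_pow_near_of_lt_one ht.1 (ht1.le.trans (half_pow_le _)) (show (0:ℝ) < 1/2 by norm_num) (show (1/2:ℝ) < 1 by norm_num)
    have hjn : j ≤ n := by
      by_contra hc
      push Not at hc
      exact absurd (hn1.trans ht1) (not_lt.2 (half_pow_anti hc))
    rcases hn2.lt_or_eq with hlt | heq
    · exact mem_iUnion.2 ⟨n - j, by rw [Nat.add_sub_cancel' hjn]; exact ⟨hn1.le, hlt⟩⟩
    · have hne : j ≠ n := by rintro rfl; exact absurd heq ht1.ne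
      refine mem_iUnion.2 ⟨n - 1 - j, ?_⟩
      rw [show j + (n - 1 - j) = n - 1 by omega]
      refine ⟨by rw [show n - 1 + 1 = n by omega, heq], ?_⟩
      rw [heq]
      exact pow_lt_pow_right_of_lt_one₀ (by norm_num) (by norm_num) (by omega)
  calc ∫⁻ t in Ioo 0 h, u t ≤ ∫⁻ t in ⋃ i : ℕ, Ij (j + i), u t := lintegral_mono_set hsub
    _ ≤ ∑' i : ℕ, ∫⁻ t in Ij (j + i), u t := lintegral_iUnion_le _ _
    _ ≤ ∑' i : ℕ, ENNReal.ofReal ((1/2) ^ j * (1/2) ^ i) * m := by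
        refine ENNReal.tsum_le_tsum fun i => ?_
        rw [← pow_add]
        exact hu _ (by omega)
    _ = ENNReal.ofReal ((1/2) ^ j * 2) * m := by
        rw [ENNReal.tsum_mul_right, ← ENNReal.ofReal_tsum_of_nonneg (fun _ => by positivity) (summable_geometric_two.mul_left _), tsum_mul_left, tsum_geometric_two]
    _ ≤ _ := by
        refine mul_le_mul_left (ENNReal.ofReal_le_ofReal ?_) _
        rw [pow_succ] at hj1
        linarith

lemma lint_sym (w : ℝ → ℝ≥0∞) (h : ℝ) : ∫⁻ t in Icc (-h) h, w t ≤ (∫⁻ t in Ioo 0 h, w t) + ∫⁻ t in Ioo 0 h, w (-t) := by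
  have hsub : Icc (-h) h ⊆ (Ioo 0 h ∪ Neg.neg ⁻¹' Ioo 0 h) ∪ {0, h, -h} := fun t ht => by
    rcases lt_trichotomy t 0 with h1 | h1 | h1
    · rcases ht.1.lt_or_eq with h2 | h2
      · exact Or.inl (Or.inr ⟨by simpa using h1, by show -t < h; linarith⟩)
      · exact Or.inr (by simp [← h2])
    · exact Or.inr (by simp [h1])
    · rcases ht.2.lt_or_eq with h2 | h2
      · exact Or.inl (Or.inl ⟨h1, h2⟩)
      · exact Or.inr (by simp [← h2])
  have e0 : ∫⁻ t in ({0, h, -h} : Set ℝ), w t = 0 := setLIntegral_measure_zero _ _ (Set.Finite.measure_zero (by simp) _)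
  have e1 : ∫⁻ t in Neg.neg ⁻¹' Ioo 0 h, w t = ∫⁻ t in Ioo 0 h, w (-t) := by
    have := (Measure.measurePreserving_neg (volume : Measure ℝ)).setLIntegral_comp_preimage_emb (MeasurableEquiv.neg ℝ).measurableEmbedding (fun t => w (-t)) (Ioo 0 h)
    simpa using this
  calc _ ≤ ∫⁻ t in (Ioo 0 h ∪ Neg.neg ⁻¹' Ioo 0 h) ∪ {0, h, -h}, w t := lintegral_mono_set hsub
    _ ≤ (∫⁻ t in (Ioo 0 h ∪ Neg.neg ⁻¹' Ioo 0 h), w t) + ∫⁻ t in ({0, h, -h} : Set ℝ), w t := lintegral_union_le _ _ _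
    _ ≤ _ := by
      rw [e0, add_zero, ← e1]
      exact lintegral_union_le _ _ _

section
variable {κ M : ℝ} {s J0 : ℕ} {lam : ℕ → ℕ} {σ : ℝ} {γ γd γ2 γs γsd γs2 : ℝ × ℝ → ℝ → ℝ}

lemma tt_lint (h : Pair κ M s J0 lam σ γ γd γ2 γs γsd γs2) (F : DD) {j : ℕ} (hj : J0 ≤ j) (x : ℝ × ℝ) :
    ∫⁻ t in Ij j, ENNReal.ofReal |F (Gm σ γ x t)| ≤ ENNReal.ofReal ((1/2) ^ j) * ENNReal.ofReal (TT σ γ j (dabs F) x) := by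
  have ok := h.c.ok (Wt.one J0 h.c.M0) h.hσ hj
  rw [TT, mkAv_val ok, ofReal_integral_eq_lintegral_ofReal (ok.intble (dabs F) x) (by
    refine (ae_restrict_mem (Ij_meas j)).mono fun t ht => ?_
    have := (Ij_pos j ht).le
    simp only [dabs, one_mul, Pi.zero_apply]
    positivity), ← lintegral_const_mul' _ _ ENNReal.ofReal_ne_top]
  refine setLIntegral_mono' (Ij_meas j) fun t ht => ?_
  rw [← ENNReal.ofReal_mul (by positivity)]
  refine ENNReal.ofReal_le_ofReal ?_
  have h1 := Ij_pos j ht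
  have h2 : 1 ≤ (1/2) ^ j * t⁻¹ := by rw [← div_eq_mul_inv, one_le_div h1]; exact (Ij_hi j ht).le
  simp only [dabs, one_mul]
  rw [← mul_assoc]
  exact le_mul_of_one_le_left (abs_nonneg _) h2

/-- full dyadic maximal function -/
def MX (J0 : ℕ) (σ : ℝ) (γ : ℝ × ℝ → ℝ → ℝ) (F : DD) (x : ℝ × ℝ) : ℝ≥0∞ :=
  ⨆ n, ENNReal.ofReal (dsup (Finset.Ico J0 (J0 + n)) (fun j => TT σ γ j (dabs F)) x)

lemma MX_meas (F : DD) : Measurable (MX J0 σ γ F) := Measurable.iSup fun _ => (dM _).ennreal_ofReal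

lemma MX_le (F : DD) {j : ℕ} (hj : J0 ≤ j) (x) : ENNReal.ofReal (TT σ γ j (dabs F) x) ≤ MX J0 σ γ F x := 
  le_iSup_of_le (j + 1 - J0) (ENNReal.ofReal_le_ofReal ((le_abs_self _).trans 
    (le_dsup _ (fun j => TT σ γ j (dabs F)) x (Finset.mem_Ico.2 ⟨hj, by omega⟩))))

lemma MX_bd {p C : ℝ} (hp : 1 < p) 
    (hC : ∀ J : Finset ℕ, (∀ j ∈ J, J0 ≤ j) → ∀ f : DD, N p (dsup J fun j => TT σ γ j (dabs f)) ≤ C * N p f) (F : DD) :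
    EN p (MX J0 σ γ F) ≤ ENNReal.ofReal (C * N p F) := by
  refine EN_iSup (by linarith) (fun n => (dM _).ennreal_ofReal) (fun a b hab x => ?_) fun n => ?_
  · refine ENNReal.ofReal_le_ofReal (dsup_le _ _ _ (dsup_nonneg _ _ _) fun i hi => le_dsup _ (fun j => TT σ γ j (dabs F)) _ ?_)
    rw [Finset.mem_Ico] at *
    omega
  · have h1 := EN_dd (p := p) (by linarith) (dsup (Finset.Ico J0 (J0 + n)) (fun j => TT σ γ j (dabs F)))
    simp_rw [abs_of_nonneg (dsup_nonneg _ _ _)] at h1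
    rw [h1]
    exact ENNReal.ofReal_le_ofReal (hC _ (fun j hj => (Finset.mem_Ico.1 hj).1) F)

lemma MX_half (h : Pair κ M s J0 lam σ γ γd γ2 γs γsd γs2) (F : DD) (x : ℝ × ℝ) {r : ℝ} (h0 : 0 < r) (h1 : r < (1/2) ^ J0) : 
    ∫⁻ t in Ioo 0 r, ENNReal.ofReal |F (Gm σ γ x t)| ≤ ENNReal.ofReal (4 * r) * MX J0 σ γ F x := 
  dy_sum (fun _ hj => (tt_lint h F hj x).trans (by gcongr; exact MX_le F hj x)) h0 h1
end

lemma max_pt {κ M : ℝ} {s J0 : ℕ} {lam : ℕ → ℕ} {γ γd γ2 γs γsd γs2 γd' γ2' γs' γsd' γs2' : ℝ × ℝ → ℝ → ℝ}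
    (h : Pair κ M s J0 lam 1 (fun x t => γ x (1 * t)) γd γ2 γs γsd γs2) (h' : Pair κ M s J0 lam (-1) (fun x t => γ x (-1 * t)) γd' γ2' γs' γsd' γs2')
    (F : DD) {ε r : ℝ} (h0 : 0 < r) (h1 : r < ε) (x : ℝ × ℝ) : 
    (ENNReal.ofReal (2 * r))⁻¹ * ∫⁻ t in Icc (-r) r, ENNReal.ofReal |F (x.1 - t, γ x t)| ≤
      2 * (MX J0 1 (fun x t => γ x (1 * t)) F x + MX J0 (-1) (fun x t => γ x (-1 * t)) F x) + 
        ENNReal.ofReal (2 ^ J0) * Pav ε γ (fun x => ENNReal.ofReal |F x|) x := by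
  have hr : ENNReal.ofReal (2 * r) ≠ 0 := by simpa using h0
  rw [ENNReal.inv_mul_le_iff hr ENNReal.ofReal_ne_top]
  rcases lt_or_ge r ((1/2) ^ J0) with h2 | h2
  · refine (lint_sym _ r).trans ?_
    have e1 := MX_half h F x h0 h2
    have e2 := MX_half h' F x h0 h2
    simp only [Gm, one_mul, neg_mul, sub_neg_eq_add] at e1 e2
    simp only [one_mul, neg_mul, sub_neg_eq_add]
    refine (add_le_add e1 e2).trans ?_
    rw [← mul_add, mul_add (ENNReal.ofReal (2 * r)), ← mul_assoc, show ENNReal.ofReal (2 * r) * 2 = ENNReal.ofReal (4 * r) by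
      rw [show (2:ℝ≥0∞) = ENNReal.ofReal 2 by simp, ← ENNReal.ofReal_mul (by positivity)]; congr 1; ring]
    exact le_self_add
  · rw [mul_add, ← mul_assoc (ENNReal.ofReal (2 * r)) (ENNReal.ofReal (2 ^ J0)), ← ENNReal.ofReal_mul (by positivity)]
    refine le_trans ?_ le_add_self
    have h3 : 1 ≤ ENNReal.ofReal (2 * r * 2 ^ J0) := by
      rw [ENNReal.one_le_ofReal]
      have : (1/2:ℝ) ^ J0 * 2 ^ J0 = 1 := by rw [← mul_pow]; norm_num
      nlinarith [show (0:ℝ) < 2 ^ J0 by positivity]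
    refine le_trans ?_ (le_mul_of_one_le_left zero_le h3)
    exact lintegral_mono_set (Icc_subset_Icc (by linarith) h1.le)

end TB
end

section
namespace TB

/-- truncation region -/
def SR (J0 n : ℕ) : Set ℝ := {t | (1/2:ℝ) ^ n ≤ |t| ∧ |t| < (1/2:ℝ) ^ J0}

lemma SR_meas (J0 n : ℕ) : MeasurableSet (SR J0 n) := 
  (measurableSet_le measurable_const continuous_abs.measurable).inter (measurableSet_lt continuous_abs.measurable measurable_const)

lemma SR_sub (J0 n : ℕ) : SR J0 n ⊆ Icc (-1) 1 := fun _ ht => abs_le.1 (ht.2.le.trans (half_pow_le _))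

lemma SR_fin (J0 n : ℕ) : volume (SR J0 n) ≠ ⊤ := 
  ((measure_mono (SR_sub J0 n)).trans_lt (by simp)).ne

lemma SR_inv {J0 n : ℕ} {t : ℝ} (ht : t ∈ SR J0 n) : |t⁻¹| ≤ 2 ^ n := by
  rw [abs_inv]
  have := inv_anti₀ (by positivity) ht.1
  simpa using this

lemma SR_intble {E : Type*} [NormedAddCommGroup E] [NormedSpace ℝ E] {Φ : ℝ → E} (hΦ : AEStronglyMeasurable Φ volume) {B : ℝ} (hB : ∀ t, ‖Φ t‖ ≤ B) (J0 n : ℕ) :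
    IntegrableOn (fun t => t⁻¹ • Φ t) (SR J0 n) := by
  refine Measure.integrableOn_of_bounded (SR_fin J0 n) (measurable_inv.aestronglyMeasurable.smul hΦ) (M := 2 ^ n * B) ?_
  refine (ae_restrict_mem (SR_meas J0 n)).mono fun t ht => ?_
  rw [norm_smul, Real.norm_eq_abs]
  exact mul_le_mul (SR_inv ht) (hB t) (norm_nonneg _) (by positivity)

lemma SR_succ {J0 n : ℕ} (h : J0 ≤ n) : SR J0 (n + 1) = SR J0 n ∪ (Ij n ∪ Neg.neg ⁻¹' Ij n) := by
  ext t
  have h1 : (1/2:ℝ) ^ n ≤ (1/2) ^ J0 := half_pow_anti h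
  have h2 : (1/2:ℝ) ^ (n+1) ≤ (1/2) ^ n := half_pow_anti (by omega)
  have h3 : (0:ℝ) < (1/2) ^ (n+1) := by positivity
  simp only [SR, Ij, mem_union, mem_ofPred_eq, mem_Ico, mem_preimage]
  rcases abs_cases t with ⟨e, e'⟩ | ⟨e, e'⟩ <;> rw [e]
  · constructor
    · rintro ⟨a, b⟩
      rcases le_or_gt ((1/2) ^ n) t with c | c
      · exact Or.inl ⟨c, b⟩
      · exact Or.inr (Or.inl ⟨a, c⟩)
    · rintro (⟨a, b⟩ | ⟨a, b⟩ | ⟨a, b⟩)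
      · exact ⟨h2.trans a, b⟩
      · exact ⟨a, b.trans_le h1⟩
      · linarith
  · constructor
    · rintro ⟨a, b⟩
      rcases le_or_gt ((1/2) ^ n) (-t) with c | c
      · exact Or.inl ⟨c, b⟩
      · exact Or.inr (Or.inr ⟨a, c⟩)
    · rintro (⟨a, b⟩ | ⟨a, b⟩ | ⟨a, b⟩)
      · exact ⟨h2.trans a, b⟩
      · linarith
      · exact ⟨a, b.trans_le h1⟩

lemma SR_sum {J0 : ℕ} {Φ : ℝ → ℝ} (hΦ : Measurable Φ) {B : ℝ} (hB : ∀ t, ‖Φ t‖ ≤ B) {n : ℕ} (hn : J0 ≤ n) :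
    ∫ t in SR J0 n, t⁻¹ * Φ t = ∑ j ∈ Finset.Ico J0 n, ((∫ t in Ij j, t⁻¹ * Φ t) - ∫ t in Ij j, t⁻¹ * Φ (-t)) := by
  induction n, hn using Nat.le_induction with
  | base => 
    have : SR J0 J0 = ∅ := by
      ext t; simp [SR]
    simp [this]
  | succ n hn ih =>
    have hI := SR_intble hΦ.aestronglyMeasurable hB J0 (n + 1)
    simp only [smul_eq_mul] at hI
    have hmn : MeasurableSet (Neg.neg ⁻¹' Ij n) := measurable_neg (Ij_meas n)
    have e := SR_succ hn
    rw [e] at hI ⊢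
    have d1 : Disjoint (Ij n) (Neg.neg ⁻¹' Ij n) := disjoint_left.2 fun t h1 h2 => by
      have := Ij_pos n h1
      have := Ij_pos n h2
      linarith
    have d2 : Disjoint (SR J0 n) (Ij n ∪ Neg.neg ⁻¹' Ij n) := disjoint_left.2 fun t h1 h2 => by
      have h3 := h1.1
      rcases h2 with h2 | h2
      · rw [abs_of_pos (Ij_pos n h2)] at h3
        exact absurd (Ij_hi n h2) (not_lt.2 h3)
      · rw [← abs_neg, abs_of_pos (Ij_pos n h2)] at h3
        exact absurd (Ij_hi n h2) (not_lt.2 h3)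
    rw [setIntegral_union d2 ((Ij_meas n).union hmn) hI.left_of_union hI.right_of_union,
      setIntegral_union d1 hmn hI.right_of_union.left_of_union hI.right_of_union.right_of_union, ih, Finset.sum_Ico_succ_top hn]
    have e1 : ∫ t in Neg.neg ⁻¹' Ij n, t⁻¹ * Φ t = - ∫ t in Ij n, t⁻¹ * Φ (-t) := by
      have := (Measure.measurePreserving_neg (volume : Measure ℝ)).setIntegral_preimage_emb (MeasurableEquiv.neg ℝ).measurableEmbedding (fun t => (-t)⁻¹ * Φ (-t)) (Ij n)
      simp only [neg_neg] at this
      rw [this, ← integral_neg]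
      refine integral_congr_ae (Eventually.of_forall fun t => ?_)
      simp only [inv_neg]; ring
    rw [e1]; ring

/-- truncated Hilbert transform operator -/
abbrev HN (J0 : ℕ) (γ : ℝ × ℝ → ℝ → ℝ) (n : ℕ) : Op :=
  ∑ j ∈ Finset.Ico J0 n, (TT 1 (fun x t => γ x (1 * t)) j - TT (-1) (fun x t => γ x (-1 * t)) j)

lemma HN_val {κ M : ℝ} {s J0 : ℕ} {lam : ℕ → ℕ} {γ γd γ2 γs γsd γs2 γd' γ2' γs' γsd' γs2' : ℝ × ℝ → ℝ → ℝ}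
    (h : Pair κ M s J0 lam 1 (fun x t => γ x (1 * t)) γd γ2 γs γsd γs2) (h' : Pair κ M s J0 lam (-1) (fun x t => γ x (-1 * t)) γd' γ2' γs' γsd' γs2')
    (u : DD) {n : ℕ} (hn : J0 ≤ n) (hc : Continuous fun q : (ℝ × ℝ) × ℝ => (q.1.1 - q.2, γ q.1 q.2)) (x : ℝ × ℝ) :
    ∫ t in SR J0 n, t⁻¹ * u (x.1 - t, γ x t) = HN J0 γ n u x := by
  obtain ⟨B, hB⟩ := (dD u).2.1
  rw [SR_sum (Φ := fun t => u (x.1 - t, γ x t)) ((dM u).comp (hc.comp (Continuous.prodMk_right x)).measurable) (fun t => hB _) hn, HN, LinearMap.sum_apply, sum_val]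
  refine Finset.sum_congr rfl fun j hj => ?_
  have hj := (Finset.mem_Ico.1 hj).1
  rw [LinearMap.sub_apply, sub_val, TT, TT, mkAv_val (h.c.ok (Wt.one J0 h.c.M0) h.hσ hj), mkAv_val (h'.c.ok (Wt.one J0 h.c.M0) h'.hσ hj)]
  simp [Gm]

lemma cpx_int {Φ : ℝ → ℂ} (hΦ : Continuous Φ) {B : ℝ} (hB : ∀ t, ‖Φ t‖ ≤ B) (J0 n : ℕ) :
    ‖∫ t in SR J0 n, t⁻¹ • Φ t‖ ≤ |∫ t in SR J0 n, t⁻¹ * (Φ t).re| + |∫ t in SR J0 n, t⁻¹ * (Φ t).im| := by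
  have hI := SR_intble hΦ.aestronglyMeasurable hB J0 n
  have e1 := Complex.reCLM.integral_comp_comm hI
  have e2 := Complex.imCLM.integral_comp_comm hI
  simp only [Complex.reCLM_apply, Complex.imCLM_apply, Complex.smul_re, Complex.smul_im, smul_eq_mul] at e1 e2
  rw [e1, e2]
  exact Complex.norm_le_abs_re_add_abs_im _

lemma trunc_bd {Φ : ℝ → ℂ} (hΦ : Continuous Φ) {B : ℝ} (hB : ∀ t, ‖Φ t‖ ≤ B) {J0 n : ℕ} {w : ℝ → ℝ} (hw : Continuous w) {ε K0 K1 : ℝ}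
    (hε : (1/2) ^ J0 < ε) (hws : ∀ t, w t ≠ 0 → |t| ≤ ε) (hK0 : |w 0| ≤ K0) 
    (hK1 : ∀ t, |t| < (1/2) ^ J0 → |w t - w 0| ≤ K1 * |t|) (hK2 : ∀ t, (1/2) ^ J0 ≤ |t| → |w t| ≤ K1 * |t|) :
    ‖∫ t in {t : ℝ | (1/2) ^ n ≤ |t|}, (w t / t) • Φ t‖ₑ ≤ 
      ENNReal.ofReal K0 * ENNReal.ofReal (|∫ t in SR J0 n, t⁻¹ * (Φ t).re| + |∫ t in SR J0 n, t⁻¹ * (Φ t).im|) + 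
        ENNReal.ofReal K1 * ∫⁻ t in Icc (-ε) ε, ENNReal.ofReal ‖Φ t‖ := by
  have hSm : MeasurableSet {t : ℝ | (1/2:ℝ) ^ n ≤ |t|} := measurableSet_le measurable_const continuous_abs.measurable
  set S := {t : ℝ | (1/2:ℝ) ^ n ≤ |t|} with hS
  have hB0 : 0 ≤ B := (norm_nonneg _).trans (hB 0)
  have hpos : (0:ℝ) < (1/2) ^ n := by positivity
  set a : ℝ → ℂ := S.indicator fun t => (w t / t) • Φ t with ha
  set b : ℝ → ℂ := (SR J0 n).indicator fun t => w 0 • (t⁻¹ • Φ t) with hb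
  have hbI : Integrable b := by
    rw [hb, integrable_indicator_iff (SR_meas J0 n)]
    exact (SR_intble hΦ.aestronglyMeasurable hB J0 n).smul (w 0)
  have ham : AEStronglyMeasurable a volume := by
    refine AEStronglyMeasurable.indicator ?_ hSm
    exact (hw.measurable.div measurable_id).aestronglyMeasurable.smul hΦ.aestronglyMeasurable
  have hK1' : 0 ≤ K1 := by
    have h1 := (abs_nonneg _).trans (hK2 ((1/2) ^ J0) (le_abs_self _))
    exact nonneg_of_mul_nonneg_left h1 (abs_pos.2 (by positivity))
  have hd : ∀ t, ‖a t - b t‖ ≤ (Icc (-ε) ε).indicator (fun t => K1 * ‖Φ t‖) t := fun t => by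
    by_cases hts : t ∈ S
    · have ht0 : 0 < |t| := hpos.trans_le hts
      have ht0' : t ≠ 0 := abs_pos.1 ht0
      by_cases htr : |t| < (1/2) ^ J0
      · have hm : t ∈ SR J0 n := ⟨hts, htr⟩
        rw [ha, hb, indicator_of_mem hts, indicator_of_mem hm, indicator_of_mem (show t ∈ Icc (-ε) ε from abs_le.1 (htr.trans hε).le), ← smul_assoc, ← sub_smul, norm_smul, smul_eq_mul]
        refine mul_le_mul_of_nonneg_right ?_ (norm_nonneg _)
        rw [show w t / t - w 0 * t⁻¹ = (w t - w 0) / t by ring, norm_div, Real.norm_eq_abs, Real.norm_eq_abs, div_le_iff₀ ht0]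
        exact hK1 t htr
      · have hm : t ∉ SR J0 n := fun h => htr h.2
        rw [ha, hb, indicator_of_mem hts, indicator_of_notMem hm, sub_zero, norm_smul, norm_div, Real.norm_eq_abs, Real.norm_eq_abs]
        by_cases hwt : w t = 0
        · rw [hwt]; simp only [abs_zero, zero_div, zero_mul]
          exact indicator_nonneg (fun _ _ => by positivity) _
        · rw [indicator_of_mem (show t ∈ Icc (-ε) ε from abs_le.1 (hws t hwt))]
          refine mul_le_mul_of_nonneg_right ?_ (norm_nonneg _)
          rw [div_le_iff₀ ht0]
          exact hK2 t (not_lt.1 htr)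
    · have hm : t ∉ SR J0 n := fun h => hts h.1
      rw [ha, hb, indicator_of_notMem hts, indicator_of_notMem hm, sub_zero, norm_zero]
      exact indicator_nonneg (fun _ _ => by positivity) _
  have hdI : Integrable (fun t => a t - b t) := by
    refine Integrable.mono' (g := (Icc (-ε) ε).indicator (fun t => K1 * ‖Φ t‖)) ?_ (ham.sub hbI.aestronglyMeasurable) (Eventually.of_forall hd)
    rw [integrable_indicator_iff measurableSet_Icc]
    exact (by fun_prop : Continuous fun t => K1 * ‖Φ t‖).continuousOn.integrableOn_compact isCompact_Icc
  have e : ∫ t in S, (w t / t) • Φ t = w 0 • (∫ t in SR J0 n, t⁻¹ • Φ t) + ∫ t, (a t - b t) := by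
    rw [← integral_smul, ← integral_indicator hSm, ← integral_indicator (SR_meas J0 n), ← integral_add hbI hdI]
    refine integral_congr_ae (Eventually.of_forall fun t => ?_)
    simp only [hb, ha]
    ring
  rw [e]
  refine (enorm_add_le _ _).trans (add_le_add ?_ ?_)
  · rw [enorm_smul, ← ofReal_norm, ← ofReal_norm]
    exact mul_le_mul' (ENNReal.ofReal_le_ofReal hK0) (ENNReal.ofReal_le_ofReal (cpx_int hΦ hB J0 n))
  · refine (enorm_integral_le_lintegral_enorm _).trans ?_
    rw [← lintegral_const_mul' _ _ ENNReal.ofReal_ne_top, ← lintegral_indicator measurableSet_Icc]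
    refine lintegral_mono fun t => ?_
    rw [← ofReal_norm]
    refine (ENNReal.ofReal_le_ofReal (hd t)).trans (le_of_eq ?_)
    by_cases ht : t ∈ Icc (-ε) ε
    · simp only [indicator_of_mem ht]
      rw [ENNReal.ofReal_mul hK1']
    · simp only [indicator_of_notMem ht, ENNReal.ofReal_zero]

lemma om_ex {Ω : Set (ℝ × ℝ)} (hΩb : IsCompact (closure Ω)) {ω : ℝ × ℝ → ℝ → ℝ} (hω : ContDiff ℝ (⊤ : ℕ∞) (fun q : (ℝ × ℝ) × ℝ => ω q.1 q.2))
    {ε : ℝ} (hs : ∀ (x : ℝ × ℝ) (t : ℝ), ω x t ≠ 0 → |t| ≤ ε) {J0 : ℕ} (hε : (1/2) ^ J0 < ε) : 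
    ∃ K0 K1 : ℝ, 0 ≤ K0 ∧ 0 ≤ K1 ∧ ∀ x ∈ Ω, |ω x 0| ≤ K0 ∧ (∀ t, |t| < (1/2) ^ J0 → |ω x t - ω x 0| ≤ K1 * |t|) ∧ 
      (∀ t, (1/2) ^ J0 ≤ |t| → |ω x t| ≤ K1 * |t|) := by
  have hε0 : 0 < ε := lt_trans (by positivity) hε
  have hK : IsCompact (closure Ω ×ˢ Icc (-ε) ε) := hΩb.prod isCompact_Icc
  obtain ⟨B1, hB1⟩ := hK.exists_bound_of_continuousOn hω.continuous.continuousOn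
  obtain ⟨B2, hB2⟩ := hK.exists_bound_of_continuousOn (hω.continuous_fderiv (by simp)).continuousOn
  refine ⟨|B1|, max |B2| (|B1| * 2 ^ J0), abs_nonneg _, by positivity, fun x hx => ⟨?_, fun t ht => ?_, fun t ht => ?_⟩⟩
  · exact (hB1 (x, 0) ⟨subset_closure hx, by constructor <;> linarith⟩).trans (le_abs_self _)
  · have h1 : ∀ u ∈ Icc (-ε) ε, HasDerivWithinAt (ω x) (fderiv ℝ (fun q : (ℝ × ℝ) × ℝ => ω q.1 q.2) (x, u) (0, 1)) (Icc (-ε) ε) u := fun u _ => by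
      have h2 := (hω.differentiable (by simp) (x, u)).hasFDerivAt
      have h3 : HasDerivAt (fun u : ℝ => (x, u)) ((0, 1) : (ℝ × ℝ) × ℝ) u := (hasDerivAt_const u x).prodMk (hasDerivAt_id u)
      exact (h2.comp_hasDerivAt u h3).hasDerivWithinAt
    have h2 := (convex_Icc (-ε) ε).norm_image_sub_le_of_norm_hasDerivWithin_le (C := |B2|) h1 (fun u hu => by
      refine (ContinuousLinearMap.le_opNorm _ _).trans ?_
      have : ‖((0, 1) : (ℝ × ℝ) × ℝ)‖ = 1 := by simp [Prod.norm_def]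
      rw [this, mul_one]
      exact (hB2 (x, u) ⟨subset_closure hx, hu⟩).trans (le_abs_self _)) (x := 0) (y := t) (by constructor <;> linarith) (abs_le.1 (ht.trans hε).le)
    rw [sub_zero, Real.norm_eq_abs, Real.norm_eq_abs] at h2
    exact h2.trans (mul_le_mul_of_nonneg_right (le_max_left _ _) (abs_nonneg _))
  · by_cases h0 : ω x t = 0
    · rw [h0, abs_zero]; positivity
    · have h1 := hB1 (x, t) ⟨subset_closure hx, abs_le.1 (hs x t h0)⟩
      have h2 : 1 ≤ 2 ^ J0 * |t| := by
        have : (1/2:ℝ) ^ J0 * 2 ^ J0 = 1 := by rw [← mul_pow]; norm_num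
        nlinarith [show (0:ℝ) < 2 ^ J0 by positivity]
      calc |ω x t| ≤ |B1| * 1 := by rw [mul_one]; exact h1.trans (le_abs_self _)
        _ ≤ |B1| * (2 ^ J0 * |t|) := mul_le_mul_of_nonneg_left h2 (abs_nonneg _)
        _ = (|B1| * 2 ^ J0) * |t| := by ring
        _ ≤ _ := mul_le_mul_of_nonneg_right (le_max_right _ _) (abs_nonneg _)

end TB
end

section
namespace TB

lemma cs_isD {f : ℝ × ℝ → ℂ} (hf : Continuous f) (hc : HasCompactSupport f) : IsD (fun x => ‖f x‖) := by
  obtain ⟨B, hB⟩ := hf.bounded_above_of_compact_support hc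
  obtain ⟨R, hR⟩ := hc.isCompact.isBounded.exists_norm_le
  refine ⟨hf.norm.measurable, ⟨B, fun x => by rw [abs_norm]; exact hB x⟩, R, fun x hx => ?_⟩
  have h1 := hR x (subset_tsupport f (by simpa using hx))
  exact ⟨(norm_fst_le x).trans h1, (norm_snd_le x).trans h1⟩

lemma eLp_EN {p : ℝ} (hp : 0 < p) (f : ℝ × ℝ → ℂ) (μ : Measure (ℝ × ℝ)) : eLpNorm f (ENNReal.ofReal p) μ = (∫⁻ x, ‖f x‖ₑ ^ p ∂μ) ^ (1 / p) := by
  rw [eLpNorm_eq_lintegral_rpow_enorm_toReal (by simpa using hp) ENNReal.ofReal_ne_top, ENNReal.toReal_ofReal hp.le]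

lemma fatou_EN {p : ℝ} (hp : 1 < p) {Ω : Set (ℝ × ℝ)} (hΩ : MeasurableSet Ω) {R : ℝ × ℝ → ℂ} {I : ℕ → ℝ × ℝ → ℂ} {W : ℕ → ℝ × ℝ → ℝ≥0∞} {c : ℝ≥0∞}
    (hI : ∀ x, Tendsto (fun n => I n x) atTop (nhds (R x))) (hW : ∀ n, Measurable (W n)) (hIW : ∀ n, ∀ x ∈ Ω, ‖I n x‖ₑ ≤ W n x)
    (hc : ∀ n, EN p (W n) ≤ c) : (∫⁻ x in Ω, ‖R x‖ₑ ^ p) ^ (1 / p) ≤ c := by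
  have hp0 : 0 < p := by linarith
  rw [one_div, ENNReal.rpow_inv_le_iff hp0]
  have h1 : ∀ x ∈ Ω, ‖R x‖ₑ ^ p ≤ liminf (fun n => W n x ^ p) atTop := fun x hx => by
    have h2 : Tendsto (fun n => ‖I n x‖ₑ ^ p) atTop (nhds (‖R x‖ₑ ^ p)) :=
      ((ENNReal.continuous_rpow_const.tendsto _).comp ((continuous_enorm.tendsto _).comp (hI x)))
    rw [← h2.liminf_eq]
    exact liminf_le_liminf (Eventually.of_forall fun n => ENNReal.rpow_le_rpow (hIW n x hx) hp0.le)
  calc ∫⁻ x in Ω, ‖R x‖ₑ ^ p ≤ ∫⁻ x in Ω, liminf (fun n => W n x ^ p) atTop := setLIntegral_mono' hΩ h1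
    _ ≤ ∫⁻ x, liminf (fun n => W n x ^ p) atTop := setLIntegral_le_lintegral _ _
    _ ≤ liminf (fun n => ∫⁻ x, W n x ^ p) atTop := lintegral_liminf_le fun n => (hW n).pow_const p
    _ ≤ liminf (fun _ : ℕ => c ^ p) atTop := by
        refine liminf_le_liminf (Eventually.of_forall fun n => ?_)
        have := hc n
        rwa [EN, one_div, ENNReal.rpow_inv_le_iff hp0] at this
    _ = c ^ p := by simp

lemma en3 {p : ℝ} (hp : 1 < p) (a b : ℝ≥0∞) {u v w : ℝ × ℝ → ℝ≥0∞} (hu : Measurable u) (hv : Measurable v) (hw : Measurable w) {cu cv cw n : ℝ≥0∞}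
    (h1 : EN p u ≤ cu * n) (h2 : EN p v ≤ cv * n) (h3 : EN p w ≤ cw * n) :
    EN p (fun x => a * (u x + v x) + b * w x) ≤ (a * (cu + cv) + b * cw) * n := by
  have hp0 : 0 < p := by linarith
  have huv : Measurable fun x => u x + v x := hu.add hv
  refine (EN_add hp.le (huv.const_mul a) (hw.const_mul b)).trans ?_
  rw [EN_cmul hp0 a huv, EN_cmul hp0 b hw]
  calc _ ≤ a * (cu * n + cv * n) + b * (cw * n) := by
        gcongr
        exact (EN_add hp.le hu hv).trans (add_le_add h1 h2)
    _ = _ := by ring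

end TB
end

open TB

/-- Theorem B.  Assume the normalized hypotheses (1.19)-(1.24):
`Γ(x,t) = (x₁-t, γ(x,t))` with `γ(x,0) = x₂`, `γ̇(x,0) = 0`, inverse curve data `γ*` with
`γ*(y,0) = y₂`, `γ̇*(y,0) = 0`, quasi-monotonicity of `γ̇` and `γ̇*`, the doubling bounds
`C₀⁻¹ g(A⁻¹|t|) ≤ |γ̇|, |γ̇*| ≤ C₀ g(A|t|)`, and `|∂_{x₂}γ| ≥ c₁ > 0`.  Then the maximal
operator `M` is bounded from `L^p` to `L^p(Ω)` for `p > 1` and the singular Radon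
transform `R` is bounded from `L^p` to `L^p(Ω)` for `1 < p < ∞`, with operator norms
depending only on the cutoff `ω`, the doubling function `g`, the constant `A` (and
`C₀, κ, c₁`) and the `L^∞` bounds for `γ_{x₂}, ∇γ_{x₂}, γ*_{y₂}, ∇γ*_{y₂}` — in
particular not on the `L¹` norm of `γ̈`. -/
theorem theorem_B
    (Ω : Set (ℝ × ℝ)) (hΩo : IsOpen Ω) (hΩb : IsCompact (closure Ω))
    (c₀ ε A C₀ κ c₁ M : ℝ)
    (hc₀ : 0 < c₀) (hε : 0 < ε) (hεc₀ : ε ≤ c₀)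
    (hA : 1 ≤ A) (hC₀ : 1 ≤ C₀) (hκ : 0 ≤ κ) (hc₁ : 0 < c₁)
    (g : ℝ → ℝ) (hg : IsDoubling g A)
    (ω : ℝ × ℝ → ℝ → ℝ)
    (hωsm : ContDiff ℝ (⊤ : ℕ∞) (fun q : (ℝ × ℝ) × ℝ => ω q.1 q.2))
    (hωsupp : ∀ (x : ℝ × ℝ) (t : ℝ), ω x t ≠ 0 → |t| ≤ ε)
    (p : ℝ) (hp : 1 < p) :
    -- the operator norm bound `C` depends only on the data quantified above,
    -- not on the particular curve family `γ`
    ∃ C : ℝ, 0 < C ∧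
      ∀ γ γd γdd γ2 γs γsd γsdd γs2 : ℝ × ℝ → ℝ → ℝ,
        CurveHyp c₀ A C₀ κ c₁ M g γ γd γdd γ2 →
        CurveHyp c₀ A C₀ κ c₁ M g γs γsd γsdd γs2 →
        -- `Γ*(y,t) = (y₁+t, γ*(y,t))` inverts `Γ(x,t) = (x₁-t, γ(x,t))`
        (∀ (x : ℝ × ℝ) (t : ℝ), |t| ≤ c₀ → γs (x.1 - t, γ x t) t = x.2) →
        (∀ (y : ℝ × ℝ) (t : ℝ), |t| ≤ c₀ → γ (y.1 + t, γs y t) t = y.2) →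
        ∀ f : ℝ × ℝ → ℂ, Continuous f → HasCompactSupport f →
          -- the maximal operator is bounded from `L^p` to `L^p(Ω)`, `p > 1`
          ((∫⁻ x in Ω, (⨆ (h : ℝ) (_ : 0 < h) (_ : h < ε),
              (ENNReal.ofReal (2 * h))⁻¹ *
                ∫⁻ t in Icc (-h) h, ‖f (x.1 - t, γ x t)‖₊) ^ p) ^ p⁻¹
            ≤ ENNReal.ofReal C * eLpNorm f (ENNReal.ofReal p) volume)
          ∧
          -- the singular Radon transform is bounded from `L^p` to `L^p(Ω)`
          (∀ Rf : ℝ × ℝ → ℂ,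
            (∀ x : ℝ × ℝ, Tendsto
              (fun δ : ℝ => ∫ t in {t : ℝ | δ ≤ |t|}, (ω x t / t) • f (x.1 - t, γ x t))
              (nhdsWithin 0 (Ioi 0)) (nhds (Rf x))) →
            eLpNorm Rf (ENNReal.ofReal p) (volume.restrict Ω)
              ≤ ENNReal.ofReal C * eLpNorm f (ENNReal.ofReal p) volume) := by
  have hp0 : 0 < p := by linarith
  by_cases hM : 0 ≤ M
  swap
  · exact ⟨1, one_pos, fun γ γd γdd γ2 _ _ _ _ H => absurd (M_nn H) hM⟩
  obtain ⟨s, J0, lam, hJc, hJε, hpair⟩ := pair_ex hg hC₀ hκ hc₀ M c₁ hε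
  obtain ⟨CH, CH0, hH⟩ := Hil_all (κ := κ) hM s hp
  obtain ⟨CM, CM0, hMx⟩ := Mxl_all (κ := κ) (M := M) s hp
  obtain ⟨K0, K1, K00, K10, hK⟩ := om_ex hΩb hωsm hωsupp hJε
  set KP : ℝ≥0∞ := (ENNReal.ofReal (2 * ε) ^ (p - 1) * (ENNReal.ofReal M * ENNReal.ofReal (2 * ε))) ^ (1 / p) with hKP
  have hKPt : KP ≠ ⊤ := by
    refine ENNReal.rpow_ne_top_of_nonneg (by positivity) (ENNReal.mul_ne_top (ENNReal.rpow_ne_top_of_nonneg (by linarith) ENNReal.ofReal_ne_top) ?_)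
    exact ENNReal.mul_ne_top ENNReal.ofReal_ne_top ENNReal.ofReal_ne_top
  set E1 : ℝ≥0∞ := 2 * (ENNReal.ofReal CM + ENNReal.ofReal CM) + ENNReal.ofReal (2 ^ J0) * KP with hE1
  set E2 : ℝ≥0∞ := ENNReal.ofReal K0 * (ENNReal.ofReal CH + ENNReal.ofReal CH) + ENNReal.ofReal K1 * KP with hE2
  have hE1t : E1 ≠ ⊤ := by
    refine ENNReal.add_ne_top.2 ⟨ENNReal.mul_ne_top (by simp) (by simp), ENNReal.mul_ne_top (by simp) hKPt⟩
  have hE2t : E2 ≠ ⊤ := by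
    refine ENNReal.add_ne_top.2 ⟨ENNReal.mul_ne_top (by simp) (by simp), ENNReal.mul_ne_top (by simp) hKPt⟩
  have hE : E1 + E2 ≤ ENNReal.ofReal ((E1 + E2).toReal + 1) := by
    rw [ENNReal.ofReal_add ENNReal.toReal_nonneg zero_le_one, ENNReal.ofReal_toReal (ENNReal.add_ne_top.2 ⟨hE1t, hE2t⟩)]
    exact le_self_add
  refine ⟨(E1 + E2).toReal + 1, by positivity, fun γ γd γdd γ2 γs γsd γsdd γs2 H Hs i1 i2 f hf hfc => ?_⟩
  have hP := hpair γ γd γdd γ2 γs γsd γsdd γs2 H Hs i1 i2 1 (Or.inl rfl)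
  have hP' := hpair γ γd γdd γ2 γs γsd γsdd γs2 H Hs i1 i2 (-1) (Or.inr rfl)
  have hcc := curve_cont H
  have hFD := cs_isD hf hfc
  set F : DD := ⟨fun x => ‖f x‖, hFD⟩ with hF
  have hFv : ∀ x, F x = ‖f x‖ := fun x => rfl
  set fr : DD := ⟨fun x => (f x).re, hFD.of_le (Complex.continuous_re.comp hf).measurable fun x => by
    rw [abs_norm]; exact Complex.abs_re_le_norm _⟩ with hfr
  set fi : DD := ⟨fun x => (f x).im, hFD.of_le (Complex.continuous_im.comp hf).measurable fun x => by
    rw [abs_norm]; exact Complex.abs_im_le_norm _⟩ with hfi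
  have hNr : N p fr ≤ N p F := N_mono hp0 (dD fr) (dD F) fun x => by
    rw [hFv, abs_norm]; exact Complex.abs_re_le_norm _
  have hNi : N p fi ≤ N p F := N_mono hp0 (dD fi) (dD F) fun x => by
    rw [hFv, abs_norm]; exact Complex.abs_im_le_norm _
  have hFe : ∀ x, ENNReal.ofReal |F x| = ‖f x‖ₑ := fun x => by rw [hFv, abs_norm, ofReal_norm]
  have hfN : eLpNorm f (ENNReal.ofReal p) volume = ENNReal.ofReal (N p F) := by
    rw [eLp_EN hp0, ← EN_dd hp0 F, EN]; simp_rw [hFe]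
  have hkm : Measurable fun x => ENNReal.ofReal |F x| := (dM F).abs.ennreal_ofReal
  have hPm := Pav_meas H hkm ε
  have hPb : EN p (Pav ε γ fun x => ENNReal.ofReal |F x|) ≤ KP * ENNReal.ofReal (N p F) := by
    rw [← EN_dd hp0 F]
    exact Pav_bd H Hs i1 i2 hεc₀ hkm hp
  rw [hfN]
  constructor
  · have b1 : EN p (MX J0 1 (fun x t => γ x (1 * t)) F) ≤ ENNReal.ofReal CM * ENNReal.ofReal (N p F) := by
      rw [← ENNReal.ofReal_mul CM0]
      exact MX_bd hp (hMx J0 lam 1 _ _ _ _ _ _ hP) F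
    have b2 : EN p (MX J0 (-1) (fun x t => γ x (-1 * t)) F) ≤ ENNReal.ofReal CM * ENNReal.ofReal (N p F) := by
      rw [← ENNReal.ofReal_mul CM0]
      exact MX_bd hp (hMx J0 lam (-1) _ _ _ _ _ _ hP') F
    have b3 := en3 hp 2 (ENNReal.ofReal (2 ^ J0)) (MX_meas F) (MX_meas F) hPm b1 b2 hPb
    refine le_trans ?_ (b3.trans (mul_le_mul_left (le_trans le_self_add hE) _))
    rw [EN, one_div]
    refine ENNReal.rpow_le_rpow ((setLIntegral_le_lintegral _ _).trans (lintegral_mono fun x => ENNReal.rpow_le_rpow ?_ hp0.le)) (by positivity)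
    refine iSup_le fun r => iSup_le fun h0 => iSup_le fun h1 => ?_
    have := max_pt hP hP' F h0 h1 x
    simp_rw [hFe] at this ⊢
    exact this
  · intro Rf hR
    rw [eLp_EN hp0]
    have hpow : Tendsto (fun n : ℕ => (1/2:ℝ) ^ (J0 + n)) atTop (nhdsWithin 0 (Ioi 0)) := by
      refine tendsto_nhdsWithin_iff.2 ⟨?_, Eventually.of_forall fun n => mem_Ioi.2 (by positivity)⟩
      have := (tendsto_pow_atTop_nhds_zero_of_lt_one (show (0:ℝ) ≤ 1/2 by norm_num) (by norm_num)).comp (tendsto_add_atTop_nat J0)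
      refine this.congr fun n => ?_
      simp only [Function.comp, add_comm]
    refine fatou_EN hp hΩo.measurableSet (I := fun n x => ∫ t in {t : ℝ | (1/2) ^ (J0 + n) ≤ |t|}, (ω x t / t) • f (x.1 - t, γ x t))
      (W := fun n x => ENNReal.ofReal K0 * (ENNReal.ofReal |HN J0 γ (J0 + n) fr x| + ENNReal.ofReal |HN J0 γ (J0 + n) fi x|) +
        ENNReal.ofReal K1 * Pav ε γ (fun x => ENNReal.ofReal |F x|) x) (fun x => (hR x).comp hpow) (fun n => ?_) (fun n x hx => ?_) (fun n => ?_)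
    · exact (((dM _).abs.ennreal_ofReal.add (dM _).abs.ennreal_ofReal).const_mul _).add (hPm.const_mul _)
    · obtain ⟨k0, k1, k2⟩ := hK x hx
      obtain ⟨B, hB⟩ := hf.bounded_above_of_compact_support hfc
      have h1 := trunc_bd (Φ := fun t => f (x.1 - t, γ x t)) (hf.comp (hcc.comp (Continuous.prodMk_right x))) (fun t => hB _) (J0 := J0) (n := J0 + n) (w := ω x)
        (hωsm.continuous.comp (Continuous.prodMk_right x)) hJε (hωsupp x) k0 k1 k2
      have e1 := HN_val hP hP' fr (n := J0 + n) (by omega) hcc x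
      have e2 := HN_val hP hP' fi (n := J0 + n) (by omega) hcc x
      simp only [hfr, hfi] at e1 e2
      rw [e1, e2, ENNReal.ofReal_add (abs_nonneg _) (abs_nonneg _)] at h1
      simp only [Pav, hFe]
      simp only [ofReal_norm] at h1
      exact h1
    · have hb := hH J0 lam 1 (-1) _ _ _ _ _ _ _ _ _ _ _ _ hP hP' (Finset.Ico J0 (J0 + n)) (fun j hj => (Finset.mem_Ico.1 hj).1)
      have b : ∀ u : DD, N p u ≤ N p F → EN p (fun x => ENNReal.ofReal |HN J0 γ (J0 + n) u x|) ≤ ENNReal.ofReal CH * ENNReal.ofReal (N p F) := fun u hu => by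
        rw [EN_dd hp0, ← ENNReal.ofReal_mul CH0]
        exact ENNReal.ofReal_le_ofReal ((hb u).trans (mul_le_mul_of_nonneg_left hu CH0))
      exact (en3 hp (ENNReal.ofReal K0) (ENNReal.ofReal K1) (dM _).abs.ennreal_ofReal (dM _).abs.ennreal_ofReal hPm (b fr hNr) (b fi hNi) hPb).trans
        (mul_le_mul_left (le_trans le_add_self hE) _)
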